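/- For each fixed constant R > 0 there exists q₀ such that for every integer q ≥ q₀ the following holds: if every zero ρ in ℛ of every Dirichlet L-function L(s,χ) with χ a nonprincipal character mod q satisfies λ_ρ ≥ 0.35, then ∑_{χ ≠ χ₀} ∑_{ρ ∈ ℛ, L(ρ,χ)=0} exp(−7.999·λ_ρ) < 0.99, the inner sum counting zeros with multiplicity. -/

import Mathlib

open scoped Classical

/-- The rectangle `ℛ = {z : 1 - R/log q ≤ Re z ≤ 1, |Im z| ≤ R}`. -/
def rect (q : ℕ) (R : ℝ) : Set ℂ :=
  {z : ℂ | 1 - R / Real.log q ≤ z.re ∧ z.re ≤ 1 ∧ |z.im| ≤ R}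

/-- `λ_ρ = (1 - Re ρ)·log q`. -/
noncomputable def lam (q : ℕ) (ρ : ℂ) : ℝ := (1 - ρ.re) * Real.log q

/-- The multiplicity of `z` as a zero of `f` (the analytic order, truncated to `ℕ`). -/
noncomputable def zeroMult (f : ℂ → ℂ) (z : ℂ) : ℕ :=
  if h : AnalyticAt ℂ f z then (analyticOrderAt f z).toNat else 0

namespace LFZ
open Finset

/-- The divisor bound. -/
theorem card_divisors_le_rpow {ε : ℝ} (hε : 0 < ε) :
    ∃ C : ℝ, 1 ≤ C ∧ ∀ n : ℕ, n ≠ 0 → (n.divisors.card : ℝ) ≤ C * (n : ℝ) ^ ε := by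
  set M : ℕ := ⌈(2 : ℝ) ^ (1 / ε)⌉₊ with hM
  set K : ℝ := 1 + 1 / (ε * Real.log 2) with hK
  have hl2 : 0 < Real.log 2 := Real.log_pos (by norm_num)
  have hK1 : 1 ≤ K := by
    have : 0 < 1 / (ε * Real.log 2) := by positivity
    linarith
  refine ⟨K ^ M, one_le_pow₀ hK1, fun n hn => ?_⟩
  have key : ∀ p ∈ n.primeFactors, ((n.factorization p : ℝ) + 1) ≤
      (if p < M then K else 1) * ((p : ℝ) ^ n.factorization p) ^ ε := by
    intro p hp
    have hpp := Nat.prime_of_mem_primeFactors hp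
    have hp2 : (2 : ℝ) ≤ p := by exact_mod_cast hpp.two_le
    set k := n.factorization p
    have hpe : ((p : ℝ) ^ k) ^ ε = ((p : ℝ) ^ ε) ^ k := by
      rw [← Real.rpow_natCast, ← Real.rpow_mul (by positivity), ← Real.rpow_natCast,
        ← Real.rpow_mul (by positivity), mul_comm]
    split_ifs with h
    · have h1 : (2 : ℝ) ^ (ε * k) ≤ ((p : ℝ) ^ ε) ^ k := by
        rw [Real.rpow_mul (by norm_num), Real.rpow_natCast]
        gcongr
      have h2 : 1 + Real.log 2 * (ε * k) ≤ (2 : ℝ) ^ (ε * k) := by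
        rw [Real.rpow_def_of_pos (by norm_num)]
        linarith [Real.add_one_le_exp (Real.log 2 * (ε * k))]
      rw [hpe]
      have h3 : (k : ℝ) + 1 ≤ K * (1 + Real.log 2 * (ε * k)) := by
        have h4 : 1 / (ε * Real.log 2) * (Real.log 2 * (ε * k)) = k := by
          field_simp
        have : 0 < 1 / (ε * Real.log 2) := by positivity
        have h5 : 0 ≤ Real.log 2 * (ε * k) := by positivity
        rw [hK, add_mul, mul_add (1 / (ε * Real.log 2)), h4]
        linarith
      calc (k : ℝ) + 1 ≤ K * (1 + Real.log 2 * (ε * k)) := h3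
        _ ≤ _ := by gcongr; linarith
    · have hMp : (2 : ℝ) ^ (1 / ε) ≤ p := by
        have : (M : ℝ) ≤ p := by exact_mod_cast not_lt.mp h
        exact (Nat.le_ceil _).trans this
      have h1 : (2 : ℝ) ≤ (p : ℝ) ^ ε := by
        calc (2 : ℝ) = ((2 : ℝ) ^ (1 / ε)) ^ ε := by
              rw [← Real.rpow_mul (by norm_num)]; field_simp; simp
          _ ≤ _ := by gcongr
      rw [hpe, one_mul]
      calc (k : ℝ) + 1 ≤ 2 ^ k := by exact_mod_cast Nat.lt_two_pow_self
        _ ≤ _ := by gcongr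
  rw [Nat.card_divisors hn]
  push_cast
  calc ∏ x ∈ n.primeFactors, ((n.factorization x : ℝ) + 1)
      ≤ ∏ p ∈ n.primeFactors, (if p < M then K else 1) * ((p : ℝ) ^ n.factorization p) ^ ε :=
        Finset.prod_le_prod (fun _ _ => by positivity) key
    _ = (∏ p ∈ n.primeFactors, if p < M then K else 1) * (n : ℝ) ^ ε := by
        rw [Finset.prod_mul_distrib]
        congr 1
        rw [Real.finsetProd_rpow _ _ (fun _ _ => by positivity)]
        congr 1
        conv_rhs => rw [← Nat.prod_factorization_pow_eq_self hn]
        rw [Finsupp.prod]; push_cast; rfl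
    _ ≤ K ^ M * (n : ℝ) ^ ε := by
        gcongr
        rw [Finset.prod_ite, Finset.prod_const, Finset.prod_const_one, mul_one]
        apply pow_le_pow_right₀ hK1
        calc _ ≤ (Finset.range M).card := Finset.card_le_card (fun p hp => by
              simp at hp ⊢; exact hp.2)
          _ = M := Finset.card_range _

open ZMod

theorem norm_gaussSum_primitive {N : ℕ} [NeZero N] {χ : DirichletCharacter ℂ N}
    (hχ : χ.IsPrimitive) : ‖gaussSum χ stdAddChar‖ = Real.sqrt N := by
  have h1 := congrFun (ZMod.dft_dft (fun j => χ j)) (-1)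
  have h0 : 𝓕 (fun j => χ j) = fun k => χ⁻¹ (-k) * gaussSum χ stdAddChar := by
    ext k; exact hχ.fourierTransform_eq_inv_mul_gaussSum k
  rw [h0, dft_apply] at h1
  have h2 : ∑ j : ZMod N, stdAddChar (-(j * -1)) • (χ⁻¹ (-j) * gaussSum χ stdAddChar)
      = gaussSum χ stdAddChar * gaussSum χ⁻¹ stdAddChar⁻¹ := by
    rw [gaussSum, gaussSum, mul_sum, ← Equiv.sum_comp (Equiv.neg (ZMod N))]
    refine sum_congr rfl fun j _ => ?_
    simp [AddChar.inv_apply]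
    ring
  rw [h2, ← star_gaussSum_eq] at h1
  simp at h1
  have h3 : ((‖gaussSum χ stdAddChar‖ ^ 2 : ℝ) : ℂ) = N := by
    rw [← h1, Complex.mul_conj, Complex.normSq_eq_norm_sq]
  have h4 : ‖gaussSum χ stdAddChar‖ ^ 2 = N := by exact_mod_cast h3
  rw [← h4, Real.sqrt_sq (norm_nonneg _)]

theorem norm_geom_stdAddChar_le {N : ℕ} [NeZero N] {k : ℕ} (hk0 : 0 < k) (hkN : k < N) (M : ℕ) :
    ‖∑ n ∈ range M, stdAddChar ((n : ZMod N) * (k : ZMod N))‖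
      ≤ N / (2 * k) + N / (2 * (N - k : ℝ)) := by
  have hkN' : (k : ℝ) < N := by exact_mod_cast hkN
  have hk0' : (0 : ℝ) < k := by exact_mod_cast hk0
  have hN : (0 : ℝ) < N := by linarith
  set z : ℂ := stdAddChar (k : ZMod N) with hz
  have hz1 : ‖z‖ = 1 := AddChar.norm_apply _ _
  have hpow : ∀ n : ℕ, stdAddChar ((n : ZMod N) * (k : ZMod N)) = z ^ n := by
    intro n; rw [hz, ← AddChar.map_nsmul_eq_pow, nsmul_eq_mul]
  have hzexp : z = Complex.exp (Complex.I * ((2 * Real.pi * (k / N) : ℝ) : ℂ)) := by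
    have := ZMod.stdAddChar_coe (N := N) (k : ℤ)
    rw [hz]; push_cast at this ⊢; rw [this]; congr 1; ring
  have hx : 0 < (k : ℝ) / N := by positivity
  have hx1 : (k : ℝ) / N < 1 := by rw [div_lt_one hN]; exact hkN'
  have hnorm : ‖z - 1‖ = 2 * Real.sin (Real.pi * (k / N)) := by
    rw [hzexp, Complex.norm_exp_I_mul_ofReal_sub_one]
    rw [Real.norm_eq_abs, show 2 * Real.pi * ((k : ℝ) / N) / 2 = Real.pi * (k / N) by ring]
    rw [abs_of_nonneg]
    have := Real.sin_nonneg_of_nonneg_of_le_pi (x := Real.pi * (k / N)) (by positivity)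
      (by nlinarith [Real.pi_pos])
    linarith
  have hpi := Real.pi_pos
  have hsin : 0 < Real.sin (Real.pi * (k / N)) :=
    Real.sin_pos_of_pos_of_lt_pi (by positivity) (by nlinarith)
  have hgeom : ‖∑ n ∈ range M, stdAddChar ((n : ZMod N) * (k : ZMod N))‖ ≤
      1 / Real.sin (Real.pi * (k / N)) := by
    simp_rw [hpow]
    have h1 := geom_sum_mul z M
    have h2 : ‖∑ n ∈ range M, z ^ n‖ * ‖z - 1‖ ≤ 2 := by
      rw [← norm_mul, h1]
      calc ‖z ^ M - 1‖ ≤ ‖z ^ M‖ + ‖(1 : ℂ)‖ := norm_sub_le _ _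
        _ = 2 := by rw [norm_pow, hz1]; norm_num
    rw [hnorm] at h2
    rw [le_div_iff₀ hsin]; linarith
  refine hgeom.trans ?_
  have hNk : (0 : ℝ) < N - k := by linarith
  rcases le_total ((k : ℝ) / N) (1 / 2) with h | h
  · have h1 : 2 / Real.pi * (Real.pi * (k / N)) ≤ Real.sin (Real.pi * (k / N)) :=
      Real.mul_le_sin (by positivity) (by nlinarith)
    have h2 : 2 / Real.pi * (Real.pi * ((k : ℝ) / N)) = 2 * k / N := by field_simp
    rw [h2] at h1
    have h3 : 1 / Real.sin (Real.pi * (k / N)) ≤ 1 / (2 * k / N) :=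
      one_div_le_one_div_of_le (by positivity) h1
    have h4 : 1 / (2 * (k : ℝ) / N) = N / (2 * k) := by field_simp
    have h5 : 0 ≤ (N : ℝ) / (2 * (N - k : ℝ)) := by positivity
    linarith
  · have h0 : Real.sin (Real.pi * (k / N)) = Real.sin (Real.pi * ((N - k) / N)) := by
      rw [← Real.sin_pi_sub]; congr 1; field_simp
    have hh : ((N : ℝ) - k) / N ≤ 1 / 2 := by
      rw [sub_div, div_self hN.ne']; linarith
    rw [h0] at hsin ⊢
    have h1 : 2 / Real.pi * (Real.pi * ((N - k) / N)) ≤ Real.sin (Real.pi * ((N - k) / N)) :=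
      Real.mul_le_sin (by positivity) (by nlinarith)
    have h2 : 2 / Real.pi * (Real.pi * (((N : ℝ) - k) / N)) = 2 * (N - k) / N := by field_simp
    rw [h2] at h1
    have h3 : 1 / Real.sin (Real.pi * ((N - k) / N)) ≤ 1 / (2 * (N - k) / N) :=
      one_div_le_one_div_of_le (by positivity) h1
    have h4 : 1 / (2 * ((N : ℝ) - k) / N) = N / (2 * (N - k)) := by field_simp
    have h5 : 0 ≤ (N : ℝ) / (2 * k) := by positivity
    linarith

theorem sum_inv_le (N : ℕ) : ∑ k ∈ Finset.Ico 1 N, (1 : ℝ) / k ≤ 1 + Real.log N := by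
  rcases Nat.eq_zero_or_pos N with h | h
  · subst h; simp
  have h1 : ∑ k ∈ Finset.Ico 1 N, (1 : ℝ) / k ≤ ∑ k ∈ Finset.Icc 1 N, (1 : ℝ) / k :=
    Finset.sum_le_sum_of_subset_of_nonneg (fun x hx => by simp at hx ⊢; omega)
      (fun _ _ _ => by positivity)
  have h2 := harmonic_le_one_add_log N
  rw [harmonic_eq_sum_Icc] at h2
  push_cast at h2
  simp only [one_div] at h1 ⊢
  linarith

/-- The Pólya–Vinogradov inequality for primitive characters. -/
theorem polya_vinogradov_primitive {N : ℕ} [NeZero N] (hN : N ≠ 1) {χ : DirichletCharacter ℂ N}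
    (hχ : χ.IsPrimitive) (M : ℕ) :
    ‖∑ n ∈ range M, χ n‖ ≤ Real.sqrt N * (1 + Real.log N) := by
  have hNpos : 0 < N := Nat.pos_of_ne_zero (NeZero.ne N)
  have hN0 : (0 : ℝ) < N := by exact_mod_cast hNpos
  have hinv : ∀ j : ZMod N, χ j = (N : ℂ)⁻¹ * ∑ k : ZMod N,
      stdAddChar (k * j) * (χ⁻¹ (-k) * gaussSum χ stdAddChar) := by
    intro j
    have h1 : 𝓕⁻ (𝓕 (fun j => χ j)) j = χ j := by rw [LinearEquiv.symm_apply_apply]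
    rw [← h1, invDFT_apply, smul_eq_mul]
    congr 1
    refine sum_congr rfl fun k _ => ?_
    rw [smul_eq_mul]; congr 1
    exact hχ.fourierTransform_eq_inv_mul_gaussSum k
  have hsum : ∑ n ∈ range M, χ n = (N : ℂ)⁻¹ * gaussSum χ stdAddChar * ∑ k : ZMod N,
      χ⁻¹ (-k) * ∑ n ∈ range M, stdAddChar ((n : ZMod N) * k) := by
    simp_rw [hinv, mul_sum]
    rw [Finset.sum_comm]
    refine sum_congr rfl fun k _ => sum_congr rfl fun n _ => ?_
    rw [mul_comm k]; ring
  have hzero : χ⁻¹ (-0) = 0 := by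
    rw [neg_zero]; exact DirichletCharacter.map_zero' _ hN
  have hreidx : ∑ k : ZMod N, χ⁻¹ (-k) * ∑ n ∈ range M, stdAddChar ((n : ZMod N) * k)
      = ∑ k ∈ Finset.Ico 1 N, χ⁻¹ (-(k : ZMod N)) *
        ∑ n ∈ range M, stdAddChar ((n : ZMod N) * (k : ZMod N)) := by
    have h1 : ∑ k : ZMod N, χ⁻¹ (-k) * ∑ n ∈ range M, stdAddChar ((n : ZMod N) * k)
      = ∑ k ∈ Finset.range N, χ⁻¹ (-(k : ZMod N)) *
        ∑ n ∈ range M, stdAddChar ((n : ZMod N) * (k : ZMod N)) := by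
      refine Finset.sum_bij' (fun k _ => k.val) (fun k _ => (k : ZMod N)) ?_ ?_ ?_ ?_ ?_
      · intro a _; simpa using ZMod.val_lt a
      · intro a _; simp
      · intro a _; simp
      · intro a ha; simpa using ZMod.val_cast_of_lt (by simpa using ha)
      · intro a _; simp
    rw [h1, Finset.range_eq_Ico, Finset.sum_eq_sum_Ico_succ_bot hNpos]
    simp only [Nat.cast_zero, hzero, zero_mul, zero_add]
  rw [hsum, hreidx, norm_mul, norm_mul, norm_gaussSum_primitive hχ, norm_inv, Complex.norm_natCast]
  have hbound : ‖∑ k ∈ Finset.Ico 1 N, χ⁻¹ (-(k : ZMod N)) *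
        ∑ n ∈ range M, stdAddChar ((n : ZMod N) * (k : ZMod N))‖ ≤ N * (1 + Real.log N) := by
    refine (norm_sum_le _ _).trans ?_
    calc _ ≤ ∑ k ∈ Finset.Ico 1 N, ((N : ℝ) / (2 * k) + N / (2 * (N - k : ℝ))) := by
          refine sum_le_sum fun k hk => ?_
          simp at hk
          rw [norm_mul]
          exact (mul_le_of_le_one_left (norm_nonneg _) (DirichletCharacter.norm_le_one _ _)).trans
            (norm_geom_stdAddChar_le (by omega) hk.2 M)
      _ = N / 2 * ∑ k ∈ Finset.Ico 1 N, (1 : ℝ) / k +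
          N / 2 * ∑ k ∈ Finset.Ico 1 N, (1 : ℝ) / (N - k : ℝ) := by
          rw [Finset.sum_add_distrib, mul_sum, mul_sum]
          congr 1 <;> refine sum_congr rfl fun k hk => ?_
          · field_simp
          · field_simp
      _ = N * ∑ k ∈ Finset.Ico 1 N, (1 : ℝ) / k := by
          have : ∑ k ∈ Finset.Ico 1 N, (1 : ℝ) / (N - k : ℝ) =
              ∑ k ∈ Finset.Ico 1 N, (1 : ℝ) / k := by
            refine Finset.sum_bij' (fun k _ => N - k) (fun k _ => N - k) ?_ ?_ ?_ ?_ ?_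
            all_goals intro k hk; simp at hk ⊢
            any_goals omega
            rw [Nat.cast_sub (by omega)]
          rw [this]; ring
      _ ≤ _ := by gcongr; exact sum_inv_le N
  calc (N : ℝ)⁻¹ * Real.sqrt N * _ ≤ (N : ℝ)⁻¹ * Real.sqrt N * (N * (1 + Real.log N)) := by
        gcongr
    _ = _ := by field_simp

theorem sum_coprime_eq_sum_divisors {q : ℕ} (hq : q ≠ 0) (f : ℕ → ℂ) (M : ℕ) :
    ∑ n ∈ range M, (if n.Coprime q then f n else 0)
      = ∑ d ∈ q.divisors, (ArithmeticFunction.moebius d : ℂ) *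
          ∑ n ∈ (range M).filter (d ∣ ·), f n := by
  have h1 : ∀ n : ℕ, (if n.Coprime q then (1 : ℂ) else 0) =
      ∑ d ∈ q.divisors, if d ∣ n then (ArithmeticFunction.moebius d : ℂ) else 0 := by
    intro n
    have h2 := congrArg (fun f : ArithmeticFunction ℤ => f (n.gcd q))
      ArithmeticFunction.moebius_mul_coe_zeta
    simp only [ArithmeticFunction.coe_mul_zeta_apply, ArithmeticFunction.one_apply] at h2
    have h3 : (∑ d ∈ (n.gcd q).divisors, (ArithmeticFunction.moebius d : ℂ)) =
        if n.gcd q = 1 then 1 else 0 := by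
      exact_mod_cast h2
    rw [← Finset.sum_filter]
    have h4 : q.divisors.filter (· ∣ n) = (n.gcd q).divisors := by
      ext d
      have : n.gcd q ≠ 0 := Nat.gcd_ne_zero_right hq
      simp [Nat.dvd_gcd_iff, hq]
      tauto
    rw [h4, h3]
  calc _ = ∑ n ∈ range M, (if n.Coprime q then (1 : ℂ) else 0) * f n := by simp
    _ = _ := by
      simp_rw [h1, Finset.sum_mul, mul_sum]
      rw [Finset.sum_comm]
      refine sum_congr rfl fun d _ => ?_
      rw [Finset.sum_filter]
      refine sum_congr rfl fun n _ => ?_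
      split_ifs <;> simp

theorem sum_filter_dvd_range {d : ℕ} (hd : 0 < d) (f : ℕ → ℂ) (M : ℕ) :
    ∑ n ∈ (range M).filter (d ∣ ·), f n = ∑ m ∈ range ((M + d - 1) / d), f (d * m) := by
  symm
  refine Finset.sum_bij (fun m _ => d * m) ?_ ?_ ?_ ?_
  · intro m hm
    simp at hm ⊢
    have := (Nat.lt_div_iff_mul_lt hd).mp hm
    rw [mul_comm]
    omega
  · intro a _ b _ h
    exact Nat.eq_of_mul_eq_mul_left hd h
  · intro b hb
    simp at hb
    obtain ⟨hb, m, rfl⟩ := hb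
    refine ⟨m, ?_, rfl⟩
    simp
    rw [Nat.lt_div_iff_mul_lt hd, mul_comm]
    omega
  · intro a _; rfl

/-- The Pólya–Vinogradov inequality for all nonprincipal characters. -/
theorem polya_vinogradov {ε : ℝ} (hε : 0 < ε) :
    ∃ C : ℝ, 1 ≤ C ∧ ∀ (q : ℕ) [NeZero q] (χ : DirichletCharacter ℂ q), χ ≠ 1 → ∀ M : ℕ,
      ‖∑ n ∈ range M, χ n‖ ≤ C * (q : ℝ) ^ (1 / 2 + ε) := by
  obtain ⟨C, hC, hdiv⟩ := card_divisors_le_rpow (half_pos hε)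
  refine ⟨C * (1 + 1 / (ε / 2)), ?_, fun q _ χ hχ M => ?_⟩
  · have : 0 < 1 / (ε / 2) := by positivity
    nlinarith
  have hq0 : q ≠ 0 := NeZero.ne q
  have hqpos : (1 : ℝ) ≤ q := by exact_mod_cast Nat.pos_of_ne_zero hq0
  set ψ := χ.primitiveCharacter with hψ
  have hcond : χ.conductor ≠ 1 := fun h => hχ ((χ.eq_one_iff_conductor_eq_one).mpr h)
  have : NeZero χ.conductor := ⟨χ.conductor_ne_zero⟩
  have hcq : (χ.conductor : ℝ) ≤ q := by
    exact_mod_cast Nat.le_of_dvd (Nat.pos_of_ne_zero hq0) χ.conductor_dvd_level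
  have hval : ∀ n : ℕ, χ n = if n.Coprime q then ψ n else 0 := by
    intro n
    split_ifs with h
    · have := χ.primitiveCharacter_apply_of_isCoprime (a := n) (Nat.isCoprime_iff_coprime.mpr h)
      simpa using this.symm
    · exact χ.map_nonunit (by rwa [ZMod.isUnit_iff_coprime])
  simp_rw [hval]
  rw [sum_coprime_eq_sum_divisors hq0]
  have hterm : ∀ d ∈ q.divisors, ‖(ArithmeticFunction.moebius d : ℂ) *
          ∑ n ∈ (range M).filter (d ∣ ·), ψ n‖ ≤ Real.sqrt q * (1 + Real.log q) := by
    intro d hd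
    rw [sum_filter_dvd_range (Nat.pos_of_mem_divisors hd)]
    push_cast
    simp_rw [map_mul, ← mul_sum]
    have hμ : ‖(ArithmeticFunction.moebius d : ℂ)‖ ≤ 1 := by
      rw [Complex.norm_intCast]
      exact_mod_cast ArithmeticFunction.abs_moebius_le_one
    have h1 := polya_vinogradov_primitive hcond χ.primitiveCharacter_isPrimitive
      ((M + d - 1) / d)
    rw [norm_mul, norm_mul]
    have h2 : ‖ψ (d : ZMod χ.conductor)‖ ≤ 1 := DirichletCharacter.norm_le_one _ _
    have hc1 : (1 : ℝ) ≤ χ.conductor := by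
      exact_mod_cast Nat.pos_of_ne_zero χ.conductor_ne_zero
    calc _ ≤ 1 * (1 * (Real.sqrt χ.conductor * (1 + Real.log χ.conductor))) := by
          have := Real.log_nonneg hc1
          gcongr
      _ ≤ _ := by
          rw [one_mul, one_mul]
          have := Real.log_nonneg hc1
          gcongr
  calc _ ≤ ∑ d ∈ q.divisors, Real.sqrt q * (1 + Real.log q) :=
        (norm_sum_le _ _).trans (sum_le_sum hterm)
    _ = (q.divisors.card : ℝ) * (Real.sqrt q * (1 + Real.log q)) := by simp
    _ ≤ (C * (q : ℝ) ^ (ε / 2)) * ((q : ℝ) ^ (1 / 2 : ℝ) * ((1 + 1 / (ε / 2)) * (q : ℝ) ^ (ε / 2))) := by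
        rw [← Real.sqrt_eq_rpow]
        have hlog := Real.log_nonneg hqpos
        have h3 : 1 + Real.log q ≤ (1 + 1 / (ε / 2)) * (q : ℝ) ^ (ε / 2) := by
          have h4 := Real.log_le_rpow_div (x := q) (by linarith) (half_pos hε)
          have h5 : (1 : ℝ) ≤ (q : ℝ) ^ (ε / 2) := Real.one_le_rpow hqpos (by positivity)
          calc 1 + Real.log q ≤ (q : ℝ) ^ (ε / 2) + (q : ℝ) ^ (ε / 2) / (ε / 2) := by linarith
            _ = _ := by ring
        gcongr
        exact hdiv q hq0
    _ = _ := by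
        have : (q : ℝ) ^ (1 / 2 + ε) = (q : ℝ) ^ (ε / 2) * (q : ℝ) ^ (1 / 2 : ℝ) * (q : ℝ) ^ (ε / 2) := by
          rw [← Real.rpow_add (by linarith), ← Real.rpow_add (by linarith)]; congr 1; ring
        rw [this]; ring

end LFZ

namespace LFZ
open Finset Filter Topology

theorem norm_cpow_neg_sub_le {s : ℂ} (hs : 0 < s.re) {x y : ℝ} (hx : 0 < x) (hxy : x ≤ y) :
    ‖(y : ℂ) ^ (-s) - (x : ℂ) ^ (-s)‖ ≤ ‖s‖ / s.re * (x ^ (-s.re) - y ^ (-s.re)) := by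
  have hsne : -s ≠ 0 := by
    intro h; have := congrArg Complex.re h; simp at this; linarith
  have hder : ∀ t ∈ Set.Icc x y, HasDerivAt (fun t : ℝ => (t : ℂ) ^ (-s) - (x : ℂ) ^ (-s))
      ((-s) * (t : ℂ) ^ (-s - 1)) t := by
    intro t ht
    have ht0 : t ≠ 0 := (hx.trans_le ht.1).ne'
    simpa using (hasDerivAt_ofReal_cpow_const ht0 hsne).sub_const ((x : ℂ) ^ (-s))
  have hder2 : ∀ t : ℝ, 0 < t → HasDerivAt (fun t : ℝ => ‖s‖ / s.re * (x ^ (-s.re) - t ^ (-s.re)))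
      (‖s‖ * t ^ (-s.re - 1)) t := by
    intro t ht
    have h1 := (Real.hasDerivAt_rpow_const (x := t) (p := -s.re) (Or.inl ht.ne'))
    have h2 := (h1.const_sub (x ^ (-s.re))).const_mul (‖s‖ / s.re)
    have h3 : ‖s‖ * t ^ (-s.re - 1) = ‖s‖ / s.re * -(-s.re * t ^ (-s.re - 1)) := by
      field_simp
    rw [h3]; exact h2
  have := image_norm_le_of_norm_deriv_right_le_deriv_boundary'
    (f := fun t : ℝ => (t : ℂ) ^ (-s) - (x : ℂ) ^ (-s)) (a := x) (b := y)
    (f' := fun t => (-s) * (t : ℂ) ^ (-s - 1))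
    (B := fun t : ℝ => ‖s‖ / s.re * (x ^ (-s.re) - t ^ (-s.re)))
    (B' := fun t : ℝ => ‖s‖ * t ^ (-s.re - 1))
    (fun t ht => (hder t ht).continuousAt.continuousWithinAt)
    (fun t ht => (hder t ⟨ht.1, ht.2.le⟩).hasDerivWithinAt)
    (by simp)
    (fun t ht => (hder2 t (hx.trans_le ht.1)).continuousAt.continuousWithinAt)
    (fun t ht => (hder2 t (hx.trans_le ht.1)).hasDerivWithinAt)
    (fun t ht => by
      have ht0 : 0 < t := hx.trans_le ht.1
      rw [norm_mul, norm_neg, Complex.norm_cpow_eq_rpow_re_of_pos ht0]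
      simp)
  exact this ⟨hxy, le_refl y⟩

/-- Partial summation for Dirichlet polynomials with bounded coefficient sums. -/
theorem norm_sum_Ico_mul_cpow_le {c : ℕ → ℂ} {B : ℝ} {M : ℕ} (hM : 0 < M)
    (hB : ∀ N, ‖∑ n ∈ Ico M N, c n‖ ≤ B) {s : ℂ} (hs : 0 < s.re) (N : ℕ) :
    ‖∑ n ∈ Ico M N, c n * (n : ℂ) ^ (-s)‖ ≤ B * (1 + ‖s‖ / s.re) * (M : ℝ) ^ (-s.re) := by
  have hB0 : 0 ≤ B := (norm_nonneg _).trans (hB 0)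
  have hMr : (0 : ℝ) < M := by exact_mod_cast hM
  rcases lt_or_ge N M with hNM | hNM
  · rw [Finset.Ico_eq_empty_of_le hNM.le]; simp; positivity
  have key : ∀ N, M ≤ N → ∑ n ∈ Ico M N, c n * (n : ℂ) ^ (-s) =
      (∑ n ∈ Ico M N, c n) * (N : ℂ) ^ (-s) - ∑ n ∈ Ico M N, (∑ m ∈ Ico M (n + 1), c m) *
        (((n + 1 : ℕ) : ℂ) ^ (-s) - (n : ℂ) ^ (-s)) := by
    intro N hN
    induction N, hN using Nat.le_induction with
    | base => simp
    | succ k hk ih =>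
      rw [Finset.sum_Ico_succ_top hk, ih, Finset.sum_Ico_succ_top hk (fun n => (∑ m ∈ Ico M (n + 1), c m) * _),
        Finset.sum_Ico_succ_top hk]
      ring
  have tel : ∀ N, M ≤ N → ∑ n ∈ Ico M N, ((n : ℝ) ^ (-s.re) - ((n + 1 : ℕ) : ℝ) ^ (-s.re))
      = (M : ℝ) ^ (-s.re) - (N : ℝ) ^ (-s.re) := by
    intro N hN
    induction N, hN using Nat.le_induction with
    | base => simp
    | succ k hk ih => rw [Finset.sum_Ico_succ_top hk, ih]; ring
  rw [key N hNM]
  have h1 : ‖(∑ n ∈ Ico M N, c n) * (N : ℂ) ^ (-s)‖ ≤ B * (N : ℝ) ^ (-s.re) := by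
    rw [norm_mul, Complex.norm_natCast_cpow_of_pos (by omega)]
    simp only [Complex.neg_re]
    gcongr
    exact hB N
  have h2 : ‖∑ n ∈ Ico M N, (∑ m ∈ Ico M (n + 1), c m) *
        (((n + 1 : ℕ) : ℂ) ^ (-s) - (n : ℂ) ^ (-s))‖ ≤
      B * (‖s‖ / s.re * ((M : ℝ) ^ (-s.re) - (N : ℝ) ^ (-s.re))) := by
    rw [← tel N hNM, mul_sum, mul_sum]
    refine (norm_sum_le _ _).trans (sum_le_sum fun n hn => ?_)
    simp at hn
    have hn0 : (0 : ℝ) < n := by exact_mod_cast (by omega : 0 < n)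
    have := norm_cpow_neg_sub_le hs hn0 (y := ((n + 1 : ℕ) : ℝ)) (by push_cast; linarith)
    rw [norm_mul]
    exact mul_le_mul (hB _) (by exact_mod_cast this) (norm_nonneg _) hB0
  have h3 : (N : ℝ) ^ (-s.re) ≤ (M : ℝ) ^ (-s.re) :=
    Real.rpow_le_rpow_of_nonpos hMr (by exact_mod_cast hNM) (by linarith)
  have h4 : (0 : ℝ) ≤ (N : ℝ) ^ (-s.re) := by positivity
  have h5 : 0 ≤ ‖s‖ / s.re := by positivity
  calc _ ≤ _ + _ := norm_sub_le _ _
    _ ≤ B * (N : ℝ) ^ (-s.re) + B * (‖s‖ / s.re * ((M : ℝ) ^ (-s.re) - (N : ℝ) ^ (-s.re))) :=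
      add_le_add h1 h2
    _ ≤ _ := by
      have h6 := mul_nonneg hB0 (mul_nonneg h5 h4)
      nlinarith [mul_le_mul_of_nonneg_left h3 hB0]

theorem norm_sum_Ico_le {c : ℕ → ℂ} {B : ℝ} (hB : ∀ N, ‖∑ n ∈ range N, c n‖ ≤ B) (M N : ℕ) :
    ‖∑ n ∈ Ico M N, c n‖ ≤ 2 * B := by
  have hB0 : 0 ≤ B := (norm_nonneg _).trans (hB 0)
  rcases le_total M N with h | h
  · rw [Finset.sum_Ico_eq_sub _ h]
    calc _ ≤ _ + _ := norm_sub_le _ _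
      _ ≤ _ := by linarith [hB M, hB N]
  · rw [Finset.Ico_eq_empty_of_le h]; simp; linarith

/-- A nonprincipal `L`-function is approximated by its partial sums in the right half plane. -/
theorem norm_LFunction_sub_sum_le {q : ℕ} [NeZero q] {χ : DirichletCharacter ℂ q} (hχ : χ ≠ 1)
    {B : ℝ} (hB : ∀ N, ‖∑ n ∈ range N, χ n‖ ≤ B) {s : ℂ} (hs : 0 < s.re) {M : ℕ} (hM : 0 < M) :
    ‖χ.LFunction s - ∑ n ∈ Ico 1 M, χ n * (n : ℂ) ^ (-s)‖ ≤
      2 * B * (1 + ‖s‖ / s.re) * (M : ℝ) ^ (-s.re) := by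
  set F : ℕ → ℂ → ℂ := fun N s => ∑ n ∈ Ico 1 N, χ n * (n : ℂ) ^ (-s) with hF
  have hB0 : 0 ≤ B := (norm_nonneg _).trans (hB 0)
  have hdiff : ∀ {s : ℂ}, 0 < s.re → ∀ M N : ℕ, 0 < M → M ≤ N →
      ‖F N s - F M s‖ ≤ 2 * B * (1 + ‖s‖ / s.re) * (M : ℝ) ^ (-s.re) := by
    intro s hs M N hM hMN
    have : F N s - F M s = ∑ n ∈ Ico M N, χ n * (n : ℂ) ^ (-s) := by
      rw [hF]
      simp only
      rw [← Finset.sum_Ico_consecutive _ (show 1 ≤ M by omega) hMN]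
      ring
    rw [this]
    exact norm_sum_Ico_mul_cpow_le hM (fun N => norm_sum_Ico_le hB M N) hs N
  have htend0 : ∀ {σ : ℝ}, 0 < σ → ∀ K : ℝ,
      Tendsto (fun N : ℕ => K * (N : ℝ) ^ (-σ)) atTop (𝓝 0) := by
    intro σ hσ K
    have := ((tendsto_rpow_neg_atTop hσ).comp tendsto_natCast_atTop_atTop).const_mul K
    simpa using this
  have hlim : ∀ s : ℂ, 0 < s.re → ∃ G, Tendsto (fun N => F N s) atTop (𝓝 G) := by
    intro s hs
    apply cauchySeq_tendsto_of_complete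
    rw [Metric.cauchySeq_iff']
    intro ε hε
    have h1 := (htend0 hs (2 * B * (1 + ‖s‖ / s.re))).eventually (gt_mem_nhds hε)
    obtain ⟨N, hN, hN1⟩ := (h1.and (eventually_ge_atTop 1)).exists
    refine ⟨N, fun n hn => ?_⟩
    rw [dist_eq_norm]
    exact (hdiff hs N n hN1 hn).trans_lt hN
  choose! G hG using hlim
  have hGF : ∀ s : ℂ, 0 < s.re → ∀ M : ℕ, 0 < M →
      ‖G s - F M s‖ ≤ 2 * B * (1 + ‖s‖ / s.re) * (M : ℝ) ^ (-s.re) := by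
    intro s hs M hM
    have h1 : Tendsto (fun N => ‖F N s - F M s‖) atTop (𝓝 ‖G s - F M s‖) :=
      ((hG s hs).sub_const _).norm
    refine le_of_tendsto h1 ?_
    filter_upwards [eventually_ge_atTop M] with N hN using hdiff hs M N hM hN
  have hopen : IsOpen {s : ℂ | 0 < s.re} := isOpen_lt continuous_const Complex.continuous_re
  have hloc : TendstoLocallyUniformlyOn F G atTop {s : ℂ | 0 < s.re} := by
    rw [tendstoLocallyUniformlyOn_iff_forall_isCompact hopen]
    intro K hK hKc
    rcases K.eq_empty_or_nonempty with rfl | hne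
    · exact tendstoUniformlyOn_empty
    obtain ⟨z0, hz0, hz0min⟩ := hKc.exists_isMinOn hne Complex.continuous_re.continuousOn
    obtain ⟨A, hA⟩ := hKc.isBounded.exists_norm_le
    have hσ0 : 0 < z0.re := hK hz0
    have hA0 : 0 ≤ A := (norm_nonneg _).trans (hA z0 hz0)
    rw [Metric.tendstoUniformlyOn_iff]
    intro ε hε
    have h1 := (htend0 hσ0 (2 * B * (1 + A / z0.re))).eventually (gt_mem_nhds hε)
    filter_upwards [h1, eventually_ge_atTop 1] with N hN hN1 x hx
    rw [dist_eq_norm]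
    have hxr : z0.re ≤ x.re := hz0min hx
    refine ((hGF x (hK hx) N hN1).trans ?_).trans_lt hN
    have hN1' : (1 : ℝ) ≤ N := by exact_mod_cast hN1
    have := hA x hx
    gcongr
  have hGdiff : DifferentiableOn ℂ G {s : ℂ | 0 < s.re} := by
    refine hloc.differentiableOn (Eventually.of_forall fun N => ?_) hopen
    intro s _
    refine DifferentiableWithinAt.fun_sum fun n hn => ?_
    simp at hn
    refine DifferentiableWithinAt.const_mul ?_ _
    refine (DifferentiableAt.const_cpow (by fun_prop) (Or.inl ?_)).differentiableWithinAt
    exact_mod_cast (by omega : n ≠ 0)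
  have hGL : Set.EqOn G χ.LFunction {s : ℂ | 0 < s.re} := by
    refine (hGdiff.analyticOnNhd hopen).eqOn_of_preconnected_of_eventuallyEq (z₀ := 2)
      ((DirichletCharacter.differentiable_LFunction hχ).differentiableOn.analyticOnNhd hopen)
      (convex_halfSpace_re_gt 0).isPreconnected (by simp) ?_
    have : {s : ℂ | 1 < s.re} ∈ 𝓝 (2 : ℂ) :=
      (isOpen_lt continuous_const Complex.continuous_re).mem_nhds (by simp)
    filter_upwards [this] with s hs
    have hs' : 1 < s.re := hs
    rw [DirichletCharacter.LFunction_eq_LSeries _ hs']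
    have hsum := DirichletCharacter.LSeriesSummable_of_one_lt_re χ hs'
    have h1 := hsum.hasSum.tendsto_sum_nat
    refine tendsto_nhds_unique (hG s (by linarith)) (h1.congr' ?_)
    filter_upwards [eventually_ge_atTop 1] with N hN
    rw [hF, Finset.range_eq_Ico, Finset.sum_eq_sum_Ico_succ_bot (by omega)]
    simp only [LSeries.term_zero, zero_add]
    refine sum_congr rfl fun n hn => ?_
    simp at hn
    rw [LSeries.term_of_ne_zero (by omega), Complex.cpow_neg, div_eq_mul_inv]
  rw [← hGL hs]
  exact hGF s hs M hM

/-- Convexity-type upper bound for nonprincipal `L`-functions. -/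
theorem norm_LFunction_le {ε T : ℝ} (hε : 0 < ε) (hT : 0 ≤ T) :
    ∃ K : ℝ, 1 ≤ K ∧ ∀ (q : ℕ) [NeZero q] (χ : DirichletCharacter ℂ q), χ ≠ 1 → ∀ s : ℂ,
      1 / 4 ≤ s.re → |s.im| ≤ T →
      ‖χ.LFunction s‖ ≤ K * (q : ℝ) ^ (1 / 2 * max 0 (1 - s.re) + ε) := by
  obtain ⟨C, hC, hPV⟩ := polya_vinogradov hε
  refine ⟨2 * (3 + 1 / ε) + 2 * C * (2 + 4 * T), ?_, fun q _ χ hχ s hs ht => ?_⟩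
  · have : 0 < 1 / ε := by positivity
    nlinarith
  have hq1 : (1 : ℝ) ≤ q := by exact_mod_cast Nat.pos_of_ne_zero (NeZero.ne q)
  have hq0 : (0 : ℝ) < q := by linarith
  have hs0 : 0 < s.re := by linarith
  set M : ℕ := ⌈(q : ℝ) ^ (1 / 2 : ℝ)⌉₊ with hM
  have hM1 : (q : ℝ) ^ (1 / 2 : ℝ) ≤ M := Nat.le_ceil _
  have hsq1 : (1 : ℝ) ≤ (q : ℝ) ^ (1 / 2 : ℝ) := Real.one_le_rpow hq1 (by norm_num)
  have hM2 : (M : ℝ) ≤ 2 * (q : ℝ) ^ (1 / 2 : ℝ) := by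
    have := Nat.ceil_lt_add_one (a := (q : ℝ) ^ (1 / 2 : ℝ)) (by positivity)
    linarith
  have hMpos : 0 < M := by
    have : (0 : ℝ) < M := by linarith
    exact_mod_cast this
  have hMr : (1 : ℝ) ≤ M := by exact_mod_cast hMpos
  set m := max 0 (1 - s.re) with hm
  have hm0 : 0 ≤ m := le_max_left _ _
  have hm1 : m ≤ 1 := max_le (by norm_num) (by linarith)
  have hms : 1 - s.re ≤ m := le_max_right _ _
  have h1 := norm_LFunction_sub_sum_le hχ (hPV q χ hχ) hs0 hMpos
  have hsum : ‖∑ n ∈ Ico 1 M, χ n * (n : ℂ) ^ (-s)‖ ≤ (M : ℝ) ^ m * (1 + Real.log M) := by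
    calc _ ≤ ∑ n ∈ Ico 1 M, (M : ℝ) ^ m * (1 / n) := by
          refine (norm_sum_le _ _).trans (sum_le_sum fun n hn => ?_)
          simp at hn
          have hn1 : (1 : ℝ) ≤ n := by exact_mod_cast hn.1
          have hnM : (n : ℝ) ≤ M := by exact_mod_cast hn.2.le
          rw [norm_mul, Complex.norm_natCast_cpow_of_pos (by omega)]
          calc _ ≤ 1 * (n : ℝ) ^ (-s).re := by
                gcongr; exact DirichletCharacter.norm_le_one _ _
            _ ≤ (n : ℝ) ^ (m - 1) := by
                rw [one_mul]
                exact Real.rpow_le_rpow_of_exponent_le hn1 (by simp; linarith)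
            _ = (n : ℝ) ^ m * (1 / n) := by
                rw [Real.rpow_sub (by linarith), Real.rpow_one]; ring
            _ ≤ _ := by gcongr
      _ = (M : ℝ) ^ m * ∑ n ∈ Ico 1 M, (1 : ℝ) / n := by rw [mul_sum]
      _ ≤ _ := by gcongr; exact sum_inv_le M
  have hMm : (M : ℝ) ^ m ≤ 2 * (q : ℝ) ^ (1 / 2 * m) := by
    calc (M : ℝ) ^ m ≤ (2 * (q : ℝ) ^ (1 / 2 : ℝ)) ^ m := by gcongr
      _ = (2 : ℝ) ^ m * (q : ℝ) ^ (1 / 2 * m) := by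
          rw [Real.mul_rpow (by norm_num) (by positivity), ← Real.rpow_mul hq0.le]
      _ ≤ (2 : ℝ) ^ (1 : ℝ) * (q : ℝ) ^ (1 / 2 * m) := by
          gcongr; norm_num
      _ = _ := by norm_num
  have hlog : 1 + Real.log M ≤ (3 + 1 / ε) * (q : ℝ) ^ ε := by
    have h2 : Real.log M ≤ Real.log 2 + Real.log q / 2 := by
      calc Real.log M ≤ Real.log (2 * (q : ℝ) ^ (1 / 2 : ℝ)) := Real.log_le_log (by linarith) hM2
        _ = _ := by
          rw [Real.log_mul (by norm_num) (by positivity), Real.log_rpow hq0]; ring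
    have h3 := Real.log_le_rpow_div hq0.le hε
    have h4 : (1 : ℝ) ≤ (q : ℝ) ^ ε := Real.one_le_rpow hq1 hε.le
    have h5 := Real.log_two_lt_d9
    have h6 := Real.log_nonneg hq1
    have h7 : (3 + 1 / ε) * (q : ℝ) ^ ε = 3 * (q : ℝ) ^ ε + (q : ℝ) ^ ε / ε := by ring
    rw [h7]; linarith
  have hns : ‖s‖ / s.re ≤ 1 + 4 * T := by
    rw [div_le_iff₀ hs0]
    have := Complex.norm_le_abs_re_add_abs_im s
    rw [abs_of_pos hs0] at this
    nlinarith
  have htail : (q : ℝ) ^ (1 / 2 + ε) * (M : ℝ) ^ (-s.re) ≤ (q : ℝ) ^ (1 / 2 * m + ε) := by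
    calc _ ≤ (q : ℝ) ^ (1 / 2 + ε) * ((q : ℝ) ^ (1 / 2 : ℝ)) ^ (-s.re) := by
          gcongr ?_ * ?_
          exact Real.rpow_le_rpow_of_nonpos (by linarith) hM1 (by linarith)
      _ = (q : ℝ) ^ (1 / 2 + ε + 1 / 2 * (-s.re)) := by
          rw [← Real.rpow_mul hq0.le, ← Real.rpow_add hq0]
      _ ≤ _ := Real.rpow_le_rpow_of_exponent_le hq1 (by linarith)
  have hfin : ‖χ.LFunction s‖ ≤ 2 * (C * (q : ℝ) ^ (1 / 2 + ε)) * (1 + ‖s‖ / s.re) *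
      (M : ℝ) ^ (-s.re) + (M : ℝ) ^ m * (1 + Real.log M) := by
    calc _ = ‖(χ.LFunction s - ∑ n ∈ Ico 1 M, χ n * (n : ℂ) ^ (-s)) +
            ∑ n ∈ Ico 1 M, χ n * (n : ℂ) ^ (-s)‖ := by rw [sub_add_cancel]
      _ ≤ _ := (norm_add_le _ _).trans (add_le_add h1 hsum)
  have e1 : (M : ℝ) ^ m * (1 + Real.log M) ≤
      2 * (3 + 1 / ε) * (q : ℝ) ^ (1 / 2 * m + ε) := by
    have := Real.log_nonneg hMr
    calc _ ≤ (2 * (q : ℝ) ^ (1 / 2 * m)) * ((3 + 1 / ε) * (q : ℝ) ^ ε) := by gcongr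
      _ = _ := by rw [Real.rpow_add hq0]; ring
  have e2 : 2 * (C * (q : ℝ) ^ (1 / 2 + ε)) * (1 + ‖s‖ / s.re) * (M : ℝ) ^ (-s.re) ≤
      2 * C * (2 + 4 * T) * (q : ℝ) ^ (1 / 2 * m + ε) := by
    calc _ = 2 * C * (1 + ‖s‖ / s.re) * ((q : ℝ) ^ (1 / 2 + ε) * (M : ℝ) ^ (-s.re)) := by ring
      _ ≤ _ := by
        have : 1 + ‖s‖ / s.re ≤ 2 + 4 * T := by linarith
        exact mul_le_mul (mul_le_mul_of_nonneg_left this (by positivity)) htail (by positivity)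
          (by positivity)
  linarith

end LFZ

namespace LFZ
open Finset Filter Topology Metric Real

/-- A holomorphic logarithm on a disc. -/
theorem exists_log {F : ℂ → ℂ} (hF : Differentiable ℂ F) {ρ : ℝ} (hρ : 0 < ρ)
    (h0 : ∀ z ∈ ball (0 : ℂ) ρ, F z ≠ 0) :
    ∃ h : ℂ → ℂ, (∀ z ∈ ball (0 : ℂ) ρ, HasDerivAt h (logDeriv F z) z) ∧
      ∀ z ∈ ball (0 : ℂ) ρ, Complex.exp (h z) = F z := by
  have hd : DifferentiableOn ℂ (logDeriv F) (ball 0 ρ) := by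
    unfold logDeriv
    exact (hF.contDiff.differentiable_deriv_two.differentiableOn).div hF.differentiableOn h0
  obtain ⟨h, hh0, hh⟩ := (hd.isExactOn_ball).with_val_at 0 (Complex.log (F 0))
  refine ⟨h, hh, ?_⟩
  have hmem : (0 : ℂ) ∈ ball (0 : ℂ) ρ := by simpa using hρ
  have hconst : ∀ z ∈ ball (0 : ℂ) ρ, HasDerivAt (fun w => F w * Complex.exp (-h w)) 0 z := by
    intro z hz
    refine ((hF z).hasDerivAt.mul ((hh z hz).neg.cexp)).congr_deriv ?_
    have := h0 z hz
    rw [logDeriv_apply, Pi.neg_apply]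
    field_simp
    ring
  have hc : ∀ z ∈ ball (0 : ℂ) ρ, F z * Complex.exp (-h z) = F 0 * Complex.exp (-h 0) := by
    intro z hz
    refine (isOpen_ball.is_const_of_deriv_eq_zero (convex_ball _ _).isPreconnected
      (fun w hw => (hconst w hw).differentiableAt.differentiableWithinAt)
      (fun w hw => (hconst w hw).deriv) hz hmem)
  intro z hz
  have := hc z hz
  rw [hh0, Complex.exp_neg (Complex.log _), Complex.exp_log (h0 0 hmem),
    mul_inv_cancel₀ (h0 0 hmem), Complex.exp_neg] at this
  field_simp at this
  exact this.symm

theorem circleAverage_ofReal_re {f : ℂ → ℂ} {r : ℝ} (hf : CircleIntegrable f 0 r) :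
    circleAverage (fun z => (f z).re) 0 r = (circleAverage f 0 r).re :=
  Complex.reCLM.circleAverage_comp_comm hf

/-- The cosine Fourier coefficients of the real part of a holomorphic function on a circle. -/
theorem circleAverage_re_mul_re_pow {h : ℂ → ℂ} {r : ℝ} (hr : 0 < r)
    (hh : DiffContOnCl ℂ h (ball 0 r)) {k : ℕ} (hk : k ≠ 0) :
    circleAverage (fun z => (h z).re * (z ^ k).re) 0 r
      = r ^ (2 * k) / 2 * (iteratedDeriv k h 0 / k.factorial).re := by
  have hcont : ContinuousOn h (sphere 0 r) :=
    hh.continuousOn_ball.mono sphere_subset_closedBall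
  have hne : ∀ z ∈ sphere (0 : ℂ) r, z ≠ 0 := by
    intro z hz h0
    simp [h0] at hz
    exact hr.ne hz
  have hint1 : CircleIntegrable (fun z => h z * z ^ k) 0 r :=
    (hcont.mul (by fun_prop)).circleIntegrable hr.le
  have hint2 : CircleIntegrable (fun z => h z * (z ^ k)⁻¹) 0 r :=
    (hcont.mul (ContinuousOn.inv₀ (by fun_prop) fun z hz => pow_ne_zero _ (hne z hz))).circleIntegrable
      hr.le
  have e1 : circleAverage (fun z => h z * z ^ k) 0 r = 0 := by
    have hd : DiffContOnCl ℂ (fun z => h z * z ^ k) (ball 0 |r|) := by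
      rw [abs_of_pos hr]
      exact hh.smul (c := h) (f := fun z => z ^ k)
        (Differentiable.diffContOnCl (by fun_prop))
    rw [hd.circleAverage]
    simp [hk]
  have e2 : circleAverage (fun z => h z * (z ^ k)⁻¹) 0 r = iteratedDeriv k h 0 / k.factorial := by
    rw [circleAverage_eq_circleIntegral hr.ne']
    have := hh.circleIntegral_one_div_sub_center_pow_smul hr k
    have e : (∮ z in C(0, r), (z - 0)⁻¹ • (h z * (z ^ k)⁻¹))
        = ∮ z in C(0, r), (1 / (z - 0) ^ (k + 1)) • h z := by
      congr 1
      ext z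
      simp only [sub_zero, smul_eq_mul, pow_succ]
      field_simp
    rw [e, this, smul_smul]
    have : (2 * (π : ℂ) * Complex.I) ≠ 0 := Complex.two_pi_I_ne_zero
    simp only [smul_eq_mul]
    field_simp
  have hpt : Set.EqOn (fun z => (h z).re * (z ^ k).re)
      (fun z => (h z * z ^ k).re * (1 / 2) + (h z * (z ^ k)⁻¹).re * (r ^ (2 * k) / 2))
      (sphere 0 |r|) := by
    intro z hz
    rw [abs_of_pos hr] at hz
    have hz' : ‖z ^ k‖ ^ 2 = r ^ (2 * k) := by
      simp at hz
      rw [norm_pow, hz]; ring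
    have hconj : (z ^ k)⁻¹ * (r ^ (2 * k) : ℝ) = (starRingEnd ℂ) (z ^ k) := by
      rw [Complex.inv_def, ← hz', Complex.normSq_eq_norm_sq, mul_assoc, ← Complex.ofReal_mul,
        inv_mul_cancel₀ (pow_ne_zero _ (norm_ne_zero_iff.2 (pow_ne_zero _ (hne z hz))))]
      simp
    have e3 : (h z * (z ^ k)⁻¹).re * (r ^ (2 * k) / 2) =
        (h z * (starRingEnd ℂ) (z ^ k)).re / 2 := by
      rw [← hconj, ← mul_assoc, Complex.re_mul_ofReal]
      ring
    simp only [e3]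
    simp only [Complex.mul_re, Complex.conj_re, Complex.conj_im]
    ring
  rw [circleAverage_congr_sphere hpt, circleAverage_fun_add]
  · have h1 : circleAverage (fun z => (h z * z ^ k).re * (1 / 2)) 0 r = 0 := by
      have := circleAverage_ofReal_re hint1
      rw [e1] at this
      have h2 := circleAverage_fun_smul (a := (1 / 2 : ℝ)) (f := fun z => (h z * z ^ k).re) (c := 0)
        (R := r)
      simp only [smul_eq_mul, this] at h2
      simpa [mul_comm] using h2
    have h2 : circleAverage (fun z => (h z * (z ^ k)⁻¹).re * (r ^ (2 * k) / 2)) 0 r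
        = r ^ (2 * k) / 2 * (iteratedDeriv k h 0 / k.factorial).re := by
      have := circleAverage_ofReal_re hint2
      rw [e2] at this
      have h2 := circleAverage_fun_smul (a := (r ^ (2 * k) / 2 : ℝ))
        (f := fun z => (h z * (z ^ k)⁻¹).re) (c := 0) (R := r)
      simp only [smul_eq_mul, this] at h2
      simpa [mul_comm] using h2
    rw [h1, h2, zero_add]
  · exact ((Complex.continuous_re.comp_continuousOn (hcont.mul (by fun_prop))).mul
      continuousOn_const).circleIntegrable hr.le
  · refine ContinuousOn.circleIntegrable hr.le (ContinuousOn.mul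
      (Complex.continuous_re.comp_continuousOn (hcont.mul ?_)) continuousOn_const)
    exact ContinuousOn.inv₀ (by fun_prop) fun z hz => pow_ne_zero _ (hne z hz)

/-- Jensen-type formulas for a zero-free function. -/
theorem circleAverage_log_norm_zero_free {F : ℂ → ℂ} (hF : Differentiable ℂ F) {r : ℝ}
    (hr : 0 < r) (h0 : ∀ z ∈ closedBall (0 : ℂ) r, F z ≠ 0) :
    circleAverage (fun z => Real.log ‖F z‖) 0 r = Real.log ‖F 0‖ ∧
    circleAverage (fun z => Real.log ‖F z‖ * z.re) 0 r = r ^ 2 / 2 * (logDeriv F 0).re ∧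
    circleAverage (fun z => Real.log ‖F z‖ * (z ^ 2).re) 0 r
      = r ^ 4 / 4 * (deriv (logDeriv F) 0).re := by
  obtain ⟨δ, hδ, hsub⟩ := (isCompact_closedBall (0 : ℂ) r).exists_thickening_subset_open
    (isOpen_ne_fun hF.continuous continuous_const : IsOpen {z | F z ≠ 0}) h0
  rw [thickening_closedBall hδ hr.le] at hsub
  obtain ⟨h, hh, hexp⟩ := exists_log hF (ρ := δ + r) (by positivity) (fun z hz => hsub hz)
  have hsub2 : closedBall (0 : ℂ) r ⊆ ball 0 (δ + r) := closedBall_subset_ball (by linarith)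
  have hdiff : DifferentiableOn ℂ h (ball 0 (δ + r)) :=
    fun z hz => (hh z hz).differentiableAt.differentiableWithinAt
  have hcl : DiffContOnCl ℂ h (ball 0 r) := (hdiff.mono (by
    rw [closure_ball _ hr.ne']; exact hsub2)).diffContOnCl
  have hlog : ∀ z ∈ closedBall (0 : ℂ) r, Real.log ‖F z‖ = (h z).re := by
    intro z hz
    rw [← hexp z (hsub2 hz), Complex.norm_exp, Real.log_exp]
  have hlog' : ∀ z ∈ sphere (0 : ℂ) |r|, Real.log ‖F z‖ = (h z).re := by
    intro z hz
    rw [abs_of_pos hr] at hz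
    exact hlog z (sphere_subset_closedBall hz)
  have hd1 : deriv h =ᶠ[𝓝 0] logDeriv F := by
    filter_upwards [ball_mem_nhds (0 : ℂ) (by positivity : 0 < δ + r)] with z hz
    exact (hh z hz).deriv
  refine ⟨?_, ?_, ?_⟩
  · rw [circleAverage_congr_sphere (f₂ := fun z => (h z).re) (fun z hz => hlog' z hz),
      circleAverage_ofReal_re, DiffContOnCl.circleAverage (by rwa [abs_of_pos hr]),
      hlog 0 (by simp [hr.le])]
    exact (hcl.continuousOn_ball.mono sphere_subset_closedBall).circleIntegrable hr.le
  · rw [circleAverage_congr_sphere (f₂ := fun z => (h z).re * (z ^ 1).re)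
      (fun z hz => by simp only [hlog' z hz, pow_one]),
      circleAverage_re_mul_re_pow hr hcl one_ne_zero, iteratedDeriv_one, hd1.eq_of_nhds]
    simp
  · rw [circleAverage_congr_sphere (f₂ := fun z => (h z).re * (z ^ 2).re)
      (fun z hz => by simp only [hlog' z hz]),
      circleAverage_re_mul_re_pow hr hcl two_ne_zero, iteratedDeriv_succ, iteratedDeriv_one,
      hd1.deriv_eq]
    simp
    ring

theorem zeroMult_eq {f : ℂ → ℂ} (hf : Differentiable ℂ f) (z : ℂ) :
    zeroMult f z = (analyticOrderAt f z).toNat := by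
  unfold zeroMult
  rw [dif_pos (hf.analyticAt z)]

theorem analyticOrderAt_ne_top {f : ℂ → ℂ} (hf : Differentiable ℂ f) {w : ℂ} (hw : f w ≠ 0)
    (a : ℂ) : analyticOrderAt f a ≠ ⊤ := by
  intro h
  rw [analyticOrderAt_eq_top] at h
  have hfa : AnalyticOnNhd ℂ f Set.univ := fun z _ => hf.analyticAt z
  have := hfa.eqOn_zero_of_preconnected_of_eventuallyEq_zero
    isPreconnected_univ (Set.mem_univ a) h
  exact hw (this (Set.mem_univ w))

theorem zeroMult_pos {f : ℂ → ℂ} (hf : Differentiable ℂ f) {w : ℂ} (hw : f w ≠ 0) {a : ℂ}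
    (ha : f a = 0) : 0 < zeroMult f a := by
  rw [zeroMult_eq hf]
  have h1 := analyticOrderAt_ne_top hf hw a
  have h2 : analyticOrderAt f a ≠ 0 := by
    rw [(hf.analyticAt a).analyticOrderAt_ne_zero]
    exact ha
  rw [Nat.pos_iff_ne_zero]
  simp [ENat.toNat_eq_zero, h1, h2]

theorem exists_factor {f : ℂ → ℂ} (hf : Differentiable ℂ f) {w : ℂ} (hw : f w ≠ 0) (a : ℂ) :
    ∃ g : ℂ → ℂ, Differentiable ℂ g ∧ g a ≠ 0 ∧ ∀ z, f z = (z - a) ^ zeroMult f a * g z := by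
  have htop := analyticOrderAt_ne_top hf hw a
  have hn : analyticOrderAt f a = (zeroMult f a : ℕ) := by
    rw [zeroMult_eq hf, ENat.natCast_toNat htop]
  obtain ⟨g, hg, hga, hfg⟩ := ((hf.analyticAt a).analyticOrderAt_eq_natCast).1 hn
  set n := zeroMult f a
  have hz : ∀ z, z ≠ a → (z - a) ^ n ≠ 0 := fun z hz => pow_ne_zero _ (sub_ne_zero.2 hz)
  refine ⟨Function.update (fun z => f z / (z - a) ^ n) a (g a), fun z => ?_, by simpa, fun z => ?_⟩
  · by_cases hza : z = a
    · subst hza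
      have : Function.update (fun z' => f z' / (z' - z) ^ n) z (g z) =ᶠ[𝓝 z] g := by
        filter_upwards [hfg] with y hy
        by_cases hyz : y = z
        · simp [hyz]
        · rw [Function.update_of_ne hyz, hy, smul_eq_mul, mul_div_cancel_left₀ _ (hz y hyz)]
      exact hg.differentiableAt.congr_of_eventuallyEq this
    · have : Function.update (fun z' => f z' / (z' - a) ^ n) a (g a) =ᶠ[𝓝 z]
          fun z' => f z' / (z' - a) ^ n := by
        filter_upwards [isOpen_ne.mem_nhds hza] with y hy
        rw [Function.update_of_ne hy]
      refine DifferentiableAt.congr_of_eventuallyEq ?_ this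
      exact (hf z).div (by fun_prop) (hz z hza)
  · by_cases hza : z = a
    · subst hza
      simpa using hfg.self_of_nhds
    · rw [Function.update_of_ne hza, mul_div_cancel₀ _ (hz z hza)]

theorem exists_factor_finset {f : ℂ → ℂ} (hf : Differentiable ℂ f) {w : ℂ} (hw : f w ≠ 0)
    (Z : Finset ℂ) :
    ∃ g : ℂ → ℂ, Differentiable ℂ g ∧ (∀ z ∈ Z, g z ≠ 0) ∧
      ∀ z, f z = (∏ ρ ∈ Z, (z - ρ) ^ zeroMult f ρ) * g z := by
  induction Z using Finset.induction_on with
  | empty => exact ⟨f, hf, by simp, by simp⟩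
  | insert a Z ha ih =>
    obtain ⟨g, hg, hgZ, hfg⟩ := ih
    have hgw : g w ≠ 0 := by
      intro h
      rw [hfg, h, mul_zero] at hw
      exact hw rfl
    obtain ⟨g', hg', hga', hgg'⟩ := exists_factor hg hgw a
    have hm : zeroMult g a = zeroMult f a := by
      rw [zeroMult_eq hg, zeroMult_eq hf]
      have hP : Differentiable ℂ (fun z => ∏ ρ ∈ Z, (z - ρ) ^ zeroMult f ρ) := by fun_prop
      have : f = (fun z => ∏ ρ ∈ Z, (z - ρ) ^ zeroMult f ρ) * g := funext hfg
      have h2 : analyticOrderAt f a = analyticOrderAt g a := by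
        conv_lhs => rw [this]
        rw [analyticOrderAt_mul (hP.analyticAt a) (hg.analyticAt a),
          (hP.analyticAt a).analyticOrderAt_eq_zero.2, zero_add]
        exact Finset.prod_ne_zero_iff.2 fun ρ hρ => pow_ne_zero _
          (sub_ne_zero.2 fun h => ha (h ▸ hρ))
      rw [h2]
    refine ⟨g', hg', fun z hz => ?_, fun z => ?_⟩
    · rcases Finset.mem_insert.1 hz with rfl | hz
      · exact hga'
      · intro h
        exact hgZ z hz (by rw [hgg', h, mul_zero])
    · rw [hfg, hgg', Finset.prod_insert ha, hm]
      ring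

theorem norm_sub_eq_of_mem_sphere {r : ℝ} (hr : 0 < r) {z : ℂ} (hz : ‖z‖ = r) (ρ : ℂ) :
    ‖z - ρ‖ = ‖(r : ℂ) - (starRingEnd ℂ ρ / r) * z‖ := by
  have hr' : (r : ℂ) ≠ 0 := by exact_mod_cast hr.ne'
  have h1 : (r : ℂ) - (starRingEnd ℂ ρ / r) * z = (z / r) * starRingEnd ℂ (z - ρ) := by
    have : z * starRingEnd ℂ z = (r : ℂ) ^ 2 := by
      rw [Complex.mul_conj, Complex.normSq_eq_norm_sq, hz]
      push_cast; rfl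
    rw [map_sub]
    field_simp
    linear_combination -this
  rw [h1, norm_mul, Complex.norm_conj, norm_div, hz, Complex.norm_real, Real.norm_of_nonneg hr.le,
    div_self hr.ne', one_mul]

/-- Jensen-type formulas for entire functions: mean and first two cosine coefficients of
`log ‖f‖` on a circle without zeros. -/
theorem circleAverage_log_norm_formulas {f : ℂ → ℂ} (hf : Differentiable ℂ f) (hf0 : f 0 ≠ 0)
    {r : ℝ} (hr : 0 < r) (hbd : ∀ z : ℂ, ‖z‖ = r → f z ≠ 0) (Z : Finset ℂ)
    (hZ : ∀ z, z ∈ Z ↔ f z = 0 ∧ ‖z‖ ≤ r) :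
    circleAverage (fun z => Real.log ‖f z‖) 0 r = Real.log ‖f 0‖
      + ∑ ρ ∈ Z, zeroMult f ρ * Real.log (r / ‖ρ‖) ∧
    circleAverage (fun z => Real.log ‖f z‖ * z.re) 0 r = r ^ 2 / 2 * ((logDeriv f 0).re
      + ∑ ρ ∈ Z, (zeroMult f ρ : ℝ) * (1 / ρ - starRingEnd ℂ ρ / r ^ 2).re) ∧
    circleAverage (fun z => Real.log ‖f z‖ * (z ^ 2).re) 0 r
      = r ^ 4 / 4 * ((deriv (logDeriv f) 0).re
      + ∑ ρ ∈ Z, (zeroMult f ρ : ℝ) * (1 / ρ ^ 2 - starRingEnd ℂ ρ ^ 2 / r ^ 4).re) := by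
  obtain ⟨g, hg, hgZ, hfg⟩ := exists_factor_finset hf hf0 Z
  have hr' : (r : ℂ) ≠ 0 := by exact_mod_cast hr.ne'
  have hρ0 : ∀ ρ ∈ Z, ρ ≠ 0 := fun ρ hρ h => hf0 (h ▸ ((hZ ρ).1 hρ).1)
  have hρr : ∀ ρ ∈ Z, ‖ρ‖ < r := fun ρ hρ =>
    lt_of_le_of_ne ((hZ ρ).1 hρ).2 fun h => hbd ρ h ((hZ ρ).1 hρ).1
  have hg0 : ∀ z ∈ closedBall (0 : ℂ) r, g z ≠ 0 := by
    intro z hz h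
    have hz' : ‖z‖ ≤ r := by simpa using hz
    have : z ∈ Z := (hZ z).2 ⟨by rw [hfg, h, mul_zero], hz'⟩
    exact hgZ z this h
  set B : ℂ → ℂ → ℂ := fun ρ z => (r : ℂ) - (starRingEnd ℂ ρ / r) * z with hB
  have hBd : ∀ ρ, Differentiable ℂ (B ρ) := fun ρ => by simp only [hB]; fun_prop
  have hB0 : ∀ ρ ∈ Z, ∀ z ∈ closedBall (0 : ℂ) r, B ρ z ≠ 0 := by
    intro ρ hρ z hz h
    have hz' : ‖z‖ ≤ r := by simpa using hz
    have h1 : (r : ℂ) = (starRingEnd ℂ ρ / r) * z := sub_eq_zero.1 h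
    have h2 := congrArg norm h1
    rw [norm_mul, norm_div, Complex.norm_conj, Complex.norm_real, Real.norm_of_nonneg hr.le] at h2
    have h3 : ‖ρ‖ / r < 1 := (div_lt_one hr).2 (hρr ρ hρ)
    have h4 : ‖ρ‖ / r * ‖z‖ ≤ ‖ρ‖ / r * r := by gcongr
    nlinarith
  obtain ⟨g1, g2, g3⟩ := circleAverage_log_norm_zero_free hg hr hg0
  have hBf := fun ρ hρ => circleAverage_log_norm_zero_free (hBd ρ) hr (hB0 ρ hρ)
  have hlog : ∀ z ∈ sphere (0 : ℂ) |r|, Real.log ‖f z‖ = Real.log ‖g z‖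
      + ∑ ρ ∈ Z, zeroMult f ρ * Real.log ‖B ρ z‖ := by
    intro z hz
    have hz' : ‖z‖ = r := by simpa [abs_of_pos hr] using hz
    have hzρ : ∀ ρ ∈ Z, ‖z - ρ‖ ^ zeroMult f ρ ≠ 0 := fun ρ hρ => by
      have := hρr ρ hρ
      refine pow_ne_zero _ (norm_ne_zero_iff.2 (sub_ne_zero.2 fun h => ?_))
      rw [← h, hz'] at this
      exact lt_irrefl _ this
    rw [hfg, norm_mul, norm_prod, Real.log_mul, Real.log_prod, add_comm]
    · congr 1
      refine sum_congr rfl fun ρ hρ => ?_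
      rw [norm_pow, Real.log_pow, norm_sub_eq_of_mem_sphere hr hz']
    · intro ρ hρ; rw [norm_pow]; exact hzρ ρ hρ
    · simp only [norm_pow]
      exact Finset.prod_ne_zero_iff.2 hzρ
    · exact norm_ne_zero_iff.2 (hg0 z (by simp [hz']))
  have hci : ∀ G : ℂ → ℂ, Differentiable ℂ G → (∀ z ∈ closedBall (0 : ℂ) r, G z ≠ 0) →
      ∀ p : ℂ → ℝ, Continuous p → CircleIntegrable (fun z => Real.log ‖G z‖ * p z) 0 r := by
    intro G hG hG0 p hp
    refine ContinuousOn.circleIntegrable hr.le (ContinuousOn.mul (ContinuousOn.log ?_ ?_)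
      hp.continuousOn)
    · exact hG.continuous.norm.continuousOn
    · intro z hz
      exact norm_ne_zero_iff.2 (hG0 z (sphere_subset_closedBall hz))
  have hsum : ∀ p : ℂ → ℝ, Continuous p →
      circleAverage (fun z => Real.log ‖f z‖ * p z) 0 r =
      circleAverage (fun z => Real.log ‖g z‖ * p z) 0 r +
      ∑ ρ ∈ Z, zeroMult f ρ * circleAverage (fun z => Real.log ‖B ρ z‖ * p z) 0 r := by
    intro p hp
    have hpt : Set.EqOn (fun z => Real.log ‖f z‖ * p z) (fun z => Real.log ‖g z‖ * p z +
        ∑ ρ ∈ Z, (zeroMult f ρ : ℝ) • (Real.log ‖B ρ z‖ * p z)) (sphere 0 |r|) := by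
      intro z hz
      simp only [hlog z hz, add_mul, Finset.sum_mul, smul_eq_mul, mul_assoc]
    have hBi : ∀ ρ ∈ Z, CircleIntegrable
        (fun z => (zeroMult f ρ : ℝ) • (Real.log ‖B ρ z‖ * p z)) 0 r :=
      fun ρ hρ => (hci _ (hBd ρ) (hB0 ρ hρ) p hp).const_fun_smul
    rw [circleAverage_congr_sphere hpt, circleAverage_fun_add (hci g hg hg0 p hp)
      (CircleIntegrable.fun_sum _ hBi), circleAverage_fun_sum hBi]
    congr 1
    refine sum_congr rfl fun ρ _ => ?_
    rw [circleAverage_fun_smul, smul_eq_mul]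
  have hnhds : ∀ᶠ z in 𝓝 (0 : ℂ), ‖z‖ ≤ r ∧ ∀ ρ ∈ Z, z - ρ ≠ 0 := by
    refine Filter.Eventually.and ?_ ?_
    · filter_upwards [closedBall_mem_nhds (0 : ℂ) hr] with z hz
      simpa using hz
    · rw [Filter.eventually_all_finset]
      intro ρ hρ
      filter_upwards [isOpen_ne.mem_nhds (hρ0 ρ hρ).symm] with z hz
      exact sub_ne_zero.2 hz
  have hld : logDeriv f =ᶠ[𝓝 0] fun z => ∑ ρ ∈ Z, zeroMult f ρ * (1 / (z - ρ)) + logDeriv g z := by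
    filter_upwards [hnhds] with z hz
    have hfe : f = fun z => (∏ ρ ∈ Z, (z - ρ) ^ zeroMult f ρ) * g z := funext hfg
    have hpd : ∀ ρ ∈ Z, DifferentiableAt ℂ (fun z => (z - ρ) ^ zeroMult f ρ) z :=
      fun ρ _ => by fun_prop
    conv_lhs => rw [hfe]
    rw [logDeriv_mul z _ (hg0 z (by simp [hz.1])) (by fun_prop) (hg z), logDeriv_prod]
    · congr 1
      refine sum_congr rfl fun ρ hρ => ?_
      have := logDeriv_fun_pow (f := fun z : ℂ => z - ρ) (x := z) (by fun_prop) (zeroMult f ρ)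
      rw [this, logDeriv_apply]
      simp
    · exact fun ρ hρ => pow_ne_zero _ (hz.2 ρ hρ)
    · exact hpd
    · exact Finset.prod_ne_zero_iff.2 fun ρ hρ => pow_ne_zero _ (hz.2 ρ hρ)
  have hgld : DifferentiableAt ℂ (logDeriv g) 0 := by
    unfold logDeriv
    exact (hg.contDiff.differentiable_deriv_two 0).div (hg 0) (hg0 0 (by simp [hr.le]))
  have hld0 : logDeriv g 0 = logDeriv f 0 + ∑ ρ ∈ Z, zeroMult f ρ * (1 / ρ) := by
    have e := hld.eq_of_nhds
    rw [e, add_right_comm, ← Finset.sum_add_distrib]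
    rw [Finset.sum_eq_zero, zero_add]
    intro ρ hρ
    have := hρ0 ρ hρ
    simp
  have hld1 : deriv (logDeriv g) 0 = deriv (logDeriv f) 0 +
      ∑ ρ ∈ Z, zeroMult f ρ * (1 / ρ ^ 2) := by
    have hd : HasDerivAt (fun z => ∑ ρ ∈ Z, (zeroMult f ρ : ℂ) * (1 / (z - ρ)) + logDeriv g z)
        (∑ ρ ∈ Z, (zeroMult f ρ : ℂ) * (-1 / ρ ^ 2) + deriv (logDeriv g) 0) 0 := by
      refine HasDerivAt.add (HasDerivAt.fun_sum fun ρ hρ => ?_) hgld.hasDerivAt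
      have h1 : HasDerivAt (fun z : ℂ => z - ρ) 1 0 := (hasDerivAt_id 0).sub_const ρ
      have h2 := (h1.fun_inv (by simpa using hρ0 ρ hρ)).const_mul (zeroMult f ρ : ℂ)
      simpa [one_div] using h2
    rw [hld.deriv_eq, hd.deriv, add_right_comm, ← Finset.sum_add_distrib, Finset.sum_eq_zero,
      zero_add]
    intro ρ hρ
    ring
  have hBl : ∀ ρ z, logDeriv (B ρ) z = -(starRingEnd ℂ ρ / r) / B ρ z := by
    intro ρ z
    have : HasDerivAt (B ρ) (-(starRingEnd ℂ ρ / r)) z := by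
      simpa using ((hasDerivAt_id z).const_mul (starRingEnd ℂ ρ / r)).const_sub (r : ℂ)
    rw [logDeriv_apply, this.deriv]
  have hBval : ∀ ρ, B ρ 0 = r := fun ρ => by simp [hB]
  have hBl1 : ∀ ρ, deriv (logDeriv (B ρ)) 0 = -(starRingEnd ℂ ρ ^ 2 / r ^ 4) := by
    intro ρ
    have h1 : HasDerivAt (B ρ) (-(starRingEnd ℂ ρ / r)) 0 := by
      simpa using ((hasDerivAt_id (0 : ℂ)).const_mul (starRingEnd ℂ ρ / r)).const_sub (r : ℂ)
    have h2 := (h1.fun_inv (by rw [hBval]; exact hr')).const_mul (-(starRingEnd ℂ ρ / r))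
    have e : logDeriv (B ρ) = fun z => -(starRingEnd ℂ ρ / r) * (B ρ z)⁻¹ := by
      ext z; rw [hBl, div_eq_mul_inv]
    rw [e, h2.deriv, hBval]
    field_simp
  refine ⟨?_, ?_, ?_⟩
  · have := hsum (fun _ => 1) continuous_const
    simp only [mul_one] at this
    rw [this, g1, hfg 0, norm_mul, norm_prod, Real.log_mul, Real.log_prod]
    · rw [add_comm (∑ _ ∈ Z, _) (Real.log _), add_assoc, ← Finset.sum_add_distrib]
      congr 1
      refine sum_congr rfl fun ρ hρ => ?_
      rw [(hBf ρ hρ).1, hBval, norm_pow, Real.log_pow, Complex.norm_real, Real.norm_of_nonneg hr.le,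
        Real.log_div hr.ne' (norm_ne_zero_iff.2 (hρ0 ρ hρ))]
      simp
      ring
    · intro ρ hρ
      exact norm_ne_zero_iff.2 (pow_ne_zero _ (by simpa using hρ0 ρ hρ))
    · exact Finset.prod_ne_zero_iff.2 fun ρ hρ =>
        norm_ne_zero_iff.2 (pow_ne_zero _ (by simpa using hρ0 ρ hρ))
    · exact norm_ne_zero_iff.2 (hg0 0 (by simp [hr.le]))
  · rw [hsum _ Complex.continuous_re, g2, hld0]
    have : ∀ ρ ∈ Z, (zeroMult f ρ : ℝ) * circleAverage (fun z => Real.log ‖B ρ z‖ * z.re) 0 r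
        = r ^ 2 / 2 * (zeroMult f ρ * (-(starRingEnd ℂ ρ / r ^ 2)).re) := by
      intro ρ hρ
      rw [(hBf ρ hρ).2.1, hBl, hBval, mul_left_comm]
      congr 4
      field_simp
    rw [sum_congr rfl this, ← mul_sum, ← mul_add, Complex.add_re, Complex.re_sum,
      add_assoc, ← Finset.sum_add_distrib]
    congr 2
    refine sum_congr rfl fun ρ hρ => ?_
    rw [← Complex.ofReal_natCast, Complex.re_ofReal_mul, ← mul_add, sub_eq_add_neg, Complex.add_re]
  · rw [hsum _ (by fun_prop), g3, hld1]
    have : ∀ ρ ∈ Z, (zeroMult f ρ : ℝ) * circleAverage (fun z => Real.log ‖B ρ z‖ * (z ^ 2).re) 0 r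
        = r ^ 4 / 4 * (zeroMult f ρ * (-(starRingEnd ℂ ρ ^ 2 / r ^ 4)).re) := by
      intro ρ hρ
      rw [(hBf ρ hρ).2.2, hBl1, mul_left_comm]
    rw [sum_congr rfl this, ← mul_sum, ← mul_add, Complex.add_re, Complex.re_sum,
      add_assoc, ← Finset.sum_add_distrib]
    congr 2
    refine sum_congr rfl fun ρ hρ => ?_
    rw [← Complex.ofReal_natCast, Complex.re_ofReal_mul, ← mul_add, sub_eq_add_neg, Complex.add_re]

/-- The weight `Λ(n) n^{-σ} (1 + c log n)`. -/
noncomputable def vmWeight (σ c : ℝ) (n : ℕ) : ℝ :=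
  ArithmeticFunction.vonMangoldt n * (n : ℝ) ^ (-σ) * (1 + c * Real.log n)

theorem vmWeight_nonneg {σ c : ℝ} (hc : 0 ≤ c) (n : ℕ) : 0 ≤ vmWeight σ c n := by
  unfold vmWeight
  have := Real.log_natCast_nonneg n
  have := ArithmeticFunction.vonMangoldt_nonneg (n := n)
  positivity

/-- The twist `χ(n) n^{-iτ}`. -/
noncomputable def chiTwist {q : ℕ} (χ : DirichletCharacter ℂ q) (τ : ℝ) (n : ℕ) : ℂ :=
  χ n * (n : ℂ) ^ (-(τ * Complex.I))

theorem norm_natCast_cpow_mul_I_le (n : ℕ) (τ : ℝ) : ‖(n : ℂ) ^ (-(τ * Complex.I))‖ ≤ 1 := by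
  rcases Nat.eq_zero_or_pos n with rfl | hn
  · by_cases h : (-(τ * Complex.I) : ℂ) = 0
    · simp [h]
    · rw [Nat.cast_zero, Complex.zero_cpow h]; simp
  · rw [Complex.norm_natCast_cpow_of_pos hn]; simp

theorem norm_chiTwist_le {q : ℕ} (χ : DirichletCharacter ℂ q) (τ : ℝ) (n : ℕ) :
    ‖chiTwist χ τ n‖ ≤ 1 := by
  unfold chiTwist
  rw [norm_mul]
  exact mul_le_one₀ (χ.norm_le_one _) (norm_nonneg _) (norm_natCast_cpow_mul_I_le n τ)

theorem hasSum_vmWeight_mul {q : ℕ} [NeZero q] (χ : DirichletCharacter ℂ q) {σ : ℝ} (hσ : 1 < σ)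
    (c τ : ℝ) :
    HasSum (fun n => (vmWeight σ c n : ℂ) * chiTwist χ τ n)
      (-logDeriv χ.LFunction (σ + τ * Complex.I)
        + c * deriv (logDeriv χ.LFunction) (σ + τ * Complex.I)) := by
  set s : ℂ := σ + τ * Complex.I with hs
  have hsre : 1 < s.re := by simp [hs, hσ]
  set g : ℕ → ℂ := (fun n : ℕ => χ n) * (fun n : ℕ => (ArithmeticFunction.vonMangoldt n : ℂ)) with hg
  have hL : ∀ z : ℂ, 1 < z.re → LSeries g z = -logDeriv χ.LFunction z := by
    intro z hz
    rw [hg, DirichletCharacter.LSeries_twist_vonMangoldt_eq χ hz, logDeriv_apply,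
      DirichletCharacter.LFunction_eq_LSeries χ hz,
      DirichletCharacter.deriv_LFunction_eq_deriv_LSeries χ hz, neg_div]
  have habs : LSeries.abscissaOfAbsConv g < s.re := by
    refine lt_of_le_of_lt (LSeries.abscissaOfAbsConv_le_of_forall_lt_LSeriesSummable
      (x := 1) fun y hy => ?_) (by exact_mod_cast hsre)
    exact DirichletCharacter.LSeriesSummable_twist_vonMangoldt χ (by simpa using hy)
  have hev : LSeries g =ᶠ[𝓝 s] fun z => -logDeriv χ.LFunction z := by
    filter_upwards [(isOpen_lt continuous_const Complex.continuous_re).mem_nhds hsre] with z hz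
    exact hL z hz
  have h1 : HasSum (LSeries.term g s) (-logDeriv χ.LFunction s) := by
    rw [← hL s hsre]
    exact (DirichletCharacter.LSeriesSummable_twist_vonMangoldt χ hsre).hasSum
  have h2 : HasSum (LSeries.term (LSeries.logMul g) s) (deriv (logDeriv χ.LFunction) s) := by
    have e : LSeries (LSeries.logMul g) s = deriv (logDeriv χ.LFunction) s := by
      have := LSeries_deriv habs
      rw [hev.deriv_eq, deriv.fun_neg] at this
      exact (neg_injective this).symm
    rw [← e]
    exact (LSeriesSummable_logMul_of_lt_re habs).hasSum
  refine (h1.add (h2.mul_left (c : ℂ))).congr_fun fun n => ?_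
  rcases Nat.eq_zero_or_pos n with rfl | hn
  · simp [vmWeight]
  have hn0 : (n : ℂ) ≠ 0 := by exact_mod_cast hn.ne'
  rw [LSeries.term_of_ne_zero hn.ne', LSeries.term_of_ne_zero hn.ne', vmWeight, chiTwist, hg,
    LSeries.logMul, hs]
  have e1 : (n : ℂ) ^ (σ + τ * Complex.I) = (n : ℂ) ^ (σ : ℂ) * (n : ℂ) ^ (τ * Complex.I) :=
    Complex.cpow_add _ _ hn0
  have e2 : (((n : ℝ) ^ (-σ) : ℝ) : ℂ) = ((n : ℂ) ^ (σ : ℂ))⁻¹ := by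
    rw [Complex.ofReal_cpow (by positivity)]
    push_cast
    rw [Complex.cpow_neg]
  have h3 : (n : ℂ) ^ (σ : ℂ) ≠ 0 := by simp [Complex.cpow_eq_zero_iff, hn.ne']
  have h4 : (n : ℂ) ^ (τ * Complex.I) ≠ 0 := by simp [Complex.cpow_eq_zero_iff, hn.ne']
  have h5 : (Real.log n : ℂ) = Complex.log n := Complex.natCast_log
  simp only [Pi.mul_apply]
  rw [e1, Complex.cpow_neg, ← h5]
  rw [Complex.ofReal_mul, Complex.ofReal_mul, e2]
  push_cast
  field_simp

theorem summable_vmWeight {σ : ℝ} (hσ : 1 < σ) {c : ℝ} (hc : 0 ≤ c) : Summable (vmWeight σ c) := by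
  have := (hasSum_vmWeight_mul (1 : DirichletCharacter ℂ 1) hσ c 0).summable.norm
  refine this.congr fun n => ?_
  have : chiTwist (1 : DirichletCharacter ℂ 1) 0 n = 1 := by
    unfold chiTwist
    have : ((1 : DirichletCharacter ℂ 1) (n : ZMod 1)) = 1 := by
      have : ((n : ZMod 1)) = 1 := Subsingleton.elim _ _
      rw [this, map_one]
    rw [this]; simp
  rw [this, mul_one, Complex.norm_real, Real.norm_of_nonneg (vmWeight_nonneg hc n)]

theorem norm_inv_LFunction_le {q : ℕ} [NeZero q] (χ : DirichletCharacter ℂ q) {σ : ℝ} (hσ : 1 < σ)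
    {s : ℂ} (hs : σ ≤ s.re) : ‖(χ.LFunction s)⁻¹‖ ≤ ‖riemannZeta σ‖ := by
  have hs1 : 1 < s.re := by linarith
  have h1 := DirichletCharacter.LSeries.mul_mu_eq_one χ hs1
  rw [DirichletCharacter.LFunction_eq_LSeries χ hs1, inv_eq_of_mul_eq_one_right h1]
  have hsum : HasSum (fun n => ‖LSeries.term 1 (σ : ℂ) n‖) ‖riemannZeta σ‖ := by
    have h2 := LSeriesHasSum_one (s := (σ : ℂ)) (by simpa using hσ)
    have h3 : ∀ n, LSeries.term 1 (σ : ℂ) n = (‖LSeries.term 1 (σ : ℂ) n‖ : ℝ) := by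
      intro n
      rcases Nat.eq_zero_or_pos n with rfl | hn
      · simp
      · rw [LSeries.term_of_ne_zero hn.ne', Pi.one_apply, norm_div, norm_one,
          Complex.norm_natCast_cpow_of_pos hn, Complex.ofReal_re, Complex.ofReal_div,
          Complex.ofReal_cpow (by positivity)]
        simp
    have h4 : HasSum (fun n => ((‖LSeries.term 1 (σ : ℂ) n‖ : ℝ) : ℂ)) (riemannZeta σ) :=
      h2.congr_fun fun n => (h3 n).symm
    have h5 : HasSum (fun n => ‖LSeries.term 1 (σ : ℂ) n‖) (riemannZeta σ).re := by
      simpa using Complex.hasSum_re h4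
    have h6 : riemannZeta σ = ((riemannZeta σ).re : ℂ) := by
      rw [← h5.tsum_eq, Complex.ofReal_tsum]
      exact h4.tsum_eq.symm
    have h7 : 0 ≤ (riemannZeta σ).re := by
      rw [← h5.tsum_eq]; exact tsum_nonneg fun n => norm_nonneg _
    rw [h6, Complex.norm_real, Real.norm_of_nonneg h7]
    exact h5
  refine le_trans ?_ hsum.tsum_eq.le
  refine tsum_of_norm_bounded hsum.summable.hasSum fun n => ?_
  rcases Nat.eq_zero_or_pos n with rfl | hn
  · simp
  rw [LSeries.norm_term_eq, LSeries.norm_term_eq, if_neg hn.ne', if_neg hn.ne', Complex.ofReal_re]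
  have hn1 : (1 : ℝ) ≤ n := by exact_mod_cast hn
  have : ‖((fun n : ℕ => χ n) * fun n : ℕ => ((ArithmeticFunction.moebius n : ℤ) : ℂ) : ℕ → ℂ) n‖ ≤ 1 := by
    simp only [Pi.mul_apply, norm_mul]
    refine mul_le_one₀ (χ.norm_le_one _) (norm_nonneg _) ?_
    rw [Complex.norm_intCast]
    exact_mod_cast ArithmeticFunction.abs_moebius_le_one
  simp only [Pi.one_apply, norm_one]
  exact div_le_div₀ zero_le_one this (by positivity) (Real.rpow_le_rpow_of_exponent_le hn1 hs)

/-- `log ζ(1 + b/L) = o(L)`. -/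
theorem eventually_log_zeta_le {b ε : ℝ} (hb : 0 < b) (hε : 0 < ε) :
    ∀ᶠ L : ℝ in atTop, Real.log ‖riemannZeta ((1 + b / L : ℝ) : ℂ)‖ ≤ ε * L := by
  have h0 : Tendsto (fun L : ℝ => b / L) atTop (𝓝 0) := tendsto_const_nhds.div_atTop tendsto_id
  have h1 : Tendsto (fun L : ℝ => ((1 + b / L : ℝ) : ℂ)) atTop (𝓝[≠] 1) := by
    rw [tendsto_nhdsWithin_iff]
    constructor
    · have : Tendsto (fun L : ℝ => (1 + b / L : ℝ)) atTop (𝓝 (1 + 0)) := tendsto_const_nhds.add h0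
      rw [add_zero] at this
      have h2 := (Complex.continuous_ofReal.tendsto 1).comp this
      rwa [Complex.ofReal_one] at h2
    · filter_upwards [eventually_gt_atTop 0] with L hL h
      have h2 : (1 + b / L : ℝ) = 1 := by
        rw [Set.mem_singleton_iff, ← Complex.ofReal_one, Complex.ofReal_inj] at h
        exact h
      have : 0 < b / L := by positivity
      linarith
  have h2 := (riemannZeta_residue_one.comp h1).norm
  rw [norm_one] at h2
  have h3 := h2.eventually (gt_mem_nhds (show (1 : ℝ) < 2 by norm_num))
  have h4 : ∀ᶠ L : ℝ in atTop, Real.log L ≤ (ε / 2) * L := by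
    have := Real.isLittleO_log_id_atTop.bound (show 0 < ε / 2 by positivity)
    filter_upwards [this, eventually_ge_atTop 1] with L hL hL1
    rw [Real.norm_of_nonneg (Real.log_nonneg hL1), id, Real.norm_of_nonneg (by linarith)] at hL
    exact hL
  filter_upwards [h3, h4, eventually_gt_atTop 0, eventually_ge_atTop (2 / ε * Real.log (2 / b))]
    with L h3 h4 hL h5
  have h6 : b / L * ‖riemannZeta ((1 + b / L : ℝ) : ℂ)‖ < 2 := by
    have e : ‖((1 + b / L : ℝ) : ℂ) - 1‖ = b / L := by
      rw [← Complex.ofReal_one, ← Complex.ofReal_sub, Complex.norm_real, Real.norm_of_nonneg] <;>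
      · ring_nf; try positivity
    simpa only [Function.comp, norm_mul, e] using h3
  have h7 : ‖riemannZeta ((1 + b / L : ℝ) : ℂ)‖ ≤ L * (2 / b) := by
    rw [div_mul_eq_mul_div, div_lt_iff₀ hL] at h6
    rw [← mul_div_assoc, le_div_iff₀ hb]
    linarith
  have hpos : 0 < ‖riemannZeta ((1 + b / L : ℝ) : ℂ)‖ := by
    refine norm_pos_iff.2 (riemannZeta_ne_zero_of_one_lt_re ?_)
    rw [Complex.ofReal_re]
    have : 0 < b / L := by positivity
    linarith
  calc Real.log ‖riemannZeta ((1 + b / L : ℝ) : ℂ)‖ ≤ Real.log (L * (2 / b)) :=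
        Real.log_le_log hpos h7
    _ = Real.log L + Real.log (2 / b) := Real.log_mul hL.ne' (by positivity)
    _ ≤ ε / 2 * L + ε / 2 * L := by
        gcongr
        rw [div_mul_eq_mul_div, div_le_iff₀ hε] at h5
        linarith
    _ = ε * L := by ring

theorem circleAverage_comp_neg (f : ℂ → ℝ) (r : ℝ) :
    circleAverage (fun z => f (-z)) 0 r = circleAverage f 0 r := by
  rw [circleAverage_eq_integral_add (f := f) (c := 0) (R := r) π, circleAverage_def]
  congr 2
  ext θ
  congr 1
  simp [circleMap, add_mul, Complex.exp_add]

theorem circleAverage_min_re_sq {r : ℝ} (hr : 0 < r) :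
    circleAverage (fun z => (min z.re 0) ^ 2) 0 r = r ^ 2 / 4 := by
  have hi : ∀ g : ℂ → ℝ, Continuous g → CircleIntegrable g 0 r := fun g hg =>
    hg.continuousOn.circleIntegrable hr.le
  have h1 : circleAverage (fun z => (max z.re 0) ^ 2) 0 r
      = circleAverage (fun z => (min z.re 0) ^ 2) 0 r := by
    rw [← circleAverage_comp_neg (fun z => (min z.re 0) ^ 2)]
    congr 1
    ext z
    rcases le_total z.re 0 with h | h <;> simp [h]
  have h2 : circleAverage (fun z => (z ^ 2).re) 0 r = 0 := by
    rw [circleAverage_ofReal_re (f := fun z => z ^ 2)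
      ((by fun_prop : Continuous fun z : ℂ => z ^ 2).continuousOn.circleIntegrable hr.le)]
    rw [DiffContOnCl.circleAverage (Differentiable.diffContOnCl (by fun_prop))]
    simp
  have h3 : circleAverage (fun z => (min z.re 0) ^ 2 + (max z.re 0) ^ 2) 0 r
      = circleAverage (fun z => r ^ 2 / 2 + (1 / 2 : ℝ) • (z ^ 2).re) 0 r := by
    refine circleAverage_congr_sphere fun z hz => ?_
    have hz' : ‖z‖ = r := by simpa [abs_of_pos hr] using hz
    have h4 : z.re ^ 2 + z.im ^ 2 = r ^ 2 := by
      rw [← hz', ← Complex.normSq_eq_norm_sq, Complex.normSq_apply]; ring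
    have h5 : (z ^ 2).re = z.re ^ 2 - z.im ^ 2 := by rw [pow_two, Complex.mul_re]; ring
    simp only [smul_eq_mul]
    rw [h5, ← h4]
    rcases le_total z.re 0 with h | h <;> simp [h] <;> ring
  rw [circleAverage_fun_add (hi _ (by fun_prop)) (hi _ (by fun_prop)),
    circleAverage_fun_add (hi _ (by fun_prop)) (hi _ (by fun_prop)), circleAverage_fun_smul, h2, h1,
    circleAverage_const] at h3
  simp at h3
  linarith

theorem kernel_re_lower {β r : ℝ} (hr : 0 < r) (hβ : 0 ≤ β) {z : ℂ} (hz0 : z ≠ 0)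
    (hzr : ‖z‖ ≤ r) (hz : z.re ≤ -β) :
    -(2 * β / r ^ 2) * Real.log (r / ‖z‖) ≤
      -(1 / z - starRingEnd ℂ z / r ^ 2).re + β * (1 / z ^ 2 - starRingEnd ℂ z ^ 2 / r ^ 4).re := by
  set N := ‖z‖ ^ 2 with hN
  have hNpos : 0 < N := by positivity
  have hn : z.re ^ 2 + z.im ^ 2 = N := by
    rw [hN, ← Complex.normSq_eq_norm_sq, Complex.normSq_apply]; ring
  have hNr : N ≤ r ^ 2 := by rw [hN]; gcongr
  have e1 : (1 / z - starRingEnd ℂ z / r ^ 2).re = z.re * (1 / N - 1 / r ^ 2) := by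
    rw [one_div, Complex.sub_re, Complex.inv_re, Complex.normSq_eq_norm_sq, ← hN,
      ← Complex.ofReal_pow, Complex.div_ofReal_re, Complex.conj_re]
    ring
  have e2 : (1 / z ^ 2 - starRingEnd ℂ z ^ 2 / r ^ 4).re
      = (2 * z.re ^ 2 - N) * (1 / N ^ 2 - 1 / r ^ 4) := by
    have hsq : (z ^ 2).re = 2 * z.re ^ 2 - N := by rw [pow_two, Complex.mul_re, ← hn]; ring
    rw [one_div, Complex.sub_re, Complex.inv_re, Complex.normSq_eq_norm_sq, norm_pow, ← hN,
      ← Complex.ofReal_pow, Complex.div_ofReal_re, ← map_pow, Complex.conj_re, hsq]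
    ring
  have hlog : (1 - N / r ^ 2) ≤ 2 * Real.log (r / ‖z‖) := by
    have h1 : 2 * Real.log (r / ‖z‖) = -Real.log (N / r ^ 2) := by
      rw [← Real.log_inv, inv_div, hN, ← div_pow, Real.log_pow]; norm_num
    have h2 := Real.log_le_sub_one_of_pos (show 0 < N / r ^ 2 by positivity)
    linarith
  have key : -(β / r ^ 2) * (1 - N / r ^ 2) ≤
      -(z.re * (1 / N - 1 / r ^ 2)) + β * ((2 * z.re ^ 2 - N) * (1 / N ^ 2 - 1 / r ^ 4)) := by
    have hdiff : 0 ≤ 1 / N - 1 / r ^ 2 := by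
      rw [sub_nonneg]; exact one_div_le_one_div_of_le hNpos hNr
    have e3 : -(z.re * (1 / N - 1 / r ^ 2)) + β * ((2 * z.re ^ 2 - N) * (1 / N ^ 2 - 1 / r ^ 4))
        = (1 / N - 1 / r ^ 2) *
          ((-z.re) + β * (2 * z.re ^ 2) * (1 / N + 1 / r ^ 2) - β - β * N / r ^ 2) := by
      field_simp
      ring
    have e4 : -(β / r ^ 2) * (1 - N / r ^ 2) = (1 / N - 1 / r ^ 2) * (-(β * N / r ^ 2)) := by
      field_simp
    rw [e3, e4]
    refine mul_le_mul_of_nonneg_left ?_ hdiff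
    have : 0 ≤ β * (2 * z.re ^ 2) * (1 / N + 1 / r ^ 2) := by positivity
    linarith
  rw [e1, e2]
  refine le_trans ?_ key
  have : β / r ^ 2 * (1 - N / r ^ 2) ≤ β / r ^ 2 * (2 * Real.log (r / ‖z‖)) := by gcongr
  calc -(2 * β / r ^ 2) * Real.log (r / ‖z‖) = -(β / r ^ 2 * (2 * Real.log (r / ‖z‖))) := by ring
    _ ≤ _ := by linarith

/-- A Jensen-type bound for the logarithmic derivative with zeros kept near the centre. -/
theorem jensen_kernel_bound {f : ℂ → ℂ} (hf : Differentiable ℂ f) (hf0 : f 0 ≠ 0)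
    {r L β ε δ : ℝ} (hr1 : 1 / 2 ≤ r) (hr2 : r ≤ 3 / 4) (hL : 0 < L) (hβ : 0 ≤ β) (hε : 0 ≤ ε)
    (hε1 : ε ≤ 1 / 10) (hδ : 0 ≤ δ)
    (hbd : ∀ z : ℂ, ‖z‖ = r → f z ≠ 0) (Z : Finset ℂ)
    (hZ : ∀ z, z ∈ Z ↔ f z = 0 ∧ ‖z‖ ≤ r) (hZre : ∀ z ∈ Z, z.re ≤ -β)
    (hup : ∀ z : ℂ, ‖z‖ = r → Real.log ‖f z‖ ≤ (1 / 2 * max 0 (-z.re) + 2 * ε) * L)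
    (hlow : ∀ z : ℂ, ‖z‖ = r → 0 ≤ z.re → -(ε * L) ≤ Real.log ‖f z‖)
    (h0 : -(ε * L) ≤ Real.log ‖f 0‖)
    (S : Finset ℂ) (hSZ : S ⊆ Z) (hS1 : ∀ z ∈ S, ‖z‖ ≤ 1 / 4) (hS2 : ∀ z ∈ S, -δ ≤ z.re) :
    (∑ z ∈ S, (zeroMult f z : ℝ) ≤ 2 * L) ∧
    (∑ z ∈ S, (zeroMult f z : ℝ) * (-(1 / z).re + β * (1 / z ^ 2).re))
      + (-logDeriv f 0 + β * deriv (logDeriv f) 0).re ≤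
      L / 4 + 8 * ε * L + 40 * β * L + 2 * L * (4 * δ + 16 * β * δ ^ 2) := by
  have hr : 0 < r := by linarith
  obtain ⟨j0, j1, j2⟩ := circleAverage_log_norm_formulas hf hf0 hr hbd Z hZ
  have hz0 : ∀ z ∈ Z, z ≠ 0 := fun z hz h => hf0 (h ▸ ((hZ z).1 hz).1)
  have hcont : ContinuousOn (fun z => Real.log ‖f z‖) (sphere 0 r) := by
    refine ContinuousOn.log hf.continuous.norm.continuousOn fun z hz => ?_
    exact norm_ne_zero_iff.2 (hbd z (by simpa using hz))
  have hci : ∀ p : ℂ → ℝ, Continuous p → CircleIntegrable (fun z => Real.log ‖f z‖ * p z) 0 r :=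
    fun p hp => (hcont.mul hp.continuousOn).circleIntegrable hr.le
  have hci0 : CircleIntegrable (fun z => Real.log ‖f z‖) 0 r := hcont.circleIntegrable hr.le
  have hsph : ∀ z ∈ sphere (0 : ℂ) |r|, ‖z‖ = r := fun z hz => by
    simpa [abs_of_pos hr] using hz
  have hup' : ∀ z : ℂ, ‖z‖ = r → Real.log ‖f z‖ ≤ (23 / 40) * L := by
    intro z hz
    refine (hup z hz).trans ?_
    have : max 0 (-z.re) ≤ 3 / 4 := by
      refine max_le (by norm_num) ?_
      have := (abs_le.1 (Complex.abs_re_le_norm z)).1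
      linarith
    gcongr
    linarith
  have hA0 : circleAverage (fun z => Real.log ‖f z‖) 0 r ≤ 23 / 40 * L :=
    circleAverage_mono_on_of_le_circle hci0 fun z hz => hup' z (hsph z hz)
  have hlogpos : ∀ z ∈ Z, 0 ≤ (zeroMult f z : ℝ) * Real.log (r / ‖z‖) := by
    intro z hz
    refine mul_nonneg (Nat.cast_nonneg _) (Real.log_nonneg ?_)
    rw [one_le_div (norm_pos_iff.2 (hz0 z hz))]
    exact ((hZ z).1 hz).2
  have hsumlog : ∑ z ∈ Z, (zeroMult f z : ℝ) * Real.log (r / ‖z‖) ≤ L := by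
    have : ε * L ≤ 1 / 10 * L := by gcongr
    linarith
  have hcount : ∑ z ∈ S, (zeroMult f z : ℝ) ≤ 2 * L := by
    have h1 : ∑ z ∈ S, (zeroMult f z : ℝ) * (1 / 2) ≤
        ∑ z ∈ S, (zeroMult f z : ℝ) * Real.log (r / ‖z‖) := by
      refine sum_le_sum fun z hz => ?_
      have hzp : 0 < ‖z‖ := norm_pos_iff.2 (hz0 z (hSZ hz))
      have h2 : (2 : ℝ) ≤ r / ‖z‖ := by
        rw [le_div_iff₀ hzp]
        have := hS1 z hz
        linarith
      have h3 := Real.log_le_log (by norm_num) h2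
      have := Real.log_two_gt_d9
      gcongr
      linarith
    have h2 := Finset.sum_le_sum_of_subset_of_nonneg hSZ (fun z hz _ => hlogpos z hz)
    rw [← Finset.sum_mul] at h1
    linarith
  refine ⟨hcount, ?_⟩
  -- the quadratic term
  have hA2 : circleAverage (fun z => Real.log ‖f z‖ * (z ^ 2).re) 0 r ≤ r ^ 2 * (2 * L) := by
    have h1 : circleAverage (fun z => Real.log ‖f z‖ * (z ^ 2).re) 0 r ≤
        circleAverage (fun z => r ^ 2 * (23 / 20 * L) - (r ^ 2) • Real.log ‖f z‖) 0 r := by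
      refine circleAverage_mono (hci _ (by fun_prop)) ?_ fun z hz => ?_
      · exact CircleIntegrable.sub (continuousOn_const.circleIntegrable hr.le)
          hci0.const_fun_smul
      · have hz' := hsph z hz
        have h2 : |(z ^ 2).re| ≤ r ^ 2 := by
          refine (Complex.abs_re_le_norm _).trans ?_
          rw [norm_pow, hz']
        have h3 : |Real.log ‖f z‖| ≤ 23 / 20 * L - Real.log ‖f z‖ := by
          have := hup' z hz'
          rw [abs_le]; constructor <;> linarith
        calc Real.log ‖f z‖ * (z ^ 2).re ≤ |Real.log ‖f z‖| * |(z ^ 2).re| := by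
              rw [← abs_mul]; exact le_abs_self _
          _ ≤ (23 / 20 * L - Real.log ‖f z‖) * r ^ 2 :=
              mul_le_mul h3 h2 (abs_nonneg _) ((abs_nonneg _).trans h3)
          _ = _ := by rw [smul_eq_mul]; ring
    rw [circleAverage_fun_sub (continuousOn_const.circleIntegrable hr.le) hci0.const_fun_smul,
      circleAverage_const, circleAverage_fun_smul, j0, smul_eq_mul, ← mul_sub] at h1
    refine h1.trans (mul_le_mul_of_nonneg_left ?_ (by positivity))
    have h2 := Finset.sum_nonneg hlogpos
    have : ε * L ≤ 1 / 10 * L := by gcongr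
    linarith
  -- the linear term
  have hA1 : -circleAverage (fun z => Real.log ‖f z‖ * z.re) 0 r ≤
      L / 2 * (r ^ 2 / 4) + 2 * ε * r * L := by
    have e : -circleAverage (fun z => Real.log ‖f z‖ * z.re) 0 r
        = circleAverage (fun z => (-1 : ℝ) • (Real.log ‖f z‖ * z.re)) 0 r := by
      rw [circleAverage_fun_smul]; simp
    rw [e]
    have h1 : circleAverage (fun z => (-1 : ℝ) • (Real.log ‖f z‖ * z.re)) 0 r ≤
        circleAverage (fun z => (L / 2) • (min z.re 0) ^ 2 + 2 * ε * r * L) 0 r := by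
      refine circleAverage_mono (hci _ (by fun_prop)).const_fun_smul
        (Continuous.continuousOn (by fun_prop)).circleIntegrable' fun z hz => ?_
      have hz' := hsph z hz
      have hre := abs_le.1 (Complex.abs_re_le_norm z)
      rw [hz'] at hre
      simp only [smul_eq_mul]
      rcases le_total z.re 0 with h | h
      · rw [min_eq_left h]
        have h1 := hup z hz'
        rw [max_eq_right (by linarith)] at h1
        have h2 : -z.re * Real.log ‖f z‖ ≤ -z.re * ((1 / 2 * -z.re + 2 * ε) * L) :=
          mul_le_mul_of_nonneg_left h1 (by linarith)
        have h3 : -z.re * (2 * ε * L) ≤ r * (2 * ε * L) := by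
          gcongr; linarith
        nlinarith
      · rw [min_eq_right h]
        have h1 := hlow z hz' h
        have h2 : z.re * -(ε * L) ≤ z.re * Real.log ‖f z‖ := mul_le_mul_of_nonneg_left h1 h
        have h3 : z.re * (ε * L) ≤ r * (ε * L) := by
          gcongr; exact hre.2
        have : 0 ≤ r * (ε * L) := by positivity
        nlinarith
    refine h1.trans (le_of_eq ?_)
    rw [circleAverage_fun_add, circleAverage_fun_smul, circleAverage_min_re_sq hr,
      circleAverage_const, smul_eq_mul]
    · exact (Continuous.continuousOn (by fun_prop)).circleIntegrable hr.le
    · exact continuousOn_const.circleIntegrable hr.le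
  -- combine
  set t : ℂ → ℝ := fun z => -(1 / z - starRingEnd ℂ z / r ^ 2).re
    + β * (1 / z ^ 2 - starRingEnd ℂ z ^ 2 / r ^ 4).re with ht
  have hr2' : 1 / r ^ 2 ≤ 4 := by
    rw [div_le_iff₀ (by positivity)]; nlinarith
  have hr1' : 1 / r ≤ 2 := by
    rw [div_le_iff₀ (by positivity)]; nlinarith
  have heq : (-logDeriv f 0 + β * deriv (logDeriv f) 0).re + ∑ z ∈ Z, (zeroMult f z : ℝ) * t z ≤
      L / 4 + 8 * ε * L + 32 * β * L := by
    have e1 : (-logDeriv f 0 + β * deriv (logDeriv f) 0).re + ∑ z ∈ Z, (zeroMult f z : ℝ) * t z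
        = (2 / r ^ 2) * -circleAverage (fun z => Real.log ‖f z‖ * z.re) 0 r
          + (4 * β / r ^ 4) * circleAverage (fun z => Real.log ‖f z‖ * (z ^ 2).re) 0 r := by
      rw [j1, j2]
      simp only [ht, mul_add, Finset.sum_add_distrib, Complex.add_re, Complex.neg_re,
        Complex.re_ofReal_mul]
      have e2 : ∑ x ∈ Z, (zeroMult f x : ℝ) * -(1 / x - starRingEnd ℂ x / r ^ 2).re
          = -∑ x ∈ Z, (zeroMult f x : ℝ) * (1 / x - starRingEnd ℂ x / r ^ 2).re := by
        rw [← Finset.sum_neg_distrib]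
        exact sum_congr rfl fun _ _ => by ring
      have e3 : ∑ x ∈ Z, (zeroMult f x : ℝ) * (β * (1 / x ^ 2 - starRingEnd ℂ x ^ 2 / r ^ 4).re)
          = β * ∑ x ∈ Z, (zeroMult f x : ℝ) * (1 / x ^ 2 - starRingEnd ℂ x ^ 2 / r ^ 4).re := by
        rw [mul_sum]
        exact sum_congr rfl fun _ _ => by ring
      rw [e2, e3]
      field_simp
      ring
    rw [e1]
    have h1 : (2 / r ^ 2) * -circleAverage (fun z => Real.log ‖f z‖ * z.re) 0 r ≤
        L / 4 + 8 * ε * L := by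
      calc (2 / r ^ 2) * -circleAverage (fun z => Real.log ‖f z‖ * z.re) 0 r
          ≤ (2 / r ^ 2) * (L / 2 * (r ^ 2 / 4) + 2 * ε * r * L) := by gcongr
        _ = L / 4 + 4 * ε * L * (1 / r) := by field_simp; ring
        _ ≤ L / 4 + 4 * ε * L * 2 := by gcongr
        _ = _ := by ring
    have h2 : (4 * β / r ^ 4) * circleAverage (fun z => Real.log ‖f z‖ * (z ^ 2).re) 0 r ≤
        32 * β * L := by
      calc (4 * β / r ^ 4) * circleAverage (fun z => Real.log ‖f z‖ * (z ^ 2).re) 0 r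
          ≤ (4 * β / r ^ 4) * (r ^ 2 * (2 * L)) := by gcongr
        _ = 8 * β * L * (1 / r ^ 2) := by field_simp; ring
        _ ≤ 8 * β * L * 4 := by gcongr
        _ = _ := by ring
    linarith
  have hdrop : -(8 * β * L) + ∑ z ∈ S, (zeroMult f z : ℝ) * t z ≤
      ∑ z ∈ Z, (zeroMult f z : ℝ) * t z := by
    rw [← Finset.sum_sdiff hSZ, add_le_add_iff_right]
    have h1 : ∀ z ∈ Z \ S, -(8 * β) * ((zeroMult f z : ℝ) * Real.log (r / ‖z‖)) ≤
        (zeroMult f z : ℝ) * t z := by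
      intro z hz
      have hzZ := (Finset.mem_sdiff.1 hz).1
      have h2 := kernel_re_lower hr hβ (hz0 z hzZ) ((hZ z).1 hzZ).2 (hZre z hzZ)
      have h3 : 0 ≤ Real.log (r / ‖z‖) := by
        refine Real.log_nonneg ?_
        rw [one_le_div (norm_pos_iff.2 (hz0 z hzZ))]
        exact ((hZ z).1 hzZ).2
      have h4 : -(8 * β) * Real.log (r / ‖z‖) ≤ t z := by
        refine le_trans ?_ h2
        rw [neg_mul, neg_mul, neg_le_neg_iff]
        gcongr
        calc 2 * β / r ^ 2 = 2 * β * (1 / r ^ 2) := by ring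
          _ ≤ 2 * β * 4 := by gcongr
          _ = 8 * β := by ring
      calc -(8 * β) * ((zeroMult f z : ℝ) * Real.log (r / ‖z‖))
          = (zeroMult f z : ℝ) * (-(8 * β) * Real.log (r / ‖z‖)) := by ring
        _ ≤ _ := by gcongr
    have h2 := sum_le_sum h1
    rw [← mul_sum] at h2
    have h3 : ∑ z ∈ Z \ S, (zeroMult f z : ℝ) * Real.log (r / ‖z‖) ≤ L :=
      (Finset.sum_le_sum_of_subset_of_nonneg Finset.sdiff_subset
        (fun z hz _ => hlogpos z hz)).trans hsumlog
    have h4 : 8 * β * ∑ z ∈ Z \ S, (zeroMult f z : ℝ) * Real.log (r / ‖z‖) ≤ 8 * β * L := by gcongr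
    linarith
  have hkeep : ∑ z ∈ S, (zeroMult f z : ℝ) * (-(1 / z).re + β * (1 / z ^ 2).re)
      ≤ ∑ z ∈ S, (zeroMult f z : ℝ) * t z + 2 * L * (4 * δ + 16 * β * δ ^ 2) := by
    have h1 : ∀ z ∈ S, (zeroMult f z : ℝ) * (-(1 / z).re + β * (1 / z ^ 2).re) ≤
        (zeroMult f z : ℝ) * t z + (zeroMult f z : ℝ) * (4 * δ + 16 * β * δ ^ 2) := by
      intro z hz
      rw [← mul_add]
      refine mul_le_mul_of_nonneg_left ?_ (Nat.cast_nonneg _)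
      have hre := hS2 z hz
      have hre' := hZre z (hSZ hz)
      have e1 : (starRingEnd ℂ z / r ^ 2).re = z.re * (1 / r ^ 2) := by
        rw [← Complex.ofReal_pow, Complex.div_ofReal_re, Complex.conj_re]; ring
      have e2 : (starRingEnd ℂ z ^ 2 / r ^ 4).re = (z.re ^ 2 - z.im ^ 2) * (1 / r ^ 2) ^ 2 := by
        rw [← Complex.ofReal_pow, Complex.div_ofReal_re, ← map_pow, Complex.conj_re, pow_two,
          Complex.mul_re]
        field_simp
      simp only [ht, Complex.sub_re, e1, e2]
      have h2 : -z.re * (1 / r ^ 2) ≤ δ * 4 :=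
        mul_le_mul (by linarith) hr2' (by positivity) hδ
      have h3 : (z.re ^ 2 - z.im ^ 2) * (1 / r ^ 2) ^ 2 ≤ δ ^ 2 * 4 ^ 2 := by
        calc (z.re ^ 2 - z.im ^ 2) * (1 / r ^ 2) ^ 2 ≤ δ ^ 2 * (1 / r ^ 2) ^ 2 := by
              gcongr
              nlinarith [sq_nonneg z.im]
          _ ≤ δ ^ 2 * 4 ^ 2 := by gcongr
      have h4 := mul_le_mul_of_nonneg_left h3 hβ
      linarith
    refine (sum_le_sum h1).trans ?_
    rw [Finset.sum_add_distrib, ← Finset.sum_mul]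
    gcongr
  linarith

/-- The real part of `1/(z+b) + b/(z+b)^2` at `z = l + iy`. -/
noncomputable def Gk (b l y : ℝ) : ℝ :=
  l / ((l + b) ^ 2 + y ^ 2) + 2 * b * (l + b) ^ 2 / ((l + b) ^ 2 + y ^ 2) ^ 2

theorem zeros_finite {f : ℂ → ℂ} (hf : Differentiable ℂ f) {w : ℂ} (hw : f w ≠ 0) {K : Set ℂ}
    (hK : IsCompact K) : {z | z ∈ K ∧ f z = 0}.Finite := by
  by_contra hinf
  obtain ⟨z, -, hz⟩ := Set.Infinite.exists_accPt_of_subset_isCompact hinf hK fun z hz => hz.1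
  have hfa : AnalyticOnNhd ℂ f Set.univ := fun z _ => hf.analyticAt z
  have hfr : ∃ᶠ x in 𝓝[≠] z, f x = 0 := by
    rw [accPt_iff_frequently_nhdsNE] at hz
    exact hz.mono fun x hx => hx.2
  exact hw (hfa.eqOn_zero_of_preconnected_of_frequently_eq_zero isPreconnected_univ
    (Set.mem_univ z) hfr (Set.mem_univ w))

theorem zeroMult_comp_add {f : ℂ → ℂ} (hf : Differentiable ℂ f) (c z : ℂ) :
    zeroMult (fun w => f (c + w)) z = zeroMult f (c + z) := by
  have hd : Differentiable ℂ fun w => f (c + w) := hf.comp (by fun_prop)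
  rw [zeroMult_eq hf, zeroMult_eq hd]
  have := analyticOrderAt_comp_of_deriv_ne_zero (f := f) (g := fun w => c + w) (z₀ := z)
    (by fun_prop) (by simp)
  rw [← this]
  rfl

theorem logDeriv_comp_add (f : ℂ → ℂ) (c : ℂ) :
    logDeriv (fun w => f (c + w)) = fun w => logDeriv f (c + w) := by
  funext w
  simp only [logDeriv_apply, deriv_comp_const_add]

theorem kernel_eq_Gk {b L : ℝ} (hL : 0 < L) {ρ : ℂ} {τ : ℝ} (hρ : ρ.re < 1) (hb : 0 < b) :
    (-(1 / (ρ - (1 + (b / L : ℝ) + τ * Complex.I))).re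
      + (b / L) * (1 / (ρ - (1 + (b / L : ℝ) + τ * Complex.I)) ^ 2).re)
      = L * Gk b ((1 - ρ.re) * L) ((ρ.im - τ) * L) := by
  set z := ρ - (1 + (b / L : ℝ) + τ * Complex.I) with hz
  have hre : z.re = -((1 - ρ.re) * L + b) / L := by
    simp [hz]; field_simp; ring
  have him : z.im = ((ρ.im - τ) * L) / L := by
    simp [hz]; field_simp
  set X := (1 - ρ.re) * L + b with hX
  set y := (ρ.im - τ) * L with hy
  have hX0 : 0 < X := by
    have : 0 < (1 - ρ.re) * L := mul_pos (by linarith) hL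
    linarith
  have hW : 0 < X ^ 2 + y ^ 2 := by positivity
  have hn : Complex.normSq z = (X ^ 2 + y ^ 2) / L ^ 2 := by
    rw [Complex.normSq_apply, hre, him]; field_simp
  have hsq : (z ^ 2).re = (X ^ 2 - y ^ 2) / L ^ 2 := by
    rw [pow_two, Complex.mul_re, hre, him]; field_simp
  have hl : (1 - ρ.re) * L = X - b := by rw [hX]; ring
  rw [one_div, one_div, Complex.inv_re, Complex.inv_re, map_pow, hn, hsq, hre, Gk, ← hX, hl]
  field_simp
  ring

theorem tendsto_log_nat : Tendsto (fun q : ℕ => Real.log q) atTop atTop :=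
  Real.tendsto_log_atTop.comp tendsto_natCast_atTop_atTop

theorem zeros_kernel_le {b R T ε : ℝ} (hb : 0 < b) (hR : 0 < R) (hT : 0 ≤ T) (hε : 0 < ε) :
    ∃ q₀ : ℕ, ∀ (q : ℕ) [NeZero q], q₀ ≤ q → ∀ χ : DirichletCharacter ℂ q, χ ≠ 1 →
      ∀ τ : ℝ, |τ| ≤ T → ∀ Z : Finset ℂ, (∀ ρ ∈ Z, χ.LFunction ρ = 0 ∧ |ρ.im - τ| ≤ 1 / 8 ∧
        1 - R / Real.log q ≤ ρ.re) →
      (∑ ρ ∈ Z, (zeroMult χ.LFunction ρ : ℝ) ≤ 2 * Real.log q) ∧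
      (∑ ρ ∈ Z, (zeroMult χ.LFunction ρ : ℝ) * Gk b (lam q ρ) ((ρ.im - τ) * Real.log q))
        + (1 / Real.log q) * (∑' n, (vmWeight (1 + b / Real.log q) (b / Real.log q) n : ℂ)
          * chiTwist χ τ n).re ≤ 1 / 4 + ε := by
  set e : ℝ := min (ε / 16) (1 / 10) with he
  have he0 : 0 < e := lt_min (by linarith) (by norm_num)
  have he1 : e ≤ 1 / 10 := min_le_right _ _
  have he2 : e ≤ ε / 16 := min_le_left _ _
  obtain ⟨K, hK1, hK⟩ := norm_LFunction_le (ε := e) (T := T + 1) he0 (by linarith)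
  have hlim : Tendsto (fun L : ℝ => 40 * (b / L) + 2 * (4 * ((b + R) / L)
      + 16 * (b / L) * ((b + R) / L) ^ 2)) atTop (𝓝 0) := by
    have h1 : ∀ c : ℝ, Tendsto (fun L : ℝ => c / L) atTop (𝓝 0) := fun c =>
      tendsto_const_nhds.div_atTop tendsto_id
    have := ((h1 b).const_mul 40).add ((((h1 (b + R)).const_mul 4).add
      (((h1 b).const_mul 16).mul ((h1 (b + R)).pow 2))).const_mul 2)
    simpa using this
  have hev : ∀ᶠ L : ℝ in atTop, 0 < L ∧ Real.log K ≤ e * L ∧ (b + R) / L ≤ 1 / 8 ∧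
      40 * (b / L) + 2 * (4 * ((b + R) / L) + 16 * (b / L) * ((b + R) / L) ^ 2) ≤ ε / 2 ∧
      Real.log ‖riemannZeta ((1 + b / L : ℝ) : ℂ)‖ ≤ e * L := by
    have h1 : Tendsto (fun L : ℝ => (b + R) / L) atTop (𝓝 0) :=
      tendsto_const_nhds.div_atTop tendsto_id
    have h2 : Tendsto (fun L : ℝ => e * L) atTop atTop := tendsto_id.const_mul_atTop he0
    filter_upwards [eventually_gt_atTop 0, h2.eventually_ge_atTop (Real.log K),
      h1.eventually_le_const (show (0 : ℝ) < 1 / 8 by norm_num),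
      hlim.eventually_le_const (show (0 : ℝ) < ε / 2 by positivity),
      eventually_log_zeta_le hb he0] with L h1 h2 h3 h4 h5
    exact ⟨h1, h2, h3, h4, h5⟩
  obtain ⟨q₀, hq₀⟩ := eventually_atTop.1 (tendsto_log_nat.eventually hev)
  refine ⟨q₀, fun q _ hq χ hχ τ hτ Z hZ => ?_⟩
  obtain ⟨hL, hlK, hbR, hsm, hzeta⟩ := hq₀ q hq
  set L := Real.log q with hLdef
  have hq0 : (0 : ℝ) < q := by exact_mod_cast Nat.pos_of_ne_zero (NeZero.ne q)
  set c : ℂ := 1 + (b / L : ℝ) + τ * Complex.I with hc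
  have hcre : c.re = 1 + b / L := by simp [hc]
  have hcim : c.im = τ := by simp [hc]
  have hβ : 0 < b / L := by positivity
  set F := χ.LFunction with hF
  have hFd : Differentiable ℂ F := DirichletCharacter.differentiable_LFunction hχ
  set f : ℂ → ℂ := fun w => F (c + w) with hf
  have hfd : Differentiable ℂ f := hFd.comp (by fun_prop : Differentiable ℂ fun w => c + w)
  have hne : ∀ s : ℂ, 1 ≤ s.re → F s ≠ 0 := fun s hs =>
    DirichletCharacter.LFunction_ne_zero_of_one_le_re χ (Or.inl hχ) hs
  have hlogge : ∀ z : ℂ, 0 ≤ z.re → -(e * L) ≤ Real.log ‖f z‖ := by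
    intro z hz
    have h1 := norm_inv_LFunction_le χ (σ := 1 + b / L) (s := c + z) (by linarith)
      (by rw [Complex.add_re, hcre]; linarith)
    have hne1 : F (c + z) ≠ 0 := hne _ (by rw [Complex.add_re, hcre]; linarith)
    have hpos : 0 < ‖(F (c + z))⁻¹‖ := norm_pos_iff.2 (inv_ne_zero hne1)
    have h2 := Real.log_le_log hpos h1
    rw [norm_inv, Real.log_inv] at h2
    have : Real.log ‖f z‖ = Real.log ‖F (c + z)‖ := rfl
    linarith
  have hf0 : f 0 ≠ 0 := hne _ (by rw [add_zero, hcre]; linarith)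
  have hfin : {z | z ∈ closedBall (0 : ℂ) (3 / 4) ∧ f z = 0}.Finite :=
    zeros_finite hfd hf0 (isCompact_closedBall _ _)
  obtain ⟨r, ⟨hr1, hr2⟩, hrn⟩ : ∃ r ∈ Set.Ioo (1 / 2 : ℝ) (3 / 4),
      r ∉ Set.image norm {z | z ∈ closedBall (0 : ℂ) (3 / 4) ∧ f z = 0} :=
    (Set.Ioo_infinite (by norm_num)).exists_notMem_finite (hfin.image _)
  have hbd : ∀ z : ℂ, ‖z‖ = r → f z ≠ 0 := fun z hz h0 =>
    hrn ⟨z, ⟨by simpa [hz] using hr2.le, h0⟩, hz⟩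
  set Z' : Finset ℂ := hfin.toFinset.filter (fun z => ‖z‖ ≤ r) with hZ'
  have hZ'mem : ∀ z, z ∈ Z' ↔ f z = 0 ∧ ‖z‖ ≤ r := by
    intro z
    simp only [hZ', Finset.mem_filter, Set.Finite.mem_toFinset, Set.mem_ofPred_eq, mem_closedBall,
      dist_zero_right]
    exact ⟨fun h => ⟨h.1.2, h.2⟩, fun h => ⟨⟨h.2.trans hr2.le, h.1⟩, h.2⟩⟩
  have hzre : ∀ ρ : ℂ, F ρ = 0 → ρ.re < 1 := fun ρ h => by
    by_contra h1
    exact hne ρ (not_lt.1 h1) h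
  have hup : ∀ z : ℂ, ‖z‖ = r → Real.log ‖f z‖ ≤ (1 / 2 * max 0 (-z.re) + 2 * e) * L := by
    intro z hz
    have h1 := (abs_le.1 (Complex.abs_re_le_norm z)).1
    have h2 := Complex.abs_im_le_norm z
    have h3 := hK q χ hχ (c + z) (by rw [Complex.add_re, hcre]; linarith)
      (by
        rw [Complex.add_im, hcim]
        calc |τ + z.im| ≤ |τ| + |z.im| := abs_add_le _ _
          _ ≤ T + 1 := by linarith)
    have h4 := Real.log_le_log (norm_pos_iff.2 (hbd z hz)) h3
    rw [Real.log_mul (by positivity) (by positivity), Real.log_rpow hq0] at h4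
    have h5 : max 0 (1 - (c + z).re) ≤ max 0 (-z.re) := by
      apply max_le_max le_rfl
      rw [Complex.add_re, hcre]; linarith
    have h6 : (1 / 2 * max 0 (1 - (c + z).re) + e) * L ≤ (1 / 2 * max 0 (-z.re) + e) * L := by
      gcongr
    linarith
  set S : Finset ℂ := Z.image (fun ρ => ρ - c) with hS
  have hSim : ∀ z ∈ S, f z = 0 ∧ ‖z‖ ≤ 1 / 4 ∧ -((b + R) / L) ≤ z.re := by
    intro z hz
    obtain ⟨ρ, hρ, rfl⟩ := Finset.mem_image.1 hz
    obtain ⟨h1, h2, h3⟩ := hZ ρ hρ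
    have h4 := hzre ρ h1
    have h5 : (ρ - c).re = ρ.re - 1 - b / L := by rw [Complex.sub_re, hcre]; ring
    have h6 : (ρ - c).im = ρ.im - τ := by rw [Complex.sub_im, hcim]
    have h7 : (b + R) / L = b / L + R / L := add_div _ _ _
    refine ⟨by simpa [hf] using h1, ?_, by rw [h5]; linarith⟩
    have h8 := Complex.norm_le_abs_re_add_abs_im (ρ - c)
    rw [h5, h6] at h8
    have h9 : |ρ.re - 1 - b / L| ≤ 1 / 8 := by
      rw [abs_le]; constructor <;> linarith
    linarith
  obtain ⟨g1, g2⟩ := jensen_kernel_bound hfd hf0 hr1.le hr2.le hL hβ.le he0.le he1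
    (show 0 ≤ (b + R) / L by positivity) hbd Z' hZ'mem
    (fun z hz => by
      have := hzre _ ((hZ'mem z).1 hz).1
      rw [Complex.add_re, hcre] at this
      linarith) hup (fun z _ h => hlogge z h) (hlogge 0 (by simp)) S
    (fun z hz => (hZ'mem z).2 ⟨(hSim z hz).1, by linarith [(hSim z hz).2.1]⟩)
    (fun z hz => (hSim z hz).2.1) (fun z hz => (hSim z hz).2.2)
  have hinj : Set.InjOn (fun ρ : ℂ => ρ - c) Z := fun x _ y _ h => by simpa using h
  have hm : ∀ ρ : ℂ, zeroMult f (ρ - c) = zeroMult F ρ := fun ρ => by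
    rw [hf, zeroMult_comp_add hFd, add_sub_cancel]
  rw [hS, Finset.sum_image hinj] at g1 g2
  simp only [hm] at g1 g2
  refine ⟨g1, ?_⟩
  have hsum := (hasSum_vmWeight_mul χ (σ := 1 + b / L) (by linarith) (b / L) τ).tsum_eq
  have hcc : ((1 + b / L : ℝ) : ℂ) + τ * Complex.I = c := by rw [hc]; push_cast; ring
  have hfun : f = fun w => F (c + w) := rfl
  have hld0 : logDeriv f 0 = logDeriv F c := by rw [hfun, logDeriv_comp_add]; simp
  have hld1 : deriv (logDeriv f) 0 = deriv (logDeriv F) c := by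
    rw [hfun, logDeriv_comp_add, deriv_comp_const_add, add_zero]
  rw [hcc, ← hF] at hsum
  rw [hsum]
  rw [hld0, hld1] at g2
  have hG : ∑ ρ ∈ Z, (zeroMult F ρ : ℝ) * (-(1 / (ρ - c)).re + b / L * (1 / (ρ - c) ^ 2).re)
      = L * ∑ ρ ∈ Z, (zeroMult F ρ : ℝ) * Gk b (lam q ρ) ((ρ.im - τ) * L) := by
    rw [mul_sum]
    refine sum_congr rfl fun ρ hρ => ?_
    rw [hc, kernel_eq_Gk hL (hzre ρ (hZ ρ hρ).1) hb, lam]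
    ring
  rw [hG] at g2
  have hfinal : L * (∑ ρ ∈ Z, (zeroMult F ρ : ℝ) * Gk b (lam q ρ) ((ρ.im - τ) * L)
      + 1 / L * (-logDeriv F c + ((b / L : ℝ) : ℂ) * deriv (logDeriv F) c).re)
      ≤ L * (1 / 4 + ε) := by
    have h1 : L * (1 / L * (-logDeriv F c + ((b / L : ℝ) : ℂ) * deriv (logDeriv F) c).re)
      = (-logDeriv F c + ((b / L : ℝ) : ℂ) * deriv (logDeriv F) c).re := by
      field_simp
    rw [mul_add, h1]
    refine g2.trans ?_
    have h2 := mul_le_mul_of_nonneg_right hsm hL.le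
    have h3 := mul_le_mul_of_nonneg_right he2 hL.le
    nlinarith
  exact le_of_mul_le_mul_left hfinal hL

/-- The entire function `(s - 1) ζ(s)`. -/
noncomputable def zetaOne : ℂ → ℂ := Function.update (fun s => (s - 1) * riemannZeta s) 1 1

theorem zetaOne_one : zetaOne 1 = 1 := Function.update_self ..

theorem zetaOne_of_ne {s : ℂ} (hs : s ≠ 1) : zetaOne s = (s - 1) * riemannZeta s :=
  Function.update_of_ne hs ..

theorem differentiable_zetaOne : Differentiable ℂ zetaOne := by
  rw [← differentiableOn_univ,
    ← Complex.differentiableOn_compl_singleton_and_continuousAt_iff (c := 1) Filter.univ_mem]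
  refine ⟨DifferentiableOn.congr (f := fun s ↦ (s - 1) * riemannZeta s)
    (fun s hs ↦ DifferentiableAt.differentiableWithinAt ?_)
    fun _ hs ↦ Function.update_of_ne (Set.mem_sdiff_singleton.mp hs).2 ..,
    continuousWithinAt_compl_self.mp ?_⟩
  · exact (by fun_prop : DifferentiableAt ℂ (fun s : ℂ => s - 1) s).mul
      (differentiableAt_riemannZeta (Set.mem_sdiff_singleton.mp hs).2)
  · unfold zetaOne
    simpa using riemannZeta_residue_one

theorem zetaOne_ne_zero {s : ℂ} (hs : 1 ≤ s.re) : zetaOne s ≠ 0 := by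
  rcases eq_or_ne s 1 with rfl | h
  · rw [zetaOne_one]; exact one_ne_zero
  · rw [zetaOne_of_ne h]
    exact mul_ne_zero (sub_ne_zero.2 h) (riemannZeta_ne_zero_of_one_le_re hs)

theorem logDeriv_riemannZeta_eq {s : ℂ} (hs : 1 < s.re) :
    logDeriv riemannZeta s = logDeriv zetaOne s - 1 / (s - 1) := by
  have hs1 : s ≠ 1 := fun h => by simp [h] at hs
  have hev : zetaOne =ᶠ[𝓝 s] (fun s => (s - 1) * riemannZeta s) := by
    filter_upwards [isOpen_ne.mem_nhds hs1] with z hz using zetaOne_of_ne hz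
  have h1 : logDeriv zetaOne s = logDeriv (fun s => (s - 1) * riemannZeta s) s := by
    rw [logDeriv_apply, logDeriv_apply, hev.deriv_eq, hev.eq_of_nhds]
  rw [h1, logDeriv_mul (f := fun s : ℂ => s - 1) (g := riemannZeta) s (sub_ne_zero.2 hs1)
    (riemannZeta_ne_zero_of_one_lt_re hs) (by fun_prop) (differentiableAt_riemannZeta hs1),
    logDeriv_apply (fun s : ℂ => s - 1)]
  simp

theorem deriv_logDeriv_riemannZeta_eq {s : ℂ} (hs : 1 < s.re) :
    deriv (logDeriv riemannZeta) s = deriv (logDeriv zetaOne) s + 1 / (s - 1) ^ 2 := by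
  have hs1 : s - 1 ≠ 0 := fun h => by rw [sub_eq_zero] at h; simp [h] at hs
  have hev : logDeriv riemannZeta =ᶠ[𝓝 s] fun z => logDeriv zetaOne z - (z - 1)⁻¹ := by
    filter_upwards [(isOpen_lt continuous_const Complex.continuous_re).mem_nhds hs] with z hz
    rw [logDeriv_riemannZeta_eq hz, one_div]
  have hd : DifferentiableAt ℂ (logDeriv zetaOne) s := by
    have ha := differentiable_zetaOne.analyticAt s
    exact (ha.deriv.div ha (zetaOne_ne_zero hs.le)).differentiableAt
  have h2 : HasDerivAt (fun z : ℂ => (z - 1)⁻¹) (-1 / (s - 1) ^ 2) s :=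
    ((hasDerivAt_id s).sub_const 1).inv hs1
  rw [hev.deriv_eq, deriv_fun_sub hd h2.differentiableAt, h2.deriv]
  ring

theorem exists_logDeriv_zetaOne_bound (T : ℝ) : ∃ C, 0 ≤ C ∧ ∀ s : ℂ, 1 ≤ s.re → s.re ≤ 2 →
    |s.im| ≤ T → ‖logDeriv zetaOne s‖ ≤ C ∧ ‖deriv (logDeriv zetaOne) s‖ ≤ C := by
  have hK : IsCompact (Set.Icc (1 : ℝ) 2 ×ℂ Set.Icc (-T) T) := isCompact_Icc.reProdIm isCompact_Icc
  have han : ∀ s ∈ Set.Icc (1 : ℝ) 2 ×ℂ Set.Icc (-T) T, AnalyticAt ℂ (logDeriv zetaOne) s := by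
    intro s hs
    have ha := differentiable_zetaOne.analyticAt s
    exact ha.deriv.div ha (zetaOne_ne_zero (Complex.mem_reProdIm.1 hs).1.1)
  obtain ⟨C₁, h1⟩ := hK.exists_bound_of_continuousOn
    (fun s hs => (han s hs).continuousAt.continuousWithinAt)
  obtain ⟨C₂, h2⟩ := hK.exists_bound_of_continuousOn
    (fun s hs => (han s hs).deriv.continuousAt.continuousWithinAt)
  refine ⟨max 0 (max C₁ C₂), le_max_left _ _, fun s a b c => ?_⟩
  have hs : s ∈ Set.Icc (1 : ℝ) 2 ×ℂ Set.Icc (-T) T :=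
    Complex.mem_reProdIm.2 ⟨⟨a, b⟩, abs_le.1 c⟩
  exact ⟨(h1 s hs).trans (by simp), (h2 s hs).trans (by simp)⟩

/-- Mertens-type asymptotics for twisted sums of the von Mangoldt function. -/
theorem tsum_vmWeight_asymp {a c T ε : ℝ} (ha : 0 < a) (hc : 0 ≤ c) (hε : 0 < ε) :
    ∀ᶠ L : ℝ in atTop, ∀ τ : ℝ, |τ| ≤ T →
      Summable (fun n => (vmWeight (1 + a / L) (c / L) n : ℂ) * (n : ℂ) ^ (-(τ * Complex.I))) ∧
      ‖(1 / L : ℝ) * (∑' n, (vmWeight (1 + a / L) (c / L) n : ℂ) * (n : ℂ) ^ (-(τ * Complex.I)))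
        - (1 / (a + (τ * L : ℝ) * Complex.I) + c / (a + (τ * L : ℝ) * Complex.I) ^ 2)‖ ≤ ε := by
  obtain ⟨C, hC0, hC⟩ := exists_logDeriv_zetaOne_bound T
  have hlim : Tendsto (fun L : ℝ => 1 / L * (C + c / L * C)) atTop (𝓝 0) := by
    have h1 : ∀ c : ℝ, Tendsto (fun L : ℝ => c / L) atTop (𝓝 0) := fun c =>
      tendsto_const_nhds.div_atTop tendsto_id
    simpa using (h1 1).mul (((h1 c).mul_const C).const_add C)
  filter_upwards [eventually_gt_atTop 0, eventually_ge_atTop a,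
    hlim.eventually_le_const hε] with L hL hLa hsm τ hτ
  have haL : 0 < a / L := by positivity
  have haL1 : a / L ≤ 1 := (div_le_one hL).2 hLa
  have hh := hasSum_vmWeight_mul (q := 1) 1 (σ := 1 + a / L) (by linarith) (c / L) τ
  have htw : ∀ n : ℕ, chiTwist (1 : DirichletCharacter ℂ 1) τ n = (n : ℂ) ^ (-(τ * Complex.I)) := by
    intro n
    have : (n : ZMod 1) = 1 := Subsingleton.elim _ _
    rw [chiTwist, this, map_one, one_mul]
  simp only [htw, DirichletCharacter.LFunction_modOne_eq] at hh
  refine ⟨hh.summable, ?_⟩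
  rw [hh.tsum_eq]
  set s : ℂ := ((1 + a / L : ℝ) : ℂ) + τ * Complex.I with hs
  have hsre : s.re = 1 + a / L := by simp [hs]
  have hsim : s.im = τ := by simp [hs]
  obtain ⟨b1, b2⟩ := hC s (by linarith) (by linarith) (by rw [hsim]; exact hτ)
  have hLC : (L : ℂ) ≠ 0 := Complex.ofReal_ne_zero.2 hL.ne'
  have hz : (a : ℂ) + (τ * L : ℝ) * Complex.I ≠ 0 := by
    intro h
    have := congrArg Complex.re h
    simp at this
    linarith
  have hs1 : s - 1 = (a + (τ * L : ℝ) * Complex.I) / L := by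
    rw [hs]; push_cast; field_simp; ring
  have e : (1 / L : ℝ) * (-logDeriv riemannZeta s + (c / L : ℝ) * deriv (logDeriv riemannZeta) s)
      - (1 / (a + (τ * L : ℝ) * Complex.I) + c / (a + (τ * L : ℝ) * Complex.I) ^ 2)
      = (1 / L : ℝ) * (-logDeriv zetaOne s + (c / L : ℝ) * deriv (logDeriv zetaOne) s) := by
    rw [logDeriv_riemannZeta_eq (by linarith), deriv_logDeriv_riemannZeta_eq (by linarith), hs1]
    set z : ℂ := (a : ℂ) + (τ * L : ℝ) * Complex.I
    push_cast
    field_simp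
    ring
  rw [e, norm_mul, Complex.norm_real, Real.norm_of_nonneg (by positivity)]
  refine le_trans ?_ hsm
  gcongr
  refine (norm_add_le _ _).trans ?_
  rw [norm_neg, norm_mul, Complex.norm_real, Real.norm_of_nonneg (by positivity)]
  gcongr

theorem sum_same_re_eq {q : ℕ} [NeZero q] (P : Finset (DirichletCharacter ℂ q × ℂ))
    (z : DirichletCharacter ℂ q × ℂ → ℂ) :
    ∑ j ∈ P, ∑ k ∈ P, (if j.1 = k.1 then (z j * starRingEnd ℂ (z k)).re else 0)
      = ∑ χ : DirichletCharacter ℂ q, ‖∑ j ∈ P with j.1 = χ, z j‖ ^ 2 := by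
  have h : ∀ χ : DirichletCharacter ℂ q, ‖∑ j ∈ P with j.1 = χ, z j‖ ^ 2
      = ∑ j ∈ P, ∑ k ∈ P, if j.1 = χ then
        (if j.1 = k.1 then (z j * starRingEnd ℂ (z k)).re else 0) else 0 := by
    intro χ
    have h1 : ((‖∑ j ∈ P with j.1 = χ, z j‖ ^ 2 : ℝ) : ℂ)
        = ∑ j ∈ P with j.1 = χ, ∑ k ∈ P with k.1 = χ, z j * starRingEnd ℂ (z k) := by
      rw [Complex.ofReal_pow, ← Complex.mul_conj', map_sum, Finset.sum_mul_sum]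
    have h2 := congrArg Complex.re h1
    rw [Complex.ofReal_re, Complex.re_sum] at h2
    rw [h2, Finset.sum_filter]
    refine sum_congr rfl fun j _ => ?_
    by_cases hj : j.1 = χ
    · rw [if_pos hj, Complex.re_sum, Finset.sum_filter]
      refine sum_congr rfl fun k _ => ?_
      rw [if_pos hj, hj]
      simp only [eq_comm]
    · simp [hj]
  symm
  rw [sum_congr rfl fun χ _ => h χ, Finset.sum_comm]
  refine sum_congr rfl fun j _ => ?_
  rw [Finset.sum_comm]
  refine sum_congr rfl fun k _ => ?_
  rw [Finset.sum_ite_eq]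
  simp

theorem conj_apply_eq_inv {q : ℕ} [NeZero q] (χ : DirichletCharacter ℂ q) (a : ZMod q) :
    starRingEnd ℂ (χ a) = χ⁻¹ a := by
  rw [← MulChar.star_eq_inv]
  rfl

/-- Squared norms of character combinations, dropping the coprimality condition on the diagonal
blocks. -/
theorem normSq_sum_char_le {q : ℕ} [NeZero q] (P : Finset (DirichletCharacter ℂ q × ℂ))
    (z : DirichletCharacter ℂ q × ℂ → ℂ) (n : ℕ) :
    ‖∑ j ∈ P, j.1 n * z j‖ ^ 2 ≤
      ∑ j ∈ P, ∑ k ∈ P, (if j.1 = k.1 then (z j * starRingEnd ℂ (z k)).re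
        else ((j.1 * k.1⁻¹ : DirichletCharacter ℂ q) n * (z j * starRingEnd ℂ (z k))).re) := by
  by_cases hn : IsUnit (n : ZMod q)
  · have h1 : ((‖∑ j ∈ P, j.1 n * z j‖ ^ 2 : ℝ) : ℂ)
        = ∑ j ∈ P, ∑ k ∈ P, (j.1 * k.1⁻¹ : DirichletCharacter ℂ q) n
          * (z j * starRingEnd ℂ (z k)) := by
      rw [Complex.ofReal_pow, ← Complex.mul_conj', map_sum, Finset.sum_mul_sum]
      refine sum_congr rfl fun j _ => sum_congr rfl fun k _ => ?_
      rw [map_mul, conj_apply_eq_inv, MulChar.mul_apply]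
      ring
    have h2 := congrArg Complex.re h1
    rw [Complex.ofReal_re, Complex.re_sum] at h2
    rw [h2]
    refine sum_le_sum fun j _ => ?_
    rw [Complex.re_sum]
    refine sum_le_sum fun k _ => ?_
    split_ifs with h
    · rw [h, mul_inv_cancel, MulChar.one_apply hn, one_mul]
    · exact le_rfl
  · have h0 : ∀ χ : DirichletCharacter ℂ q, χ n = 0 := fun χ => χ.map_nonunit hn
    simp only [h0, zero_mul, Finset.sum_const_zero, norm_zero, Complex.zero_re]
    rw [sum_same_re_eq]
    simp only [ne_eq, OfNat.ofNat_ne_zero, not_false_eq_true, zero_pow]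
    exact Finset.sum_nonneg fun _ _ => sq_nonneg _

/-- The real part of `1/(γ+iy) + γ/(γ+iy)²`. -/
noncomputable def hk (γ y : ℝ) : ℝ := 2 * γ ^ 3 / (γ ^ 2 + y ^ 2) ^ 2

theorem re_kernel_eq_hk {γ : ℝ} (hγ : 0 < γ) (y : ℝ) :
    (1 / (γ + (y : ℝ) * Complex.I) + γ / (γ + (y : ℝ) * Complex.I) ^ 2 : ℂ).re = hk γ y := by
  have hn : Complex.normSq (γ + y * Complex.I) = γ ^ 2 + y ^ 2 := by
    simp [Complex.normSq_apply]; ring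
  have hW : 0 < γ ^ 2 + y ^ 2 := by positivity
  rw [Complex.add_re, one_div, Complex.inv_re, hn, div_eq_mul_inv (γ : ℂ),
    Complex.re_ofReal_mul, Complex.inv_re, map_pow, hn, pow_two (_ + _ * _ : ℂ), Complex.mul_re, hk]
  simp
  field_simp
  ring

theorem inv_one_add_le_exp {x : ℝ} (hx : 0 ≤ x) : 1 / (1 + x) ≤ 1 / 4 + 3 / 4 * Real.exp (-x) := by
  have hp : (0 : ℝ) < 1 + x := by linarith
  rcases le_or_gt 3 x with h3 | h3
  · have : 1 / (1 + x) ≤ 1 / 4 := one_div_le_one_div_of_le (by norm_num) (by linarith)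
    have := Real.exp_pos (-x)
    linarith
  set f : ℝ → ℝ := fun y => Real.log (1 + y) - Real.log (3 - y) - y with hf
  have hd : ∀ y ∈ Set.Ico (0 : ℝ) 3, HasDerivAt f (1 / (1 + y) - -1 / (3 - y) - 1) y := by
    intro y hy
    exact ((((hasDerivAt_id y).const_add 1).log (by simp only [id]; linarith [hy.1])).sub
      (((hasDerivAt_id y).const_sub 3).log (by simp only [id]; linarith [hy.2]))).sub
      (hasDerivAt_id y)
  have hmono : MonotoneOn f (Set.Ico 0 3) := by
    refine monotoneOn_of_deriv_nonneg (convex_Ico 0 3)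
      (fun y hy => (hd y hy).continuousAt.continuousWithinAt)
      (fun y hy => (hd y (interior_subset hy)).differentiableAt.differentiableWithinAt)
      fun y hy => ?_
    have hy' := interior_subset hy
    rw [(hd y hy').deriv]
    have h1 : 0 < 1 + y := by linarith [hy'.1]
    have h2 : 0 < 3 - y := by linarith [hy'.2]
    have : 1 / (1 + y) - -1 / (3 - y) - 1 = (1 - y) ^ 2 / ((1 + y) * (3 - y)) := by
      field_simp; ring
    rw [this]
    positivity
  have h0 := hmono (Set.left_mem_Ico.2 (by norm_num)) ⟨hx, h3⟩ hx
  simp only [hf, add_zero, sub_zero, Real.log_one] at h0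
  have h3x : 0 < 3 - x := by linarith
  have h4 : Real.log ((3 - x) / (3 * (1 + x))) ≤ -x := by
    rw [Real.log_div h3x.ne' (by positivity), Real.log_mul (by norm_num) hp.ne']
    linarith
  have h5 := (Real.log_le_iff_le_exp (by positivity)).1 h4
  have h6 : 1 / (1 + x) = 1 / 4 + 3 / 4 * ((3 - x) / (3 * (1 + x))) := by
    field_simp; ring
  rw [h6]
  linarith

theorem natCast_cpow_mul_conj {n : ℕ} (hn : n ≠ 0) (a b : ℝ) :
    (n : ℂ) ^ (-(a * Complex.I)) * starRingEnd ℂ ((n : ℂ) ^ (-(b * Complex.I)))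
      = (n : ℂ) ^ (-(((a - b : ℝ) : ℂ) * Complex.I)) := by
  have hn0 : (n : ℂ) ≠ 0 := Nat.cast_ne_zero.2 hn
  have h1 : starRingEnd ℂ ((n : ℂ) ^ (-(b * Complex.I))) = (n : ℂ) ^ (b * Complex.I) := by
    have := Complex.cpow_conj (n : ℂ) (-(b * Complex.I))
      (by rw [Complex.natCast_arg]; exact Real.pi_ne_zero.symm)
    simpa using this.symm
  rw [h1, ← Complex.cpow_add _ _ hn0]
  congr 1
  push_cast
  ring

theorem vmWeight_eq_exp {a c L : ℝ} (hL : 0 < L) {n : ℕ} (hn : n ≠ 0) :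
    vmWeight (1 + a / L) (c / L) n = ArithmeticFunction.vonMangoldt n / n
      * Real.exp (-(a * (Real.log n / L))) * (1 + c * (Real.log n / L)) := by
  have hn0 : (0 : ℝ) < n := by exact_mod_cast Nat.pos_of_ne_zero hn
  have : (n : ℝ) ^ (-(1 + a / L)) = 1 / n * Real.exp (-(a * (Real.log n / L))) := by
    rw [neg_add, Real.rpow_add hn0, Real.rpow_neg_one, Real.rpow_def_of_pos hn0, one_div]
    congr 2
    field_simp
  rw [vmWeight, this]
  ring

theorem vmWeight_zero (σ c : ℝ) : vmWeight σ c 0 = 0 := by simp [vmWeight]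

/-- A majorant for the square of the weight with `b = 1` over the weight with `γ = 1/2`. -/
noncomputable def vmMajorant (L : ℝ) (n : ℕ) : ℝ :=
  1 / 4 * vmWeight (1 + (3 / 2) / L) (8 / L) n + 3 / 4 * vmWeight (1 + 2 / L) (0 / L) n

theorem vmWeight_sq_le {L : ℝ} (hL : 0 < L) (n : ℕ) :
    vmWeight (1 + 1 / L) (1 / L) n ^ 2 ≤
      vmMajorant L n * vmWeight (1 + (1 / 2) / L) ((1 / 2) / L) n := by
  rcases Nat.eq_zero_or_pos n with rfl | hn
  · simp [vmWeight_zero]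
  rw [vmMajorant, vmWeight_eq_exp hL hn.ne', vmWeight_eq_exp hL hn.ne', vmWeight_eq_exp hL hn.ne',
    vmWeight_eq_exp hL hn.ne']
  set t := Real.log n / L with ht
  have ht0 : 0 ≤ t := div_nonneg (Real.log_natCast_nonneg n) hL.le
  set W := ArithmeticFunction.vonMangoldt n / (n : ℝ) with hW
  have e1 : Real.exp (-(1 * t)) = Real.exp (-(t / 2)) ^ 2 := by
    rw [← Real.exp_nat_mul]; congr 1; push_cast; ring
  have e2 : Real.exp (-(3 / 2 * t)) = Real.exp (-(t / 2)) ^ 3 := by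
    rw [← Real.exp_nat_mul]; congr 1; push_cast; ring
  have e3 : Real.exp (-(2 * t)) = Real.exp (-(t / 2)) ^ 4 := by
    rw [← Real.exp_nat_mul]; congr 1; push_cast; ring
  have e4 : Real.exp (-(1 / 2 * t)) = Real.exp (-(t / 2)) := by congr 1; ring
  rw [e1, e2, e3, e4]
  have hx := inv_one_add_le_exp (x := t / 2) (by positivity)
  set E := Real.exp (-(t / 2)) with hE
  have h1 : 1 ≤ (1 / 4 + 3 / 4 * E) * (1 + t / 2) := by
    rwa [div_le_iff₀ (by positivity)] at hx
  have e5 : (1 / 4 * (W * E ^ 3 * (1 + 8 * t)) + 3 / 4 * (W * E ^ 4 * (1 + 0 * t)))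
      * (W * E * (1 + 1 / 2 * t)) - (W * E ^ 2 * (1 + 1 * t)) ^ 2
      = W ^ 2 * E ^ 4 * ((1 / 4 + 3 / 4 * E) * (1 + t / 2) - 1) := by ring
  have h2 : 0 ≤ W ^ 2 * E ^ 4 * ((1 / 4 + 3 / 4 * E) * (1 + t / 2) - 1) := by
    have : 0 ≤ (1 / 4 + 3 / 4 * E) * (1 + t / 2) - 1 := by linarith
    positivity
  linarith

theorem re_tsum_vmWeight_asymp {a c T ε : ℝ} (ha : 0 < a) (hc : 0 ≤ c) (hε : 0 < ε) :
    ∀ᶠ L : ℝ in atTop, ∀ τ : ℝ, |τ| ≤ T →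
      |1 / L * (∑' n, (vmWeight (1 + a / L) (c / L) n : ℂ) * (n : ℂ) ^ (-(τ * Complex.I))).re
        - (1 / (a + (τ * L : ℝ) * Complex.I) + c / (a + (τ * L : ℝ) * Complex.I) ^ 2 : ℂ).re|
        ≤ ε := by
  filter_upwards [tsum_vmWeight_asymp (T := T) ha hc hε] with L h τ hτ
  refine le_trans ?_ (h τ hτ).2
  refine le_trans (le_of_eq ?_) (Complex.abs_re_le_norm _)
  rw [Complex.sub_re, Complex.re_ofReal_mul]

theorem tsum_vmWeight_le {a c ε : ℝ} (ha : 0 < a) (hc : 0 ≤ c) (hε : 0 < ε) :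
    ∀ᶠ L : ℝ in atTop, Summable (vmWeight (1 + a / L) (c / L)) ∧
      1 / L * ∑' n, vmWeight (1 + a / L) (c / L) n ≤ 1 / a + c / a ^ 2 + ε := by
  filter_upwards [re_tsum_vmWeight_asymp (T := 0) ha hc hε, eventually_gt_atTop 0] with L h hL
  have hs : Summable (vmWeight (1 + a / L) (c / L)) :=
    summable_vmWeight (by have : 0 < a / L := by positivity
                          linarith) (by positivity)
  refine ⟨hs, ?_⟩
  have h0 := h 0 (by simp)
  have e1 : (∑' n, (vmWeight (1 + a / L) (c / L) n : ℂ) * (n : ℂ) ^ (-(((0 : ℝ) : ℂ) * Complex.I))).re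
      = ∑' n, vmWeight (1 + a / L) (c / L) n := by
    simp only [Complex.ofReal_zero, zero_mul, neg_zero, Complex.cpow_zero, mul_one]
    rw [← Complex.ofReal_tsum, Complex.ofReal_re]
  rw [e1] at h0
  have e2 : (1 / (a + ((0 : ℝ) * L : ℝ) * Complex.I)
      + c / (a + ((0 : ℝ) * L : ℝ) * Complex.I) ^ 2 : ℂ).re = 1 / a + c / a ^ 2 := by
    have : (1 / (a + ((0 : ℝ) * L : ℝ) * Complex.I)
      + c / (a + ((0 : ℝ) * L : ℝ) * Complex.I) ^ 2 : ℂ) = ((1 / a + c / a ^ 2 : ℝ) : ℂ) := by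
      push_cast; simp
    rw [this, Complex.ofReal_re]
  rw [e2] at h0
  have := (abs_le.1 h0).2
  linarith

theorem vmMajorant_asymp {ε : ℝ} (hε : 0 < ε) :
    ∀ᶠ L : ℝ in atTop, Summable (vmMajorant L) ∧ 1 / L * ∑' n, vmMajorant L n ≤ 103 / 72 + ε := by
  filter_upwards [tsum_vmWeight_le (a := 3 / 2) (c := 8) (by norm_num) (by norm_num) hε,
    tsum_vmWeight_le (a := 2) (c := 0) (by norm_num) (by norm_num) hε] with L h1 h2
  have hs : Summable (vmMajorant L) := (h1.1.mul_left _).add (h2.1.mul_left _)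
  refine ⟨hs, ?_⟩
  have : ∑' n, vmMajorant L n = 1 / 4 * ∑' n, vmWeight (1 + (3 / 2) / L) (8 / L) n
      + 3 / 4 * ∑' n, vmWeight (1 + 2 / L) (0 / L) n := by
    unfold vmMajorant
    rw [(h1.1.mul_left _).tsum_add (h2.1.mul_left _), tsum_mul_left, tsum_mul_left]
  rw [this]
  have h1' := h1.2
  have h2' := h2.2
  norm_num at h1' h2' ⊢
  linarith

/-- Large-sieve type duality over the primes for zeros of different characters. -/
theorem prime_duality {R ε : ℝ} (hR : 0 < R) (hε : 0 < ε) :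
    ∃ q₀ : ℕ, ∀ (q : ℕ) [NeZero q], q₀ ≤ q → ∀ P : Finset (DirichletCharacter ℂ q × ℂ),
      (∀ p ∈ P, p.1 ≠ 1 ∧ |p.2.im| ≤ R) →
      ∀ Z : DirichletCharacter ℂ q × ℂ → Finset ℂ,
      (∀ p ∈ P, ∀ ρ ∈ Z p, p.1.LFunction ρ = 0 ∧ |ρ.im - p.2.im| ≤ 1 / 8 ∧
        1 - R / Real.log q ≤ ρ.re) →
      ∀ w : DirichletCharacter ℂ q × ℂ → ℝ, (∀ p, 0 ≤ w p) → ∀ X : ℝ, 0 ≤ X →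
      X ≤ ∑ p ∈ P, w p * (∑ ρ ∈ Z p, (zeroMult p.1.LFunction ρ : ℝ)
        * Gk 1 (lam q ρ) ((ρ.im - p.2.im) * Real.log q) - (1 / 4 + ε)) →
      X ^ 2 ≤ (103 / 72 + ε) * (∑ j ∈ P, ∑ k ∈ P, (if j.1 = k.1 then
        w j * w k * hk (1 / 2) ((j.2.im - k.2.im) * Real.log q) else 0)
        + (1 / 4 + ε) * (∑ p ∈ P, w p) ^ 2) := by
  obtain ⟨q₁, h1⟩ := zeros_kernel_le (b := 1) (T := R) one_pos hR hR.le hε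
  obtain ⟨q₂, h2⟩ := zeros_kernel_le (b := 1 / 2) (T := 2 * R) (by norm_num) hR (by positivity) hε
  have hev : ∀ᶠ q : ℕ in atTop, 0 < Real.log q ∧
      (Summable (vmMajorant (Real.log q)) ∧
        1 / Real.log q * ∑' n, vmMajorant (Real.log q) n ≤ 103 / 72 + ε) ∧
      ∀ τ : ℝ, |τ| ≤ 2 * R → Summable (fun n => (vmWeight (1 + (1 / 2) / Real.log q)
        ((1 / 2) / Real.log q) n : ℂ) * (n : ℂ) ^ (-(τ * Complex.I))) ∧
        1 / Real.log q * (∑' n, (vmWeight (1 + (1 / 2) / Real.log q)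
        ((1 / 2) / Real.log q) n : ℂ) * (n : ℂ) ^ (-(τ * Complex.I))).re
        ≤ hk (1 / 2) (τ * Real.log q) + ε := by
    refine tendsto_log_nat.eventually (p := fun L : ℝ => 0 < L ∧
      (Summable (vmMajorant L) ∧ 1 / L * ∑' n, vmMajorant L n ≤ 103 / 72 + ε) ∧
      ∀ τ : ℝ, |τ| ≤ 2 * R → Summable (fun n => (vmWeight (1 + (1 / 2) / L)
        ((1 / 2) / L) n : ℂ) * (n : ℂ) ^ (-(τ * Complex.I))) ∧
        1 / L * (∑' n, (vmWeight (1 + (1 / 2) / L)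
        ((1 / 2) / L) n : ℂ) * (n : ℂ) ^ (-(τ * Complex.I))).re
        ≤ hk (1 / 2) (τ * L) + ε) ?_
    have hhalf : (0 : ℝ) < 1 / 2 := by norm_num
    filter_upwards [eventually_gt_atTop 0, vmMajorant_asymp hε,
      re_tsum_vmWeight_asymp (T := 2 * R) hhalf hhalf.le hε,
      tsum_vmWeight_asymp (T := 2 * R) hhalf hhalf.le hε] with L a b c d
    refine ⟨a, b, fun τ hτ => ⟨(d τ hτ).1, ?_⟩⟩
    have := (abs_le.1 (c τ hτ)).2
    have e := re_kernel_eq_hk hhalf (τ * L)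
    rw [e] at this
    linarith
  obtain ⟨q₃, h3⟩ := eventually_atTop.1 hev
  refine ⟨max q₁ (max q₂ q₃), fun q _ hq P hP Z hZ w hw X hX hXle => ?_⟩
  obtain ⟨hL, ⟨hMs, hM⟩, hH⟩ := h3 q (le_trans (by simp) hq)
  replace h1 := h1 q (le_trans (by simp) hq)
  replace h2 := h2 q (le_trans (by simp) hq)
  set L := Real.log q with hLdef
  set g : ℕ → ℝ := vmWeight (1 + 1 / L) (1 / L) with hg
  set h : ℕ → ℝ := vmWeight (1 + (1 / 2) / L) ((1 / 2) / L) with hh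
  have hg0 : ∀ n, 0 ≤ g n := fun n => vmWeight_nonneg (by positivity) n
  have hh0 : ∀ n, 0 ≤ h n := fun n => vmWeight_nonneg (by positivity) n
  set Tw : DirichletCharacter ℂ q × ℂ → DirichletCharacter ℂ q × ℂ → ℕ → ℂ := fun j k n =>
    if j.1 = k.1 then (n : ℂ) ^ (-(((j.2.im - k.2.im : ℝ) : ℂ) * Complex.I))
      else chiTwist (j.1 * k.1⁻¹) (j.2.im - k.2.im) n with hTw
  have him : ∀ j ∈ P, ∀ k ∈ P, |j.2.im - k.2.im| ≤ 2 * R := fun j hj k hk =>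
    (abs_sub _ _).trans (by linarith [(hP j hj).2, (hP k hk).2])
  have hTs : ∀ j ∈ P, ∀ k ∈ P, Summable fun n => (h n : ℂ) * Tw j k n := by
    intro j hj k hk
    simp only [hTw]
    split_ifs with hjk
    · exact (hH _ (him j hj k hk)).1
    · exact (hasSum_vmWeight_mul _ (by have : 0 < 1 / 2 / L := by positivity
                                       linarith) _ _).summable
  have hTv : ∀ j ∈ P, ∀ k ∈ P, 1 / L * (∑' n, (h n : ℂ) * Tw j k n).re ≤
      (if j.1 = k.1 then hk (1 / 2) ((j.2.im - k.2.im) * L) else 0) + (1 / 4 + ε) := by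
    intro j hj k hk
    simp only [hTw]
    split_ifs with hjk
    · have := (hH _ (him j hj k hk)).2
      linarith
    · have := (h2 (j.1 * k.1⁻¹) (fun h => hjk (mul_inv_eq_one.1 h)) _ (him j hj k hk) ∅
        (by simp)).2
      rw [Finset.sum_empty, zero_add] at this
      linarith
  set s : ℕ → ℂ := fun n => ∑ p ∈ P, (w p : ℂ) * chiTwist p.1 p.2.im n with hs
  have hsn : ∀ n, h n * ‖s n‖ ^ 2 ≤
      ∑ j ∈ P, ∑ k ∈ P, w j * w k * ((h n : ℂ) * Tw j k n).re := by
    intro n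
    rcases Nat.eq_zero_or_pos n with rfl | hn
    · simp [hh, vmWeight_zero]
    have := normSq_sum_char_le P (fun p => (w p : ℂ) * (n : ℂ) ^ (-(p.2.im * Complex.I))) n
    have e : ∑ j ∈ P, j.1 n * ((w j : ℂ) * (n : ℂ) ^ (-(j.2.im * Complex.I))) = s n := by
      rw [hs]
      exact sum_congr rfl fun p _ => by rw [chiTwist]; ring
    rw [e] at this
    refine (mul_le_mul_of_nonneg_left this (hh0 n)).trans (le_of_eq ?_)
    rw [mul_sum]
    refine sum_congr rfl fun j _ => ?_
    rw [mul_sum]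
    refine sum_congr rfl fun k _ => ?_
    have e2 : (w j : ℂ) * (n : ℂ) ^ (-(j.2.im * Complex.I))
        * starRingEnd ℂ ((w k : ℂ) * (n : ℂ) ^ (-(k.2.im * Complex.I)))
        = ((w j * w k : ℝ) : ℂ) * (n : ℂ) ^ (-(((j.2.im - k.2.im : ℝ) : ℂ) * Complex.I)) := by
      rw [map_mul, Complex.conj_ofReal, ← natCast_cpow_mul_conj hn.ne']
      push_cast
      ring
    rw [e2, Complex.re_ofReal_mul, Complex.re_ofReal_mul]
    simp only [hTw]
    split_ifs with hjk
    · ring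
    · rw [chiTwist, mul_left_comm, Complex.re_ofReal_mul]
      ring
  set V : ℝ := ∑ j ∈ P, ∑ k ∈ P, w j * w k * (∑' n, (h n : ℂ) * Tw j k n).re with hV
  have hVsum : HasSum (fun n => ∑ j ∈ P, ∑ k ∈ P, w j * w k * ((h n : ℂ) * Tw j k n).re) V :=
    hasSum_sum fun j hj => hasSum_sum fun k hk =>
      (Complex.hasSum_re (hTs j hj k hk).hasSum).mul_left _
  have hVle : 1 / L * V ≤ ∑ j ∈ P, ∑ k ∈ P, (if j.1 = k.1 then
        w j * w k * hk (1 / 2) ((j.2.im - k.2.im) * L) else 0)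
        + (1 / 4 + ε) * (∑ p ∈ P, w p) ^ 2 := by
    rw [hV, pow_two, Finset.sum_mul_sum, mul_sum, mul_sum, ← Finset.sum_add_distrib]
    refine sum_le_sum fun j hj => ?_
    rw [mul_sum, mul_sum, ← Finset.sum_add_distrib]
    refine sum_le_sum fun k hk' => ?_
    have := mul_le_mul_of_nonneg_left (hTv j hj k hk') (mul_nonneg (hw j) (hw k))
    split_ifs at this ⊢ <;> nlinarith
  have hgs : HasSum (fun n => -(g n * (s n).re)) (-∑ p ∈ P, w p *
      (∑' n, (g n : ℂ) * chiTwist p.1 p.2.im n).re) := by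
    have h0 : HasSum (fun n => ∑ p ∈ P, w p * ((g n : ℂ) * chiTwist p.1 p.2.im n).re)
        (∑ p ∈ P, w p * (∑' n, (g n : ℂ) * chiTwist p.1 p.2.im n).re) :=
      hasSum_sum fun p _ => (Complex.hasSum_re (hasSum_vmWeight_mul _
        (by have : 0 < 1 / L := by positivity
            linarith) _ _).summable.hasSum).mul_left _
    have e0 : (fun n => -(g n * (s n).re))
        = fun n => -∑ p ∈ P, w p * ((g n : ℂ) * chiTwist p.1 p.2.im n).re := by
      funext n
      rw [hs, Complex.re_sum, mul_sum]
      refine congrArg Neg.neg (sum_congr rfl fun p _ => ?_)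
      rw [Complex.re_ofReal_mul, Complex.re_ofReal_mul]
      ring
    rw [e0]
    exact h0.neg
  have hX1 : L * X ≤ -∑ p ∈ P, w p * (∑' n, (g n : ℂ) * chiTwist p.1 p.2.im n).re := by
    refine (mul_le_mul_of_nonneg_left hXle hL.le).trans ?_
    rw [mul_sum, ← Finset.sum_neg_distrib]
    refine sum_le_sum fun p hp => ?_
    have := (h1 p.1 (hP p hp).1 p.2.im (hP p hp).2 (Z p) (hZ p hp)).2
    have h5 := mul_le_mul_of_nonneg_left this (mul_nonneg hL.le (hw p))
    have e5 : L * w p * (1 / L * (∑' n, (g n : ℂ) * chiTwist p.1 p.2.im n).re)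
      = w p * (∑' n, (g n : ℂ) * chiTwist p.1 p.2.im n).re := by field_simp
    rw [mul_add, e5] at h5
    linarith
  set M : ℝ := ∑' n, vmMajorant L n with hMdef
  have hM0 : ∀ n, 0 ≤ vmMajorant L n := fun n => by
    have h1 : 0 ≤ vmWeight (1 + (3 / 2) / L) (8 / L) n := vmWeight_nonneg (by positivity) n
    have h2 : 0 ≤ vmWeight (1 + 2 / L) (0 / L) n := vmWeight_nonneg (by simp) n
    unfold vmMajorant
    positivity
  have hκ : ∀ κ : ℝ, 0 < κ → 2 * (L * X) ≤ κ * M + κ⁻¹ * V := by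
    intro κ hκ
    have hsumR := (hMs.hasSum.mul_left κ).add (hVsum.mul_left κ⁻¹)
    refine le_trans ?_ (hasSum_le (fun n => ?_) (hgs.mul_left 2) hsumR)
    · linarith
    have h6 : -(g n * (s n).re) ≤ g n * ‖s n‖ := by
      have := (abs_le.1 (Complex.abs_re_le_norm (s n))).1
      nlinarith [hg0 n]
    have h7 := vmWeight_sq_le hL n
    have h8 : 2 * (g n * ‖s n‖) ≤ κ * vmMajorant L n + κ⁻¹ * (h n * ‖s n‖ ^ 2) := by
      refine abs_le_of_sq_le_sq' ?_ ?_ |>.2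
      · have e8 : (κ * vmMajorant L n + κ⁻¹ * (h n * ‖s n‖ ^ 2)) ^ 2
            = (κ * vmMajorant L n - κ⁻¹ * (h n * ‖s n‖ ^ 2)) ^ 2
              + 4 * (vmMajorant L n * h n) * ‖s n‖ ^ 2 := by field_simp; ring
        rw [e8]
        nlinarith [sq_nonneg (κ * vmMajorant L n - κ⁻¹ * (h n * ‖s n‖ ^ 2)),
          mul_le_mul_of_nonneg_right h7 (sq_nonneg ‖s n‖)]
      · have := hM0 n
        have := hh0 n
        positivity
    have h9 := mul_le_mul_of_nonneg_left (hsn n) (inv_pos.2 hκ).le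
    linarith
  rcases hX.eq_or_lt with rfl | hXpos
  · have hV0 : 0 ≤ V := hVsum.nonneg fun n =>
      le_trans (mul_nonneg (hh0 n) (sq_nonneg _)) (hsn n)
    have : 0 ≤ 1 / L * V := by positivity
    have h10 := this.trans hVle
    rw [zero_pow two_ne_zero]
    positivity
  set B : ℝ := 103 / 72 + ε with hB
  have hBpos : 0 < B := by positivity
  have hfin := hκ (X / B) (by positivity)
  have h11 : X / B * M ≤ X / B * (L * B) := by
    refine mul_le_mul_of_nonneg_left ?_ (by positivity)
    rwa [one_div, inv_mul_le_iff₀ hL] at hM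
  have e12 : X / B * (L * B) = L * X := by field_simp
  have h13 : L * X ≤ (X / B)⁻¹ * V := by linarith
  have h14 : X ^ 2 ≤ B * (1 / L * V) := by
    rw [inv_div, div_mul_eq_mul_div, le_div_iff₀ hXpos] at h13
    rw [one_div, ← mul_assoc, mul_comm B, mul_assoc, le_inv_mul_iff₀ hL]
    nlinarith
  exact h14.trans (mul_le_mul_of_nonneg_left hVle hBpos.le)

/-- The product `∏_{p ∣ n} (1 - p^{-z})`. -/
noncomputable def sieveProd (z : ℂ) (n : ℕ) : ℂ := ∏ p ∈ n.primeFactors, (1 - (p : ℂ) ^ (-z))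

theorem norm_natCast_cpow_neg_le_one {z : ℂ} (hz : 0 ≤ z.re) (n : ℕ) (hn : n ≠ 0) :
    ‖(n : ℂ) ^ (-z)‖ ≤ 1 := by
  rw [Complex.norm_natCast_cpow_of_pos (Nat.pos_of_ne_zero hn)]
  exact Real.rpow_le_one_of_one_le_of_nonpos (by exact_mod_cast Nat.one_le_iff_ne_zero.2 hn)
    (by simpa using hz)

theorem norm_sieveProd_le {z : ℂ} (hz : 0 ≤ z.re) {n : ℕ} (hn : n ≠ 0) :
    ‖sieveProd z n‖ ≤ n.divisors.card := by
  have h1 : ‖sieveProd z n‖ ≤ ∏ p ∈ n.primeFactors, (2 : ℝ) := by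
    refine (Finset.norm_prod_le _ _).trans (Finset.prod_le_prod (fun _ _ => norm_nonneg _) ?_)
    intro p hp
    refine (norm_sub_le _ _).trans ?_
    have := norm_natCast_cpow_neg_le_one hz p (Nat.prime_of_mem_primeFactors hp).ne_zero
    rw [norm_one]; linarith
  refine h1.trans ?_
  rw [Nat.card_divisors hn]
  push_cast
  refine Finset.prod_le_prod (fun _ _ => by norm_num) fun p hp => ?_
  have : 1 ≤ n.factorization p :=
    (Nat.prime_of_mem_primeFactors hp).factorization_pos_of_dvd hn (Nat.dvd_of_mem_primeFactors hp)
  have : (1 : ℝ) ≤ n.factorization p := by exact_mod_cast this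
  linarith

theorem sieveProd_mul {z : ℂ} {m n : ℕ} (h : m.Coprime n) :
    sieveProd z (m * n) = sieveProd z m * sieveProd z n := by
  unfold sieveProd
  rw [h.primeFactors_mul, Finset.prod_union h.disjoint_primeFactors]

theorem sieveProd_prime_pow (z : ℂ) {p : ℕ} (hp : p.Prime) {e : ℕ} (he : e ≠ 0) :
    sieveProd z (p ^ e) = 1 - (p : ℂ) ^ (-z) := by
  unfold sieveProd
  rw [Nat.primeFactors_prime_pow he hp, Finset.prod_singleton]

theorem sieveProd_one (z : ℂ) : sieveProd z 1 = 1 := by simp [sieveProd]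

theorem summable_divisors_sq_rpow {σ : ℝ} (hσ : 1 < σ) :
    Summable fun n : ℕ => (n.divisors.card : ℝ) ^ 2 * (n : ℝ) ^ (-σ) := by
  obtain ⟨C, hC, h⟩ := card_divisors_le_rpow (ε := (σ - 1) / 4) (by linarith)
  refine Summable.of_nonneg_of_le (fun n => by positivity) (fun n => ?_)
    ((Real.summable_nat_rpow.2 (by linarith : -((σ + 1) / 2) < -1)).mul_left (C ^ 2))
  rcases eq_or_ne n 0 with rfl | hn
  · simp; positivity
  have hn0 : (0 : ℝ) < n := by exact_mod_cast Nat.pos_of_ne_zero hn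
  calc (n.divisors.card : ℝ) ^ 2 * (n : ℝ) ^ (-σ)
      ≤ (C * (n : ℝ) ^ ((σ - 1) / 4)) ^ 2 * (n : ℝ) ^ (-σ) := by
        gcongr; exact h n hn
    _ = C ^ 2 * (n : ℝ) ^ (-((σ + 1) / 2)) := by
        rw [mul_pow, ← Real.rpow_natCast, ← Real.rpow_natCast, ← Real.rpow_mul hn0.le, mul_assoc,
          ← Real.rpow_add hn0]
        congr 2; push_cast; ring

theorem norm_sieve_term_le {s z z' : ℂ} (hz : 0 ≤ z.re) (hz' : 0 ≤ z'.re) (hs : s ≠ 0) (n : ℕ) :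
    ‖(n : ℂ) ^ (-s) * (sieveProd z n * sieveProd z' n)‖ ≤
      (n.divisors.card : ℝ) ^ 2 * (n : ℝ) ^ (-s.re) := by
  rcases eq_or_ne n 0 with rfl | hn
  · simp [Complex.zero_cpow (neg_ne_zero.2 hs)]
  rw [norm_mul, norm_mul, Complex.norm_natCast_cpow_of_pos (Nat.pos_of_ne_zero hn), mul_comm, sq]
  rw [Complex.neg_re]
  gcongr
  · exact norm_sieveProd_le hz hn
  · exact norm_sieveProd_le hz' hn

/-- The deviation from `1` of the quotient of local Euler factors. -/
noncomputable def localDev (x a b : ℂ) : ℂ :=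
  -(x ^ 2 * (a * b) * ((1 - a) * (1 - b)) / ((1 - x * a) * (1 - x * b)))

theorem norm_prime_cpow_le {s : ℂ} (hs : 1 ≤ s.re) (p : Nat.Primes) :
    ‖((p : ℕ) : ℂ) ^ (-s)‖ ≤ 1 / (p : ℕ) := by
  rw [Complex.norm_natCast_cpow_of_pos p.2.pos, one_div, ← Real.rpow_neg_one]
  exact Real.rpow_le_rpow_of_exponent_le (by exact_mod_cast p.2.one_le) (by simpa using hs)

theorem half_le_norm_one_sub {x a : ℂ} (hx : ‖x‖ ≤ 1 / 2) (ha : ‖a‖ ≤ 1) :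
    1 / 2 ≤ ‖1 - x * a‖ := by
  have h1 : ‖x * a‖ ≤ 1 / 2 := by
    rw [norm_mul]; nlinarith [norm_nonneg x, norm_nonneg a]
  have h2 := norm_sub_norm_le (1 : ℂ) (x * a)
  rw [norm_one] at h2; linarith

theorem norm_prime_cpow_le_half {s : ℂ} (hs : 1 ≤ s.re) (p : Nat.Primes) :
    ‖((p : ℕ) : ℂ) ^ (-s)‖ ≤ 1 / 2 := by
  refine (norm_prime_cpow_le hs p).trans ?_
  have : (2 : ℝ) ≤ (p : ℕ) := by exact_mod_cast p.2.two_le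
  gcongr

theorem norm_localDev_le {x a b : ℂ} {p : ℝ} (hx : ‖x‖ ≤ 1 / p) (hx2 : ‖x‖ ≤ 1 / 2)
    (ha : ‖a‖ ≤ 1) (hb : ‖b‖ ≤ 1) : ‖localDev x a b‖ ≤ 16 / p ^ 2 := by
  unfold localDev
  have h1 := half_le_norm_one_sub hx2 ha
  have h2 := half_le_norm_one_sub hx2 hb
  have h3 : ‖1 - a‖ ≤ 2 := (norm_sub_le _ _).trans (by rw [norm_one]; linarith)
  have h4 : ‖1 - b‖ ≤ 2 := (norm_sub_le _ _).trans (by rw [norm_one]; linarith)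
  have h5 : ‖x‖ ^ 2 ≤ (1 / p) ^ 2 := pow_le_pow_left₀ (norm_nonneg _) hx 2
  have h6 : ‖a‖ * ‖b‖ ≤ 1 := mul_le_one₀ ha (norm_nonneg _) hb
  have h7 : ‖1 - a‖ * ‖1 - b‖ ≤ 2 * 2 := mul_le_mul h3 h4 (norm_nonneg _) (by norm_num)
  have h8 : 1 / 2 * (1 / 2) ≤ ‖1 - x * a‖ * ‖1 - x * b‖ :=
    mul_le_mul h1 h2 (by norm_num) (norm_nonneg _)
  rw [norm_neg, norm_div, norm_mul, norm_mul, norm_mul, norm_mul, norm_mul, norm_pow]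
  rw [div_le_iff₀ (by linarith)]
  have h9 : ‖x‖ ^ 2 * (‖a‖ * ‖b‖) ≤ (1 / p) ^ 2 * 1 :=
    mul_le_mul h5 h6 (by positivity) (by positivity)
  calc _ ≤ (1 / p) ^ 2 * 1 * (2 * 2) := mul_le_mul h9 h7 (by positivity) (by positivity)
    _ = 16 / p ^ 2 * (1 / 2 * (1 / 2)) := by rw [div_pow, one_pow]; ring
    _ ≤ _ := mul_le_mul_of_nonneg_left h8 (by positivity)

/-- `localDev` at the prime powers `p^{-s}`, `p^{-z}`, `p^{-z'}`. -/
noncomputable def sieveLocal (s z z' : ℂ) (p : Nat.Primes) : ℂ :=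
  localDev (((p : ℕ) : ℂ) ^ (-s)) (((p : ℕ) : ℂ) ^ (-z)) (((p : ℕ) : ℂ) ^ (-z'))

theorem norm_sieveLocal_le {s z z' : ℂ} (hs : 1 ≤ s.re) (hz : 0 ≤ z.re) (hz' : 0 ≤ z'.re)
    (p : Nat.Primes) : ‖sieveLocal s z z' p‖ ≤ 16 / ((p : ℕ) : ℝ) ^ 2 :=
  norm_localDev_le (norm_prime_cpow_le hs p) (norm_prime_cpow_le_half hs p)
    (norm_natCast_cpow_neg_le_one hz p p.2.ne_zero) (norm_natCast_cpow_neg_le_one hz' p p.2.ne_zero)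

theorem summable_sixteen_div_prime_sq : Summable fun p : Nat.Primes => 16 / ((p : ℕ) : ℝ) ^ 2 := by
  have h : Summable fun n : ℕ => 16 / (n : ℝ) ^ 2 := by
    simpa [div_eq_mul_inv] using (Real.summable_nat_pow_inv.2 one_lt_two).mul_left (16 : ℝ)
  exact h.comp_injective Subtype.val_injective

theorem tsum_eq_of_geometric_tail {f : ℕ → ℂ} {c x : ℂ} (hx : ‖x‖ < 1) (h0 : f 0 = 1)
    (h1 : ∀ e, f (e + 1) = c * (x * x ^ e)) : ∑' e, f e = 1 + c * (x * (1 - x)⁻¹) := by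
  have hgeo := ((hasSum_geometric_of_norm_lt_one hx).mul_left x).mul_left c
  simp only [← h1] at hgeo
  rw [hgeo.zero_add.tsum_eq, h0]

theorem natCast_pow_cpow (p e : ℕ) (s : ℂ) : ((p ^ e : ℕ) : ℂ) ^ (-s) = ((p : ℂ) ^ (-s)) ^ e := by
  rw [Nat.cast_pow, ← Complex.natCast_cpow_natCast_mul, mul_comm, Complex.cpow_mul_nat]

theorem tsum_sieve_prime_pow {s z z' : ℂ} (hs : 1 < s.re) (p : Nat.Primes) :
    ∑' e : ℕ, (((p : ℕ) ^ e : ℕ) : ℂ) ^ (-s) * (sieveProd z ((p : ℕ) ^ e) *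
      sieveProd z' ((p : ℕ) ^ e)) =
    1 + (1 - ((p : ℕ) : ℂ) ^ (-z)) * (1 - ((p : ℕ) : ℂ) ^ (-z')) *
      (((p : ℕ) : ℂ) ^ (-s) * (1 - ((p : ℕ) : ℂ) ^ (-s))⁻¹) := by
  refine tsum_eq_of_geometric_tail
    ((norm_prime_cpow_le_half hs.le p).trans_lt (by norm_num)) ?_ fun e => ?_
  · rw [pow_zero, sieveProd_one, sieveProd_one]; simp
  · rw [natCast_pow_cpow, sieveProd_prime_pow z p.2 e.succ_ne_zero,
      sieveProd_prime_pow z' p.2 e.succ_ne_zero, pow_succ]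
    ring

/-- The Dirichlet series `∑ n^{-s} ∏_{p ∣ n} (1 - p^{-z}) (1 - p^{-z'})`. -/
noncomputable def sieveSeries (s z z' : ℂ) : ℂ :=
  ∑' n : ℕ, (n : ℂ) ^ (-s) * (sieveProd z n * sieveProd z' n)

theorem localDev_identity {x a b : ℂ} (hx : 1 - x ≠ 0) (ha : 1 - x * a ≠ 0) (hb : 1 - x * b ≠ 0)
    (hab : 1 - x * (a * b) ≠ 0) :
    (1 + (1 - a) * (1 - b) * (x * (1 - x)⁻¹)) * (1 - x * a)⁻¹ * (1 - x * b)⁻¹ =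
      (1 - x)⁻¹ * (1 - x * (a * b))⁻¹ * (1 + localDev x a b) := by
  have e1 : 1 + (1 - a) * (1 - b) * (x * (1 - x)⁻¹) = (1 - x * (a + b - a * b)) * (1 - x)⁻¹ := by
    field_simp; ring
  have e2 : 1 + localDev x a b =
      (1 - x * (a * b)) * ((1 - x * (a + b - a * b)) * ((1 - x * a)⁻¹ * (1 - x * b)⁻¹)) := by
    have hD : (1 - x * a) * (1 - x * b) ≠ 0 := mul_ne_zero ha hb
    rw [localDev, ← sub_eq_add_neg, one_sub_div hD, ← mul_inv, div_eq_mul_inv, ← mul_assoc]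
    ring
  rw [e1, e2, mul_assoc (1 - x)⁻¹, inv_mul_cancel_left₀ hab]
  ring

theorem multipliable_sieveLocal {s z z' : ℂ} (hs : 1 ≤ s.re) (hz : 0 ≤ z.re) (hz' : 0 ≤ z'.re) :
    Multipliable fun p => 1 + sieveLocal s z z' p :=
  multipliable_one_add_of_summable
    (summable_sixteen_div_prime_sq.of_nonneg_of_le (fun _ => norm_nonneg _)
      (norm_sieveLocal_le hs hz hz'))

theorem sieveSeries_mul_eq {s z z' : ℂ} (hs : 1 < s.re) (hz : 0 ≤ z.re) (hz' : 0 ≤ z'.re) :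
    sieveSeries s z z' * riemannZeta (s + z) * riemannZeta (s + z') =
      riemannZeta s * riemannZeta (s + z + z') * ∏' p, (1 + sieveLocal s z z' p) := by
  have hs0 : s ≠ 0 := fun h => by simp [h] at hs; linarith
  have hsum : Summable fun n : ℕ => ‖(n : ℂ) ^ (-s) * (sieveProd z n * sieveProd z' n)‖ :=
    (summable_divisors_sq_rpow hs).of_nonneg_of_le (fun _ => norm_nonneg _)
      (norm_sieve_term_le hz hz' hs0)
  have hE := EulerProduct.eulerProduct_hasProd
    (f := fun n : ℕ => (n : ℂ) ^ (-s) * (sieveProd z n * sieveProd z' n))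
    (by simp [sieveProd_one]) (fun {m n} h => by
      simp only [sieveProd_mul h, Nat.cast_mul, Complex.natCast_mul_natCast_cpow]; ring)
    hsum (by simp [Complex.zero_cpow (neg_ne_zero.2 hs0)])
  simp only [tsum_sieve_prime_pow hs] at hE
  have h1 := riemannZeta_eulerProduct_hasProd (s := s + z) (by simp; linarith)
  have h2 := riemannZeta_eulerProduct_hasProd (s := s + z') (by simp; linarith)
  have h3 := riemannZeta_eulerProduct_hasProd hs
  have h4 := riemannZeta_eulerProduct_hasProd (s := s + z + z') (by simp; linarith)
  have hL := (hE.mul h1).mul h2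
  have hR := (h3.mul h4).mul (multipliable_sieveLocal hs.le hz hz').hasProd
  refine hL.unique ?_
  convert hR using 2 with p
  have hp : ((p : ℕ) : ℂ) ≠ 0 := by exact_mod_cast p.2.ne_zero
  have ha := norm_natCast_cpow_neg_le_one hz p p.2.ne_zero
  have hb := norm_natCast_cpow_neg_le_one hz' p p.2.ne_zero
  have hx := norm_prime_cpow_le_half hs.le p
  have e1 : ∀ w : ℂ, ((p : ℕ) : ℂ) ^ (-(s + w)) = ((p : ℕ) : ℂ) ^ (-s) * ((p : ℕ) : ℂ) ^ (-w) :=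
    fun w => by rw [neg_add, Complex.cpow_add _ _ hp]
  have e2 : ((p : ℕ) : ℂ) ^ (-(s + z + z')) =
      ((p : ℕ) : ℂ) ^ (-s) * (((p : ℕ) : ℂ) ^ (-z) * ((p : ℕ) : ℂ) ^ (-z')) := by
    rw [neg_add, neg_add, Complex.cpow_add _ _ hp, Complex.cpow_add _ _ hp, mul_assoc]
  have hne : ∀ a : ℂ, ‖a‖ ≤ 1 → 1 - ((p : ℕ) : ℂ) ^ (-s) * a ≠ 0 := fun a ha h => by
    have := half_le_norm_one_sub hx ha
    rw [h, norm_zero] at this; norm_num at this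
  refine Eq.trans ?_ ((localDev_identity ?_ (hne _ ha) (hne _ hb) (hne _ ?_)).trans ?_)
  · exact congrArg₂ (fun u v => _ * (1 - u)⁻¹ * (1 - v)⁻¹) (e1 z) (e1 z')
  rotate_left 2
  · exact congrArg (fun u => _ * (1 - u)⁻¹ * _) e2.symm
  · simpa using hne 1 (by simp)
  · rw [norm_mul]; exact mul_le_one₀ ha (norm_nonneg _) hb

theorem norm_tprod_sieveLocal_le {s z z' : ℂ} (hs : 1 ≤ s.re) (hz : 0 ≤ z.re) (hz' : 0 ≤ z'.re) :
    ‖∏' p, (1 + sieveLocal s z z' p)‖ ≤ Real.exp (∑' p : Nat.Primes, 16 / ((p : ℕ) : ℝ) ^ 2) := by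
  have h := (multipliable_sieveLocal hs hz hz').hasProd
  refine le_of_tendsto (Filter.Tendsto.norm (f := fun t : Finset Nat.Primes => ∏ p ∈ t, (1 + sieveLocal s z z' p)) h)
    (Eventually.of_forall fun t => ?_)
  calc ‖∏ p ∈ t, (1 + sieveLocal s z z' p)‖
      ≤ ∏ p ∈ t, Real.exp (16 / ((p : ℕ) : ℝ) ^ 2) := by
        refine (Finset.norm_prod_le _ _).trans
          (Finset.prod_le_prod (fun _ _ => norm_nonneg _) fun p _ => ?_)
        refine (norm_add_le _ _).trans ?_
        rw [norm_one, add_comm]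
        exact (add_le_add_left (norm_sieveLocal_le hs hz hz' p) 1).trans (Real.add_one_le_exp _)
    _ = Real.exp (∑ p ∈ t, 16 / ((p : ℕ) : ℝ) ^ 2) := (Real.exp_sum _ _).symm
    _ ≤ _ := Real.exp_le_exp.2
        (summable_sixteen_div_prime_sq.sum_le_tsum t fun _ _ => by positivity)

/-- The product over primes tends to `1` as `z → 0`, uniformly in the path of `s`. -/
theorem tendsto_tprod_sieveLocal {ι : Type*} {l : Filter ι} {s z z' : ι → ℂ}
    (hs : ∀ i, 1 ≤ (s i).re) (hz : ∀ i, 0 ≤ (z i).re) (hz' : ∀ i, 0 ≤ (z' i).re)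
    (hs1 : Tendsto s l (𝓝 1)) (hz0 : Tendsto z l (𝓝 0)) (hz0' : Tendsto z' l (𝓝 0)) :
    Tendsto (fun i => ∏' p, (1 + sieveLocal (s i) (z i) (z' i) p)) l (𝓝 1) := by
  have h := tendsto_tprod_one_add_of_dominated_convergence (𝓕 := l)
    (f := fun i p => sieveLocal (s i) (z i) (z' i) p) (g := fun _ => 0)
    summable_sixteen_div_prime_sq ?_
    (Eventually.of_forall fun i => norm_sieveLocal_le (hs i) (hz i) (hz' i))
  · simpa using h
  intro p
  have hp : ((p : ℕ) : ℂ) ≠ 0 := by exact_mod_cast p.2.ne_zero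
  have hc : ∀ {g : ι → ℂ} {w : ℂ}, Tendsto g l (𝓝 w) →
      Tendsto (fun i => ((p : ℕ) : ℂ) ^ (-(g i))) l (𝓝 (((p : ℕ) : ℂ) ^ (-w))) := fun hg =>
    hg.neg.const_cpow (Or.inl hp)
  have hx := hc hs1
  have ha := hc hz0
  have hb := hc hz0'
  simp only [neg_zero, Complex.cpow_zero] at ha hb
  have hx2 := norm_prime_cpow_le_half (s := 1) (by simp) p
  have hne : (1 - ((p : ℕ) : ℂ) ^ (-1 : ℂ) * 1) ≠ 0 := fun h => by
    have := half_le_norm_one_sub (a := 1) hx2 (by simp)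
    rw [h, norm_zero] at this; norm_num at this
  have hd := ((((hx.pow 2).mul (ha.mul hb)).mul ((ha.const_sub 1).mul (hb.const_sub 1))).div
    (((hx.mul ha).const_sub 1).mul ((hx.mul hb).const_sub 1)) (mul_ne_zero hne hne)).neg
  simpa [sieveLocal, localDev] using hd

/-- The point `1 - 2πiξ` on the line of real part `1`. -/
noncomputable def lineOne (ξ : ℝ) : ℂ := 1 - 2 * π * ξ * Complex.I

@[simp] theorem lineOne_re (ξ : ℝ) : (lineOne ξ).re = 1 := by simp [lineOne]

theorem continuous_lineOne : Continuous lineOne := by unfold lineOne; fun_prop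

theorem norm_lineOne_add_le {α : ℝ} (hα : 0 ≤ α) (ξ : ℝ) :
    ‖(α : ℂ) + lineOne ξ‖ ≤ (α + 7) * (1 + |ξ|) := by
  have h1 : ‖(α : ℂ) + lineOne ξ‖ ≤ α + 1 + 2 * π * |ξ| := by
    unfold lineOne
    calc ‖(α : ℂ) + (1 - 2 * π * ξ * Complex.I)‖ ≤ ‖(α : ℂ)‖ + (‖(1 : ℂ)‖ + ‖(2 * π * ξ * Complex.I : ℂ)‖) :=
          (norm_add_le _ _).trans (add_le_add_right (norm_sub_le _ _) _)
      _ = α + 1 + 2 * π * |ξ| := by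
          simp [abs_of_nonneg hα, abs_of_pos Real.pi_pos]; ring
  have := Real.pi_lt_d2
  nlinarith [abs_nonneg ξ, Real.pi_pos]

open scoped FourierTransform ContDiff in
/-- A smooth compactly supported function is a superposition of exponentials `e^{-wt}` on
`Re w = 1` with rapidly decreasing weight. -/
theorem exists_exp_superposition {F : ℝ → ℝ} (hF : ContDiff ℝ ∞ F) (hc : HasCompactSupport F) :
    ∃ g : ℝ → ℂ, Continuous g ∧ (∀ k : ℕ, MeasureTheory.Integrable fun ξ => |ξ| ^ k * ‖g ξ‖) ∧
      (∀ t, (F t : ℂ) = ∫ ξ, g ξ * Complex.exp (-(lineOne ξ) * t)) ∧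
      (∀ α t : ℝ, ((α * F t - deriv F t : ℝ) : ℂ) =
        ∫ ξ, g ξ * (α + lineOne ξ) * Complex.exp (-(lineOne ξ) * t)) := by
  set f : ℝ → ℂ := fun t => ((F t * Real.exp t : ℝ) : ℂ) with hf
  have hfs : ContDiff ℝ ∞ f := Complex.ofRealCLM.contDiff.comp (hF.mul Real.contDiff_exp)
  have hfc : HasCompactSupport f :=
    (hc.mul_right (f' := Real.exp)).comp_left (g := fun x : ℝ => (x : ℂ)) Complex.ofReal_zero
  set φ : SchwartzMap ℝ ℂ := hfc.toSchwartzMap hfs with hφ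
  obtain ⟨Fo, hFo⟩ : ∃ Fo : SchwartzMap ℝ ℂ → SchwartzMap ℝ ℂ, ∀ ψ, Fo ψ = 𝓕 ψ := ⟨_, fun _ => rfl⟩
  have hφf : (φ : ℝ → ℂ) = f := rfl
  have hinv : ∀ (ψ : SchwartzMap ℝ ℂ) (t : ℝ),
      ψ t = ∫ ξ : ℝ, Fo ψ ξ * Complex.exp (2 * π * ξ * Complex.I * t) := by
    intro ψ t
    have h := congrArg (fun η : SchwartzMap ℝ ℂ => η t) 
      (FourierTransform.fourierInv_fourier_eq ψ : 𝓕⁻ (𝓕 ψ : SchwartzMap ℝ ℂ) = ψ)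
    simp only [SchwartzMap.fourierInv_coe, ← hFo] at h
    rw [← h, Real.fourierInv_eq']
    refine MeasureTheory.integral_congr_ae (Eventually.of_forall fun ξ => ?_)
    simp only [RCLike.inner_apply, conj_trivial, smul_eq_mul]
    rw [mul_comm]; congr 2; push_cast; ring
  have hder : ∀ t, (SchwartzMap.derivCLM ℂ ℂ φ) t = (((deriv F t + F t) * Real.exp t : ℝ) : ℂ) := by
    intro t
    rw [SchwartzMap.derivCLM_apply, hφf]
    have h1 : HasDerivAt F (deriv F t) t :=
      ((hF.differentiable (by simp)) t).hasDerivAt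
    have h2 := (h1.mul (Real.hasDerivAt_exp t)).ofReal_comp
    rw [show f = fun t => (((F * Real.exp) t : ℝ) : ℂ) from rfl, h2.deriv]
    congr 1; ring
  have hfd : ∀ ξ : ℝ, Fo (SchwartzMap.derivCLM ℂ ℂ φ) ξ = (2 * π * Complex.I * ξ) * Fo φ ξ := by
    intro ξ
    have h := congrFun (Real.fourier_deriv (f := (φ : ℝ → ℂ)) φ.integrable φ.differentiable
      (SchwartzMap.derivCLM ℂ ℂ φ).integrable) ξ
    rw [hFo, hFo, SchwartzMap.fourier_coe, SchwartzMap.fourier_coe]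
    exact h
  have hexp : ∀ ξ t : ℝ, Complex.exp (-(lineOne ξ) * t) =
      (Real.exp (-t) : ℝ) * Complex.exp (2 * π * ξ * Complex.I * t) := by
    intro ξ t
    rw [Complex.ofReal_exp, ← Complex.exp_add]; congr 1; unfold lineOne; push_cast; ring
  have hee : ∀ t : ℝ, ((Real.exp t : ℝ) : ℂ) * ((Real.exp (-t) : ℝ) : ℂ) = 1 := by
    intro t
    rw [← Complex.ofReal_mul, ← Real.exp_add]; simp
  have hF1 : ∀ t, (F t : ℂ) = ∫ ξ : ℝ, Fo φ ξ * Complex.exp (-(lineOne ξ) * t) := by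
    intro t
    simp only [hexp]
    have := hinv φ t
    rw [hφf, hf] at this
    calc (F t : ℂ) = (F t * Real.exp t : ℝ) * ((Real.exp (-t) : ℝ) : ℂ) := by
          rw [Complex.ofReal_mul, mul_assoc, hee, mul_one]
      _ = ∫ ξ : ℝ, Fo φ ξ * Complex.exp (2 * π * ξ * Complex.I * t) * ((Real.exp (-t) : ℝ) : ℂ) := by
          rw [MeasureTheory.integral_mul_const, ← this]
      _ = _ := by
          refine MeasureTheory.integral_congr_ae (Eventually.of_forall fun ξ => ?_)
          simp only []; ring
  have hdec : ∀ (ψ : SchwartzMap ℝ ℂ) (k : ℕ), MeasureTheory.Integrable fun ξ => |ξ| ^ k * ‖ψ ξ‖ :=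
    fun ψ k => by simpa using ψ.integrable_pow_mul MeasureTheory.volume k
  have hosc : ∀ (ψ : SchwartzMap ℝ ℂ) (t : ℝ), MeasureTheory.Integrable fun ξ : ℝ =>
      ψ ξ * Complex.exp (2 * π * ξ * Complex.I * t) := by
    intro ψ t
    refine ψ.integrable.mul_bdd (c := 1) (by fun_prop) (Eventually.of_forall fun ξ => ?_)
    rw [Complex.norm_exp]; simp
  refine ⟨Fo φ, (Fo φ).continuous, hdec _, hF1, fun α t => ?_⟩
  have h1 := hinv φ t
  have h2 := hinv (SchwartzMap.derivCLM ℂ ℂ φ) t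
  have h3 : ∫ ξ : ℝ, Fo φ ξ * (α + lineOne ξ) * Complex.exp (-(lineOne ξ) * t) =
      ∫ ξ : ℝ, ((Real.exp (-t) : ℝ) : ℂ) * ((α + 1) * (Fo φ ξ * Complex.exp (2 * π * ξ * Complex.I * t))
        - Fo (SchwartzMap.derivCLM ℂ ℂ φ) ξ * Complex.exp (2 * π * ξ * Complex.I * t)) := by
    refine MeasureTheory.integral_congr_ae (Eventually.of_forall fun ξ => ?_)
    simp only [hexp, hfd]; unfold lineOne; ring
  rw [h3, MeasureTheory.integral_const_mul, MeasureTheory.integral_sub ((hosc _ t).const_mul _)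
    (hosc _ t), MeasureTheory.integral_const_mul, ← h1, ← h2, hder, hφf, hf]
  have hee' := hee t
  push_cast at hee' ⊢
  linear_combination (-(α + 1) * (F t : ℂ) + (((deriv F t : ℝ) : ℂ) + F t)) * hee'

theorem sieveProd_eq_sum (z : ℂ) {n : ℕ} (hn : n ≠ 0) :
    sieveProd z n = ∑ d ∈ n.divisors, (ArithmeticFunction.moebius d : ℂ) * (d : ℂ) ^ (-z) := by
  set r := ∏ p ∈ n.primeFactors, p with hr
  have hr0 : r ≠ 0 := Finset.prod_ne_zero_iff.2 fun p hp => (Nat.prime_of_mem_primeFactors hp).ne_zero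
  have hrn : r ∣ n := Nat.prod_primeFactors_dvd n
  have hrp : r.primeFactors = n.primeFactors := Nat.primeFactors_prod_primeFactors n
  have hrs : Squarefree r := by
    refine Finset.squarefree_prod_of_pairwise_isCoprime (fun p hp q hq hpq => ?_)
      fun p hp => (Nat.prime_of_mem_primeFactors hp).squarefree
    exact Nat.coprime_iff_isRelPrime.1 ((Nat.coprime_primes (Nat.prime_of_mem_primeFactors hp)
      (Nat.prime_of_mem_primeFactors hq)).2 hpq)
  let f : ArithmeticFunction ℂ := ⟨fun d => if d = 0 then 0 else (d : ℂ) ^ (-z), by simp⟩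
  have hf : f.IsMultiplicative := by
    rw [ArithmeticFunction.IsMultiplicative.iff_ne_zero]
    refine ⟨by simp [f], fun {a b} ha hb _ => ?_⟩
    simp [f, ha, hb, Complex.natCast_mul_natCast_cpow]
  have h1 := ArithmeticFunction.IsMultiplicative.prodPrimeFactors_one_sub_of_squarefree f hf hrs
  rw [hrp] at h1
  have h2 : sieveProd z n = ∏ p ∈ n.primeFactors, (1 - f p) := by
    refine Finset.prod_congr rfl fun p hp => ?_
    simp [f, (Nat.prime_of_mem_primeFactors hp).ne_zero]
  rw [h2, h1]
  refine (Finset.sum_subset (Nat.divisors_subset_of_dvd hn hrn) fun d hd hdr => ?_).trans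
    (sum_congr rfl fun d hd => ?_)
  · have hd0 := (Nat.pos_of_mem_divisors hd).ne'
    have : ¬ Squarefree d := fun hsq => hdr <| Nat.mem_divisors.2 ⟨by
      rw [← Nat.prod_primeFactors_of_squarefree hsq]
      exact Finset.prod_dvd_prod_of_subset _ _ _
        (Nat.primeFactors_mono (Nat.dvd_of_mem_divisors hd) hn), hr0⟩
    simp [ArithmeticFunction.moebius_eq_zero_of_not_squarefree this]
  · simp [f, (Nat.pos_of_mem_divisors hd).ne']

theorem norm_riemannZeta_le {σ : ℝ} (hσ : 1 < σ) {s : ℂ} (hs : s.re = σ) :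
    ‖riemannZeta s‖ ≤ ‖riemannZeta σ‖ := by
  rw [zeta_eq_tsum_one_div_nat_cpow (by rw [hs]; exact hσ),
    zeta_eq_tsum_one_div_nat_cpow (s := σ) (by simpa using hσ)]
  have h1 : ∀ n : ℕ, (1 / (n : ℂ) ^ (σ : ℂ)) = ((1 / (n : ℝ) ^ σ : ℝ) : ℂ) := fun n => by
    push_cast
    rw [Complex.ofReal_cpow (by positivity)]; simp
  have h2 : Summable fun n : ℕ => 1 / (n : ℝ) ^ σ := Real.summable_one_div_nat_rpow.2 hσ
  simp only [h1, ← Complex.ofReal_tsum]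
  rw [Complex.norm_of_nonneg (tsum_nonneg fun n => by positivity)]
  refine tsum_of_norm_bounded h2.hasSum fun n => ?_
  rcases eq_or_ne n 0 with rfl | hn
  · have : s ≠ 0 := fun h => by simp [h] at hs; linarith
    simp [Complex.zero_cpow this]; positivity
  rw [norm_div, norm_one, Complex.norm_natCast_cpow_of_pos (Nat.pos_of_ne_zero hn), hs]

theorem riemannZeta_eq_zetaOne_div {h : ℂ} (hh : h ≠ 0) : riemannZeta (1 + h) = zetaOne (1 + h) / h := by
  rw [zetaOne_of_ne (by simpa using hh)]
  field_simp
  ring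

theorem exists_zeta_bound (A : ℝ) : ∃ C, 0 < C ∧ ∀ h : ℂ, 0 < h.re → h.re ≤ A →
    ‖riemannZeta (1 + h)‖ ≤ C / h.re := by
  obtain ⟨C, hC⟩ := (isCompact_Icc (a := (0 : ℝ)) (b := A)).exists_bound_of_continuousOn
    (f := fun t : ℝ => zetaOne (1 + t))
    (differentiable_zetaOne.continuous.comp (by fun_prop)).continuousOn
  refine ⟨max C 1, by positivity, fun h h0 hA' => ?_⟩
  have h1 : ‖riemannZeta (1 + h)‖ ≤ ‖riemannZeta ((1 + h.re : ℝ) : ℂ)‖ :=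
    norm_riemannZeta_le (by linarith) (by simp)
  refine h1.trans ?_
  push_cast
  rw [riemannZeta_eq_zetaOne_div (by exact_mod_cast h0.ne'), norm_div, Complex.norm_real,
    Real.norm_of_nonneg h0.le]
  gcongr
  exact (hC _ ⟨h0.le, hA'⟩).trans (le_max_left _ _)

theorem exists_inv_zeta_bound {α : ℝ} (hα : 0 ≤ α) : ∃ C, 0 < C ∧ ∀ L : ℝ, 1 ≤ L → ∀ ξ : ℝ,
    ‖(riemannZeta (1 + (α + lineOne ξ) / L))⁻¹‖ ≤ C * (1 + |ξ|) ^ 2 / L := by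
  obtain ⟨C₁, hC₁, h₁⟩ := exists_zeta_bound (α + 1)
  have hcpt : IsCompact (closedBall (1 : ℂ) (2 * (α + 7)) ∩ {s | 1 ≤ s.re}) :=
    (isCompact_closedBall _ _).inter_right (isClosed_le continuous_const Complex.continuous_re)
  obtain ⟨C₂, hC₂⟩ := hcpt.exists_bound_of_continuousOn (f := fun s => (zetaOne s)⁻¹)
    (differentiable_zetaOne.continuous.continuousOn.inv₀ fun s hs => zetaOne_ne_zero hs.2)
  refine ⟨max C₁ (C₂ * (α + 7)), lt_max_of_lt_left hC₁, fun L hL ξ => ?_⟩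
  have hL0 : (0 : ℝ) < L := by linarith
  have hre : ((α + lineOne ξ) / L : ℂ).re = (α + 1) / L := by
    rw [Complex.div_ofReal_re]; simp
  have hpos : 0 < (α + 1) / L := by positivity
  rcases le_or_gt |ξ| L with hξ | hξ
  · have hn : ‖((α + lineOne ξ) / L : ℂ)‖ ≤ (α + 7) * (1 + |ξ|) / L := by
      rw [norm_div, Complex.norm_real, Real.norm_of_nonneg hL0.le]
      gcongr
      exact norm_lineOne_add_le hα ξ
    have hne : ((α + lineOne ξ) / L : ℂ) ≠ 0 := fun h => by
      rw [h] at hre; simp at hre; linarith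
    have hC₂' := hC₂ (1 + (α + lineOne ξ) / L) ⟨by
      rw [mem_closedBall, dist_eq_norm, add_sub_cancel_left]
      refine hn.trans ?_
      rw [div_le_iff₀ hL0]; nlinarith [abs_nonneg ξ], by
      rw [Set.mem_ofPred_eq, Complex.add_re, Complex.one_re, hre]; linarith⟩
    rw [riemannZeta_eq_zetaOne_div hne, inv_div, div_eq_mul_inv, norm_mul]
    have hC₂0 : 0 ≤ C₂ := (norm_nonneg _).trans hC₂'
    calc _ ≤ (α + 7) * (1 + |ξ|) / L * C₂ := mul_le_mul hn hC₂' (norm_nonneg _) (by positivity)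
      _ = C₂ * (α + 7) * (1 + |ξ|) / L := by ring
      _ ≤ max C₁ (C₂ * (α + 7)) * (1 + |ξ|) ^ 2 / L := by
        gcongr
        · exact le_max_right _ _
        · nlinarith [abs_nonneg ξ]
  · have h2 := norm_inv_LFunction_le (1 : DirichletCharacter ℂ 1) (σ := 1 + (α + 1) / L)
      (by linarith) (s := 1 + (α + lineOne ξ) / L)
      (by rw [Complex.add_re, Complex.one_re, hre])
    rw [DirichletCharacter.LFunction_modOne_eq] at h2
    refine h2.trans ?_
    have h3 := h₁ (((α + 1) / L : ℝ) : ℂ) (by simpa using hpos)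
      (by rw [Complex.ofReal_re]; exact div_le_self (by linarith) hL)
    rw [Complex.ofReal_re] at h3
    refine (le_trans (by push_cast; exact le_rfl) h3).trans ?_
    rw [div_div_eq_mul_div, div_le_div_iff₀ (by linarith) hL0]
    have h4 : L * L ≤ (1 + |ξ|) ^ 2 := by nlinarith
    calc C₁ * L * L = C₁ * (L * L) * 1 := by ring
      _ ≤ max C₁ (C₂ * (α + 7)) * (1 + |ξ|) ^ 2 * (α + 1) := by
        gcongr
        · exact le_max_left _ _
        · linarith

theorem tendsto_zeta_div {h : ℂ} (hh : h ≠ 0) :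
    Tendsto (fun L : ℝ => riemannZeta (1 + h / L) / L) atTop (𝓝 h⁻¹) := by
  have h1 : Tendsto (fun L : ℝ => zetaOne (1 + h / L) / h) atTop (𝓝 (zetaOne 1 / h)) := by
    have h0 : Tendsto (fun L : ℝ => h / (L : ℂ)) atTop (𝓝 0) := by
      rw [tendsto_zero_iff_norm_tendsto_zero]
      simp only [norm_div, Complex.norm_real]
      exact tendsto_const_nhds.div_atTop tendsto_norm_atTop_atTop
    have := (differentiable_zetaOne.continuous.tendsto (1 + 0)).comp (h0.const_add 1)
    rw [add_zero] at this
    exact this.div_const h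
  rw [zetaOne_one, one_div] at h1
  refine h1.congr' ?_
  filter_upwards [eventually_gt_atTop 0] with L hL
  have hL' : (L : ℂ) ≠ 0 := by exact_mod_cast hL.ne'
  rw [riemannZeta_eq_zetaOne_div (div_ne_zero hh hL')]
  field_simp

end LFZ

namespace LFZ
open Finset Filter Topology Metric Real MeasureTheory

/-- The sieve weight `∑_{d ∣ n} μ(d) F(log d / L)`. -/
noncomputable def sieveWt (F : ℝ → ℝ) (L : ℝ) (n : ℕ) : ℝ :=
  ∑ d ∈ n.divisors, (ArithmeticFunction.moebius d : ℝ) * F (Real.log d / L)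

theorem natCast_cpow_neg_div (d : ℕ) (hd : d ≠ 0) (w : ℂ) (L : ℝ) :
    (d : ℂ) ^ (-(w / L)) = Complex.exp (-w * ((Real.log d / L : ℝ) : ℂ)) := by
  rw [Complex.cpow_def_of_ne_zero (by exact_mod_cast hd), ← Complex.natCast_log]
  congr 1; push_cast; ring

theorem continuous_sieveProd_lineOne (L : ℝ) (n : ℕ) :
    Continuous fun ξ => sieveProd (lineOne ξ / L) n := by
  unfold sieveProd
  refine continuous_finsetProd _ fun p hp => continuous_const.sub ?_
  have : ∀ ξ, (p : ℂ) ^ (-(lineOne ξ / L)) = Complex.exp (-(lineOne ξ) * ((Real.log p / L : ℝ) : ℂ)) :=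
    fun ξ => natCast_cpow_neg_div p (Nat.prime_of_mem_primeFactors hp).ne_zero _ _
  simp only [this]
  exact Complex.continuous_exp.comp (continuous_lineOne.neg.mul continuous_const)

theorem lineOne_div_re_nonneg {L : ℝ} (hL : 0 < L) (ξ : ℝ) : 0 ≤ (lineOne ξ / L : ℂ).re := by
  rw [Complex.div_ofReal_re, lineOne_re]; positivity

theorem integrable_mul_sieveProd {g : ℝ → ℂ} (hgi : Integrable g) {L : ℝ}
    (hL : 0 < L) {n : ℕ} (hn : n ≠ 0) : Integrable fun ξ => g ξ * sieveProd (lineOne ξ / L) n := by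
  refine hgi.mul_bdd (c := n.divisors.card) (continuous_sieveProd_lineOne L n).aestronglyMeasurable
    (Eventually.of_forall fun ξ => norm_sieveProd_le (lineOne_div_re_nonneg hL ξ) hn)

theorem sieveWt_eq_integral {F : ℝ → ℝ} {g : ℝ → ℂ} (hgi : Integrable g)
    (hF : ∀ t, (F t : ℂ) = ∫ ξ, g ξ * Complex.exp (-(lineOne ξ) * t)) {L : ℝ} (hL : 0 < L)
    {n : ℕ} (hn : n ≠ 0) :
    (sieveWt F L n : ℂ) = ∫ ξ, g ξ * sieveProd (lineOne ξ / L) n := by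
  simp only [sieveProd_eq_sum _ hn, mul_sum]
  rw [integral_finsetSum]
  · unfold sieveWt
    push_cast
    refine sum_congr rfl fun d hd => ?_
    have hd0 := (Nat.pos_of_mem_divisors hd).ne'
    rw [show ((F (Real.log d / L) : ℝ) : ℂ) = _ from hF _, ← integral_const_mul]
    refine integral_congr_ae (Eventually.of_forall fun ξ => ?_)
    simp only [natCast_cpow_neg_div d hd0]
    push_cast; ring
  · intro d hd
    have hd0 := (Nat.pos_of_mem_divisors hd).ne'
    simp only [natCast_cpow_neg_div d hd0]
    refine hgi.mul_bdd (c := ‖(ArithmeticFunction.moebius d : ℂ)‖)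
      (continuous_const.mul (Complex.continuous_exp.comp
        (continuous_lineOne.neg.mul continuous_const))).aestronglyMeasurable
      (Eventually.of_forall fun ξ => ?_)
    rw [norm_mul, ← natCast_cpow_neg_div d hd0]
    exact mul_le_of_le_one_right (norm_nonneg _)
      (norm_natCast_cpow_neg_le_one (lineOne_div_re_nonneg hL ξ) d hd0)

theorem continuous_sieveSeries {s : ℂ} (hs : 1 < s.re) {L : ℝ} (hL : 0 < L) :
    Continuous fun p : ℝ × ℝ => sieveSeries s (lineOne p.1 / L) (lineOne p.2 / L) := by
  have hs0 : s ≠ 0 := fun h => by simp [h] at hs; linarith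
  refine continuous_tsum (fun n => ?_) (summable_divisors_sq_rpow hs) fun n p =>
    norm_sieve_term_le (lineOne_div_re_nonneg hL _) (lineOne_div_re_nonneg hL _) hs0 n
  exact continuous_const.mul (((continuous_sieveProd_lineOne L n).comp continuous_fst).mul
    ((continuous_sieveProd_lineOne L n).comp continuous_snd))

theorem hasSum_sieveWt_sq {F : ℝ → ℝ} {g : ℝ → ℂ} (hgi : Integrable g)
    (hF : ∀ t, (F t : ℂ) = ∫ ξ, g ξ * Complex.exp (-(lineOne ξ) * t)) {L : ℝ} (hL : 0 < L)
    {σ : ℝ} (hσ : 1 < σ) :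
    HasSum (fun n : ℕ => ((sieveWt F L n ^ 2 * (n : ℝ) ^ (-σ) : ℝ) : ℂ))
      (∫ p : ℝ × ℝ, g p.1 * g p.2 * sieveSeries σ (lineOne p.1 / L) (lineOne p.2 / L)) := by
  have hσ0 : (σ : ℂ) ≠ 0 := by exact_mod_cast (by linarith : σ ≠ 0)
  set G : ℕ → ℝ → ℂ := fun n ξ => g ξ * sieveProd (lineOne ξ / L) n with hG
  have hGi : ∀ n, n ≠ 0 → Integrable (G n) := fun n hn => integrable_mul_sieveProd hgi hL hn
  have hcast : ∀ n : ℕ, n ≠ 0 → (n : ℂ) ^ (-(σ : ℂ)) = (((n : ℝ) ^ (-σ) : ℝ) : ℂ) := fun n hn => by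
    rw [Complex.ofReal_cpow (by positivity)]; simp
  have hterm : ∀ (n : ℕ) (p : ℝ × ℝ), g p.1 * g p.2 * ((n : ℂ) ^ (-(σ : ℂ)) *
      (sieveProd (lineOne p.1 / L) n * sieveProd (lineOne p.2 / L) n)) =
      (n : ℂ) ^ (-(σ : ℂ)) * (G n p.1 * G n p.2) := fun n p => by simp only [hG]; ring
  have hint : ∀ n : ℕ, Integrable fun p : ℝ × ℝ => g p.1 * g p.2 * ((n : ℂ) ^ (-(σ : ℂ)) *
      (sieveProd (lineOne p.1 / L) n * sieveProd (lineOne p.2 / L) n)) := by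
    intro n
    simp only [hterm]
    rcases eq_or_ne n 0 with rfl | hn
    · simp [Complex.zero_cpow (neg_ne_zero.2 hσ0)]
    · exact ((hGi n hn).mul_prod (hGi n hn)).const_mul _
  have hnorm : ∀ n : ℕ, ∫ p : ℝ × ℝ, ‖g p.1 * g p.2 * ((n : ℂ) ^ (-(σ : ℂ)) *
      (sieveProd (lineOne p.1 / L) n * sieveProd (lineOne p.2 / L) n))‖ ≤
      (∫ ξ, ‖g ξ‖) ^ 2 * ((n.divisors.card : ℝ) ^ 2 * (n : ℝ) ^ (-σ)) := by
    intro n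
    calc _ ≤ ∫ p : ℝ × ℝ, ‖g p.1‖ * ‖g p.2‖ * ((n.divisors.card : ℝ) ^ 2 * (n : ℝ) ^ (-σ)) := by
          refine integral_mono (hint n).norm ((hgi.norm.mul_prod hgi.norm).mul_const _) fun p => ?_
          simp only [norm_mul (g p.1 * g p.2), norm_mul (g p.1)]
          gcongr
          simpa using norm_sieve_term_le (s := σ) (lineOne_div_re_nonneg hL p.1)
            (lineOne_div_re_nonneg hL p.2) hσ0 n
      _ = _ := by
          rw [integral_mul_const, sq]
          congr 1
          rw [Measure.volume_eq_prod]
          exact (integral_prod_mul (fun ξ => ‖g ξ‖) (fun ξ => ‖g ξ‖)).trans (by ring)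
  have h := hasSum_integral_of_summable_integral_norm hint
    (Summable.of_nonneg_of_le (fun n => integral_nonneg fun _ => norm_nonneg _) hnorm
      ((summable_divisors_sq_rpow hσ).mul_left _))
  have e1 : ∀ p : ℝ × ℝ, ∑' n : ℕ, g p.1 * g p.2 * ((n : ℂ) ^ (-(σ : ℂ)) *
      (sieveProd (lineOne p.1 / L) n * sieveProd (lineOne p.2 / L) n)) =
      g p.1 * g p.2 * sieveSeries σ (lineOne p.1 / L) (lineOne p.2 / L) := fun p => tsum_mul_left
  simp only [e1] at h
  have e2 : (fun n : ℕ => ((sieveWt F L n ^ 2 * (n : ℝ) ^ (-σ) : ℝ) : ℂ)) = fun n : ℕ =>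
      ∫ p : ℝ × ℝ, g p.1 * g p.2 * ((n : ℂ) ^ (-(σ : ℂ)) *
        (sieveProd (lineOne p.1 / L) n * sieveProd (lineOne p.2 / L) n)) := by
    funext n
    rcases eq_or_ne n 0 with rfl | hn
    · simp [Complex.zero_cpow (neg_ne_zero.2 hσ0),
        Real.zero_rpow (neg_ne_zero.2 (by linarith : σ ≠ 0))]
    · simp only [hterm]
      rw [integral_const_mul, Measure.volume_eq_prod, integral_prod_mul (G n) (G n), hcast n hn,
        ← sieveWt_eq_integral hgi hF hL hn]
      push_cast; ring
  rw [e2]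
  exact h

theorem sieveSeries_lineOne_eq {α : ℝ} (hα : 0 < α) {L : ℝ} (hL : 0 < L) (ξ ξ' : ℝ) :
    sieveSeries ((1 + α / L : ℝ) : ℂ) (lineOne ξ / L) (lineOne ξ' / L) =
      riemannZeta ((1 + α / L : ℝ) : ℂ) * riemannZeta (1 + (α + lineOne ξ + lineOne ξ') / L) *
        (∏' p, (1 + sieveLocal ((1 + α / L : ℝ) : ℂ) (lineOne ξ / L) (lineOne ξ' / L) p)) *
        (riemannZeta (1 + (α + lineOne ξ) / L))⁻¹ * (riemannZeta (1 + (α + lineOne ξ') / L))⁻¹ := by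
  have hs : 1 < (((1 + α / L : ℝ) : ℂ)).re := by
    rw [Complex.ofReal_re]; linarith [div_pos hα hL]
  have hLc : (L : ℂ) ≠ 0 := by exact_mod_cast hL.ne'
  have hne : ∀ ξ, riemannZeta (1 + (α + lineOne ξ) / L) ≠ 0 := fun ξ =>
    riemannZeta_ne_zero_of_one_le_re (by
      rw [Complex.add_re, Complex.one_re, Complex.div_ofReal_re, Complex.add_re, lineOne_re,
        Complex.ofReal_re]
      have : 0 ≤ (α + 1) / L := by positivity
      linarith)
  have heq := sieveSeries_mul_eq hs (lineOne_div_re_nonneg hL ξ) (lineOne_div_re_nonneg hL ξ')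
  have hre : ∀ ξ, (((1 + α / L : ℝ) : ℂ) + lineOne ξ / L) = 1 + (α + lineOne ξ) / L := fun ξ => by
    push_cast; ring
  have hre2 : (((1 + α / L : ℝ) : ℂ) + lineOne ξ / L + lineOne ξ' / L) =
      1 + (α + lineOne ξ + lineOne ξ') / L := by push_cast; ring
  rw [hre2, hre, hre] at heq
  have n1 := hne ξ
  have n2 := hne ξ'
  rw [← heq]
  generalize riemannZeta (1 + (α + lineOne ξ) / L) = x at n1 ⊢
  generalize riemannZeta (1 + (α + lineOne ξ') / L) = y at n2 ⊢
  generalize sieveSeries _ _ _ = w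
  field_simp

theorem norm_sieveSeries_le {α : ℝ} (hα : 0 < α) : ∃ C, 0 < C ∧ ∀ L : ℝ, 1 ≤ L → ∀ ξ ξ' : ℝ,
    ‖sieveSeries ((1 + α / L : ℝ) : ℂ) (lineOne ξ / L) (lineOne ξ' / L)‖ ≤
      C * (1 + |ξ|) ^ 2 * (1 + |ξ'|) ^ 2 := by
  obtain ⟨C₁, hC₁, h₁⟩ := exists_zeta_bound (α + 2)
  obtain ⟨C₂, hC₂, h₂⟩ := exists_inv_zeta_bound hα.le
  set E := Real.exp (∑' p : Nat.Primes, 16 / ((p : ℕ) : ℝ) ^ 2)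
  have hE : 0 < E := Real.exp_pos _
  refine ⟨(C₁ / α) * (C₁ / (α + 2)) * E * C₂ * C₂, by positivity, fun L hL ξ ξ' => ?_⟩
  have hL0 : 0 < L := by linarith
  have hs : 1 < (((1 + α / L : ℝ) : ℂ)).re := by
    rw [Complex.ofReal_re]; linarith [div_pos hα hL0]
  have hLc : (L : ℂ) ≠ 0 := by exact_mod_cast hL0.ne'
  have hz := lineOne_div_re_nonneg hL0 ξ
  have hz' := lineOne_div_re_nonneg hL0 ξ'
  rw [sieveSeries_lineOne_eq hα hL0]
  simp only [norm_mul]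
  have a1 : ‖riemannZeta ((1 + α / L : ℝ) : ℂ)‖ ≤ C₁ / α * L := by
    have h := h₁ ((α / L : ℝ) : ℂ) (by rw [Complex.ofReal_re]; positivity) (by
      rw [Complex.ofReal_re]; linarith [div_le_self hα.le hL])
    rw [Complex.ofReal_re] at h
    calc _ = ‖riemannZeta (1 + ((α / L : ℝ) : ℂ))‖ := by push_cast; rfl
      _ ≤ _ := h
      _ = _ := by field_simp
  have a2 : ‖riemannZeta (1 + (α + lineOne ξ + lineOne ξ') / L)‖ ≤ C₁ / (α + 2) * L := by
    have hr : ((α + lineOne ξ + lineOne ξ') / L : ℂ).re = (α + 2) / L := by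
      rw [Complex.div_ofReal_re, Complex.add_re, Complex.add_re, lineOne_re, lineOne_re,
        Complex.ofReal_re]; ring
    have h := h₁ ((α + lineOne ξ + lineOne ξ') / L) (by rw [hr]; positivity) (by
      rw [hr]; exact div_le_self (by positivity) hL)
    rw [hr] at h
    refine h.trans (le_of_eq (by field_simp))
  calc _ ≤ (C₁ / α * L) * (C₁ / (α + 2) * L) * E * (C₂ * (1 + |ξ|) ^ 2 / L) *
        (C₂ * (1 + |ξ'|) ^ 2 / L) := by
        have a3 := norm_tprod_sieveLocal_le hs.le hz hz'
        have a4 := h₂ L hL ξ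
        have a5 := h₂ L hL ξ'
        gcongr
    _ = _ := by field_simp

theorem tendsto_sieveSeries {α : ℝ} (hα : 0 < α) (ξ ξ' : ℝ) :
    Tendsto (fun L : ℝ => sieveSeries ((1 + α / L : ℝ) : ℂ) (lineOne ξ / L) (lineOne ξ' / L)) atTop
      (𝓝 ((α + lineOne ξ) * (α + lineOne ξ') / (α * (α + lineOne ξ + lineOne ξ')))) := by
  have hn1 : ∀ ξ, (α : ℂ) + lineOne ξ ≠ 0 := fun ξ h => by
    have := congrArg Complex.re h
    simp at this; linarith
  have hn2 : (α : ℂ) + lineOne ξ + lineOne ξ' ≠ 0 := fun h => by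
    have := congrArg Complex.re h
    simp at this; linarith
  have hα' : (α : ℂ) ≠ 0 := by exact_mod_cast hα.ne'
  have t1 := tendsto_zeta_div hα'
  have t2 := tendsto_zeta_div hn2
  have t3 := (tendsto_zeta_div (hn1 ξ)).inv₀ (inv_ne_zero (hn1 ξ))
  have t4 := (tendsto_zeta_div (hn1 ξ')).inv₀ (inv_ne_zero (hn1 ξ'))
  have hz : ∀ w : ℂ, Tendsto (fun L : ℝ => w / ((max L 1 : ℝ) : ℂ)) atTop (𝓝 0) := fun w => by
    rw [tendsto_zero_iff_norm_tendsto_zero]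
    simp only [norm_div, Complex.norm_real]
    exact tendsto_const_nhds.div_atTop (tendsto_norm_atTop_atTop.comp
      (tendsto_atTop_mono (fun L => le_max_left L 1) tendsto_id))
  have hpos : ∀ L : ℝ, 0 < max L 1 := fun L => by positivity
  have t5 : Tendsto (fun L : ℝ => ∏' p, (1 + sieveLocal ((1 + α / (max L 1) : ℝ) : ℂ)
      (lineOne ξ / ((max L 1 : ℝ) : ℂ)) (lineOne ξ' / ((max L 1 : ℝ) : ℂ)) p)) atTop (𝓝 1) := by
    refine tendsto_tprod_sieveLocal (fun L => ?_) (fun L => lineOne_div_re_nonneg (hpos L) _)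
      (fun L => lineOne_div_re_nonneg (hpos L) _) ?_ (hz _) (hz _)
    · rw [Complex.ofReal_re]; linarith [div_pos hα (hpos L)]
    · have := (hz α).const_add 1
      rw [add_zero] at this
      refine this.congr fun L => by push_cast; rfl
  have h := (((t1.mul t2).mul t5).mul t3).mul t4
  simp only [inv_inv, mul_one] at h
  rw [show (α : ℂ)⁻¹ * (α + lineOne ξ + lineOne ξ')⁻¹ * (α + lineOne ξ) * (α + lineOne ξ') =
    (α + lineOne ξ) * (α + lineOne ξ') / (α * (α + lineOne ξ + lineOne ξ')) by field_simp] at h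
  refine h.congr' ?_
  filter_upwards [eventually_ge_atTop 1] with L hL
  have hL0 : 0 < L := by linarith
  have hLc : (L : ℂ) ≠ 0 := by exact_mod_cast hL0.ne'
  rw [max_eq_left hL, sieveSeries_lineOne_eq hα hL0,
    show (1 + (α : ℂ) / L) = ((1 + α / L : ℝ) : ℂ) by push_cast; rfl]
  have alg : ∀ a b c d e : ℂ, a / L * (b / L) * c * (d / L)⁻¹ * (e / L)⁻¹ =
      a * b * c * d⁻¹ * e⁻¹ := fun a b c d e => by
    simp only [div_eq_mul_inv, mul_inv, inv_inv]
    field_simp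
  exact alg _ _ _ _ _

theorem tendsto_tsum_sieveWt_sq {F : ℝ → ℝ} {g : ℝ → ℂ} (hg : Continuous g)
    (hgi : ∀ k : ℕ, Integrable fun ξ => |ξ| ^ k * ‖g ξ‖)
    (hF : ∀ t, (F t : ℂ) = ∫ ξ, g ξ * Complex.exp (-(lineOne ξ) * t)) {α : ℝ} (hα : 0 < α) :
    Tendsto (fun L : ℝ => ((∑' n : ℕ, sieveWt F L n ^ 2 * (n : ℝ) ^ (-(1 + α / L)) : ℝ) : ℂ)) atTop
      (𝓝 (∫ p : ℝ × ℝ, g p.1 * g p.2 * ((α + lineOne p.1) * (α + lineOne p.2) /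
        (α * (α + lineOne p.1 + lineOne p.2))))) := by
  have hgi0 : Integrable g :=
    (integrable_norm_iff hg.aestronglyMeasurable).1 (by simpa using hgi 0)
  have hgi2 : Integrable fun ξ => (1 + |ξ|) ^ 2 * ‖g ξ‖ := by
    refine ((hgi 0).add (((hgi 1).const_mul 2).add (hgi 2))).congr (Eventually.of_forall fun ξ => ?_)
    simp only [Pi.add_apply]; ring
  obtain ⟨C, hC, hbd⟩ := norm_sieveSeries_le hα
  have key : Tendsto (fun L : ℝ => ∫ p : ℝ × ℝ, g p.1 * g p.2 *
      sieveSeries ((1 + α / L : ℝ) : ℂ) (lineOne p.1 / L) (lineOne p.2 / L)) atTop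
      (𝓝 (∫ p : ℝ × ℝ, g p.1 * g p.2 * ((α + lineOne p.1) * (α + lineOne p.2) /
        (α * (α + lineOne p.1 + lineOne p.2))))) := by
    refine tendsto_integral_filter_of_dominated_convergence
      (fun p : ℝ × ℝ => C * (((1 + |p.1|) ^ 2 * ‖g p.1‖) * ((1 + |p.2|) ^ 2 * ‖g p.2‖))) ?_ ?_
      ((hgi2.mul_prod hgi2).const_mul C) (Eventually.of_forall fun p =>
        (tendsto_sieveSeries hα p.1 p.2).const_mul _)
    · filter_upwards [eventually_gt_atTop 0] with L hL
      have hs : 1 < (((1 + α / L : ℝ) : ℂ)).re := by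
        rw [Complex.ofReal_re]; linarith [div_pos hα hL]
      have hc : Continuous fun p : ℝ × ℝ => g p.1 * g p.2 :=
        (hg.comp continuous_fst).mul (hg.comp continuous_snd)
      have hc' := hc.mul (continuous_sieveSeries hs hL)
      exact hc'.aestronglyMeasurable
    · filter_upwards [eventually_ge_atTop 1] with L hL
      refine Eventually.of_forall fun p => ?_
      rw [norm_mul, norm_mul]
      calc _ ≤ ‖g p.1‖ * ‖g p.2‖ * (C * (1 + |p.1|) ^ 2 * (1 + |p.2|) ^ 2) := by
            gcongr; exact hbd L hL _ _
        _ = _ := by ring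
  refine key.congr' ?_
  filter_upwards [eventually_gt_atTop 0] with L hL
  have h := hasSum_sieveWt_sq hgi0 hF hL (σ := 1 + α / L) (by linarith [div_pos hα hL])
  rw [← h.tsum_eq, Complex.ofReal_tsum]

end LFZ

namespace LFZ
open Finset Filter Topology Metric Real MeasureTheory
open scoped ContDiff

theorem integral_lineOne_pair {G : ℝ → ℂ} (hG : Continuous G) (hGi : Integrable G) {α : ℝ}
    (hα : 0 < α) :
    ∫ p : ℝ × ℝ, G p.1 * G p.2 * (α + lineOne p.1 + lineOne p.2)⁻¹ =
      ∫ t in Set.Ioi (0 : ℝ), Complex.exp (-α * t) *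
        (∫ ξ, G ξ * Complex.exp (-(lineOne ξ) * t)) ^ 2 := by
  have hre : ∀ p : ℝ × ℝ, (-((α : ℂ) + lineOne p.1 + lineOne p.2)).re = -(α + 2) := fun p => by
    simp only [Complex.neg_re, Complex.add_re, lineOne_re, Complex.ofReal_re]; ring
  have hin : ∀ p : ℝ × ℝ, ((α : ℂ) + lineOne p.1 + lineOne p.2)⁻¹ =
      ∫ t in Set.Ioi (0 : ℝ), Complex.exp (-(α + lineOne p.1 + lineOne p.2) * t) := fun p => by
    rw [integral_exp_mul_complex_Ioi (by rw [hre]; linarith)]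
    rw [Complex.ofReal_zero, mul_zero, Complex.exp_zero, ← one_div, div_neg, neg_div, neg_neg]
  simp only [hin, ← integral_const_mul]
  rw [integral_integral_swap]
  · refine integral_congr_ae (Eventually.of_forall fun t => ?_)
    simp only
    rw [sq, ← integral_prod_mul, ← Measure.volume_eq_prod, ← integral_const_mul]
    refine integral_congr_ae (Eventually.of_forall fun p => ?_)
    simp only
    have : Complex.exp (-(α + lineOne p.1 + lineOne p.2) * t) = Complex.exp (-α * t) *
        (Complex.exp (-(lineOne p.1) * t) * Complex.exp (-(lineOne p.2) * t)) := by
      rw [← Complex.exp_add, ← Complex.exp_add]; congr 1; ring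
    rw [this]; ring
  · have hexp : IntegrableOn (fun t : ℝ => Real.exp (-(α + 2) * t)) (Set.Ioi 0) :=
      integrableOn_exp_mul_Ioi (by linarith) 0
    have hGG : Integrable fun p : ℝ × ℝ => ‖G p.1‖ * ‖G p.2‖ := hGi.norm.mul_prod hGi.norm
    refine (hGG.mul_prod hexp).mono' ?_ (Eventually.of_forall fun z => ?_)
    · have hl1 : Continuous fun z : (ℝ × ℝ) × ℝ => lineOne z.1.1 :=
        continuous_lineOne.comp (continuous_fst.comp continuous_fst)
      have hl2 : Continuous fun z : (ℝ × ℝ) × ℝ => lineOne z.1.2 :=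
        continuous_lineOne.comp (continuous_snd.comp continuous_fst)
      have hg1 : Continuous fun z : (ℝ × ℝ) × ℝ => G z.1.1 :=
        hG.comp (continuous_fst.comp continuous_fst)
      have hg2 : Continuous fun z : (ℝ × ℝ) × ℝ => G z.1.2 :=
        hG.comp (continuous_snd.comp continuous_fst)
      have : Continuous fun z : (ℝ × ℝ) × ℝ => G z.1.1 * G z.1.2 *
          Complex.exp (-(α + lineOne z.1.1 + lineOne z.1.2) * (z.2 : ℂ)) :=
        (hg1.mul hg2).mul (Complex.continuous_exp.comp
          ((((continuous_const.add hl1).add hl2).neg).mul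
            (Complex.continuous_ofReal.comp continuous_snd)))
      exact this.aestronglyMeasurable
    · simp only [Function.uncurry, norm_mul, Complex.norm_exp]
      refine le_of_eq ?_
      congr 2
      rw [Complex.re_mul_ofReal, hre]

/-- Integral of a squared derivative up to `t`. -/
noncomputable def energy (F : ℝ → ℝ) (t : ℝ) : ℝ := ∫ s in (0 : ℝ)..t, deriv F s ^ 2

theorem integral_exp_sq_eq {F : ℝ → ℝ} (hF : ContDiff ℝ ∞ F) (hc : HasCompactSupport F) {α : ℝ}
    (hα : 0 < α) :
    IntegrableOn (fun t => energy F t * Real.exp (-α * t)) (Set.Ioi 0) ∧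
    α⁻¹ * ∫ t in Set.Ioi (0 : ℝ), Real.exp (-α * t) * (α * F t - deriv F t) ^ 2 =
      F 0 ^ 2 + ∫ t in Set.Ioi (0 : ℝ), energy F t * Real.exp (-α * t) := by
  have hd : ∀ t, HasDerivAt F (deriv F t) t := fun t =>
    (hF.differentiable (by simp) t).hasDerivAt
  have hdc : Continuous (deriv F) := hF.continuous_deriv (by simp)
  have hd2c : Continuous fun t => deriv F t ^ 2 := hdc.pow 2
  have hcd : HasCompactSupport (deriv F) := hc.deriv
  have hcd2 : HasCompactSupport fun t => deriv F t ^ 2 := by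
    have := hcd.mul_right (f' := deriv F)
    simp only [sq]
    exact this
  have hi2 : Integrable fun t => deriv F t ^ 2 := hd2c.integrable_of_hasCompactSupport hcd2
  have hec : Continuous fun t : ℝ => Real.exp (-α * t) := by fun_prop
  have hE : ∀ t, HasDerivAt (energy F) (deriv F t ^ 2) t := fun t =>
    intervalIntegral.integral_hasDerivAt_right (hd2c.intervalIntegrable _ _)
      (hd2c.stronglyMeasurableAtFilter _ _) hd2c.continuousAt
  have hexp : ∀ t : ℝ, HasDerivAt (fun t : ℝ => Real.exp (-α * t)) (-α * Real.exp (-α * t)) t :=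
    fun t => by
      have := ((hasDerivAt_id t).const_mul (-α)).exp
      simp only [id, mul_one] at this
      exact this.congr_deriv (mul_comm _ _)
  have hI1 : Integrable fun t => Real.exp (-α * t) * deriv F t ^ 2 :=
    (hec.mul hd2c).integrable_of_hasCompactSupport hcd2.mul_left
  have hEb : ∀ t, ‖energy F t‖ ≤ ∫ s, deriv F s ^ 2 := fun t => by
    unfold energy
    refine (intervalIntegral.norm_integral_le_integral_norm_uIoc).trans ?_
    simp only [Real.norm_of_nonneg (sq_nonneg _)]
    exact setIntegral_le_integral hi2 (Eventually.of_forall fun _ => sq_nonneg _)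
  have hEcont : Continuous (energy F) := continuous_iff_continuousAt.2 fun t => (hE t).continuousAt
  have hexpi : IntegrableOn (fun t : ℝ => Real.exp (-α * t)) (Set.Ioi 0) :=
    integrableOn_exp_mul_Ioi (by linarith) 0
  have hI2 : IntegrableOn (fun t => energy F t * Real.exp (-α * t)) (Set.Ioi 0) :=
    Integrable.bdd_mul (c := ∫ s, deriv F s ^ 2) hexpi hEcont.aestronglyMeasurable
      (Eventually.of_forall hEb)
  have hexp0 : Tendsto (fun t : ℝ => Real.exp (-α * t)) atTop (𝓝 0) :=
    Real.tendsto_exp_atBot.comp ((tendsto_id.const_mul_atTop_of_neg (by linarith)))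
  have p1 : ∫ t in Set.Ioi (0 : ℝ), (α * (energy F t * Real.exp (-α * t)) -
      Real.exp (-α * t) * deriv F t ^ 2) = 0 := by
    refine (integral_Ioi_of_hasDerivAt_of_tendsto'
      (f := fun t => -(energy F t * Real.exp (-α * t)))
      (m := 0) (fun t _ => ?_) ((hI2.const_mul α).sub hI1.integrableOn) ?_).trans ?_
    rotate_left 2
    · simp [energy]
    · exact (((hE t).mul (hexp t)).neg).congr_deriv (by simp only [Pi.sub_apply]; ring)
    · rw [← neg_zero (G := ℝ)]
      refine Tendsto.neg ?_
      refine squeeze_zero_norm (a := fun t => (∫ s, deriv F s ^ 2) * Real.exp (-α * t))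
        (fun t => ?_) (by simpa using hexp0.const_mul _)
      rw [norm_mul, Real.norm_of_nonneg (Real.exp_pos _).le]
      exact mul_le_mul_of_nonneg_right (hEb t) (Real.exp_pos _).le
  have hI3c : Continuous fun t => Real.exp (-α * t) * (α * F t - deriv F t) ^ 2 :=
    hec.mul (((continuous_const.mul hF.continuous).sub hdc).pow 2)
  have hIFc : Continuous fun t => Real.exp (-α * t) * (α ^ 2 * F t ^ 2 - 2 * α * (F t * deriv F t)) :=
    hec.mul ((continuous_const.mul (hF.continuous.pow 2)).sub
      (continuous_const.mul (hF.continuous.mul hdc)))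
  have hIF : Integrable fun t => Real.exp (-α * t) * (α ^ 2 * F t ^ 2 - 2 * α * (F t * deriv F t)) := by
    refine hIFc.integrable_of_hasCompactSupport ?_
    refine hc.mono fun t ht => ?_
    contrapose! ht
    simp only [Function.notMem_support] at ht ⊢
    simp [ht]
  have p2 : ∫ t in Set.Ioi (0 : ℝ), Real.exp (-α * t) * (α ^ 2 * F t ^ 2 - 2 * α * (F t * deriv F t)) =
      α * F 0 ^ 2 := by
    refine (integral_Ioi_of_hasDerivAt_of_tendsto'
      (f := fun t => -α * (F t ^ 2 * Real.exp (-α * t)))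
      (m := 0) (fun t _ => ?_) hIF.integrableOn ?_).trans ?_
    rotate_left 2
    · simp
    · exact ((((hd t).pow 2).mul (hexp t)).const_mul (-α)).congr_deriv (by simp; ring)
    · have h0 : Tendsto (fun t => F t ^ 2 * Real.exp (-α * t)) atTop (𝓝 0) := by
        obtain ⟨A, hA⟩ := hc.isCompact.bddAbove
        refine tendsto_const_nhds.congr' ?_
        filter_upwards [eventually_gt_atTop A] with t ht
        have : F t = 0 := image_eq_zero_of_notMem_tsupport fun h => absurd (hA h) (not_le.2 ht)
        simp [this]
      simpa using h0.const_mul (-α)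
  refine ⟨hI2, ?_⟩
  have p3 : ∫ t in Set.Ioi (0 : ℝ), Real.exp (-α * t) * (α * F t - deriv F t) ^ 2 =
      (∫ t in Set.Ioi (0 : ℝ), Real.exp (-α * t) * (α ^ 2 * F t ^ 2 - 2 * α * (F t * deriv F t))) +
      ∫ t in Set.Ioi (0 : ℝ), Real.exp (-α * t) * deriv F t ^ 2 := by
    rw [← integral_add hIF.integrableOn hI1.integrableOn]
    exact integral_congr_ae (Eventually.of_forall fun t => by simp only; ring)
  rw [integral_sub (hI2.const_mul α) hI1.integrableOn, integral_const_mul] at p1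
  rw [p3, p2, ← sub_eq_zero.1 p1]
  field_simp

theorem tendsto_tsum_sieveWt_sq_energy {F : ℝ → ℝ} (hF : ContDiff ℝ ∞ F) (hc : HasCompactSupport F) :
    (∀ L : ℝ, 0 < L → ∀ σ : ℝ, 1 < σ →
      Summable fun n : ℕ => sieveWt F L n ^ 2 * (n : ℝ) ^ (-σ)) ∧
    ∀ α : ℝ, 0 < α → Tendsto (fun L : ℝ => ∑' n : ℕ, sieveWt F L n ^ 2 * (n : ℝ) ^ (-(1 + α / L)))
      atTop (𝓝 (F 0 ^ 2 + ∫ t in Set.Ioi (0 : ℝ), energy F t * Real.exp (-α * t))) := by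
  obtain ⟨g, hg, hgi, h1, h2⟩ := exists_exp_superposition hF hc
  have hgi0 : Integrable g :=
    (integrable_norm_iff hg.aestronglyMeasurable).1 (by simpa using hgi 0)
  refine ⟨fun L hL σ hσ => ?_, fun α hα => ?_⟩
  · exact Complex.summable_ofReal.1 (hasSum_sieveWt_sq hgi0 h1 hL hσ).summable
  have ht := tendsto_tsum_sieveWt_sq hg hgi h1 hα
  set G : ℝ → ℂ := fun ξ => g ξ * (α + lineOne ξ) with hG
  have hGc : Continuous G := hg.mul (continuous_const.add continuous_lineOne)
  have hGi : Integrable G := by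
    refine Integrable.mono' (((hgi 0).const_mul (α + 7)).add ((hgi 1).const_mul (α + 7)))
      hGc.aestronglyMeasurable (Eventually.of_forall fun ξ => ?_)
    simp only [hG, norm_mul, Pi.add_apply, pow_zero, pow_one, one_mul]
    have := norm_lineOne_add_le hα.le ξ
    nlinarith [norm_nonneg (g ξ), mul_le_mul_of_nonneg_left this (norm_nonneg (g ξ))]
  have e1 : (∫ p : ℝ × ℝ, g p.1 * g p.2 * ((α + lineOne p.1) * (α + lineOne p.2) /
      (α * (α + lineOne p.1 + lineOne p.2)))) =
      ((F 0 ^ 2 + ∫ t in Set.Ioi (0 : ℝ), energy F t * Real.exp (-α * t) : ℝ) : ℂ) := by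
    rw [← (integral_exp_sq_eq hF hc hα).2]
    have : ∀ p : ℝ × ℝ, g p.1 * g p.2 * ((α + lineOne p.1) * (α + lineOne p.2) /
        (α * (α + lineOne p.1 + lineOne p.2))) =
        (α : ℂ)⁻¹ * (G p.1 * G p.2 * (α + lineOne p.1 + lineOne p.2)⁻¹) := fun p => by
      simp only [hG, div_eq_mul_inv, mul_inv]; ring
    simp only [this]
    rw [integral_const_mul, integral_lineOne_pair hGc hGi hα, Complex.ofReal_mul, Complex.ofReal_inv,
      ← integral_complex_ofReal]
    congr 1
    refine integral_congr_ae (Eventually.of_forall fun t => ?_)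
    simp only [hG]
    rw [← h2 α t]
    push_cast; ring
  rw [e1] at ht
  have := (Complex.continuous_re.tendsto _).comp ht
  simpa only [Function.comp_def, Complex.ofReal_re] using this

/-- A Karamata-type comparison: convergence of moments gives an upper bound for continuous tests. -/
theorem eventually_tsum_le_of_tendsto_moments {w y : ℝ → ℕ → ℝ} {r e : ℝ → ℝ} {μ : Measure ℝ}
    (hw : ∀ L n, 0 ≤ w L n) (hy : ∀ L, 0 < L → ∀ n, y L n ∈ Set.Icc (0 : ℝ) 1)
    (hs : ∀ L, 0 < L → Summable (w L)) (hr : Integrable r μ)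
    (he : Continuous e) (he1 : ∀ᵐ t ∂μ, e t ∈ Set.Icc (0 : ℝ) 1)
    (hm : ∀ k : ℕ, Tendsto (fun L => ∑' n, w L n * y L n ^ k) atTop (𝓝 (∫ t, r t * e t ^ k ∂μ)))
    {H : ℝ → ℝ} (hH : Continuous H) {ε : ℝ} (hε : 0 < ε) :
    ∀ᶠ L in atTop, ∑' n, w L n * H (y L n) ≤ (∫ t, r t * H (e t) ∂μ) + ε := by
  have hsum : ∀ f : ℝ → ℝ, Continuous f → ∀ L, 0 < L → Summable fun n => w L n * f (y L n) := by
    intro f hf L hL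
    obtain ⟨C, hC⟩ := (isCompact_Icc (a := (0 : ℝ)) (b := 1)).exists_bound_of_continuousOn
      hf.continuousOn
    refine Summable.of_norm_bounded ((hs L hL).mul_right C) fun n => ?_
    rw [norm_mul, Real.norm_of_nonneg (hw L n)]
    exact mul_le_mul_of_nonneg_left (hC _ (hy L hL n)) (hw L n)
  have hint : ∀ f : ℝ → ℝ, Continuous f → Integrable (fun t => r t * f (e t)) μ := by
    intro f hf
    obtain ⟨C, hC⟩ := (isCompact_Icc (a := (0 : ℝ)) (b := 1)).exists_bound_of_continuousOn
      hf.continuousOn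
    refine hr.mul_bdd (c := C) (hf.comp he).aestronglyMeasurable ?_
    filter_upwards [he1] with t ht using hC _ ht
  have hpoly : ∀ Q : Polynomial ℝ, Tendsto (fun L => ∑' n, w L n * Q.eval (y L n)) atTop
      (𝓝 (∫ t, r t * Q.eval (e t) ∂μ)) := by
    intro Q
    have h := tendsto_finsetSum (Finset.range (Q.natDegree + 1))
      fun k _ => (hm k).const_mul (Q.coeff k)
    have e2 : ∫ t, r t * Q.eval (e t) ∂μ =
        ∑ k ∈ Finset.range (Q.natDegree + 1), Q.coeff k * ∫ t, r t * e t ^ k ∂μ := by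
      simp only [← integral_const_mul]
      rw [← integral_finsetSum _ fun k _ => (hint (fun x => x ^ k) (by fun_prop)).const_mul _]
      refine integral_congr_ae (Eventually.of_forall fun t => ?_)
      simp only [Polynomial.eval_eq_sum_range, mul_sum]
      exact sum_congr rfl fun k _ => by ring
    rw [e2]
    refine h.congr' ?_
    filter_upwards [eventually_gt_atTop 0] with L hL
    simp only [← tsum_mul_left]
    rw [← Summable.tsum_finsetSum fun k _ => (hsum (fun x => x ^ k) (by fun_prop) L hL).mul_left _]
    refine tsum_congr fun n => ?_
    simp only [Polynomial.eval_eq_sum_range, mul_sum]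
    exact sum_congr rfl fun k _ => by ring
  set A := ∫ t, |r t| ∂μ with hA
  have hA0 : 0 ≤ A := integral_nonneg fun _ => abs_nonneg _
  set M := (∫ t, r t ∂μ) + 1 + A with hM
  set δ := ε / (2 * (|M| + A + 1)) with hδ
  have hδ0 : 0 < δ := by positivity
  obtain ⟨Q, hQ⟩ := exists_polynomial_near_of_continuousOn 0 1 H hH.continuousOn δ hδ0
  have hm0 := hm 0
  simp only [pow_zero, mul_one] at hm0
  filter_upwards [eventually_gt_atTop 0, (hpoly Q).eventually_le_const (lt_add_of_pos_right _
    (half_pos hε)), hm0.eventually_le_const (lt_add_one _)] with L hL h1 h2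
  have i1 : ∑' n, w L n * H (y L n) ≤ ∑' n, w L n * Q.eval (y L n) + δ * ∑' n, w L n := by
    rw [← tsum_mul_left, ← Summable.tsum_add (hsum _ Q.continuous L hL) ((hs L hL).mul_left _)]
    refine Summable.tsum_le_tsum (fun n => ?_) (hsum _ hH L hL)
      ((hsum _ Q.continuous L hL).add ((hs L hL).mul_left _))
    have := abs_lt.1 (hQ _ (hy L hL n))
    nlinarith [hw L n]
  have i2 : ∫ t, r t * Q.eval (e t) ∂μ ≤ (∫ t, r t * H (e t) ∂μ) + δ * A := by
    rw [hA, ← integral_const_mul, ← integral_add (hint _ hH) (hr.abs.const_mul δ)]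
    refine integral_mono_ae (hint _ Q.continuous) ((hint _ hH).add (hr.abs.const_mul δ)) ?_
    filter_upwards [he1] with t ht
    have h3 := hQ _ ht
    have h4 : r t * (Q.eval (e t) - H (e t)) ≤ |r t| * δ := by
      refine (le_abs_self _).trans ?_
      rw [abs_mul]
      exact mul_le_mul_of_nonneg_left h3.le (abs_nonneg _)
    linarith
  have i3 : δ * ((∑' n, w L n) + A) ≤ ε / 2 := by
    have : (∑' n, w L n) + A ≤ |M| + A + 1 := by linarith [le_abs_self M]
    calc δ * ((∑' n, w L n) + A) ≤ δ * (|M| + A + 1) := by gcongr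
      _ = ε / 2 := by rw [hδ]; field_simp
  linarith

theorem exists_cutoff {u δ δ' : ℝ} (hu : 0 < u) (hδ' : 0 < δ') (hδ : δ' < δ) :
    ∃ F : ℝ → ℝ, ContDiff ℝ ∞ F ∧ HasCompactSupport F ∧ (∀ t, 0 ≤ t → t ≤ u → F t = 1) ∧
      (∀ t, u + δ ≤ t → F t = 0) ∧ (∀ t, 0 ≤ t → |F t| ≤ 1) ∧
      (∀ t, 0 ≤ t → t ≤ u → energy F t ≤ 0) ∧
      (∀ t, u ≤ t → energy F t ≤ min (t - u) δ / δ' ^ 2) := by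
  let B : ContDiffBump (u + δ / 2) := ⟨δ' / 2, δ / 2, by linarith, by linarith⟩
  let B' : ContDiffBump (-2 : ℝ) := ⟨1 / 2, 1, by norm_num, by norm_num⟩
  obtain ⟨φ, hφ⟩ : ∃ φ : ℝ → ℝ, φ = B.normed volume := ⟨_, rfl⟩
  obtain ⟨ψ, hψ⟩ : ∃ ψ : ℝ → ℝ, ψ = B'.normed volume := ⟨_, rfl⟩
  have cφ : ContDiff ℝ ∞ φ := hφ ▸ B.contDiff_normed
  have cψ : ContDiff ℝ ∞ ψ := hψ ▸ B'.contDiff_normed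
  have nφ : ∀ t, 0 ≤ φ t := fun t => hφ ▸ B.nonneg_normed t
  have bφ : ∀ t, φ t ≤ 1 / δ' := fun t => by
    have h := B.normed_le_div_measure_closedBall_rIn volume t
    rw [Real.volume_real_closedBall (by change 0 ≤ δ' / 2; linarith)] at h
    rw [hφ]
    refine h.trans (le_of_eq ?_)
    change 1 / (2 * (δ' / 2)) = _
    rw [mul_div_cancel₀ _ two_ne_zero]
  have sφ : Function.support φ = ball (u + δ / 2) (δ / 2) := hφ ▸ B.support_normed_eq
  have sψ : Function.support ψ = ball (-2 : ℝ) 1 := hψ ▸ B'.support_normed_eq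
  have zφ : ∀ t, (t ≤ u ∨ u + δ ≤ t) → φ t = 0 := fun t ht => by
    rw [← Function.notMem_support, sφ, Real.ball_eq_Ioo, Set.mem_Ioo]
    rintro ⟨h1, h2⟩; rcases ht with h | h <;> linarith
  have zψ : ∀ t, (t ≤ -3 ∨ -1 ≤ t) → ψ t = 0 := fun t ht => by
    rw [← Function.notMem_support, sψ, Real.ball_eq_Ioo, Set.mem_Ioo]
    rintro ⟨h1, h2⟩; rcases ht with h | h <;> linarith
  have iφ : ∫ t, φ t = 1 := hφ ▸ B.integral_normed
  have iψ : ∫ t, ψ t = 1 := hψ ▸ B'.integral_normed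
  have ci : ∀ a b, IntervalIntegrable φ volume a b := fun a b => cφ.continuous.intervalIntegrable a b
  have ci' : ∀ a b, IntervalIntegrable ψ volume a b := fun a b => cψ.continuous.intervalIntegrable a b
  have Iφ : ∀ t, u + δ ≤ t → ∫ s in (-3 : ℝ)..t, φ s = 1 := fun t ht => by
    rw [intervalIntegral.integral_eq_integral_of_support_subset, iφ]
    rw [sφ, Real.ball_eq_Ioo]
    intro x hx; exact ⟨by linarith [hx.1], by linarith [hx.2]⟩
  have Iψ : ∀ t, -1 ≤ t → ∫ s in (-3 : ℝ)..t, ψ s = 1 := fun t ht => by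
    rw [intervalIntegral.integral_eq_integral_of_support_subset, iψ]
    rw [sψ, Real.ball_eq_Ioo]
    intro x hx; exact ⟨by linarith [hx.1], by linarith [hx.2]⟩
  have Iφ0 : ∀ t, t ≤ u → ∫ s in (-3 : ℝ)..t, φ s = 0 := fun t ht => by
    refine intervalIntegral.integral_zero_ae (Eventually.of_forall fun s hs => zφ s (Or.inl ?_))
    rcases Set.mem_uIoc.1 hs with h | h <;> linarith [h.1, h.2]
  have Iψ0 : ∀ t, t ≤ -3 → ∫ s in (-3 : ℝ)..t, ψ s = 0 := fun t ht => by
    refine intervalIntegral.integral_zero_ae (Eventually.of_forall fun s hs => zψ s (Or.inl ?_))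
    rcases Set.mem_uIoc.1 hs with h | h <;> linarith [h.1, h.2]
  let F : ℝ → ℝ := fun t => (∫ s in (-3 : ℝ)..t, ψ s) - ∫ s in (-3 : ℝ)..t, φ s
  have hd : ∀ t, HasDerivAt F (ψ t - φ t) t := fun t =>
    (intervalIntegral.integral_hasDerivAt_right (ci' _ _)
      (cψ.continuous.stronglyMeasurableAtFilter _ _) cψ.continuous.continuousAt).sub
    (intervalIntegral.integral_hasDerivAt_right (ci _ _)
      (cφ.continuous.stronglyMeasurableAtFilter _ _) cφ.continuous.continuousAt)
  have hderiv : deriv F = fun t => ψ t - φ t := funext fun t => (hd t).deriv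
  have hF1 : ∀ t, 0 ≤ t → F t = 1 - ∫ s in (-3 : ℝ)..t, φ s := fun t ht => by
    simp only [F]; rw [Iψ t (by linarith)]
  have hF0 : ∀ t, u + δ ≤ t → F t = 0 := fun t ht => by
    rw [hF1 t (by linarith), Iφ t ht, sub_self]
  have hen : ∀ t, 0 ≤ t → energy F t = ∫ s in (0 : ℝ)..t, φ s ^ 2 := fun t ht => by
    unfold energy
    refine intervalIntegral.integral_congr fun s hs => ?_
    rw [Set.uIcc_of_le ht] at hs
    simp only [hderiv, zψ s (Or.inr (by linarith [hs.1])), zero_sub, neg_sq]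
  have ci2 : ∀ a b, IntervalIntegrable (fun s => φ s ^ 2) volume a b :=
    fun a b => (cφ.continuous.pow 2).intervalIntegrable a b
  have hen0 : ∀ t, 0 ≤ t → t ≤ u → energy F t = 0 := fun t ht htu => by
    rw [hen t ht]
    refine intervalIntegral.integral_zero_ae (Eventually.of_forall fun s hs => ?_)
    rw [Set.uIoc_of_le ht] at hs
    rw [zφ s (Or.inl (by linarith [hs.2]))]; ring
  have hlip : ∀ t, u ≤ t → energy F t ≤ (t - u) / δ' ^ 2 := fun t ht => by
    have h1 := intervalIntegral.integral_add_adjacent_intervals (ci2 0 u) (ci2 u t)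
    rw [← hen u hu.le, hen0 u hu.le le_rfl, zero_add, ← hen t (by linarith)] at h1
    rw [← h1]
    refine (le_abs_self _).trans ?_
    have h2 := intervalIntegral.norm_integral_le_of_norm_le_const (a := u) (b := t)
      (f := fun s => φ s ^ 2) (C := (1 / δ') ^ 2) fun s _ => by
        rw [Real.norm_of_nonneg (sq_nonneg _)]
        exact pow_le_pow_left₀ (nφ s) (bφ s) 2
    rw [abs_of_nonneg (sub_nonneg.2 ht)] at h2
    refine h2.trans (le_of_eq (by ring))
  refine ⟨F, ?_, ?_, ?_, hF0, ?_, fun t ht htu => (hen0 t ht htu).le, ?_⟩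
  · rw [contDiff_infty_iff_deriv, hderiv]
    exact ⟨fun t => (hd t).differentiableAt, cψ.sub cφ⟩
  · refine HasCompactSupport.intro (isCompact_Icc (a := (-3 : ℝ)) (b := u + δ)) fun t ht => ?_
    rw [Set.mem_Icc, not_and_or, not_le, not_le] at ht
    rcases ht with h | h
    · simp only [F]; rw [Iψ0 t h.le, Iφ0 t (by linarith), sub_zero]
    · exact hF0 t h.le
  · intro t ht htu
    rw [hF1 t ht, Iφ0 t htu, sub_zero]
  · intro t ht
    rw [hF1 t ht]
    have h0 : 0 ≤ ∫ s in (-3 : ℝ)..t, φ s :=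
      intervalIntegral.integral_nonneg (by linarith) fun s _ => nφ s
    have h1 : ∫ s in (-3 : ℝ)..t, φ s ≤ 1 := by
      rcases le_total (u + δ) t with h | h
      · exact (Iφ t h).le
      · have h2 := intervalIntegral.integral_add_adjacent_intervals (ci (-3) t) (ci t (u + δ))
        rw [Iφ _ le_rfl] at h2
        linarith [intervalIntegral.integral_nonneg (μ := volume) h fun s _ => nφ s]
    rw [abs_le]; constructor <;> linarith
  · intro t ht
    rcases le_total (t - u) δ with h | h
    · rw [min_eq_left h]; exact hlip t ht
    · rw [min_eq_right h]
      have h1 := intervalIntegral.integral_add_adjacent_intervals (ci2 0 (u + δ)) (ci2 (u + δ) t)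
      rw [← hen t (by linarith), ← hen (u + δ) (by linarith)] at h1
      have h2 : ∫ s in (u + δ)..t, φ s ^ 2 = 0 := by
        refine intervalIntegral.integral_zero_ae (Eventually.of_forall fun s hs => ?_)
        rw [Set.uIoc_of_le (by linarith)] at hs
        rw [zφ s (Or.inr (by linarith [hs.1]))]; ring
      rw [← h1, h2, add_zero]
      simpa using hlip (u + δ) (by linarith)

theorem sieveWt_one (F : ℝ → ℝ) (L : ℝ) : sieveWt F L 1 = F 0 := by simp [sieveWt]

/-- Mean square of the sieve weights over `1 < n ≤ e^{xL}`, weighted by `n^{-1+1/L}`. -/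
theorem sieveWt_mean_square {F : ℝ → ℝ} (hF : ContDiff ℝ ∞ F) (hc : HasCompactSupport F)
    {u δ δ' x x' ε : ℝ} (hu : 0 < u) (hδ' : 0 < δ') (hδ : δ' < δ) (hF0 : F 0 = 1)
    (h1 : ∀ t, 0 ≤ t → t ≤ u → energy F t ≤ 0)
    (h2 : ∀ t, u ≤ t → energy F t ≤ min (t - u) δ / δ' ^ 2) (hx : u + δ ≤ x) (hx' : x < x')
    (hε : 0 < ε) :
    ∀ᶠ L : ℝ in atTop, ∀ N : ℕ, (N : ℝ) ≤ Real.exp (x * L) →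
      ∑ n ∈ Finset.Icc 2 N, sieveWt F L n ^ 2 * (n : ℝ)⁻¹ * Real.exp (Real.log n / L) ≤
      (δ * Real.exp x' - Real.exp u * (Real.exp δ - 1)) / δ' ^ 2 + ε := by
  obtain ⟨hS, hT⟩ := tendsto_tsum_sieveWt_sq_energy hF hc
  have hexp : Real.exp (-x') < Real.exp (-x) := Real.exp_lt_exp.2 (by linarith)
  set b := Real.exp (-x') with hb
  set a := Real.exp (-x) with ha
  have hb0 : 0 < b := Real.exp_pos _
  let H : ℝ → ℝ := fun y => ((max y b) ^ 2)⁻¹ * max 0 (min 1 ((y - b) / (a - b)))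
  have hHc : Continuous H := by
    refine Continuous.mul (Continuous.inv₀ (by fun_prop) fun y => ?_) (by fun_prop)
    have : 0 < max y b := lt_max_of_lt_right hb0
    positivity
  have hH0 : ∀ y, 0 ≤ H y := fun y => mul_nonneg (by positivity) (le_max_left _ _)
  have hHle : ∀ y, a ≤ y → H y = (y ^ 2)⁻¹ := fun y hy => by
    simp only [H]
    rw [max_eq_left (by linarith), min_eq_left, max_eq_right zero_le_one, mul_one]
    rw [le_div_iff₀ (by linarith)]; linarith
  have hHz : ∀ y, y ≤ b → H y = 0 := fun y hy => by
    simp only [H]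
    rw [max_eq_left (a := (0 : ℝ)), mul_zero]
    exact (min_le_right _ _).trans (div_nonpos_of_nonpos_of_nonneg (by linarith) (by linarith))
  have hHub : ∀ y, 0 < y → H y ≤ (y ^ 2)⁻¹ := fun y hy => by
    calc H y ≤ ((max y b) ^ 2)⁻¹ * 1 :=
          mul_le_mul_of_nonneg_left (max_le zero_le_one (min_le_left _ _)) (by positivity)
      _ ≤ _ := by
          rw [mul_one]
          exact inv_anti₀ (by positivity) (pow_le_pow_left₀ hy.le (le_max_left _ _) 2)
  let w : ℝ → ℕ → ℝ := fun L n => if 2 ≤ n then sieveWt F L n ^ 2 * (n : ℝ)⁻¹ * Real.exp (-(Real.log n / L)) else 0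
  let y : ℝ → ℕ → ℝ := fun L n => Real.exp (-(Real.log n / L))
  have hterm : ∀ L : ℝ, ∀ k : ℕ, ∀ n : ℕ, 2 ≤ n → sieveWt F L n ^ 2 * (n : ℝ) ^ (-(1 + ((k : ℝ) + 1) / L)) =
      w L n * y L n ^ k := fun L k n hn => by
    have hn0 : (0 : ℝ) < n := by positivity
    simp only [w, y, if_pos hn]
    rw [← Real.exp_nat_mul, mul_assoc, mul_assoc, ← Real.exp_add]
    congr 1
    rw [neg_add, Real.rpow_add hn0, Real.rpow_neg_one, Real.rpow_def_of_pos hn0]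
    congr 2; ring
  have hmom : ∀ L : ℝ, 0 < L → ∀ k : ℕ, HasSum (fun n => w L n * y L n ^ k)
      ((∑' n : ℕ, sieveWt F L n ^ 2 * (n : ℝ) ^ (-(1 + ((k : ℝ) + 1) / L))) - 1) := by
    intro L hL k
    have hs := (hS L hL (1 + ((k : ℝ) + 1) / L) (by
      have : 0 < ((k : ℝ) + 1) / L := by positivity
      linarith)).hasSum.sub (hasSum_ite_eq 1 (1 : ℝ))
    have e : (fun n => w L n * y L n ^ k) = fun n : ℕ =>
        sieveWt F L n ^ 2 * (n : ℝ) ^ (-(1 + ((k : ℝ) + 1) / L)) - if n = 1 then 1 else 0 := by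
      funext n
      rcases lt_trichotomy n 1 with hn | rfl | hn
      · obtain rfl : n = 0 := by omega
        have : -(1 + ((k : ℝ) + 1) / L) ≠ 0 := by
          have : 0 < ((k : ℝ) + 1) / L := by positivity
          linarith
        simp [w, sieveWt]
      · simp [w, sieveWt_one, hF0]
      · rw [← hterm L k n hn, if_neg (by omega), sub_zero]
    rw [e]
    exact hs
  have hE := integral_exp_sq_eq hF hc (α := 1) one_pos
  have key := eventually_tsum_le_of_tendsto_moments (w := w) (y := y)
    (r := fun t => energy F t * Real.exp (-1 * t)) (e := fun t => Real.exp (-t))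
    (μ := volume.restrict (Set.Ioi 0))
    (fun L n => by simp only [w]; split_ifs <;> positivity)
    (fun L hL n => ⟨(Real.exp_pos _).le, Real.exp_le_one_iff.2 (by
      have := Real.log_natCast_nonneg n
      have : 0 ≤ Real.log n / L := by positivity
      linarith)⟩)
    (fun L hL => by simpa using (hmom L hL 0).summable) hE.1 (by fun_prop)
    ((ae_restrict_iff' measurableSet_Ioi).2 (Eventually.of_forall fun t ht =>
      ⟨(Real.exp_pos _).le, Real.exp_le_one_iff.2 (by linarith [Set.mem_Ioi.1 ht])⟩))
    (fun k => by
      have h := (hT ((k : ℝ) + 1) (by positivity)).sub_const 1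
      have e : (∫ t in Set.Ioi (0 : ℝ), energy F t * Real.exp (-1 * t) * Real.exp (-t) ^ k) =
          F 0 ^ 2 + (∫ t in Set.Ioi (0 : ℝ), energy F t * Real.exp (-((k : ℝ) + 1) * t)) - 1 := by
        rw [hF0, one_pow, add_sub_cancel_left]
        refine integral_congr_ae (Eventually.of_forall fun t => ?_)
        simp only
        rw [← Real.exp_nat_mul, mul_assoc, ← Real.exp_add]
        congr 2; ring
      rw [e]
      refine h.congr' ?_
      filter_upwards [eventually_gt_atTop 0] with L hL using (hmom L hL k).tsum_eq.symm)
    hHc hε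
  have hI : ∫ t in Set.Ioi (0 : ℝ), energy F t * Real.exp (-1 * t) * H (Real.exp (-t)) ≤
      (δ * Real.exp x' - Real.exp u * (Real.exp δ - 1)) / δ' ^ 2 := by
    have hm0 : ∀ t, u ≤ t → 0 ≤ min (t - u) δ / δ' ^ 2 := fun t ht =>
      div_nonneg (le_min (by linarith) (by linarith)) (by positivity)
    set q : ℝ → ℝ := fun t => min (t - u) δ / δ' ^ 2 * Real.exp t with hq
    have hqc : Continuous q := by fun_prop
    have hle : ∫ t in Set.Ioi (0 : ℝ), energy F t * Real.exp (-1 * t) * H (Real.exp (-t)) ≤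
        ∫ t in Set.Ioi (0 : ℝ), (Set.Ioc u x').indicator q t := by
      refine setIntegral_mono_on ?_ ?_ measurableSet_Ioi fun t ht => ?_
      · refine hE.1.mul_bdd (c := (b ^ 2)⁻¹) (hHc.comp (by fun_prop)).aestronglyMeasurable
          (Eventually.of_forall fun t => ?_)
        rw [Real.norm_of_nonneg (hH0 _)]
        calc _ ≤ (b ^ 2)⁻¹ * 1 := by
              refine mul_le_mul ?_ (max_le zero_le_one (min_le_left _ _)) (le_max_left _ _)
                (by positivity)
              exact inv_anti₀ (by positivity) (pow_le_pow_left₀ hb0.le (le_max_right _ _) 2)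
          _ = _ := mul_one _
      · exact ((integrable_indicator_iff measurableSet_Ioc).2
          (hqc.integrableOn_Ioc)).integrableOn
      · rw [neg_one_mul]
        have hp : 0 ≤ Real.exp (-t) * H (Real.exp (-t)) := mul_nonneg (Real.exp_pos _).le (hH0 _)
        rw [mul_assoc]
        by_cases h : t ∈ Set.Ioc u x'
        · rw [Set.indicator_of_mem h]
          refine mul_le_mul (h2 t h.1.le) ?_ hp (hm0 t h.1.le)
          calc _ ≤ Real.exp (-t) * (Real.exp (-t) ^ 2)⁻¹ :=
                mul_le_mul_of_nonneg_left (hHub _ (Real.exp_pos _)) (Real.exp_pos _).le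
            _ = _ := by
                rw [← Real.exp_nat_mul, ← Real.exp_neg, ← Real.exp_add]
                congr 1; push_cast; ring
        · rw [Set.indicator_of_notMem h]
          rcases le_or_gt t u with htu | htu
          · exact mul_nonpos_of_nonpos_of_nonneg (h1 t (Set.mem_Ioi.1 ht).le htu) hp
          · have : x' < t := by
              by_contra hh
              exact h ⟨htu, not_lt.1 hh⟩
            rw [hHz _ (Real.exp_le_exp.2 (by linarith)), mul_zero, mul_zero]
    refine hle.trans ?_
    rw [setIntegral_indicator measurableSet_Ioc, Set.inter_eq_right.2 fun t ht =>
      Set.mem_Ioi.2 (hu.trans ht.1), ← intervalIntegral.integral_of_le (by linarith),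
      ← intervalIntegral.integral_add_adjacent_intervals (hqc.intervalIntegrable u (u + δ))
        (hqc.intervalIntegrable (u + δ) x')]
    have j1 : ∫ t in u..(u + δ), q t = ((δ - 1) * Real.exp (u + δ) + Real.exp u) / δ' ^ 2 := by
      rw [intervalIntegral.integral_congr (g := fun t => (t - u) * Real.exp t / δ' ^ 2),
        intervalIntegral.integral_eq_sub_of_hasDerivAt
          (f := fun t => (t - u - 1) * Real.exp t / δ' ^ 2)]
      · ring
      · intro t _
        have := ((((hasDerivAt_id t).sub_const u).sub_const 1).mul (Real.hasDerivAt_exp t)).div_const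
          (δ' ^ 2)
        exact this.congr_deriv (by simp; ring)
      · exact Continuous.intervalIntegrable (by fun_prop) _ _
      · intro t ht
        rw [Set.uIcc_of_le (by linarith)] at ht
        simp only [hq]
        rw [min_eq_left (by linarith [ht.2])]; ring
    have j2 : ∫ t in (u + δ)..x', q t = δ * (Real.exp x' - Real.exp (u + δ)) / δ' ^ 2 := by
      rw [intervalIntegral.integral_congr (g := fun t => δ / δ' ^ 2 * Real.exp t),
        intervalIntegral.integral_const_mul, integral_exp]
      · ring
      · intro t ht
        rw [Set.uIcc_of_le (by linarith)] at ht
        simp only [hq]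
        rw [min_eq_right (by linarith [ht.1])]
    rw [j1, j2, Real.exp_add]
    refine le_of_eq (by ring)
  filter_upwards [key, eventually_gt_atTop 0] with L hL hL0 N hN
  refine le_trans ?_ (hL.trans (by linarith))
  have hsm : Summable fun n => w L n * H (y L n) := by
    obtain ⟨C, hC⟩ := (isCompact_Icc (a := (0 : ℝ)) (b := 1)).exists_bound_of_continuousOn
      hHc.continuousOn
    have hs0 : Summable (w L) := by simpa using (hmom L hL0 0).summable
    refine Summable.of_norm_bounded (hs0.norm.mul_right C) fun n => ?_
    rw [norm_mul]
    refine mul_le_mul_of_nonneg_left (hC _ ⟨(Real.exp_pos _).le, Real.exp_le_one_iff.2 ?_⟩)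
      (norm_nonneg _)
    have := Real.log_natCast_nonneg n
    have : 0 ≤ Real.log n / L := by positivity
    linarith
  refine le_trans (sum_le_sum fun n hn => ?_) (hsm.sum_le_tsum (Finset.Icc 2 N) fun n _ =>
    mul_nonneg (by simp only [w]; split_ifs <;> positivity) (hH0 _))
  obtain ⟨hn2, hnN⟩ := Finset.mem_Icc.1 hn
  have hn0 : (0 : ℝ) < n := by positivity
  have hlog : Real.log n / L ≤ x := by
    rw [div_le_iff₀ hL0, ← Real.log_exp (x * L)]
    exact Real.log_le_log hn0 ((Nat.cast_le.2 hnN).trans hN)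
  simp only [w, y, if_pos hn2]
  rw [hHle _ (Real.exp_le_exp.2 (by linarith)), mul_assoc, mul_assoc, mul_assoc]
  refine le_of_eq ?_
  congr 2
  rw [← Real.exp_nat_mul, ← Real.exp_neg, ← Real.exp_add]
  congr 1; push_cast; ring

end LFZ

namespace LFZ
open Finset Filter Topology Metric Real

theorem sum_inv_le_inv_totient {r : ℕ} (hr : Squarefree r) (s : Finset ℕ)
    (hs : ∀ n ∈ s, n ≠ 0 ∧ ∏ p ∈ n.primeFactors, p = r) :
    ∑ n ∈ s, (n : ℝ)⁻¹ ≤ (r.totient : ℝ)⁻¹ := by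
  have hr0 : r ≠ 0 := hr.ne_zero
  let f : ℕ →* ℝ :=
    { toFun := fun n => (n : ℝ)⁻¹, map_one' := by simp, map_mul' := by intro a b; simp [mul_comm] }
  have hf : ∀ {p : ℕ}, p.Prime → ‖f p‖ < 1 := by
    intro p hp
    have : (1 : ℝ) < p := by exact_mod_cast hp.one_lt
    change ‖(p : ℝ)⁻¹‖ < 1
    rw [norm_inv, Real.norm_natCast]
    exact inv_lt_one_of_one_lt₀ this
  obtain ⟨-, hS⟩ := EulerProduct.summable_and_hasSum_factoredNumbers_prod_filter_prime_geometric
    hf r.primeFactors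
  have hdvd : ∀ n ∈ s, r ∣ n := fun n hn => (hs n hn).2 ▸ Nat.prod_primeFactors_dvd n
  have hmem : ∀ n ∈ s, n / r ∈ Nat.factoredNumbers r.primeFactors := by
    intro n hn
    have hn0 := (hs n hn).1
    have h1 : n / r ≠ 0 := by
      have := Nat.div_pos (Nat.le_of_dvd (Nat.pos_of_ne_zero hn0) (hdvd n hn))
        (Nat.pos_of_ne_zero hr0)
      omega
    refine Nat.mem_factoredNumbers_of_primeFactors_subset h1 ?_
    have h2 : r.primeFactors = n.primeFactors := by
      rw [← (hs n hn).2, Nat.primeFactors_prod_primeFactors]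
    rw [h2]
    exact Nat.primeFactors_mono (Nat.div_dvd_of_dvd (hdvd n hn)) hn0
  have key : ∑ n ∈ s, ((n / r : ℕ) : ℝ)⁻¹ ≤ ∏ p ∈ r.primeFactors with p.Prime, (1 - f p)⁻¹ := by
    let g : s → Nat.factoredNumbers r.primeFactors := fun n => ⟨n.1 / r, hmem n.1 n.2⟩
    have hg : Function.Injective g := by
      intro a b hab
      have h1 : a.1 / r = b.1 / r := congrArg Subtype.val hab
      apply Subtype.ext
      rw [← Nat.div_mul_cancel (hdvd a.1 a.2), ← Nat.div_mul_cancel (hdvd b.1 b.2), h1]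
    have h2 := sum_le_hasSum (s.attach.map ⟨g, hg⟩) (fun i _ => by
      change (0 : ℝ) ≤ ((i : ℕ) : ℝ)⁻¹; positivity) hS
    rw [Finset.sum_map] at h2
    rw [← Finset.sum_attach]
    exact h2
  have hφ : (r.totient : ℝ) = r * ∏ p ∈ r.primeFactors, (1 - (p : ℝ)⁻¹) := by
    have := Nat.totient_eq_mul_prod_factors r
    have h2 := congrArg (fun x : ℚ => (x : ℝ)) this
    push_cast at h2
    exact h2
  have hfilter : (r.primeFactors.filter Nat.Prime) = r.primeFactors :=
    Finset.filter_true_of_mem fun p hp => Nat.prime_of_mem_primeFactors hp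
  calc ∑ n ∈ s, (n : ℝ)⁻¹ = (r : ℝ)⁻¹ * ∑ n ∈ s, ((n / r : ℕ) : ℝ)⁻¹ := by
        rw [mul_sum]
        refine sum_congr rfl fun n hn => ?_
        rw [← mul_inv, ← Nat.cast_mul, Nat.mul_div_cancel' (hdvd n hn)]
    _ ≤ (r : ℝ)⁻¹ * ∏ p ∈ r.primeFactors with p.Prime, (1 - f p)⁻¹ := by gcongr
    _ = (r.totient : ℝ)⁻¹ := by
        rw [hφ, mul_inv, ← Finset.prod_inv_distrib, hfilter]
        rfl

/-- The normalising sum of Selberg's weights. -/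
noncomputable def selbergSum (W : ℕ) : ℝ :=
  ∑ r ∈ (Icc 1 W).filter Squarefree, (r.totient : ℝ)⁻¹

theorem log_le_selbergSum (W : ℕ) : Real.log (W + 1) ≤ selbergSum W := by
  have h1 := log_add_one_le_harmonic W
  have h2 : ((harmonic W : ℚ) : ℝ) = ∑ n ∈ Icc 1 W, (n : ℝ)⁻¹ := by
    rw [harmonic_eq_sum_Icc]; push_cast; rfl
  have h3 : Real.log (W + 1) ≤ ∑ n ∈ Icc 1 W, (n : ℝ)⁻¹ := by
    rw [← h2]; exact_mod_cast h1
  refine h3.trans ?_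
  have hmaps : ∀ n ∈ Icc 1 W, (∏ p ∈ n.primeFactors, p) ∈ (Icc 1 W).filter Squarefree := by
    intro n hn
    rw [mem_Icc] at hn
    have hd := Nat.prod_primeFactors_dvd n
    have := Nat.le_of_dvd (by omega) hd
    have h0 : ∏ p ∈ n.primeFactors, p ≠ 0 :=
      fun h => by rw [h] at hd; simp at hd; omega
    rw [mem_filter, mem_Icc]
    refine ⟨⟨by omega, by omega⟩, ?_⟩
    refine Finset.squarefree_prod_of_pairwise_isCoprime (fun a ha b hb hab => ?_) fun p hp =>
      (Nat.prime_of_mem_primeFactors hp).squarefree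
    exact (Nat.coprime_iff_isRelPrime.1 ((Nat.coprime_primes (Nat.prime_of_mem_primeFactors ha)
      (Nat.prime_of_mem_primeFactors hb)).2 hab))
  rw [← Finset.sum_fiberwise_of_maps_to hmaps, selbergSum]
  refine sum_le_sum fun r hr => sum_inv_le_inv_totient (mem_filter.1 hr).2 _ fun n hn => ?_
  rw [mem_filter, mem_Icc] at hn
  exact ⟨by omega, hn.2⟩

theorem selbergSum_pos {W : ℕ} (hW : 0 < W) : 0 < selbergSum W := by
  have h1 : (1 : ℝ) < W + 1 := by
    have : (0 : ℝ) < W := by exact_mod_cast hW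
    linarith
  exact (Real.log_pos h1).trans_le (log_le_selbergSum W)

/-- Selberg's weights of level `W`. -/
noncomputable def selbergWt (W d : ℕ) : ℝ :=
  (ArithmeticFunction.moebius d : ℝ) * d / selbergSum W *
    ∑ r ∈ ((Icc 1 W).filter Squarefree).filter (d ∣ ·), (r.totient : ℝ)⁻¹

theorem selbergWt_one {W : ℕ} (hW : 0 < W) : selbergWt W 1 = 1 := by
  have := (selbergSum_pos hW).ne'
  simp only [selbergWt, one_dvd, filter_true]
  rw [← selbergSum]
  simp
  field_simp

theorem sum_divisors_moebius (n : ℕ) :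
    ∑ d ∈ n.divisors, (ArithmeticFunction.moebius d : ℝ) = if n = 1 then 1 else 0 := by
  have h := congrArg (fun f : ArithmeticFunction ℤ => f n) ArithmeticFunction.moebius_mul_coe_zeta
  simp only [ArithmeticFunction.coe_mul_zeta_apply, ArithmeticFunction.one_apply] at h
  exact_mod_cast h

theorem sum_moebius_between {r s : ℕ} (hs : Squarefree s) (hrs : r ∣ s) :
    ∑ d ∈ s.divisors.filter (r ∣ ·), (ArithmeticFunction.moebius d : ℝ) =
      if s = r then (ArithmeticFunction.moebius r : ℝ) else 0 := by
  obtain ⟨t, rfl⟩ := hrs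
  have hr0 : r ≠ 0 := left_ne_zero_of_mul hs.ne_zero
  have ht0 : t ≠ 0 := right_ne_zero_of_mul hs.ne_zero
  have h1 : (r * t).divisors.filter (r ∣ ·) = t.divisors.image (r * ·) := by
    ext d
    simp only [mem_filter, Nat.mem_divisors, mem_image]
    constructor
    · rintro ⟨⟨h1, h2⟩, e, rfl⟩
      exact ⟨e, ⟨Nat.dvd_of_mul_dvd_mul_left (Nat.pos_of_ne_zero hr0) h1, ht0⟩, rfl⟩
    · rintro ⟨e, ⟨he, -⟩, rfl⟩
      exact ⟨⟨Nat.mul_dvd_mul_left r he, hs.ne_zero⟩, Dvd.intro e rfl⟩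
  rw [h1, Finset.sum_image (fun a _ b _ h => Nat.eq_of_mul_eq_mul_left (Nat.pos_of_ne_zero hr0) h)]
  have h2 : ∀ e ∈ t.divisors, (ArithmeticFunction.moebius (r * e) : ℝ) =
      (ArithmeticFunction.moebius r : ℝ) * (ArithmeticFunction.moebius e : ℝ) := by
    intro e he
    have hsq : Squarefree (r * e) :=
      hs.squarefree_of_dvd (Nat.mul_dvd_mul_left r (Nat.dvd_of_mem_divisors he))
    rw [ArithmeticFunction.isMultiplicative_moebius.map_mul_of_coprime
      (Nat.coprime_of_squarefree_mul hsq)]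
    push_cast; rfl
  rw [sum_congr rfl h2, ← mul_sum]
  rw [sum_divisors_moebius]
  by_cases ht : t = 1
  · simp [ht]
  · rw [if_neg ht, if_neg, mul_zero]
    intro h
    exact ht (Nat.eq_of_mul_eq_mul_left (Nat.pos_of_ne_zero hr0) (by rw [h, mul_one]))

theorem sum_selbergWt_div {W r : ℕ} (hr : r ∈ Icc 1 W) :
    ∑ d ∈ (Icc 1 W).filter (r ∣ ·), selbergWt W d / d =
      if Squarefree r then (ArithmeticFunction.moebius r : ℝ) / (r.totient * selbergSum W)
        else 0 := by
  set A := (Icc 1 W).filter Squarefree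
  have h1 : ∀ d ∈ (Icc 1 W).filter (r ∣ ·), selbergWt W d / d = ∑ s ∈ A,
      if d ∣ s then (ArithmeticFunction.moebius d : ℝ) * ((s.totient : ℝ)⁻¹ / selbergSum W)
        else 0 := by
    intro d hd
    have hd0 : (d : ℝ) ≠ 0 := by
      have := (mem_Icc.1 (mem_filter.1 hd).1).1
      exact_mod_cast (by omega : d ≠ 0)
    rw [selbergWt, ← Finset.sum_filter, ← mul_sum, ← Finset.sum_div]
    change _ * (∑ r ∈ A with d ∣ r, (r.totient : ℝ)⁻¹) / _ = _
    field_simp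
  rw [sum_congr rfl h1, Finset.sum_comm]
  have h2 : ∀ s ∈ A, (∑ d ∈ (Icc 1 W).filter (r ∣ ·),
      if d ∣ s then (ArithmeticFunction.moebius d : ℝ) * ((s.totient : ℝ)⁻¹ / selbergSum W)
        else 0) = if s = r then (ArithmeticFunction.moebius r : ℝ) *
          ((r.totient : ℝ)⁻¹ / selbergSum W) else 0 := by
    intro s hs
    obtain ⟨hs1, hs2⟩ := mem_filter.1 hs
    rw [mem_Icc] at hs1
    have h3 : ((Icc 1 W).filter (r ∣ ·)).filter (· ∣ s) = s.divisors.filter (r ∣ ·) := by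
      ext d
      simp only [mem_filter, mem_Icc, Nat.mem_divisors]
      constructor
      · rintro ⟨⟨-, h⟩, h'⟩
        exact ⟨⟨h', by omega⟩, h⟩
      · rintro ⟨⟨h', h0⟩, h⟩
        have := Nat.le_of_dvd (by omega) h'
        have := Nat.pos_of_dvd_of_pos h' (by omega)
        exact ⟨⟨⟨by omega, by omega⟩, h⟩, h'⟩
    rw [← Finset.sum_filter, h3, ← Finset.sum_mul]
    by_cases hrs : r ∣ s
    · rw [sum_moebius_between hs2 hrs]
      by_cases h : s = r
      · simp [h]
      · simp [h]
    · have h4 : s.divisors.filter (r ∣ ·) = ∅ := by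
        refine Finset.filter_eq_empty_iff.2 fun d hd hrd => hrs ?_
        exact hrd.trans (Nat.dvd_of_mem_divisors hd)
      have h5 : s ≠ r := fun h => hrs (h ▸ dvd_rfl)
      simp [h4, h5]
  rw [sum_congr rfl h2, Finset.sum_ite_eq']
  by_cases h : Squarefree r
  · rw [if_pos h, if_pos (mem_filter.2 ⟨hr, h⟩)]
    rw [div_eq_mul_inv, div_eq_mul_inv, mul_inv]
  · rw [if_neg h, if_neg (fun h' => h (mem_filter.1 h').2)]

theorem sum_selbergWt_mul_lcm {W : ℕ} (hW : 0 < W) :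
    ∑ d ∈ Icc 1 W, ∑ e ∈ Icc 1 W, selbergWt W d * selbergWt W e / (d.lcm e : ℕ) =
      (selbergSum W)⁻¹ := by
  have hG := (selbergSum_pos hW).ne'
  have h1 : ∀ d ∈ Icc 1 W, ∀ e ∈ Icc 1 W, selbergWt W d * selbergWt W e / (d.lcm e : ℕ) =
      ∑ r ∈ Icc 1 W, (r.totient : ℝ) * ((if r ∣ d then selbergWt W d / d else 0) *
        (if r ∣ e then selbergWt W e / e else 0)) := by
    intro d hd e he
    rw [mem_Icc] at hd he
    have hd0 : (d : ℝ) ≠ 0 := by exact_mod_cast (by omega : d ≠ 0)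
    have he0 : (e : ℝ) ≠ 0 := by exact_mod_cast (by omega : e ≠ 0)
    have hgl : ((d.gcd e : ℕ) : ℝ) * (d.lcm e : ℕ) = d * e := by
      exact_mod_cast Nat.gcd_mul_lcm d e
    have hl0 : ((d.lcm e : ℕ) : ℝ) ≠ 0 := by
      intro h; rw [h, mul_zero] at hgl; exact mul_ne_zero hd0 he0 hgl.symm
    have hφ : ((d.gcd e : ℕ) : ℝ) = ∑ r ∈ (Icc 1 W).filter (fun r => r ∣ d ∧ r ∣ e),
        (r.totient : ℝ) := by
      have h2 := Nat.sum_totient (d.gcd e)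
      have h3 : (d.gcd e).divisors = (Icc 1 W).filter (fun r => r ∣ d ∧ r ∣ e) := by
        ext r
        simp only [Nat.mem_divisors, mem_filter, mem_Icc, Nat.dvd_gcd_iff]
        constructor
        · rintro ⟨⟨h1, h2⟩, -⟩
          have := Nat.le_of_dvd (by omega) h1
          have := Nat.pos_of_dvd_of_pos h1 (by omega)
          exact ⟨⟨by omega, by omega⟩, h1, h2⟩
        · rintro ⟨-, h⟩
          exact ⟨h, (Nat.gcd_pos_of_pos_left e (by omega)).ne'⟩
      rw [← h3]
      exact_mod_cast h2.symm
    have h4 : selbergWt W d * selbergWt W e / (d.lcm e : ℕ) =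
        ((d.gcd e : ℕ) : ℝ) * ((selbergWt W d / d) * (selbergWt W e / e)) := by
      field_simp
      linear_combination (-(selbergWt W d * selbergWt W e)) * hgl
    rw [h4, hφ, Finset.sum_mul, Finset.sum_filter]
    refine sum_congr rfl fun r _ => ?_
    by_cases a : r ∣ d <;> by_cases b : r ∣ e <;> simp [a, b]
  rw [sum_congr rfl fun d hd => sum_congr rfl fun e he => h1 d hd e he]
  rw [sum_congr rfl fun d _ => Finset.sum_comm, Finset.sum_comm]
  have h2 : ∀ r ∈ Icc 1 W, (∑ d ∈ Icc 1 W, ∑ e ∈ Icc 1 W, (r.totient : ℝ) *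
      ((if r ∣ d then selbergWt W d / d else 0) * (if r ∣ e then selbergWt W e / e else 0))) =
      if Squarefree r then (r.totient : ℝ)⁻¹ / (selbergSum W) ^ 2 else 0 := by
    intro r hr
    simp_rw [← mul_sum, ← Finset.sum_mul]
    rw [← Finset.sum_filter, sum_selbergWt_div hr]
    have hr0 : (r.totient : ℝ) ≠ 0 := by
      exact_mod_cast (Nat.totient_pos.2 (mem_Icc.1 hr).1).ne'
    by_cases h : Squarefree r
    · have h5 : (ArithmeticFunction.moebius r : ℝ) ^ 2 = 1 := by
        exact_mod_cast ArithmeticFunction.moebius_sq_eq_one_of_squarefree h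
      rw [if_pos h, if_pos h]
      field_simp
      exact h5
    · simp [h]
  rw [sum_congr rfl h2, ← Finset.sum_filter, ← Finset.sum_div, ← selbergSum]
  field_simp

theorem abs_selbergWt_le {W d : ℕ} (hd : d ∈ Icc 1 W) :
    |selbergWt W d| ≤ d.divisors.card := by
  rw [mem_Icc] at hd
  have hW : 0 < W := by omega
  have hG := selbergSum_pos hW
  have hφ : 0 < d.totient := Nat.totient_pos.2 (by omega)
  have hφ' : (0 : ℝ) < d.totient := by exact_mod_cast hφ
  have h1 : (d : ℝ) ≤ d.divisors.card * d.totient := by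
    have h2 : d ≤ d.divisors.card * d.totient := by
      conv_lhs => rw [← Nat.sum_totient d]
      rw [← smul_eq_mul]
      exact Finset.sum_le_card_nsmul _ _ _ fun r hr =>
        Nat.le_of_dvd hφ (Nat.totient_dvd_of_dvd (Nat.dvd_of_mem_divisors hr))
    exact_mod_cast h2
  have h2 : ∑ r ∈ ((Icc 1 W).filter Squarefree).filter (d ∣ ·), (r.totient : ℝ)⁻¹ ≤
      (d.totient : ℝ)⁻¹ * selbergSum W := by
    rw [selbergSum, mul_sum]
    have h3 : ∀ r ∈ ((Icc 1 W).filter Squarefree).filter (d ∣ ·), (r.totient : ℝ)⁻¹ ≤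
        (d.totient : ℝ)⁻¹ * ((r / d : ℕ).totient : ℝ)⁻¹ := by
      intro r hr
      obtain ⟨hr1, k, rfl⟩ := mem_filter.1 hr
      have hk : 0 < d * k := by have := mem_Icc.1 (mem_filter.1 hr1).1; omega
      have hk0 : 0 < k := Nat.pos_of_mul_pos_left hk
      rw [Nat.mul_div_cancel_left k (by omega), ← mul_inv]
      have h4 : 0 < k.totient := Nat.totient_pos.2 hk0
      gcongr
      exact_mod_cast Nat.totient_super_multiplicative d k
    refine (sum_le_sum h3).trans ?_
    rw [← Finset.sum_image (f := fun k : ℕ => (d.totient : ℝ)⁻¹ * (k.totient : ℝ)⁻¹)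
      (g := fun r => r / d)]
    · refine Finset.sum_le_sum_of_subset_of_nonneg ?_ fun _ _ _ => by positivity
      intro k hk
      obtain ⟨r, hr, rfl⟩ := mem_image.1 hk
      obtain ⟨hr1, k, rfl⟩ := mem_filter.1 hr
      obtain ⟨hr2, hr3⟩ := mem_filter.1 hr1
      rw [mem_Icc] at hr2
      have hk0 : 0 < k := Nat.pos_of_mul_pos_left (show 0 < d * k by omega)
      rw [Nat.mul_div_cancel_left k (by omega), mem_filter, mem_Icc]
      have : k ≤ d * k := Nat.le_mul_of_pos_left k (by omega)
      exact ⟨⟨by omega, by omega⟩, hr3.squarefree_of_dvd (Dvd.intro_left d rfl)⟩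
    · intro a ha b hb hab
      have h5 := (mem_filter.1 ha).2
      have h6 := (mem_filter.1 hb).2
      have hab' : a / d = b / d := hab
      rw [← Nat.div_mul_cancel h5, ← Nat.div_mul_cancel h6, hab']
  have hμ : |(ArithmeticFunction.moebius d : ℝ)| ≤ 1 := by
    exact_mod_cast ArithmeticFunction.abs_moebius_le_one
  have h0 : 0 ≤ ∑ r ∈ ((Icc 1 W).filter Squarefree).filter (d ∣ ·), (r.totient : ℝ)⁻¹ :=
    Finset.sum_nonneg fun _ _ => by positivity
  rw [selbergWt, abs_mul, abs_div, abs_mul, abs_of_pos hG, abs_of_nonneg h0, Nat.abs_cast]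
  calc |(ArithmeticFunction.moebius d : ℝ)| * d / selbergSum W *
        ∑ r ∈ ((Icc 1 W).filter Squarefree).filter (d ∣ ·), (r.totient : ℝ)⁻¹
      ≤ 1 * d / selbergSum W * ((d.totient : ℝ)⁻¹ * selbergSum W) := by gcongr
    _ = d / d.totient := by field_simp
    _ ≤ _ := by rw [div_le_iff₀ hφ']; exact h1

theorem sum_Ioc_filter_dvd {E : Type*} [AddCommMonoid E] {m : ℕ} (hm : 0 < m) (U N : ℕ)
    (f : ℕ → E) :
    ∑ n ∈ (Ioc U N).filter (m ∣ ·), f n = ∑ k ∈ Ioc (U / m) (N / m), f (m * k) := by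
  have h1 : (Ioc U N).filter (m ∣ ·) = (Ioc (U / m) (N / m)).image (m * ·) := by
    ext n
    simp only [mem_filter, mem_Ioc, mem_image]
    constructor
    · rintro ⟨⟨h1, h2⟩, k, rfl⟩
      refine ⟨k, ⟨?_, ?_⟩, rfl⟩
      · rw [Nat.div_lt_iff_lt_mul hm, mul_comm]; exact h1
      · rw [Nat.le_div_iff_mul_le hm, mul_comm]; exact h2
    · rintro ⟨k, ⟨h1, h2⟩, rfl⟩
      rw [Nat.div_lt_iff_lt_mul hm, mul_comm] at h1
      rw [Nat.le_div_iff_mul_le hm, mul_comm] at h2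
      exact ⟨⟨h1, h2⟩, Dvd.intro k rfl⟩
  rw [h1, Finset.sum_image fun a _ b _ h => Nat.eq_of_mul_eq_mul_left hm h]

theorem sum_Ioc_filter_dvd_char {q : ℕ} (χ : DirichletCharacter ℂ q) {m : ℕ} (hm : 0 < m)
    (U N : ℕ) (s : ℂ) :
    ∑ n ∈ (Ioc U N).filter (m ∣ ·), χ n * (n : ℂ) ^ (-s) =
      χ m * (m : ℂ) ^ (-s) * ∑ k ∈ Ico (U / m + 1) (N / m + 1), χ k * (k : ℂ) ^ (-s) := by
  rw [sum_Ioc_filter_dvd hm, mul_sum]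
  have h1 : Ioc (U / m) (N / m) = Ico (U / m + 1) (N / m + 1) := by
    ext k; simp only [mem_Ioc, mem_Ico]; omega
  rw [h1]
  refine sum_congr rfl fun k _ => ?_
  rw [Nat.cast_mul, Nat.cast_mul, map_mul, Complex.natCast_mul_natCast_cpow]
  ring

theorem norm_char_mul_cpow_mul_le {q : ℕ} (χ : DirichletCharacter ℂ q) {m U : ℕ} (hm : 0 < m)
    {s : ℂ} (hs : 0 < s.re) {C : ℝ} (hC : 0 ≤ C) {z : ℂ}
    (hz : ‖z‖ ≤ C * ((U / m + 1 : ℕ) : ℝ) ^ (-s.re)) :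
    ‖χ m * (m : ℂ) ^ (-s) * z‖ ≤ C * ((U + 1 : ℕ) : ℝ) ^ (-s.re) := by
  have hm' : (0 : ℝ) < m := by exact_mod_cast hm
  rw [norm_mul, norm_mul, Complex.norm_natCast_cpow_of_pos hm, Complex.neg_re]
  calc ‖χ m‖ * (m : ℝ) ^ (-s.re) * ‖z‖
      ≤ 1 * (m : ℝ) ^ (-s.re) * (C * ((U / m + 1 : ℕ) : ℝ) ^ (-s.re)) := by
        gcongr
        exact χ.norm_le_one m
    _ = C * (((m * (U / m + 1) : ℕ) : ℝ) ^ (-s.re)) := by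
        rw [Nat.cast_mul, Real.mul_rpow (by positivity) (by positivity)]; ring
    _ ≤ _ := by
        refine mul_le_mul_of_nonneg_left ?_ hC
        refine Real.rpow_le_rpow_of_nonpos (by positivity) ?_ (by linarith)
        exact_mod_cast Nat.lt_mul_div_succ U hm

theorem norm_sum_Ioc_dvd_le {q : ℕ} {χ : DirichletCharacter ℂ q} {B : ℝ}
    (hB : ∀ N, ‖∑ n ∈ range N, χ n‖ ≤ B) {s : ℂ} (hs : 0 < s.re) {m : ℕ} (hm : 0 < m) (U N : ℕ) :
    ‖∑ n ∈ (Ioc U N).filter (m ∣ ·), χ n * (n : ℂ) ^ (-s)‖ ≤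
      2 * B * (1 + ‖s‖ / s.re) * ((U + 1 : ℕ) : ℝ) ^ (-s.re) := by
  have hB0 : 0 ≤ B := (norm_nonneg _).trans (hB 0)
  rw [sum_Ioc_filter_dvd_char χ hm]
  refine norm_char_mul_cpow_mul_le χ hm hs (by positivity) ?_
  exact norm_sum_Ico_mul_cpow_le (c := fun n : ℕ => χ n) (Nat.succ_pos _) (norm_sum_Ico_le hB _) hs _

theorem norm_sum_Icc_dvd_le_of_zero {q : ℕ} [NeZero q] {χ : DirichletCharacter ℂ q} (hχ : χ ≠ 1)
    {B : ℝ} (hB : ∀ N, ‖∑ n ∈ range N, χ n‖ ≤ B) {s : ℂ} (hs : 0 < s.re)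
    (hL : χ.LFunction s = 0) {m : ℕ} (hm : 0 < m) (N : ℕ) :
    ‖∑ n ∈ (Ioc 0 N).filter (m ∣ ·), χ n * (n : ℂ) ^ (-s)‖ ≤
      2 * B * (1 + ‖s‖ / s.re) * ((N + 1 : ℕ) : ℝ) ^ (-s.re) := by
  have hB0 : 0 ≤ B := (norm_nonneg _).trans (hB 0)
  rw [sum_Ioc_filter_dvd_char χ hm]
  refine norm_char_mul_cpow_mul_le χ hm hs (by positivity) ?_
  have := norm_LFunction_sub_sum_le hχ hB hs (Nat.succ_pos (N / m))
  rw [hL, zero_sub, norm_neg] at this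
  simpa using this

/-- A sum over divisors with bounded index. -/
noncomputable def divSum (W : ℕ) (a : ℕ → ℝ) (n : ℕ) : ℝ := ∑ d ∈ (Icc 1 W).filter (· ∣ n), a d

theorem sum_divSum_mul_divSum (V W : ℕ) (a b : ℕ → ℝ) (S : Finset ℕ) (f : ℕ → ℂ) :
    ∑ n ∈ S, ((divSum V a n * divSum W b n : ℝ) : ℂ) * f n =
      ∑ d ∈ Icc 1 V, ∑ e ∈ Icc 1 W, ((a d * b e : ℝ) : ℂ) *
        ∑ n ∈ S.filter (d.lcm e ∣ ·), f n := by
  have h1 : ∀ n, ((divSum V a n * divSum W b n : ℝ) : ℂ) * f n =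
      ∑ d ∈ Icc 1 V, ∑ e ∈ Icc 1 W, ((a d * b e : ℝ) : ℂ) *
        (if d.lcm e ∣ n then f n else 0) := by
    intro n
    rw [divSum, divSum, Finset.sum_filter, Finset.sum_filter, Finset.sum_mul_sum]
    push_cast
    rw [Finset.sum_mul]
    refine sum_congr rfl fun d _ => ?_
    rw [Finset.sum_mul]
    refine sum_congr rfl fun e _ => ?_
    by_cases h1 : d ∣ n <;> by_cases h2 : e ∣ n <;> simp [Nat.lcm_dvd_iff, h1, h2]
  simp_rw [h1]
  rw [Finset.sum_comm]
  refine sum_congr rfl fun d _ => ?_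
  rw [Finset.sum_comm]
  refine sum_congr rfl fun e _ => ?_
  rw [← mul_sum, Finset.sum_filter]

theorem norm_sum_divSum_mul_divSum_le {V W : ℕ} {a b : ℕ → ℝ} {α β γ : ℝ}
    (ha : ∀ d ∈ Icc 1 V, |a d| ≤ α) (hb : ∀ d ∈ Icc 1 W, |b d| ≤ β) (hα : 0 ≤ α)
    (S : Finset ℕ) (f : ℕ → ℂ)
    (hf : ∀ m, 0 < m → ‖∑ n ∈ S.filter (m ∣ ·), f n‖ ≤ γ) :
    ‖∑ n ∈ S, ((divSum V a n * divSum W b n : ℝ) : ℂ) * f n‖ ≤ V * α * (W * β) * γ := by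
  rw [sum_divSum_mul_divSum]
  have h1 : ∀ d ∈ Icc 1 V, ∀ e ∈ Icc 1 W, ‖((a d * b e : ℝ) : ℂ) *
      ∑ n ∈ S.filter (d.lcm e ∣ ·), f n‖ ≤ α * β * γ := by
    intro d hd e he
    rw [norm_mul, Complex.norm_real, Real.norm_eq_abs, abs_mul]
    have := ha d hd
    have := hb e he
    have h3 := hf (d.lcm e) (Nat.lcm_pos (mem_Icc.1 hd).1 (mem_Icc.1 he).1)
    have h4 : 0 ≤ α * β := mul_nonneg hα ((abs_nonneg _).trans this)
    gcongr
  calc _ ≤ ∑ d ∈ Icc 1 V, ∑ e ∈ Icc 1 W, α * β * γ :=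
        norm_sum_le_of_le _ fun d hd => norm_sum_le_of_le _ fun e he => h1 d hd e he
    _ = _ := by simp; ring

theorem sieveWt_eq_divSum {F : ℝ → ℝ} {L v : ℝ} (hL : 0 < L) (hF : ∀ t, v ≤ t → F t = 0)
    {V : ℕ} (hV : ∀ d : ℕ, d ≠ 0 → Real.log d < v * L → d ≤ V) {n : ℕ} (hn : n ≠ 0) :
    sieveWt F L n = divSum V
      (fun d => (ArithmeticFunction.moebius d : ℝ) * F (Real.log d / L)) n := by
  rw [sieveWt, divSum]
  symm
  refine Finset.sum_subset ?_ ?_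
  · intro d hd
    exact Nat.mem_divisors.2 ⟨(mem_filter.1 hd).2, hn⟩
  · intro d hd hd'
    have hd0 : d ≠ 0 := (Nat.pos_of_mem_divisors hd).ne'
    have h1 : ¬ Real.log d < v * L := by
      intro h
      exact hd' (mem_filter.2 ⟨mem_Icc.2 ⟨by omega, hV d hd0 h⟩, Nat.dvd_of_mem_divisors hd⟩)
    rw [hF _ (by rw [le_div_iff₀ hL]; exact not_lt.1 h1), mul_zero]

theorem sieveWt_eq_zero {F : ℝ → ℝ} {L u : ℝ} (hL : 0 < L)
    (hF : ∀ t, 0 ≤ t → t ≤ u → F t = 1) {n : ℕ} (hn : 2 ≤ n) (hnu : Real.log n ≤ u * L) :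
    sieveWt F L n = 0 := by
  have h1 : ∀ d ∈ n.divisors, (ArithmeticFunction.moebius d : ℝ) * F (Real.log d / L) =
      (ArithmeticFunction.moebius d : ℝ) := by
    intro d hd
    have hd0 := Nat.pos_of_mem_divisors hd
    have hd1 : (1 : ℝ) ≤ d := by exact_mod_cast hd0
    have hdn : (d : ℝ) ≤ n := by exact_mod_cast Nat.divisor_le hd
    rw [hF _ (div_nonneg (Real.log_nonneg hd1) hL.le), mul_one]
    rw [div_le_iff₀ hL]
    exact (Real.log_le_log (by linarith) hdn).trans hnu
  rw [sieveWt, sum_congr rfl h1]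
  rw [sum_divisors_moebius, if_neg (by omega)]

/-- The integer part of `q ^ v`. -/
noncomputable def qpow (q : ℕ) (v : ℝ) : ℕ := ⌊Real.exp (v * Real.log q)⌋₊

theorem qpow_le (q : ℕ) (v : ℝ) : (qpow q v : ℝ) ≤ Real.exp (v * Real.log q) :=
  Nat.floor_le (Real.exp_pos _).le

theorem lt_qpow_succ (q : ℕ) (v : ℝ) : Real.exp (v * Real.log q) < (qpow q v + 1 : ℕ) := by
  rw [Nat.cast_add, Nat.cast_one]; exact Nat.lt_floor_add_one _

theorem le_qpow_iff {q : ℕ} {v : ℝ} {n : ℕ} (hn : n ≠ 0) :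
    n ≤ qpow q v ↔ Real.log n ≤ v * Real.log q := by
  have h0 : (0 : ℝ) < n := by exact_mod_cast Nat.pos_of_ne_zero hn
  rw [qpow, Nat.le_floor_iff (Real.exp_pos _).le, Real.log_le_iff_le_exp h0]

theorem qpow_pos {q : ℕ} {v : ℝ} (hq : 1 ≤ q) (hv : 0 ≤ v) : 0 < qpow q v := by
  have hq' : (1 : ℝ) ≤ q := by exact_mod_cast hq
  exact (le_qpow_iff one_ne_zero).2 (by
    rw [Nat.cast_one, Real.log_one]; exact mul_nonneg hv (Real.log_nonneg hq'))

theorem abs_selbergWt_qpow_le {q : ℕ} {w C η : ℝ} (hη : 0 ≤ η) (hC : 0 ≤ C)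
    (hdiv : ∀ n : ℕ, n ≠ 0 → (n.divisors.card : ℝ) ≤ C * (n : ℝ) ^ η) {d : ℕ}
    (hd : d ∈ Icc 1 (qpow q w)) :
    |selbergWt (qpow q w) d| ≤ C * Real.exp (η * (w * Real.log q)) := by
  obtain ⟨hd1, hd2⟩ := mem_Icc.1 hd
  refine (abs_selbergWt_le hd).trans ((hdiv d (by omega)).trans ?_)
  rw [mul_comm η, Real.exp_mul]
  have : (d : ℝ) ≤ _ := le_trans (by exact_mod_cast hd2) (qpow_le q w)
  gcongr

theorem tendsto_mul_exp_neg_log (K : ℝ) {c : ℝ} (hc : 0 < c) :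
    Tendsto (fun q : ℕ => K * Real.exp (-c * Real.log q)) atTop (𝓝 0) := by
  simpa using (Real.tendsto_exp_atBot.comp
    (tendsto_log_nat.const_mul_atTop_of_neg (neg_lt_zero.2 hc))).const_mul K

theorem crude_bound {R T v w y ε : ℝ} (hR : 0 < R) (hT : 0 < T) (hw : 0 < w) (hv : 0 < v)
    (hy : v + w + 1 / 2 < y) (hε : 0 < ε) :
    ∃ q₀ : ℕ, ∀ q : ℕ, [NeZero q] → q₀ ≤ q → ∃ B β : ℝ, 1 ≤ β ∧
      (∀ χ : DirichletCharacter ℂ q, χ ≠ 1 → ∀ N, ‖∑ n ∈ range N, χ n‖ ≤ B) ∧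
      (∀ d ∈ Icc 1 (qpow q w), |selbergWt (qpow q w) d| ≤ β) ∧
      ∀ s : ℂ, 1 - R / Real.log q ≤ s.re → ‖s‖ ≤ T → 0 < s.re ∧
        (qpow q v) * β * ((qpow q w) * β) *
          (2 * B * (1 + ‖s‖ / s.re) * ((qpow q y + 1 : ℕ) : ℝ) ^ (-s.re)) ≤ ε := by
  set η := (y - v - w - 1 / 2) / (2 * (1 + 2 * w)) with hη
  have hη0 : 0 < η := div_pos (by linarith) (by positivity)
  have hηe : η * (1 + 2 * w) = (y - v - w - 1 / 2) / 2 := by rw [hη]; field_simp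
  obtain ⟨C₁, hC₁, hpv⟩ := polya_vinogradov hη0
  obtain ⟨C₂, hC₂, hdiv⟩ := card_divisors_le_rpow hη0
  set K := C₂ * C₂ * (2 * C₁ * (1 + T / (1 / 2)) * Real.exp (y * R)) with hK
  have hev := ((tendsto_mul_exp_neg_log K (c := (y - v - w - 1 / 2) / 2)
    (by linarith)).eventually_le_const hε).and
    ((tendsto_log_nat.eventually_ge_atTop (2 * R)).and (eventually_ge_atTop 2))
  obtain ⟨q₀, hq₀⟩ := eventually_atTop.1 hev
  refine ⟨q₀, fun q _ hq => ?_⟩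
  obtain ⟨h1, h2, h3⟩ := hq₀ q hq
  set L := Real.log q with hL
  have hLpos : 0 < L := by linarith
  have hq0 : (0 : ℝ) < q := by exact_mod_cast (by omega : 0 < q)
  have hqe : ∀ a : ℝ, (q : ℝ) ^ a = Real.exp (a * L) := fun a => by
    rw [Real.rpow_def_of_pos hq0, mul_comm]
  refine ⟨C₁ * (q : ℝ) ^ (1 / 2 + η), C₂ * Real.exp (η * (w * L)), ?_, fun χ hχ N => hpv q χ hχ N,
    ?_, ?_⟩
  · have : 1 ≤ Real.exp (η * (w * L)) := Real.one_le_exp (by positivity)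
    nlinarith
  · exact fun d hd => abs_selbergWt_qpow_le hη0.le (zero_le_one.trans hC₂) hdiv hd
  · intro s hs hsT
    have hs2 : 1 / 2 ≤ s.re := by
      have : R / L ≤ 1 / 2 := by rw [div_le_iff₀ hLpos]; linarith
      linarith
    refine ⟨by linarith, ?_⟩
    have h6 : ((qpow q y + 1 : ℕ) : ℝ) ^ (-s.re) ≤ Real.exp (-(y * L)) * Real.exp (y * R) := by
      have hy0 : 0 < y := by linarith
      calc ((qpow q y + 1 : ℕ) : ℝ) ^ (-s.re) ≤ (Real.exp (y * L)) ^ (-s.re) :=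
            Real.rpow_le_rpow_of_nonpos (Real.exp_pos _) (lt_qpow_succ q y).le (by linarith)
        _ = Real.exp (-(y * L * s.re)) := by rw [← Real.exp_mul]; ring_nf
        _ ≤ Real.exp (-(y * L) + y * R) := by
            refine Real.exp_le_exp.2 ?_
            have : y * L * (1 - R / L) ≤ y * L * s.re :=
              mul_le_mul_of_nonneg_left hs (by positivity)
            have e : y * L * (1 - R / L) = y * L - y * R := by field_simp
            linarith
        _ = _ := Real.exp_add _ _
    have h7 : ‖s‖ / s.re ≤ T / (1 / 2) := by gcongr
    have hv' := qpow_le q v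
    have hw' := qpow_le q w
    rw [← hL] at hv' hw'
    calc (qpow q v) * (C₂ * Real.exp (η * (w * L))) * ((qpow q w) * (C₂ * Real.exp (η * (w * L)))) *
          (2 * (C₁ * (q : ℝ) ^ (1 / 2 + η)) * (1 + ‖s‖ / s.re) *
            ((qpow q y + 1 : ℕ) : ℝ) ^ (-s.re))
        ≤ Real.exp (v * L) * (C₂ * Real.exp (η * (w * L))) *
          (Real.exp (w * L) * (C₂ * Real.exp (η * (w * L)))) *
          (2 * (C₁ * Real.exp ((1 / 2 + η) * L)) * (1 + T / (1 / 2)) *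
            (Real.exp (-(y * L)) * Real.exp (y * R))) := by
          rw [hqe]
          have : 0 ≤ ‖s‖ / s.re := by positivity
          have h8 : 1 + ‖s‖ / s.re ≤ 1 + T / (1 / 2) := by linarith
          gcongr
      _ = K * Real.exp (-((y - v - w - 1 / 2) / 2) * L) := by
          have e : Real.exp (-((y - v - w - 1 / 2) / 2) * L) = Real.exp (v * L) *
              Real.exp (η * (w * L)) * Real.exp (w * L) * Real.exp (η * (w * L)) *
              Real.exp ((1 / 2 + η) * L) * Real.exp (-(y * L)) := by
            simp only [← Real.exp_add]
            congr 1
            linear_combination (-L) * hηe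
          rw [e, hK]; ring
      _ ≤ ε := h1

/-- Selberg's divisor sum of level `q ^ w`. -/
noncomputable def selbergDiv (q : ℕ) (w : ℝ) (n : ℕ) : ℝ :=
  divSum (qpow q w) (selbergWt (qpow q w)) n

theorem detection {F : ℝ → ℝ} {R u v w x ε : ℝ} (hR : 0 < R) (hu : 0 < u) (hv : 0 < v)
    (hw : 0 < w) (hx : v + w + 1 / 2 < x) (hux : u ≤ x) (hF1 : ∀ t, 0 ≤ t → t ≤ u → F t = 1)
    (hF0 : ∀ t, v ≤ t → F t = 0) (hF : ∀ t, 0 ≤ t → |F t| ≤ 1) (hε : 0 < ε) :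
    ∃ q₀ : ℕ, ∀ q : ℕ, [NeZero q] → q₀ ≤ q → ∀ χ : DirichletCharacter ℂ q, χ ≠ 1 → ∀ ρ : ℂ,
      ρ ∈ rect q R → χ.LFunction ρ = 0 →
      1 - ε ≤ ‖∑ n ∈ Ioc (qpow q u) (qpow q x),
        ((sieveWt F (Real.log q) n * selbergDiv q w n : ℝ) : ℂ) * (χ n * (n : ℂ) ^ (-ρ))‖ := by
  obtain ⟨q₀, hq₀⟩ := crude_bound (T := 1 + R) hR (by linarith) hw hv hx hε
  obtain ⟨q₁, hq₁⟩ := eventually_atTop.1 (tendsto_log_nat.eventually_ge_atTop R)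
  refine ⟨max q₀ (max 2 q₁), fun q _ hq χ hχ ρ hρ hρ0 => ?_⟩
  obtain ⟨B, β, hβ, hB, hβw, hs⟩ := hq₀ q (le_trans (le_max_left _ _) hq)
  have hq' := le_trans (le_max_right _ _) hq
  have hq2 : 2 ≤ q := le_trans (le_max_left _ _) hq'
  have hLR := hq₁ q (le_trans (le_max_right _ _) hq')
  have hq1 : (1 : ℝ) < q := by exact_mod_cast (by omega : 1 < q)
  have hL : 0 < Real.log q := Real.log_pos hq1
  obtain ⟨hρ1, hρ2, hρ3⟩ := hρ
  have hx0 : 0 < x := by linarith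
  have hRL : R / Real.log q ≤ 1 := by rw [div_le_one hL]; exact hLR
  obtain ⟨hre, hle⟩ := hs ρ hρ1 (by
    refine (Complex.norm_le_abs_re_add_abs_im ρ).trans (add_le_add ?_ hρ3)
    rw [abs_le]; constructor <;> linarith)
  have hW0 : 0 < qpow q w := qpow_pos (by omega) hw.le
  set a : ℕ → ℝ := fun d => (ArithmeticFunction.moebius d : ℝ) * F (Real.log d / Real.log q)
  have hψ : ∀ n : ℕ, n ≠ 0 → sieveWt F (Real.log q) n = divSum (qpow q v) a n := fun n hn =>
    sieveWt_eq_divSum hL hF0 (fun d hd h => (le_qpow_iff hd).2 h.le) hn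
  set f : ℕ → ℂ := fun n => ((sieveWt F (Real.log q) n * selbergDiv q w n : ℝ) : ℂ) *
    (χ n * (n : ℂ) ^ (-ρ)) with hf
  have ha : ∀ d ∈ Icc 1 (qpow q v), |a d| ≤ β := by
    intro d hd
    have hd1 : (1 : ℝ) ≤ d := by exact_mod_cast (mem_Icc.1 hd).1
    have hμ : |(ArithmeticFunction.moebius d : ℝ)| ≤ 1 := by
      exact_mod_cast ArithmeticFunction.abs_moebius_le_one
    have h2 := hF (Real.log d / Real.log q) (div_nonneg (Real.log_nonneg hd1) hL.le)
    rw [abs_mul]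
    have h0 := abs_nonneg (F (Real.log d / Real.log q))
    have h0' := abs_nonneg (ArithmeticFunction.moebius d : ℝ)
    nlinarith
  have htot : ‖∑ n ∈ Ioc 0 (qpow q x), f n‖ ≤ ε := by
    have h1 : ∑ n ∈ Ioc 0 (qpow q x), f n = ∑ n ∈ Ioc 0 (qpow q x),
        ((divSum (qpow q v) a n * divSum (qpow q w) (selbergWt (qpow q w)) n : ℝ) : ℂ) *
          (χ n * (n : ℂ) ^ (-ρ)) := by
      refine sum_congr rfl fun n hn => ?_
      rw [hf, ← hψ n (by have := (mem_Ioc.1 hn).1; omega)]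
      rfl
    rw [h1]
    refine (norm_sum_divSum_mul_divSum_le ha hβw (by linarith) _ _ fun m hm =>
      norm_sum_Icc_dvd_le_of_zero hχ (hB χ hχ) hre hρ0 hm _).trans ?_
    exact hle
  have h1x : 1 ≤ qpow q x := qpow_pos (by omega) hx0.le
  have hux' : qpow q u ≤ qpow q x := by
    refine Nat.floor_le_floor (Real.exp_le_exp.2 ?_)
    gcongr
  have h1u : 1 ≤ qpow q u := qpow_pos (by omega) hu.le
  have hsplit : ∑ n ∈ Ioc 0 (qpow q x), f n = 1 + ∑ n ∈ Ioc (qpow q u) (qpow q x), f n := by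
    rw [← Finset.sum_Ioc_consecutive f (Nat.zero_le _) hux']
    congr 1
    rw [Finset.sum_eq_single 1]
    · have h4 : selbergDiv q w 1 = 1 := by
        rw [selbergDiv, divSum]
        have : (Icc 1 (qpow q w)).filter (· ∣ 1) = {1} := by
          ext d
          simp only [mem_filter, mem_Icc, Nat.dvd_one, mem_singleton]
          constructor
          · exact fun h => h.2
          · rintro rfl; exact ⟨⟨le_rfl, hW0⟩, rfl⟩
        rw [this, Finset.sum_singleton, selbergWt_one hW0]
      rw [hf]
      simp only [sieveWt_one, h4, hF1 0 le_rfl hu.le]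
      simp
    · intro n hn hn1
      rw [mem_Ioc] at hn
      rw [hf]
      simp only
      rw [sieveWt_eq_zero hL hF1 (by omega) ((le_qpow_iff (by omega)).1 hn.2)]
      simp
    · intro h
      exact absurd (mem_Ioc.2 ⟨by omega, h1u⟩) h
  rw [hsplit] at htot
  have h9 : ‖(1 : ℂ)‖ - ‖∑ n ∈ Ioc (qpow q u) (qpow q x), f n‖ ≤
      ‖1 + ∑ n ∈ Ioc (qpow q u) (qpow q x), f n‖ := norm_sub_le_norm_add _ _
  rw [norm_one] at h9
  linarith

end LFZ

namespace LFZ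
open Finset Filter Topology Metric Real MeasureTheory

theorem norm_cell_sub_integral_le {h : ℝ → ℂ} {C M L : ℝ} (hC : ∀ s t, ‖h s - h t‖ ≤ C * |s - t|)
    (hM : ∀ t, ‖h t‖ ≤ M) (hh : Continuous h) (hL : 0 < L) {m k : ℕ} (hm : 0 < m) (hk : 0 < k) :
    ‖(k : ℝ)⁻¹ • h (Real.log (m * k) / L) -
      ∫ t in (k : ℝ)..(k + 1 : ℕ), t⁻¹ • h (Real.log (m * t) / L)‖ ≤
      2 * (M + C / L) * ((k : ℝ)⁻¹ - ((k + 1 : ℕ) : ℝ)⁻¹) := by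
  have hk0 : (0 : ℝ) < k := by exact_mod_cast hk
  have hk1 : (1 : ℝ) ≤ k := by exact_mod_cast hk
  have hm0 : (0 : ℝ) < m := by exact_mod_cast hm
  have hM0 : 0 ≤ M := (norm_nonneg _).trans (hM 0)
  have hC0 : 0 ≤ C := by
    have := (norm_nonneg _).trans (hC 1 0)
    simpa using this
  have hcont : ContinuousOn (fun t : ℝ => t⁻¹ • h (Real.log (m * t) / L))
      (Set.uIcc (k : ℝ) (k + 1 : ℕ)) := by
    have hpos : ∀ t ∈ Set.uIcc (k : ℝ) (k + 1 : ℕ), 0 < t := by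
      intro t ht
      rw [Set.uIcc_of_le (by push_cast; linarith)] at ht
      exact hk0.trans_le ht.1
    refine ContinuousOn.smul (continuousOn_inv₀.mono fun t ht => (hpos t ht).ne') ?_
    refine hh.comp_continuousOn (ContinuousOn.div_const (ContinuousOn.log (by fun_prop) ?_) L)
    intro t ht
    exact (mul_pos hm0 (hpos t ht)).ne'
  have hint := hcont.intervalIntegrable (μ := volume)
  have hconst : (k : ℝ)⁻¹ • h (Real.log (m * k) / L) =
      ∫ _ in (k : ℝ)..(k + 1 : ℕ), (k : ℝ)⁻¹ • h (Real.log (m * k) / L) := by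
    rw [intervalIntegral.integral_const]; push_cast; simp
  rw [hconst, ← intervalIntegral.integral_sub (by simp) hint]
  have hb : ∀ t ∈ Set.uIoc (k : ℝ) (k + 1 : ℕ), ‖(k : ℝ)⁻¹ • h (Real.log (m * k) / L) -
      t⁻¹ • h (Real.log (m * t) / L)‖ ≤ (M + C / L) * ((k : ℝ)⁻¹ * (k : ℝ)⁻¹) := by
    intro t ht
    rw [Set.uIoc_of_le (by push_cast; linarith)] at ht
    obtain ⟨ht1, ht2⟩ := ht
    push_cast at ht2
    have ht0 : 0 < t := hk0.trans ht1
    have e : (k : ℝ)⁻¹ • h (Real.log (m * k) / L) - t⁻¹ • h (Real.log (m * t) / L) =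
        (k : ℝ)⁻¹ • (h (Real.log (m * k) / L) - h (Real.log (m * t) / L)) +
        ((k : ℝ)⁻¹ - t⁻¹) • h (Real.log (m * t) / L) := by
      rw [smul_sub, sub_smul]; abel
    rw [e]
    have h1 : 0 ≤ (k : ℝ)⁻¹ - t⁻¹ := sub_nonneg.2 (inv_anti₀ hk0 ht1.le)
    have h2 : (k : ℝ)⁻¹ - t⁻¹ ≤ (k : ℝ)⁻¹ * (k : ℝ)⁻¹ := by
      rw [inv_sub_inv hk0.ne' ht0.ne', ← mul_inv, ← one_div]
      gcongr
      linarith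
    have h3 : |Real.log (m * k) / L - Real.log (m * t) / L| ≤ (k : ℝ)⁻¹ / L := by
      rw [← sub_div, abs_div, abs_of_pos hL, abs_sub_comm, Real.log_mul hm0.ne' ht0.ne',
        Real.log_mul hm0.ne' hk0.ne', add_sub_add_left_eq_sub,
        abs_of_nonneg (sub_nonneg.2 (Real.log_le_log hk0 ht1.le)), ← Real.log_div ht0.ne' hk0.ne']
      gcongr
      refine (Real.log_le_sub_one_of_pos (by positivity)).trans ?_
      rw [div_sub_one hk0.ne', ← one_div]
      gcongr
      linarith
    refine (norm_add_le _ _).trans ?_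
    rw [norm_smul, norm_smul, Real.norm_of_nonneg (by positivity), Real.norm_of_nonneg h1]
    calc (k : ℝ)⁻¹ * ‖h (Real.log (m * k) / L) - h (Real.log (m * t) / L)‖ +
          ((k : ℝ)⁻¹ - t⁻¹) * ‖h (Real.log (m * t) / L)‖
        ≤ (k : ℝ)⁻¹ * (C * ((k : ℝ)⁻¹ / L)) + ((k : ℝ)⁻¹ * (k : ℝ)⁻¹) * M := by
          have := (hC (Real.log (m * k) / L) (Real.log (m * t) / L)).trans
            (mul_le_mul_of_nonneg_left h3 hC0)
          have := hM (Real.log (m * t) / L)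
          gcongr
      _ = _ := by ring
  refine (intervalIntegral.norm_integral_le_of_norm_le_const hb).trans ?_
  have h4 : |((k + 1 : ℕ) : ℝ) - k| = 1 := by push_cast; simp
  rw [h4, mul_one, mul_comm 2, mul_assoc]
  have h5 : 0 ≤ M + C / L := by positivity
  refine mul_le_mul_of_nonneg_left ?_ h5
  push_cast
  rw [inv_sub_inv hk0.ne' (by positivity), ← mul_inv, add_sub_cancel_left, mul_one_div, ← one_div,
    div_le_div_iff₀ (by positivity) (by positivity)]
  nlinarith

theorem norm_sum_dvd_sub_integral_le {h : ℝ → ℂ} {C M u x : ℝ} {q : ℕ}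
    (hC : ∀ s t, ‖h s - h t‖ ≤ C * |s - t|) (hM : ∀ t, ‖h t‖ ≤ M)
    (hu : ∀ t ≤ u, h t = 0) (hx : ∀ t, x ≤ t → h t = 0) (hux : u ≤ x)
    (hq : 1 < q) {m : ℕ} (hm : 0 < m) (hmu : m ≤ qpow q u) :
    ‖∑ n ∈ (Ioc (qpow q u) (qpow q x)).filter (m ∣ ·), (n : ℝ)⁻¹ • h (Real.log n / Real.log q) -
      (Real.log q / m) • ∫ t in u..x, h t‖ ≤
      4 * (M + C / Real.log q) * Real.exp (-(u * Real.log q)) := by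
  set L := Real.log q with hLdef
  have hL : 0 < L := Real.log_pos (by exact_mod_cast hq)
  have hM0 : 0 ≤ M := (norm_nonneg _).trans (hM 0)
  have hC0 : 0 ≤ C := by
    have := (norm_nonneg _).trans (hC 1 0)
    simpa using this
  have hh : Continuous h := by
    have : LipschitzWith ⟨C, hC0⟩ h := LipschitzWith.of_dist_le_mul fun s t => by
      rw [dist_eq_norm, Real.dist_eq]; exact hC s t
    exact this.continuous
  have hm0 : (0 : ℝ) < m := by exact_mod_cast hm
  set K₁ := qpow q u / m with hK1
  set K₂ := qpow q x / m + 1 with hK2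
  have hK1pos : 0 < K₁ := Nat.div_pos hmu hm
  have hUN : qpow q u ≤ qpow q x := by
    refine Nat.floor_le_floor (Real.exp_le_exp.2 ?_)
    gcongr
  have hK12 : K₁ + 1 ≤ K₂ := by
    have := Nat.div_le_div_right (c := m) hUN
    omega
  have hK1r : (0 : ℝ) < K₁ := by exact_mod_cast hK1pos
  have hmK1 : (m : ℝ) * K₁ ≤ Real.exp (u * L) := by
    have : m * K₁ ≤ qpow q u := Nat.mul_div_le _ _
    exact le_trans (by exact_mod_cast this) (qpow_le q u)
  have hmK2 : Real.exp (x * L) ≤ (m : ℝ) * K₂ := by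
    have : qpow q x + 1 ≤ m * K₂ := Nat.lt_mul_div_succ _ hm
    exact (lt_qpow_succ q x).le.trans (by exact_mod_cast this)
  have hK1log : Real.log (m * K₁) / L ≤ u := by
    rw [div_le_iff₀ hL, Real.log_le_iff_le_exp (by positivity)]; exact hmK1
  have hK2log : x ≤ Real.log (m * K₂) / L := by
    have : (0 : ℝ) < K₂ := by exact_mod_cast (by omega : 0 < K₂)
    rw [le_div_iff₀ hL, Real.le_log_iff_exp_le (by positivity)]; exact hmK2
  -- the sum
  have hsum : ∑ n ∈ (Ioc (qpow q u) (qpow q x)).filter (m ∣ ·), (n : ℝ)⁻¹ • h (Real.log n / L) =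
      (m : ℝ)⁻¹ • ∑ k ∈ Ico K₁ K₂, (k : ℝ)⁻¹ • h (Real.log (m * k) / L) := by
    rw [sum_Ioc_filter_dvd hm, Finset.sum_eq_sum_Ico_succ_bot (by omega : K₁ < K₂), hu _ hK1log,
      smul_zero, zero_add, Finset.smul_sum]
    have : Ioc K₁ (qpow q x / m) = Ico (K₁ + 1) K₂ := by
      ext k; simp only [mem_Ioc, mem_Ico]; omega
    rw [this]
    refine sum_congr rfl fun k _ => ?_
    rw [Nat.cast_mul, mul_inv, mul_smul]
  -- the integral
  have hpos : ∀ t ∈ Set.uIcc (K₁ : ℝ) K₂, 0 < t := by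
    intro t ht
    rw [Set.uIcc_of_le (by exact_mod_cast (by omega : K₁ ≤ K₂))] at ht
    exact hK1r.trans_le ht.1
  have hint : ∫ t in (K₁ : ℝ)..K₂, t⁻¹ • h (Real.log (m * t) / L) = L • ∫ t in u..x, h t := by
    have h1 := intervalIntegral.integral_deriv_smul_comp (a := (K₁ : ℝ)) (b := K₂)
      (f := fun t : ℝ => Real.log (m * t) / L) (f' := fun t => t⁻¹ / L) (g := h) (by
        intro t ht
        have ht0 := hpos t ht
        have h2 := ((hasDerivAt_id t).const_mul (m : ℝ)).log (by simp; exact ⟨hm.ne', ht0.ne'⟩)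
        refine (h2.div_const L).congr_deriv ?_
        simp only [id]
        field_simp) (by
        refine ContinuousOn.div_const (continuousOn_inv₀.mono fun t ht => (hpos t ht).ne') L) hh
    have h2 : ∫ t in (Real.log (m * K₁) / L)..(Real.log (m * K₂) / L), h t = ∫ t in u..x, h t := by
      have hi : ∀ a b, IntervalIntegrable h volume a b := fun a b => hh.intervalIntegrable a b
      rw [← intervalIntegral.integral_add_adjacent_intervals (hi _ u) (hi u _),
        ← intervalIntegral.integral_add_adjacent_intervals (hi u x) (hi x _)]
      rw [intervalIntegral.integral_zero_ae (a := Real.log (m * K₁) / L), 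
        intervalIntegral.integral_zero_ae (a := x)]
      · simp
      · refine Filter.Eventually.of_forall fun t ht => hx t ?_
        rw [Set.uIoc_of_le hK2log] at ht; exact ht.1.le
      · refine Filter.Eventually.of_forall fun t ht => hu t ?_
        rw [Set.uIoc_of_le hK1log] at ht; exact ht.2
    rw [← h2, ← h1, ← intervalIntegral.integral_smul]
    refine intervalIntegral.integral_congr fun t ht => ?_
    simp only [Function.comp, smul_smul]
    congr 1
    field_simp
  have hsplit : ∫ t in (K₁ : ℝ)..K₂, t⁻¹ • h (Real.log (m * t) / L) =
      ∑ k ∈ Ico K₁ K₂, ∫ t in (k : ℝ)..(k + 1 : ℕ), t⁻¹ • h (Real.log (m * t) / L) := by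
    rw [intervalIntegral.sum_integral_adjacent_intervals_Ico (a := fun k : ℕ => (k : ℝ)) (by omega)]
    intro k hk
    refine ContinuousOn.intervalIntegrable ?_
    have hpos' : ∀ t ∈ Set.uIcc (k : ℝ) (k + 1 : ℕ), 0 < t := by
      intro t ht
      rw [Set.uIcc_of_le (by push_cast; linarith)] at ht
      have : (K₁ : ℝ) ≤ k := by exact_mod_cast hk.1
      linarith [ht.1]
    refine ContinuousOn.smul (continuousOn_inv₀.mono fun t ht => (hpos' t ht).ne') ?_
    refine hh.comp_continuousOn (ContinuousOn.div_const (ContinuousOn.log (by fun_prop) ?_) L)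
    intro t ht
    exact (mul_pos hm0 (hpos' t ht)).ne'
  have hmain : ‖∑ k ∈ Ico K₁ K₂, (k : ℝ)⁻¹ • h (Real.log (m * k) / L) -
      L • ∫ t in u..x, h t‖ ≤ 2 * (M + C / L) * (K₁ : ℝ)⁻¹ := by
    rw [← hint, hsplit, ← Finset.sum_sub_distrib]
    refine (norm_sum_le_of_le _ fun k hk => norm_cell_sub_integral_le hC hM hh hL hm
      (hK1pos.trans_le (mem_Ico.1 hk).1)).trans ?_
    rw [← mul_sum]
    have htel : ∑ k ∈ Ico K₁ K₂, ((k : ℝ)⁻¹ - ((k + 1 : ℕ) : ℝ)⁻¹) = (K₁ : ℝ)⁻¹ - (K₂ : ℝ)⁻¹ := by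
      have := Finset.sum_Ico_sub (fun k : ℕ => -(k : ℝ)⁻¹) (by omega : K₁ ≤ K₂)
      rw [show (K₁ : ℝ)⁻¹ - (K₂ : ℝ)⁻¹ = -(K₂ : ℝ)⁻¹ - -(K₁ : ℝ)⁻¹ by ring, ← this]
      exact sum_congr rfl fun k _ => by ring
    rw [htel]
    have : (0 : ℝ) ≤ (K₂ : ℝ)⁻¹ := by positivity
    have h5 : 0 ≤ M + C / L := by positivity
    gcongr
    linarith
  rw [hsum]
  have e : (L / m) • ∫ t in u..x, h t = (m : ℝ)⁻¹ • (L • ∫ t in u..x, h t) := by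
    rw [smul_smul]; congr 1; field_simp
  rw [e, ← smul_sub, norm_smul, Real.norm_of_nonneg (by positivity)]
  have hlow : Real.exp (u * L) ≤ 2 * (m * K₁) := by
    have h1 : qpow q u + 1 ≤ m * (K₁ + 1) := Nat.lt_mul_div_succ _ hm
    have h2 : m * (K₁ + 1) ≤ 2 * (m * K₁) := by nlinarith
    exact (lt_qpow_succ q u).le.trans (by exact_mod_cast h1.trans h2)
  have hinv : (m : ℝ)⁻¹ * (K₁ : ℝ)⁻¹ ≤ 2 * Real.exp (-(u * L)) := by
    rw [Real.exp_neg, ← mul_inv, ← one_div, ← div_eq_mul_inv,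
      div_le_div_iff₀ (by positivity) (Real.exp_pos _)]
    linarith
  have h5 : 0 ≤ M + C / L := by positivity
  calc (m : ℝ)⁻¹ * ‖_‖ ≤ (m : ℝ)⁻¹ * (2 * (M + C / L) * (K₁ : ℝ)⁻¹) := by gcongr
    _ = 2 * (M + C / L) * ((m : ℝ)⁻¹ * (K₁ : ℝ)⁻¹) := by ring
    _ ≤ 2 * (M + C / L) * (2 * Real.exp (-(u * L))) := by gcongr
    _ = _ := by ring

theorem norm_exp_sub_exp_le {z : ℂ} {Z x a b : ℝ} (hZ : 0 ≤ Z) (hz : |z.re| ≤ Z)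
    (ha : a ∈ Set.Icc 0 x) (hb : b ∈ Set.Icc 0 x) :
    ‖Complex.exp (z * b) - Complex.exp (z * a)‖ ≤ ‖z‖ * Real.exp (Z * x) * |b - a| := by
  have hbd : ∀ t ∈ Set.Icc 0 x, ‖Complex.exp (z * t) * z‖ ≤ ‖z‖ * Real.exp (Z * x) := by
    intro t ht
    rw [norm_mul, mul_comm, Complex.norm_exp]
    have h1 : (z * (t : ℂ)).re = z.re * t := by simp
    rw [h1]
    have h2 : z.re * t ≤ Z * x :=
      mul_le_mul ((le_abs_self _).trans hz) ht.2 ht.1 hZ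
    gcongr
  have hd : ∀ t ∈ Set.Icc 0 x, HasDerivWithinAt (fun t : ℝ => Complex.exp (z * t))
      (Complex.exp (z * t) * z) (Set.Icc 0 x) t := by
    intro t _
    have h1 : HasDerivAt (fun t : ℝ => z * (t : ℂ)) z t := by
      simpa using (Complex.ofRealCLM.hasDerivAt (x := t)).const_mul z
    exact h1.cexp.hasDerivWithinAt
  simpa using Convex.norm_image_sub_le_of_norm_hasDerivWithin_le hd hbd (convex_Icc 0 x) ha hb

theorem norm_mul_exp_sub_le {g : ℝ → ℝ} {C u x Z : ℝ} {z : ℂ}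
    (hg : ∀ s t, |g s - g t| ≤ C * |s - t|) (hg1 : ∀ t, |g t| ≤ 1) (hu : ∀ t ≤ u, g t = 0)
    (hx : ∀ t, x ≤ t → g t = 0) (hu0 : 0 ≤ u) (hux : u ≤ x) (hZ : 0 ≤ Z) (hz : |z.re| ≤ Z) :
    (∀ t, ‖(g t : ℂ) * Complex.exp (z * t)‖ ≤ Real.exp (Z * x)) ∧
    ∀ s t, ‖(g s : ℂ) * Complex.exp (z * s) - (g t : ℂ) * Complex.exp (z * t)‖ ≤
      (C + ‖z‖) * Real.exp (Z * x) * |s - t| := by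
  set c : ℝ → ℝ := fun t => max u (min t x) with hc
  have hcm : ∀ t, c t ∈ Set.Icc 0 x := fun t =>
    ⟨hu0.trans (le_max_left _ _), max_le hux (min_le_right _ _)⟩
  have hcl : ∀ s t, |c s - c t| ≤ |s - t| := by
    intro s t
    refine (abs_max_sub_max_le_max u (min s x) u (min t x)).trans (max_le (by simp) ?_)
    exact (abs_min_sub_min_le_max s x t x).trans (max_le le_rfl (by simp))
  have hk : ∀ t, (g t : ℂ) * Complex.exp (z * t) = (g t : ℂ) * Complex.exp (z * (c t : ℝ)) := by
    intro t
    rcases le_total t u with h | h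
    · rw [hu t h]; simp
    · rcases le_total x t with h' | h'
      · rw [hx t h']; simp
      · rw [hc]; simp only; rw [min_eq_left h', max_eq_right h]
  have hE : ∀ t, ‖Complex.exp (z * (c t : ℝ))‖ ≤ Real.exp (Z * x) := by
    intro t
    rw [Complex.norm_exp]
    have h1 : (z * ((c t : ℝ) : ℂ)).re = z.re * c t := by simp
    rw [h1]
    have h2 : z.re * c t ≤ Z * x :=
      mul_le_mul ((le_abs_self _).trans hz) (hcm t).2 (hcm t).1 hZ
    gcongr
  refine ⟨fun t => ?_, fun s t => ?_⟩
  · rw [hk, norm_mul, Complex.norm_real, Real.norm_eq_abs]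
    calc _ ≤ 1 * Real.exp (Z * x) := mul_le_mul (hg1 t) (hE t) (norm_nonneg _) zero_le_one
      _ = _ := one_mul _
  · rw [hk, hk]
    have e : (g s : ℂ) * Complex.exp (z * (c s : ℝ)) - (g t : ℂ) * Complex.exp (z * (c t : ℝ)) =
        ((g s - g t : ℝ) : ℂ) * Complex.exp (z * (c s : ℝ)) +
        (g t : ℂ) * (Complex.exp (z * (c s : ℝ)) - Complex.exp (z * (c t : ℝ))) := by
      push_cast; ring
    rw [e]
    refine (norm_add_le _ _).trans ?_
    rw [norm_mul, norm_mul, Complex.norm_real, Complex.norm_real, Real.norm_eq_abs,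
      Real.norm_eq_abs]
    have h1 := norm_exp_sub_exp_le hZ hz (hcm t) (hcm s)
    calc |g s - g t| * ‖Complex.exp (z * (c s : ℝ))‖ +
          |g t| * ‖Complex.exp (z * (c s : ℝ)) - Complex.exp (z * (c t : ℝ))‖
        ≤ C * |s - t| * Real.exp (Z * x) + 1 * (‖z‖ * Real.exp (Z * x) * |s - t|) := by
          refine add_le_add (mul_le_mul (hg s t) (hE s) (norm_nonneg _)
            ((abs_nonneg _).trans (hg s t))) (mul_le_mul (hg1 t) (h1.trans ?_) (norm_nonneg _)
            zero_le_one)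
          exact mul_le_mul_of_nonneg_left (hcl s t) (by positivity)
      _ = _ := by ring

theorem smoothed_selberg_sum {g : ℝ → ℝ} {C u x w Z ε : ℝ}
    (hg : ∀ s t, |g s - g t| ≤ C * |s - t|) (hg1 : ∀ t, |g t| ≤ 1) (hu : ∀ t ≤ u, g t = 0)
    (hx : ∀ t, x ≤ t → g t = 0) (hux : u ≤ x) (hw : 0 < w) (hwu : 2 * w < u) (hZ : 0 ≤ Z)
    (hε : 0 < ε) :
    ∃ q₀ : ℕ, ∀ q : ℕ, q₀ ≤ q → ∀ z : ℂ, |z.re| ≤ Z → ‖z‖ ≤ Z * Real.log q →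
      ‖∑ n ∈ Ioc (qpow q u) (qpow q x), ((selbergDiv q w n * selbergDiv q w n : ℝ) : ℂ) *
        ((n : ℝ)⁻¹ • ((g (Real.log n / Real.log q) : ℂ) *
          Complex.exp (z * (Real.log n / Real.log q : ℝ)))) -
        (Real.log q / selbergSum (qpow q w)) • ∫ t in u..x, (g t : ℂ) * Complex.exp (z * t)‖
        ≤ ε := by
  have hC0 : 0 ≤ C := by
    have := (abs_nonneg _).trans (hg 1 0)
    simpa using this
  set η := (u - 2 * w) / (2 * (2 * w)) with hη
  have hη0 : 0 < η := div_pos (by linarith) (by positivity)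
  have hηe : η * (2 * w) = (u - 2 * w) / 2 := by rw [hη]; field_simp
  obtain ⟨C₂, hC₂, hdiv⟩ := card_divisors_le_rpow hη0
  set K := C₂ * C₂ * (4 * (Real.exp (Z * x) + (C + Z) * Real.exp (Z * x))) with hK
  have hev := ((tendsto_mul_exp_neg_log K (c := (u - 2 * w) / 2)
    (by linarith)).eventually_le_const hε).and
    ((tendsto_log_nat.eventually_ge_atTop 1).and (eventually_ge_atTop 2))
  obtain ⟨q₀, hq₀⟩ := eventually_atTop.1 hev
  refine ⟨q₀, fun q hq z hz hzL => ?_⟩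
  obtain ⟨h1, h2, h3⟩ := hq₀ q hq
  set L := Real.log q with hL
  have hLpos : 0 < L := by linarith
  set W := qpow q w with hW
  have hWpos : 0 < W := qpow_pos (by omega) hw.le
  set h : ℝ → ℂ := fun t => (g t : ℂ) * Complex.exp (z * t) with hh
  obtain ⟨hM, hLip⟩ := norm_mul_exp_sub_le hg hg1 hu hx (by linarith) hux hZ hz
  have hβ : ∀ d ∈ Icc 1 W, |selbergWt W d| ≤ C₂ * Real.exp (η * (w * L)) :=
    fun d hd => abs_selbergWt_qpow_le hη0.le (zero_le_one.trans hC₂) hdiv hd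
  set I := ∫ t in u..x, h t with hI
  have hmain : (L / selbergSum W) • I = ∑ d ∈ Icc 1 W, ∑ e ∈ Icc 1 W,
      ((selbergWt W d * selbergWt W e : ℝ) : ℂ) * ((L / (d.lcm e : ℕ)) • I) := by
    have := sum_selbergWt_mul_lcm hWpos
    rw [div_eq_mul_inv, ← this, mul_sum, Finset.sum_smul]
    refine sum_congr rfl fun d _ => ?_
    rw [mul_sum, Finset.sum_smul]
    refine sum_congr rfl fun e _ => ?_
    simp only [Complex.real_smul]
    push_cast
    ring
  have hsum : ∑ n ∈ Ioc (qpow q u) (qpow q x), ((selbergDiv q w n * selbergDiv q w n : ℝ) : ℂ) *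
        ((n : ℝ)⁻¹ • ((g (Real.log n / L) : ℂ) * Complex.exp (z * (Real.log n / L : ℝ)))) =
      ∑ d ∈ Icc 1 W, ∑ e ∈ Icc 1 W, ((selbergWt W d * selbergWt W e : ℝ) : ℂ) *
        ∑ n ∈ (Ioc (qpow q u) (qpow q x)).filter (d.lcm e ∣ ·), (n : ℝ)⁻¹ • h (Real.log n / L) :=
    sum_divSum_mul_divSum W W _ _ _ fun n : ℕ => (n : ℝ)⁻¹ • h (Real.log n / L)
  rw [hsum, hmain, ← Finset.sum_sub_distrib]
  simp_rw [← Finset.sum_sub_distrib, ← mul_sub]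
  set Er := 4 * (Real.exp (Z * x) + (C + ‖z‖) * Real.exp (Z * x) / L) * Real.exp (-(u * L)) with hEr
  have hWle : (W : ℝ) ≤ Real.exp (w * L) := qpow_le q w
  have hterm : ∀ d ∈ Icc 1 W, ∀ e ∈ Icc 1 W, ‖((selbergWt W d * selbergWt W e : ℝ) : ℂ) *
      (∑ n ∈ (Ioc (qpow q u) (qpow q x)).filter (d.lcm e ∣ ·), (n : ℝ)⁻¹ • h (Real.log n / L) -
        (L / (d.lcm e : ℕ)) • I)‖ ≤
      C₂ * Real.exp (η * (w * L)) * (C₂ * Real.exp (η * (w * L))) * Er := by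
    intro d hd e he
    have hd' := mem_Icc.1 hd
    have he' := mem_Icc.1 he
    rw [norm_mul, Complex.norm_real, Real.norm_eq_abs, abs_mul]
    have hl : d.lcm e ≤ qpow q u := by
      have h6 : d.lcm e ≤ W * W :=
        (Nat.le_of_dvd (Nat.mul_pos hd'.1 he'.1) (Nat.lcm_dvd_mul d e)).trans
          (Nat.mul_le_mul hd'.2 he'.2)
      refine h6.trans (Nat.le_floor ?_)
      push_cast
      calc (W : ℝ) * W ≤ Real.exp (w * L) * Real.exp (w * L) := by gcongr
        _ = Real.exp (2 * w * L) := by rw [← Real.exp_add]; ring_nf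
        _ ≤ Real.exp (u * L) := by gcongr
    have h7 := norm_sum_dvd_sub_integral_le hLip hM
      (fun t ht => by rw [hu t ht]; simp) (fun t ht => by rw [hx t ht]; simp) hux
      (show 1 < q by omega) (Nat.lcm_pos hd'.1 he'.1) hl
    exact mul_le_mul (mul_le_mul (hβ d hd) (hβ e he) (abs_nonneg _) (by positivity)) h7
      (norm_nonneg _) (by positivity)
  refine (norm_sum_le_of_le _ fun d hd => norm_sum_le_of_le _ fun e he => hterm d hd e he).trans ?_
  have hEr2 : Er ≤ 4 * (Real.exp (Z * x) + (C + Z) * Real.exp (Z * x)) * Real.exp (-(u * L)) := by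
    rw [hEr]
    have : (C + ‖z‖) * Real.exp (Z * x) / L ≤ (C + Z) * Real.exp (Z * x) := by
      rw [div_le_iff₀ hLpos]
      have : C + ‖z‖ ≤ (C + Z) * L := by nlinarith
      nlinarith [Real.exp_pos (Z * x)]
    gcongr
  calc ∑ d ∈ Icc 1 W, ∑ e ∈ Icc 1 W,
        C₂ * Real.exp (η * (w * L)) * (C₂ * Real.exp (η * (w * L))) * Er
      = W * W * (C₂ * Real.exp (η * (w * L)) * (C₂ * Real.exp (η * (w * L))) * Er) := by
        simp; ring
    _ ≤ Real.exp (w * L) * Real.exp (w * L) *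
        (C₂ * Real.exp (η * (w * L)) * (C₂ * Real.exp (η * (w * L))) *
          (4 * (Real.exp (Z * x) + (C + Z) * Real.exp (Z * x)) * Real.exp (-(u * L)))) := by
        have : 0 ≤ Er := by positivity
        gcongr
    _ = K * Real.exp (-((u - 2 * w) / 2) * L) := by
        have e : Real.exp (-((u - 2 * w) / 2) * L) = Real.exp (w * L) * Real.exp (w * L) *
            Real.exp (η * (w * L)) * Real.exp (η * (w * L)) * Real.exp (-(u * L)) := by
          simp only [← Real.exp_add]
          congr 1
          linear_combination (-L) * hηe
        rw [e, hK]; ring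
    _ ≤ ε := h1

/-- Duality and Cauchy–Schwarz for a family of lower bounded linear forms. -/
theorem exists_dual_sq_le {ι : Type*} (P : Finset ι) (S : Finset ℕ) (ψ θ a : ℕ → ℝ)
    (ha : ∀ n ∈ S, 0 < a n) (φ : ι → ℕ → ℂ) (v : ι → ℝ) (hv : ∀ j, 0 ≤ v j) {ε : ℝ} (hε : ε ≤ 1)
    (h : ∀ j ∈ P, 1 - ε ≤ ‖∑ n ∈ S, ((ψ n * θ n : ℝ) : ℂ) * φ j n‖) :
    ∃ c : ι → ℂ, (∀ j, ‖c j‖ = 1) ∧ (1 - ε) ^ 2 * (∑ j ∈ P, v j) ^ 2 ≤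
      (∑ n ∈ S, ψ n ^ 2 * (a n)⁻¹) *
        ∑ n ∈ S, θ n ^ 2 * a n * ‖∑ j ∈ P, φ j n * (v j * c j)‖ ^ 2 := by
  choose c hc hcs using fun j => Complex.exists_norm_eq_mul_self
    (∑ n ∈ S, ((ψ n * θ n : ℝ) : ℂ) * φ j n)
  refine ⟨c, hc, ?_⟩
  have h1 : ((∑ j ∈ P, v j * ‖∑ n ∈ S, ((ψ n * θ n : ℝ) : ℂ) * φ j n‖ : ℝ) : ℂ)
      = ∑ n ∈ S, ((ψ n * θ n : ℝ) : ℂ) * ∑ j ∈ P, φ j n * (v j * c j) := by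
    rw [Complex.ofReal_sum]
    simp_rw [mul_sum]
    rw [Finset.sum_comm]
    refine sum_congr rfl fun j _ => ?_
    rw [Complex.ofReal_mul, hcs j, mul_sum, mul_sum]
    refine sum_congr rfl fun n _ => ?_
    ring
  have h2 : (1 - ε) * ∑ j ∈ P, v j ≤
      ∑ n ∈ S, |ψ n * θ n| * ‖∑ j ∈ P, φ j n * (v j * c j)‖ := by
    calc (1 - ε) * ∑ j ∈ P, v j
        ≤ ∑ j ∈ P, v j * ‖∑ n ∈ S, ((ψ n * θ n : ℝ) : ℂ) * φ j n‖ := by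
          rw [mul_sum]
          refine sum_le_sum fun j hj => ?_
          rw [mul_comm]
          exact mul_le_mul_of_nonneg_left (h j hj) (hv j)
      _ ≤ ‖((∑ j ∈ P, v j * ‖∑ n ∈ S, ((ψ n * θ n : ℝ) : ℂ) * φ j n‖ : ℝ) : ℂ)‖ := by
          rw [Complex.norm_real]; exact le_abs_self _
      _ ≤ _ := by
          rw [h1]
          refine (norm_sum_le _ _).trans (sum_le_sum fun n _ => ?_)
          rw [norm_mul, Complex.norm_real, Real.norm_eq_abs]
  have h3 : 0 ≤ (1 - ε) * ∑ j ∈ P, v j :=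
    mul_nonneg (by linarith) (Finset.sum_nonneg fun j _ => hv j)
  rw [← mul_pow]
  refine (pow_le_pow_left₀ h3 h2 2).trans ?_
  refine Finset.sum_sq_le_sum_mul_sum_of_sq_le_mul _ (fun n hn => ?_) (fun n hn => ?_)
    fun n hn => ?_
  · have := ha n hn; positivity
  · have := ha n hn; positivity
  · have := (ha n hn).ne'
    rw [mul_pow, sq_abs]
    exact le_of_eq (by field_simp)

/-- The combined exponent of a pair of zeros. -/
theorem mul_cpow_mul_conj_cpow {n : ℕ} (hn : n ≠ 0) (l : ℝ) (ρ σ : ℂ) :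
    ((n * Real.exp (-(Real.log n / l)) : ℝ) : ℂ) *
        ((n : ℂ) ^ (-ρ) * starRingEnd ℂ ((n : ℂ) ^ (-σ)))
      = (n : ℂ) ^ (-(ρ + starRingEnd ℂ σ - 1 + (1 / l : ℝ))) := by
  have hn0 : (n : ℂ) ≠ 0 := Nat.cast_ne_zero.2 hn
  have hl : Complex.log n = (Real.log n : ℂ) := by
    rw [← Complex.natCast_log]
  have hnr : (0 : ℝ) < n := by exact_mod_cast Nat.pos_of_ne_zero hn
  have h0 : ((n * Real.exp (-(Real.log n / l)) : ℝ) : ℂ)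
      = Complex.exp (Real.log n - (Real.log n / l : ℝ)) := by
    rw [← Complex.ofReal_sub, ← Complex.ofReal_exp, sub_eq_add_neg, Real.exp_add,
      Real.exp_log hnr]
  rw [h0, Complex.cpow_def_of_ne_zero hn0, Complex.cpow_def_of_ne_zero hn0,
    Complex.cpow_def_of_ne_zero hn0, ← Complex.exp_conj, ← Complex.exp_add, ← Complex.exp_add, hl]
  congr 1
  simp only [map_mul, map_neg, Complex.conj_ofReal]
  push_cast
  ring

theorem cpow_neg_eq_inv_smul_exp {n : ℕ} (hn : n ≠ 0) {l : ℝ} (hl : l ≠ 0) (s : ℂ) :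
    (n : ℂ) ^ (-s) = ((n : ℝ)⁻¹ : ℝ) • Complex.exp ((1 - s) * l * (Real.log n / l : ℝ)) := by
  have hn0 : (n : ℂ) ≠ 0 := Nat.cast_ne_zero.2 hn
  have hnr : (0 : ℝ) < n := by exact_mod_cast Nat.pos_of_ne_zero hn
  have hlog : Complex.log n = (Real.log n : ℂ) := by rw [← Complex.natCast_log]
  have h0 : (((n : ℝ)⁻¹ : ℝ) : ℂ) = Complex.exp (-Real.log n : ℝ) := by
    rw [← Complex.ofReal_exp, Real.exp_neg, Real.exp_log hnr]
  rw [Complex.real_smul, h0, Complex.cpow_def_of_ne_zero hn0, ← Complex.exp_add, hlog]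
  congr 1
  have : (l : ℂ) ≠ 0 := by exact_mod_cast hl
  push_cast
  field_simp
  ring

/-- The normalised exponent attached to a pair of zeros. -/
noncomputable def pairExp (q : ℕ) (ρ σ : ℂ) : ℂ :=
  ((lam q ρ + lam q σ - 1 : ℝ) : ℂ) - (((ρ.im - σ.im) * Real.log q : ℝ) : ℂ) * Complex.I

theorem pairExp_eq {q : ℕ} (hq : Real.log q ≠ 0) (ρ σ : ℂ) :
    (1 - (ρ + starRingEnd ℂ σ - 1 + (1 / Real.log q : ℝ))) * Real.log q = pairExp q ρ σ := by
  unfold pairExp lam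
  generalize Real.log q = l at *
  have hq' : (l : ℂ) ≠ 0 := by exact_mod_cast hq
  have h : (1 - (ρ + starRingEnd ℂ σ - 1 + (1 / l : ℝ))) * (l : ℂ)
      = (2 - ρ - starRingEnd ℂ σ) * l - 1 := by
    push_cast
    field_simp
    ring
  rw [h]
  apply Complex.ext
  · simp; ring
  · simp; ring

theorem pairExp_re (q : ℕ) (ρ σ : ℂ) : (pairExp q ρ σ).re = lam q ρ + lam q σ - 1 := by
  unfold pairExp
  generalize Real.log q = l
  simp

theorem pairExp_im (q : ℕ) (ρ σ : ℂ) :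
    (pairExp q ρ σ).im = -((ρ.im - σ.im) * Real.log q) := by
  unfold pairExp
  generalize Real.log q = l
  simp

theorem pairExp_bounds {q : ℕ} {R : ℝ} (hR : 0 < R) (hq : 1 ≤ Real.log q) {ρ σ : ℂ}
    (hρ : ρ ∈ rect q R) (hσ : σ ∈ rect q R) :
    |(pairExp q ρ σ).re| ≤ 4 * R + 1 ∧ ‖pairExp q ρ σ‖ ≤ (4 * R + 1) * Real.log q := by
  obtain ⟨h1, h2, h3⟩ := hρ
  obtain ⟨k1, k2, k3⟩ := hσ
  have hl0 : 0 < Real.log q := by linarith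
  have hlam : ∀ z : ℂ, 1 - R / Real.log q ≤ z.re → z.re ≤ 1 → 0 ≤ lam q z ∧ lam q z ≤ R := by
    intro z hz hz'
    refine ⟨mul_nonneg (by linarith) hl0.le, ?_⟩
    have : 1 - z.re ≤ R / Real.log q := by linarith
    rwa [le_div_iff₀ hl0] at this
  obtain ⟨a1, a2⟩ := hlam ρ h1 h2
  obtain ⟨b1, b2⟩ := hlam σ k1 k2
  have hre : |(pairExp q ρ σ).re| ≤ 2 * R + 1 := by
    rw [pairExp_re, abs_le]; constructor <;> linarith
  have him : |(pairExp q ρ σ).im| ≤ 2 * R * Real.log q := by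
    rw [pairExp_im, abs_neg, abs_mul, abs_of_pos hl0]
    refine mul_le_mul_of_nonneg_right ?_ hl0.le
    refine (abs_sub _ _).trans ?_
    linarith
  refine ⟨by linarith, (Complex.norm_le_abs_re_add_abs_im _).trans ?_⟩
  nlinarith

theorem sum_same_mul_le {q : ℕ} [NeZero q] (P : Finset (DirichletCharacter ℂ q × ℂ))
    (z : ℕ → DirichletCharacter ℂ q × ℂ → ℂ) {S S' : Finset ℕ} (hS : S ⊆ S') {h g : ℕ → ℝ}
    (hh : ∀ n ∈ S', 0 ≤ h n) (hg : ∀ n ∈ S', 0 ≤ g n) (hg1 : ∀ n ∈ S, g n = 1) :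
    ∑ j ∈ P, ∑ k ∈ P, (if j.1 = k.1 then
        ∑ n ∈ S, h n * (z n j * starRingEnd ℂ (z n k)).re else 0) ≤
      ∑ j ∈ P, ∑ k ∈ P, (if j.1 = k.1 then
        ∑ n ∈ S', g n * h n * (z n j * starRingEnd ℂ (z n k)).re else 0) := by
  have key : ∀ (T : Finset ℕ) (f : ℕ → ℝ), ∑ j ∈ P, ∑ k ∈ P, (if j.1 = k.1 then
        ∑ n ∈ T, f n * (z n j * starRingEnd ℂ (z n k)).re else 0)
      = ∑ n ∈ T, f n * ∑ χ : DirichletCharacter ℂ q, ‖∑ j ∈ P with j.1 = χ, z n j‖ ^ 2 := by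
    intro T f
    simp_rw [← sum_same_re_eq, mul_sum]
    rw [Finset.sum_comm (s := T)]
    refine sum_congr rfl fun j _ => ?_
    rw [Finset.sum_comm (s := T)]
    refine sum_congr rfl fun k _ => ?_
    split_ifs <;> simp
  rw [key, key]
  refine (sum_le_sum fun n hn => ?_).trans
    (Finset.sum_le_sum_of_subset_of_nonneg hS fun n hn _ => ?_)
  · rw [hg1 n hn, one_mul]
  · exact mul_nonneg (mul_nonneg (hg n hn) (hh n hn)) (Finset.sum_nonneg fun _ _ => by positivity)

theorem log_div_selbergSum_le {q : ℕ} {w : ℝ} (hw : 0 < w) (hq : 1 < q) :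
    Real.log q / selbergSum (qpow q w) ≤ 1 / w := by
  have hl : 0 < Real.log q := Real.log_pos (by exact_mod_cast hq)
  have h1 : w * Real.log q ≤ selbergSum (qpow q w) := by
    refine le_trans ?_ (log_le_selbergSum _)
    have := lt_qpow_succ q w
    push_cast at this
    exact (Real.le_log_iff_exp_le (by positivity)).2 this.le
  rw [div_le_div_iff₀ (lt_of_lt_of_le (by positivity) h1) hw]
  linarith

theorem zero_duality {F g : ℝ → ℝ} {R C M u v w x u₀ x₁ ε : ℝ} (hR : 0 < R) (hu : 0 < u)
    (hv : 0 < v) (hw : 0 < w) (hx : v + w + 1 / 2 < x) (hux : u ≤ x)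
    (hF1 : ∀ t, 0 ≤ t → t ≤ u → F t = 1) (hF0 : ∀ t, v ≤ t → F t = 0)
    (hF : ∀ t, 0 ≤ t → |F t| ≤ 1) (hM : 0 ≤ M)
    (hF2 : ∀ᶠ L in atTop, ∀ N : ℕ, (N : ℝ) ≤ Real.exp (x * L) →
      ∑ n ∈ Icc 2 N, sieveWt F L n ^ 2 * (n : ℝ)⁻¹ * Real.exp (Real.log n / L) ≤ M)
    (hg : ∀ s t, |g s - g t| ≤ C * |s - t|) (hg0 : ∀ t, 0 ≤ g t) (hg1 : ∀ t, g t ≤ 1)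
    (hgu : ∀ t ≤ u₀, g t = 0) (hgx : ∀ t, x₁ ≤ t → g t = 0)
    (hg2 : ∀ t, u ≤ t → t ≤ x → g t = 1) (hu₀ : 2 * w < u₀) (hu₀u : u₀ ≤ u) (hxx : x ≤ x₁)
    (hwu : 2 * w + 1 / 2 < u) (hε : 0 < ε) (hε1 : ε ≤ 1) :
    ∃ q₀ : ℕ, ∀ q : ℕ, [NeZero q] → q₀ ≤ q →
      ∀ P : Finset (DirichletCharacter ℂ q × ℂ),
        (∀ p ∈ P, p.1 ≠ 1 ∧ p.2 ∈ rect q R ∧ p.1.LFunction p.2 = 0) →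
      ∀ m : DirichletCharacter ℂ q × ℂ → ℝ, (∀ p, 0 ≤ m p) →
        (1 - ε) ^ 2 * (∑ p ∈ P, m p) ^ 2 ≤ M * ((∑ j ∈ P, ∑ k ∈ P, if j.1 = k.1 then
          m j * m k * (1 / w * ‖∫ t in u₀..x₁, (g t : ℂ) * Complex.exp (pairExp q j.2 k.2 * t)‖)
          else 0) + ε * (∑ p ∈ P, m p) ^ 2) := by
  obtain ⟨q₁, h₁⟩ := detection hR hu hv hw hx hux hF1 hF0 hF hε
  obtain ⟨q₂, h₂⟩ := crude_bound (R := 2 * R) (T := 2 * R + 4) (by positivity) (by positivity) hw hw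
    (show w + w + 1 / 2 < u by linarith) hε
  obtain ⟨q₃, h₃⟩ := smoothed_selberg_sum (g := g) (C := C) (u := u₀) (x := x₁) (w := w)
    (Z := 4 * R + 1) (ε := ε) hg (fun t => abs_le.2 ⟨by linarith [hg0 t], hg1 t⟩) hgu hgx
    (hu₀u.trans (hux.trans hxx)) hw hu₀ (by positivity) hε
  obtain ⟨q₄, h₄⟩ := eventually_atTop.1 (tendsto_log_nat.eventually
    (hF2.and (eventually_ge_atTop (max 1 R))))
  refine ⟨max (max q₁ q₂) (max q₃ (max q₄ 2)), fun q _ hq P hP m hm => ?_⟩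
  simp only [max_le_iff] at hq
  obtain ⟨⟨hq1, hq2⟩, hq3, hq4, hq5⟩ := hq
  obtain ⟨B, β, hβ, hB, hβw, hs⟩ := h₂ q hq2
  obtain ⟨hF2, hL⟩ := h₄ q hq4
  have hL1 : 1 ≤ Real.log q := (le_max_left _ _).trans hL
  have hLR : R ≤ Real.log q := (le_max_right _ _).trans hL
  have hK := h₃ q hq3
  have hS := log_div_selbergSum_le (q := q) hw (by omega)
  have hSp : 0 < selbergSum (qpow q w) := selbergSum_pos (qpow_pos (by omega) hw.le)
  have hU : 1 ≤ qpow q u := qpow_pos (by omega) hu.le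
  have hN := qpow_le q x
  have hsub : Ioc (qpow q u) (qpow q x) ⊆ Ioc (qpow q u₀) (qpow q x₁) := by
    refine Finset.Ioc_subset_Ioc ?_ ?_
    · exact Nat.floor_mono (Real.exp_le_exp.2 (by gcongr))
    · exact Nat.floor_mono (Real.exp_le_exp.2 (by gcongr))
  have hg3 : ∀ n ∈ Ioc (qpow q u) (qpow q x), g (Real.log n / Real.log q) = 1 := by
    intro n hn
    rw [Finset.mem_Ioc] at hn
    have hn0 : n ≠ 0 := by omega
    have a1 := (le_qpow_iff (q := q) (v := x) hn0).1 hn.2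
    have a2 : ¬ n ≤ qpow q u := by omega
    rw [le_qpow_iff hn0, not_le] at a2
    refine hg2 _ ?_ ?_
    · rw [le_div_iff₀ (by linarith)]; exact a2.le
    · rwa [div_le_iff₀ (by linarith)]
  set L := Real.log q with hLdef
  have hL0 : 0 < L := by linarith
  set a : ℕ → ℝ := fun n => n * Real.exp (-(Real.log n / L)) with ha
  set s : DirichletCharacter ℂ q × ℂ → DirichletCharacter ℂ q × ℂ → ℂ :=
    fun j k => j.2 + starRingEnd ℂ k.2 - 1 + (1 / L : ℝ) with hsdef
  obtain ⟨c, hc, hd⟩ := exists_dual_sq_le P (Ioc (qpow q u) (qpow q x)) (sieveWt F L)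
    (selbergDiv q w) a (fun n hn => by
      have : 0 < n := by rw [Finset.mem_Ioc] at hn; omega
      simp only [ha]; positivity) (fun j n => j.1 n * (n : ℂ) ^ (-j.2)) m hm hε1
    (fun j hj => h₁ q hq1 j.1 (hP j hj).1 j.2 (hP j hj).2.1 (hP j hj).2.2)
  set θ := selbergDiv q w with hθ
  set S := Ioc (qpow q u) (qpow q x) with hSdef
  set S' := Ioc (qpow q u₀) (qpow q x₁) with hSdef'
  set z : ℕ → DirichletCharacter ℂ q × ℂ → ℂ := fun n j => (n : ℂ) ^ (-j.2) * (m j * c j) with hz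
  have ha0 : ∀ n, 0 ≤ a n := fun n => by simp only [ha]; positivity
  have hpos : ∀ n ∈ S', n ≠ 0 := fun n hn => by rw [Finset.mem_Ioc] at hn; omega
  have hzz : ∀ j k n, n ≠ 0 → ((θ n ^ 2 * a n : ℝ) : ℂ) * (z n j * starRingEnd ℂ (z n k))
      = (m j * m k * (c j * starRingEnd ℂ (c k))) * ((θ n * θ n : ℝ) * (n : ℂ) ^ (-s j k)) := by
    intro j k n hn
    rw [hsdef, ← mul_cpow_mul_conj_cpow hn L]
    simp only [hz, ha, map_mul, Complex.conj_ofReal]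
    push_cast
    ring
  have hcn : ∀ j k (y : ℂ), (m j * m k * (c j * starRingEnd ℂ (c k)) * y).re ≤ m j * m k * ‖y‖ := by
    intro j k y
    refine (Complex.re_le_norm _).trans (le_of_eq ?_)
    rw [norm_mul, norm_mul, norm_mul, norm_mul, RCLike.norm_conj, hc, hc, Complex.norm_real,
      Complex.norm_real, Real.norm_of_nonneg (hm _), Real.norm_of_nonneg (hm _)]
    ring
  have hoff : ∀ j ∈ P, ∀ k ∈ P, j.1 ≠ k.1 → ∑ n ∈ S, θ n ^ 2 * a n *
      ((j.1 * k.1⁻¹ : DirichletCharacter ℂ q) n * (z n j * starRingEnd ℂ (z n k))).re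
      ≤ m j * m k * ε := by
    intro j hj k hk hjk
    have e1 : ∑ n ∈ S, θ n ^ 2 * a n *
        ((j.1 * k.1⁻¹ : DirichletCharacter ℂ q) n * (z n j * starRingEnd ℂ (z n k))).re
        = (m j * m k * (c j * starRingEnd ℂ (c k)) * ∑ n ∈ S, ((θ n * θ n : ℝ) : ℂ) *
          ((j.1 * k.1⁻¹ : DirichletCharacter ℂ q) n * (n : ℂ) ^ (-s j k))).re := by
      rw [mul_sum, Complex.re_sum]
      refine sum_congr rfl fun n hn => ?_
      rw [← Complex.re_ofReal_mul]
      congr 1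
      linear_combination ((j.1 * k.1⁻¹ : DirichletCharacter ℂ q) n) *
        hzz j k n (hpos n (hsub hn))
    rw [e1]
    refine (hcn j k _).trans (mul_le_mul_of_nonneg_left ?_ (mul_nonneg (hm j) (hm k)))
    have hχ : j.1 * k.1⁻¹ ≠ 1 := fun h => hjk (mul_inv_eq_one.1 h)
    obtain ⟨⟨j1, j2, j3⟩, ⟨k1, k2, k3⟩⟩ := (And.intro (hP j hj).2.1 (hP k hk).2.1)
    rw [← hLdef] at j1 k1
    have hsre : (s j k).re = j.2.re + k.2.re - 1 + 1 / L := by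
      simp only [hsdef, Complex.add_re, Complex.sub_re, Complex.conj_re, Complex.one_re,
        Complex.ofReal_re]
    have hsim : (s j k).im = j.2.im - k.2.im := by
      simp only [hsdef, Complex.add_im, Complex.sub_im, Complex.conj_im, Complex.one_im,
        Complex.ofReal_im]
      ring
    have hL1' : 1 / L ≤ 1 := by rw [div_le_one hL0]; exact hL1
    have hL2' : 0 < 1 / L := by positivity
    have hRL : R / L ≤ 1 := by rw [div_le_one hL0]; exact hLR
    obtain ⟨b1, b2⟩ := hs (s j k) (by rw [hsre, mul_div_assoc]; linarith) (by
      refine (Complex.norm_le_abs_re_add_abs_im _).trans ?_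
      have c1 : |(s j k).re| ≤ 2 := by rw [hsre, abs_le]; constructor <;> linarith
      have c2 : |(s j k).im| ≤ 2 * R := by
        rw [hsim]; exact (abs_sub _ _).trans (by linarith)
      linarith)
    exact (norm_sum_divSum_mul_divSum_le hβw hβw (by linarith) S _
      (fun d hd => norm_sum_Ioc_dvd_le (hB _ hχ) b1 hd _ _)).trans b2
  have hdiag : ∀ j ∈ P, ∀ k ∈ P, ∑ n ∈ S', g (Real.log n / L) * (θ n ^ 2 * a n) *
      (z n j * starRingEnd ℂ (z n k)).re ≤ m j * m k * (1 / w *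
        ‖∫ t in u₀..x₁, (g t : ℂ) * Complex.exp (pairExp q j.2 k.2 * t)‖) + m j * m k * ε := by
    intro j hj k hk
    obtain ⟨b1, b2⟩ := pairExp_bounds hR hL1 (hP j hj).2.1 (hP k hk).2.1
    have hK' := hK _ b1 b2
    have e1 : ∑ n ∈ S', g (Real.log n / L) * (θ n ^ 2 * a n) * (z n j * starRingEnd ℂ (z n k)).re
        = (m j * m k * (c j * starRingEnd ℂ (c k)) * ∑ n ∈ S', ((θ n * θ n : ℝ) : ℂ) *
          ((n : ℝ)⁻¹ • ((g (Real.log n / L) : ℂ) *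
          Complex.exp (pairExp q j.2 k.2 * (Real.log n / L : ℝ))))).re := by
      rw [mul_sum, Complex.re_sum]
      refine sum_congr rfl fun n hn => ?_
      rw [← Complex.re_ofReal_mul]
      congr 1
      have e2 := hzz j k n (hpos n hn)
      rw [cpow_neg_eq_inv_smul_exp (hpos n hn) hL0.ne', pairExp_eq hL0.ne',
        Complex.real_smul] at e2
      rw [Complex.real_smul, Complex.ofReal_mul (g _)]
      linear_combination (g (Real.log n / L) : ℂ) * e2
    rw [e1]
    refine (hcn j k _).trans ?_
    rw [← mul_add]
    refine mul_le_mul_of_nonneg_left ?_ (mul_nonneg (hm j) (hm k))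
    have e3 := norm_le_norm_add_norm_sub ((L / selbergSum (qpow q w)) • ∫ t in u₀..x₁,
      (g t : ℂ) * Complex.exp (pairExp q j.2 k.2 * t)) (∑ n ∈ S', ((θ n * θ n : ℝ) : ℂ) *
          ((n : ℝ)⁻¹ • ((g (Real.log n / L) : ℂ) *
          Complex.exp (pairExp q j.2 k.2 * (Real.log n / L : ℝ)))))
    rw [norm_sub_rev] at e3
    refine e3.trans (add_le_add ?_ hK')
    rw [norm_smul, Real.norm_of_nonneg (by positivity)]
    exact mul_le_mul_of_nonneg_right hS (norm_nonneg _)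
  have hmain : ∑ n ∈ S, θ n ^ 2 * a n * ‖∑ j ∈ P, j.1 n * (n : ℂ) ^ (-j.2) * (m j * c j)‖ ^ 2 ≤
      (∑ j ∈ P, ∑ k ∈ P, if j.1 = k.1 then
          m j * m k * (1 / w * ‖∫ t in u₀..x₁, (g t : ℂ) * Complex.exp (pairExp q j.2 k.2 * t)‖)
          else 0) + ε * (∑ p ∈ P, m p) ^ 2 := by
    calc _ ≤ ∑ n ∈ S, θ n ^ 2 * a n * ∑ j ∈ P, ∑ k ∈ P,
          (if j.1 = k.1 then (z n j * starRingEnd ℂ (z n k)).re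
          else ((j.1 * k.1⁻¹ : DirichletCharacter ℂ q) n *
            (z n j * starRingEnd ℂ (z n k))).re) := by
          refine sum_le_sum fun n _ => mul_le_mul_of_nonneg_left ?_
            (mul_nonneg (sq_nonneg _) (ha0 n))
          refine le_trans (le_of_eq ?_) (normSq_sum_char_le P (z n) n)
          simp only [hz, mul_assoc]
      _ = (∑ j ∈ P, ∑ k ∈ P, if j.1 = k.1 then
            ∑ n ∈ S, θ n ^ 2 * a n * (z n j * starRingEnd ℂ (z n k)).re else 0) +
          ∑ j ∈ P, ∑ k ∈ P, (if j.1 = k.1 then 0 else ∑ n ∈ S, θ n ^ 2 * a n *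
            ((j.1 * k.1⁻¹ : DirichletCharacter ℂ q) n * (z n j * starRingEnd ℂ (z n k))).re) := by
          simp_rw [mul_sum]
          rw [Finset.sum_comm (s := S), ← Finset.sum_add_distrib]
          refine sum_congr rfl fun j _ => ?_
          rw [Finset.sum_comm (s := S), ← Finset.sum_add_distrib]
          refine sum_congr rfl fun k _ => ?_
          split_ifs <;> simp
      _ ≤ (∑ j ∈ P, ∑ k ∈ P, if j.1 = k.1 then ∑ n ∈ S', g (Real.log n / L) * (θ n ^ 2 * a n) *
            (z n j * starRingEnd ℂ (z n k)).re else 0) +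
          ∑ j ∈ P, ∑ k ∈ P, (if j.1 = k.1 then 0 else m j * m k * ε) := by
          refine add_le_add (sum_same_mul_le P z hsub
            (fun n _ => mul_nonneg (sq_nonneg _) (ha0 n)) (fun n _ => hg0 _) hg3) ?_
          refine sum_le_sum fun j hj => sum_le_sum fun k hk => ?_
          split_ifs with h
          · exact le_rfl
          · exact hoff j hj k hk h
      _ ≤ _ := by
          have e4 : ε * (∑ p ∈ P, m p) ^ 2 = ∑ j ∈ P, ∑ k ∈ P, m j * m k * ε := by
            rw [sq, Finset.sum_mul_sum, mul_sum]
            refine sum_congr rfl fun j _ => ?_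
            rw [mul_sum]
            exact sum_congr rfl fun k _ => mul_comm _ _
          rw [e4, ← Finset.sum_add_distrib, ← Finset.sum_add_distrib]
          refine sum_le_sum fun j hj => ?_
          rw [← Finset.sum_add_distrib, ← Finset.sum_add_distrib]
          refine sum_le_sum fun k hk => ?_
          split_ifs with h
          · rw [add_zero]; exact hdiag j hj k hk
          · exact le_rfl
  refine hd.trans (mul_le_mul ?_ hmain ?_ hM)
  · refine le_trans ?_ (hF2 (qpow q x) hN)
    have hSI : S ⊆ Icc 2 (qpow q x) := by
      intro n hn
      rw [Finset.mem_Ioc] at hn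
      rw [Finset.mem_Icc]
      omega
    refine le_trans (le_of_eq (sum_congr rfl fun n _ => ?_))
      (Finset.sum_le_sum_of_subset_of_nonneg hSI fun n _ _ => by positivity)
    simp only [ha, mul_inv, Real.exp_neg, inv_inv]
    ring
  · exact Finset.sum_nonneg fun n _ => mul_nonneg (mul_nonneg (sq_nonneg _) (ha0 n)) (sq_nonneg _)

/-- The trapezoid equal to `1` on `[u, x]` and supported on `[u₀, x₁]`. -/
noncomputable def trap (u₀ u x x₁ t : ℝ) : ℝ :=
  max 0 (min 1 (min ((t - u₀) / (u - u₀)) ((x₁ - t) / (x₁ - x))))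

theorem trap_nonneg (u₀ u x x₁ t : ℝ) : 0 ≤ trap u₀ u x x₁ t := le_max_left _ _

theorem trap_le_one (u₀ u x x₁ t : ℝ) : trap u₀ u x x₁ t ≤ 1 :=
  max_le zero_le_one (min_le_left _ _)

theorem trap_eq_zero_left {u₀ u x x₁ t : ℝ} (hu : u₀ < u) (ht : t ≤ u₀) : trap u₀ u x x₁ t = 0 :=
  max_eq_left <| (min_le_right _ _).trans <| (min_le_left _ _).trans <|
    div_nonpos_of_nonpos_of_nonneg (by linarith) (by linarith)

theorem trap_eq_zero_right {u₀ u x x₁ t : ℝ} (hx : x < x₁) (ht : x₁ ≤ t) : trap u₀ u x x₁ t = 0 :=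
  max_eq_left <| (min_le_right _ _).trans <| (min_le_right _ _).trans <|
    div_nonpos_of_nonpos_of_nonneg (by linarith) (by linarith)

theorem trap_eq_one {u₀ u x x₁ t : ℝ} (hu : u₀ < u) (hx : x < x₁) (h1 : u ≤ t) (h2 : t ≤ x) :
    trap u₀ u x x₁ t = 1 := by
  unfold trap
  rw [min_eq_left, max_eq_right zero_le_one]
  refine le_min ?_ ?_
  · rw [le_div_iff₀ (by linarith)]; linarith
  · rw [le_div_iff₀ (by linarith)]; linarith

theorem trap_eq_left {u₀ u x x₁ t : ℝ} (hu : u₀ < u) (hux : u ≤ x) (hx : x < x₁) (h1 : u₀ ≤ t)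
    (h2 : t ≤ u) : trap u₀ u x x₁ t = (t - u₀) / (u - u₀) := by
  unfold trap
  have hle : (t - u₀) / (u - u₀) ≤ 1 := by rw [div_le_one (by linarith)]; linarith
  have hge : 1 ≤ (x₁ - t) / (x₁ - x) := by rw [le_div_iff₀ (by linarith)]; linarith
  rw [min_eq_left (hle.trans hge), min_eq_right hle, max_eq_right]
  exact div_nonneg (by linarith) (by linarith)

theorem trap_eq_right {u₀ u x x₁ t : ℝ} (hu : u₀ < u) (hux : u ≤ x) (hx : x < x₁) (h1 : x ≤ t)
    (h2 : t ≤ x₁) : trap u₀ u x x₁ t = (x₁ - t) / (x₁ - x) := by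
  unfold trap
  have hle : (x₁ - t) / (x₁ - x) ≤ 1 := by rw [div_le_one (by linarith)]; linarith
  have hge : 1 ≤ (t - u₀) / (u - u₀) := by rw [le_div_iff₀ (by linarith)]; linarith
  rw [min_eq_right (hle.trans hge), min_eq_right hle, max_eq_right]
  exact div_nonneg (by linarith) (by linarith)

theorem continuous_trap (u₀ u x x₁ : ℝ) : Continuous (trap u₀ u x x₁) := by
  unfold trap
  fun_prop

theorem abs_trap_sub_le {u₀ u x x₁ : ℝ} (hu : u₀ < u) (hx : x < x₁) (s t : ℝ) :
    |trap u₀ u x x₁ s - trap u₀ u x x₁ t| ≤ (1 / (u - u₀) + 1 / (x₁ - x)) * |s - t| := by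
  unfold trap
  have h1 : 0 < u - u₀ := by linarith
  have h2 : 0 < x₁ - x := by linarith
  refine (abs_max_sub_max_le_max _ _ _ _).trans (max_le (by simp; positivity) ?_)
  refine (abs_min_sub_min_le_max _ _ _ _).trans (max_le (by simp; positivity) ?_)
  refine (abs_min_sub_min_le_max _ _ _ _).trans (max_le ?_ ?_)
  · rw [← sub_div, abs_div, abs_of_pos h1, sub_sub_sub_cancel_right, div_eq_mul_one_div, mul_comm]
    exact mul_le_mul_of_nonneg_right (le_add_of_nonneg_right (by positivity)) (abs_nonneg _)
  · rw [← sub_div, abs_div, abs_of_pos h2, sub_sub_sub_cancel_left, div_eq_mul_one_div, mul_comm,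
      abs_sub_comm]
    exact mul_le_mul_of_nonneg_right (le_add_of_nonneg_left (by positivity)) (abs_nonneg _)

theorem integral_affine_mul_exp {z : ℂ} (hz : z ≠ 0) (α β : ℂ) (a b : ℝ) :
    ∫ t in a..b, (α + β * t) * Complex.exp (z * t) =
      ((α + β * b) / z - β / z ^ 2) * Complex.exp (z * b) -
        ((α + β * a) / z - β / z ^ 2) * Complex.exp (z * a) := by
  refine intervalIntegral.integral_eq_sub_of_hasDerivAt
    (f := fun t : ℝ => ((α + β * t) / z - β / z ^ 2) * Complex.exp (z * t)) (fun t _ => ?_)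
    (Continuous.intervalIntegrable (by fun_prop) _ _)
  have h1 : HasDerivAt (fun t : ℝ => (t : ℂ)) 1 t := Complex.ofRealCLM.hasDerivAt
  have h2 : HasDerivAt (fun t : ℝ => (α + β * t) / z - β / z ^ 2) (β * 1 / z) t :=
    (((h1.const_mul β).const_add α).div_const z).sub_const _
  have h3 : HasDerivAt (fun t : ℝ => Complex.exp (z * t)) (Complex.exp (z * t) * (z * 1)) t :=
    (h1.const_mul z).cexp
  refine (h2.mul h3).congr_deriv ?_
  field_simp
  ring

theorem integral_trap {u₀ u x x₁ : ℝ} (hu : u₀ < u) (hux : u ≤ x) (hx : x < x₁) {z : ℂ}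
    (hz : z ≠ 0) :
    ∫ t in u₀..x₁, (trap u₀ u x x₁ t : ℂ) * Complex.exp (z * t) =
      1 / z ^ 2 * ((Complex.exp (z * u₀) - Complex.exp (z * u)) / (u - u₀ : ℝ) +
        (Complex.exp (z * x₁) - Complex.exp (z * x)) / (x₁ - x : ℝ)) := by
  have hc : Continuous fun t : ℝ => (trap u₀ u x x₁ t : ℂ) * Complex.exp (z * t) := by
    have := continuous_trap u₀ u x x₁
    fun_prop
  have hD1 : ((u - u₀ : ℝ) : ℂ) ≠ 0 := by exact_mod_cast (sub_pos.2 hu).ne'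
  have hD2 : ((x₁ - x : ℝ) : ℂ) ≠ 0 := by exact_mod_cast (sub_pos.2 hx).ne'
  have e1 : ∫ t in u₀..u, (trap u₀ u x x₁ t : ℂ) * Complex.exp (z * t) =
      ∫ t in u₀..u, (-u₀ / (u - u₀ : ℝ) + 1 / (u - u₀ : ℝ) * t) * Complex.exp (z * t) := by
    refine intervalIntegral.integral_congr fun t ht => ?_
    rw [Set.uIcc_of_le hu.le] at ht
    rw [trap_eq_left hu hux hx ht.1 ht.2, Complex.ofReal_div, Complex.ofReal_sub t]
    congr 1
    field_simp
    ring
  have e2 : ∫ t in u..x, (trap u₀ u x x₁ t : ℂ) * Complex.exp (z * t) =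
      ∫ t in u..x, (1 + 0 * t) * Complex.exp (z * t) := by
    refine intervalIntegral.integral_congr fun t ht => ?_
    rw [Set.uIcc_of_le hux] at ht
    rw [trap_eq_one hu hx ht.1 ht.2]
    simp
  have e3 : ∫ t in x..x₁, (trap u₀ u x x₁ t : ℂ) * Complex.exp (z * t) =
      ∫ t in x..x₁, (x₁ / (x₁ - x : ℝ) + (-1) / (x₁ - x : ℝ) * t) * Complex.exp (z * t) := by
    refine intervalIntegral.integral_congr fun t ht => ?_
    rw [Set.uIcc_of_le hx.le] at ht
    rw [trap_eq_right hu hux hx ht.1 ht.2, Complex.ofReal_div, Complex.ofReal_sub x₁ t]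
    congr 1
    field_simp
    ring
  rw [← intervalIntegral.integral_add_adjacent_intervals (hc.intervalIntegrable u₀ x)
      (hc.intervalIntegrable x x₁),
    ← intervalIntegral.integral_add_adjacent_intervals (hc.intervalIntegrable u₀ u)
      (hc.intervalIntegrable u x), e1, e2, e3, integral_affine_mul_exp hz,
      integral_affine_mul_exp hz, integral_affine_mul_exp hz]
  have f1 : (-u₀ / (u - u₀ : ℝ) + 1 / (u - u₀ : ℝ) * u : ℂ) = 1 := by
    field_simp; push_cast; ring
  have f2 : (-u₀ / (u - u₀ : ℝ) + 1 / (u - u₀ : ℝ) * u₀ : ℂ) = 0 := by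
    field_simp; ring
  have f3 : (x₁ / (x₁ - x : ℝ) + (-1) / (x₁ - x : ℝ) * x : ℂ) = 1 := by
    field_simp; push_cast; ring
  have f4 : (x₁ / (x₁ - x : ℝ) + (-1) / (x₁ - x : ℝ) * x₁ : ℂ) = 0 := by
    field_simp; ring
  rw [f1, f2, f3, f4]
  ring

noncomputable def trapK (u₀ u x x₁ μ : ℝ) : ℝ :=
  1 / μ ^ 2 * ((Real.exp (μ * u₀) - Real.exp (μ * u)) / (u - u₀) +
    (Real.exp (μ * x₁) - Real.exp (μ * x)) / (x₁ - x))

noncomputable def trapA (u₀ u x x₁ μ : ℝ) : ℝ :=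
  (Real.exp (μ * u₀) + Real.exp (μ * u)) / (u - u₀) +
    (Real.exp (μ * x₁) + Real.exp (μ * x)) / (x₁ - x)

theorem integral_trap_real {u₀ u x x₁ : ℝ} (hu : u₀ < u) (hux : u ≤ x) (hx : x < x₁) {μ : ℝ}
    (hμ : μ ≠ 0) :
    ∫ t in u₀..x₁, trap u₀ u x x₁ t * Real.exp (μ * t) = trapK u₀ u x x₁ μ := by
  have h := integral_trap hu hux hx (z := (μ : ℂ)) (by exact_mod_cast hμ)
  rw [← Complex.ofReal_inj, ← intervalIntegral.integral_ofReal]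
  simp only [Complex.ofReal_mul, Complex.ofReal_exp]
  rw [h]
  unfold trapK
  push_cast
  ring

theorem norm_integral_trap_le {u₀ u x x₁ : ℝ} (hu : u₀ < u) (hux : u ≤ x)
    (hx : x < x₁) {μ : ℝ} (hμ : 0 < μ) {z : ℂ} (hz : μ ≤ z.re) :
    ‖∫ t in u₀..x₁, (trap u₀ u x x₁ t : ℂ) * Complex.exp (z * t)‖ ≤
      Real.exp ((z.re - μ) * x₁) * trapK u₀ u x x₁ μ := by
  rw [← integral_trap_real hu hux hx hμ.ne', ← intervalIntegral.integral_const_mul]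
  have hc := continuous_trap u₀ u x x₁
  have hle : u₀ ≤ x₁ := by linarith
  refine intervalIntegral.norm_integral_le_of_norm_le hle (ae_of_all _ fun t ht => ?_)
    (Continuous.intervalIntegrable (by fun_prop) _ _)
  rw [norm_mul, Complex.norm_real, Real.norm_of_nonneg (trap_nonneg _ _ _ _ _), Complex.norm_exp,
    mul_left_comm, ← Real.exp_add]
  refine mul_le_mul_of_nonneg_left (Real.exp_le_exp.2 ?_) (trap_nonneg _ _ _ _ _)
  rw [Complex.re_mul_ofReal]
  nlinarith [ht.2]

theorem norm_integral_trap_mul_le {u₀ u x x₁ : ℝ} (hu : u₀ < u) (hux : u ≤ x)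
    (hx : x < x₁) {μ : ℝ} (hμ : 0 < μ) {z : ℂ} (hz : μ ≤ z.re) :
    ‖∫ t in u₀..x₁, (trap u₀ u x x₁ t : ℂ) * Complex.exp (z * t)‖ * ‖z‖ ^ 2 ≤
      Real.exp ((z.re - μ) * x₁) * trapA u₀ u x x₁ μ := by
  have hz0 : z ≠ 0 := by
    rintro rfl
    simp only [Complex.zero_re] at hz
    linarith
  have hzn : ‖z‖ ≠ 0 := norm_ne_zero_iff.2 hz0
  have hb : ∀ t : ℝ, t ≤ x₁ → ‖Complex.exp (z * t)‖ ≤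
      Real.exp ((z.re - μ) * x₁) * Real.exp (μ * t) := by
    intro t ht
    rw [Complex.norm_exp, Complex.re_mul_ofReal, ← Real.exp_add]
    refine Real.exp_le_exp.2 ?_
    nlinarith
  have h1 : 0 < u - u₀ := by linarith
  have h2 : 0 < x₁ - x := by linarith
  rw [integral_trap hu hux hx hz0, norm_mul, norm_div, norm_pow, norm_one, one_div, mul_comm,
    ← mul_assoc, mul_inv_cancel₀ (pow_ne_zero _ hzn), one_mul]
  refine (norm_add_le _ _).trans ?_
  rw [norm_div, norm_div, Complex.norm_real, Complex.norm_real, Real.norm_of_nonneg h1.le,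
    Real.norm_of_nonneg h2.le]
  unfold trapA
  rw [mul_add, mul_div_assoc', mul_div_assoc', mul_add, mul_add]
  refine add_le_add ?_ ?_
  · exact div_le_div_of_nonneg_right ((norm_sub_le _ _).trans
      (add_le_add (hb _ (by linarith)) (hb _ (by linarith)))) h1.le
  · exact div_le_div_of_nonneg_right ((norm_sub_le _ _).trans
      (add_le_add (hb _ le_rfl) (hb _ hx.le))) h2.le

theorem norm_integral_trap_mul_add_le {u₀ u x x₁ : ℝ} (hu : u₀ < u) (hux : u ≤ x)
    (hx : x < x₁) {μ X : ℝ} (hμ : 0 < μ) (hX : μ ^ 2 ≤ X) {z : ℂ} (hz : μ ≤ z.re) :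
    ‖∫ t in u₀..x₁, (trap u₀ u x x₁ t : ℂ) * Complex.exp (z * t)‖ * (X + z.im ^ 2) ≤
      Real.exp ((z.re - μ) * x₁) *
        (trapA u₀ u x x₁ μ + (X - μ ^ 2) * trapK u₀ u x x₁ μ) := by
  have h1 := norm_integral_trap_le hu hux hx hμ hz
  have h2 := norm_integral_trap_mul_le hu hux hx hμ hz
  rw [Complex.sq_norm, Complex.normSq_apply] at h2
  set I := ‖∫ t in u₀..x₁, (trap u₀ u x x₁ t : ℂ) * Complex.exp (z * t)‖
  have hI : 0 ≤ I := norm_nonneg _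
  have h3 := mul_le_mul_of_nonneg_left h1 (sub_nonneg.2 hX)
  have h4 : μ ^ 2 ≤ z.re ^ 2 := pow_le_pow_left₀ hμ.le hz 2
  nlinarith [mul_le_mul_of_nonneg_left h4 hI]

/-- Weighted arithmetic–geometric mean for a symmetric nonnegative form. -/
theorem sum_sum_mul_le_weighted {ι : Type*} (T : Finset ι) (c : ι → ι → ℝ) (p s : ι → ℝ)
    (hc : ∀ j ∈ T, ∀ k ∈ T, 0 ≤ c j k) (hsymm : ∀ j ∈ T, ∀ k ∈ T, c j k = c k j)
    (hs : ∀ j ∈ T, 0 < s j) :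
    ∑ j ∈ T, ∑ k ∈ T, c j k * (p j * p k) ≤
      ∑ j ∈ T, ∑ k ∈ T, c j k * (p j ^ 2 * (s k / s j)) := by
  have h1 : ∑ j ∈ T, ∑ k ∈ T, c j k * (p k ^ 2 * (s j / s k)) =
      ∑ j ∈ T, ∑ k ∈ T, c j k * (p j ^ 2 * (s k / s j)) := by
    rw [Finset.sum_comm]
    exact sum_congr rfl fun j hj => sum_congr rfl fun k hk => by
      rw [hsymm k hk j hj]
  have h2 : 2 * ∑ j ∈ T, ∑ k ∈ T, c j k * (p j * p k) ≤
      ∑ j ∈ T, ∑ k ∈ T, c j k * (p j ^ 2 * (s k / s j)) +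
        ∑ j ∈ T, ∑ k ∈ T, c j k * (p k ^ 2 * (s j / s k)) := by
    rw [mul_sum, ← Finset.sum_add_distrib]
    refine sum_le_sum fun j hj => ?_
    rw [mul_sum, ← Finset.sum_add_distrib]
    refine sum_le_sum fun k hk => ?_
    have hsj := hs j hj
    have hsk := hs k hk
    have key : 2 * (p j * p k) ≤ p j ^ 2 * (s k / s j) + p k ^ 2 * (s j / s k) := by
      have e : p j ^ 2 * (s k / s j) + p k ^ 2 * (s j / s k) - 2 * (p j * p k)
          = (p j * s k - p k * s j) ^ 2 / (s j * s k) := by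
        field_simp
        ring
      have : 0 ≤ (p j * s k - p k * s j) ^ 2 / (s j * s k) := by positivity
      linarith
    nlinarith [mul_le_mul_of_nonneg_left key (hc j hj k hk)]
  linarith

/-- Greedy selection of separated representatives, each point being charged to a representative
with a smaller value of `f`. -/
theorem exists_separated_representatives {ι : Type*} (r : ι → ι → Prop) (hr : ∀ j, r j j)
    (hsymm : ∀ j k, r j k → r k j) (f : ι → ℝ) (P : Finset ι) :
    ∃ T ⊆ P, (∀ j ∈ T, ∀ k ∈ T, r j k → j = k) ∧
      ∃ rep : ι → ι, ∀ k ∈ P, rep k ∈ T ∧ r (rep k) k ∧ f (rep k) ≤ f k := by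
  induction P using Finset.strongInduction with
  | H P ih =>
    rcases P.eq_empty_or_nonempty with rfl | hne
    · exact ⟨∅, by simp, by simp, id, by simp⟩
    obtain ⟨j₀, hj₀, hmin⟩ := P.exists_min_image f hne
    have hss : P.filter (fun k => ¬ r j₀ k) ⊂ P :=
      Finset.filter_ssubset.2 ⟨j₀, hj₀, by simpa using hr j₀⟩
    obtain ⟨T, hT, hsep, rep, hp⟩ := ih _ hss
    have hTr : ∀ j ∈ T, ¬ r j₀ j := fun j hj => (Finset.mem_filter.1 (hT hj)).2
    refine ⟨insert j₀ T, Finset.insert_subset hj₀ (hT.trans hss.1), ?_,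
      fun k => if r j₀ k then j₀ else rep k, ?_⟩
    · intro j hj k hk hjk
      rw [Finset.mem_insert] at hj hk
      rcases hj with rfl | hj <;> rcases hk with rfl | hk
      · rfl
      · exact absurd hjk (hTr k hk)
      · exact absurd (hsymm _ _ hjk) (hTr j hj)
      · exact hsep j hj k hk hjk
    · intro k hk
      by_cases h : r j₀ k
      · simp only [h, if_true]
        exact ⟨Finset.mem_insert_self _ _, trivial, hmin k hk⟩
      · simp only [h, if_false]
        obtain ⟨h1, h2, h3⟩ := hp k (Finset.mem_filter.2 ⟨hk, h⟩)
        exact ⟨Finset.mem_insert_of_mem h1, h2, h3⟩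

theorem sum_sq_add_le_of_duality {ι : Type*} (T : Finset ι) (w E : ι → ℝ) {B K H a d : ℝ}
    (hw : ∀ j ∈ T, 0 < w j) (hE : ∀ j ∈ T, 0 ≤ E j) (hB : 0 ≤ B) (hK : 0 ≤ K) (hH : 0 ≤ H)
    (hd : B * a ≤ d ^ 2)
    (h : (∑ j ∈ T, w j * (w j + d)) ^ 2 ≤
      B * (∑ j ∈ T, w j ^ 2 * (H + K * E j) + a * (∑ j ∈ T, w j) ^ 2)) :
    ∑ j ∈ T, (w j ^ 2 + 2 * d * w j - B * K * E j) ≤ B * H := by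
  rcases T.eq_empty_or_nonempty with rfl | hne
  · simpa using mul_nonneg hB hH
  set S2 := ∑ j ∈ T, w j ^ 2
  set S1 := ∑ j ∈ T, w j
  have hS2 : 0 < S2 := Finset.sum_pos (fun j hj => pow_pos (hw j hj) 2) hne
  have e1 : ∑ j ∈ T, w j * (w j + d) = S2 + d * S1 := by
    simp only [S2, S1, mul_sum, ← Finset.sum_add_distrib]
    exact sum_congr rfl fun j _ => by ring
  have e2 : ∑ j ∈ T, w j ^ 2 * (H + K * E j) ≤ H * S2 + K * (S2 * ∑ j ∈ T, E j) := by
    simp only [mul_sum]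
    rw [mul_sum, ← Finset.sum_add_distrib]
    refine sum_le_sum fun j hj => ?_
    have hle : w j ^ 2 ≤ S2 :=
      Finset.single_le_sum (f := fun j => w j ^ 2) (fun i _ => sq_nonneg (w i)) hj
    have := mul_le_mul_of_nonneg_left (mul_le_mul_of_nonneg_right hle (hE j hj)) hK
    linarith
  have e3 : ∑ j ∈ T, (w j ^ 2 + 2 * d * w j - B * K * E j)
      = S2 + 2 * d * S1 - B * K * ∑ j ∈ T, E j := by
    simp only [S2, S1, mul_sum, ← Finset.sum_add_distrib, ← Finset.sum_sub_distrib]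
  rw [e1] at h
  rw [e3]
  have h1 := mul_le_mul_of_nonneg_left e2 hB
  have h2 := mul_le_mul_of_nonneg_right hd (sq_nonneg S1)
  refine le_of_mul_le_mul_left ?_ hS2
  nlinarith

/-- Passing from all points to separated representatives. -/
theorem sum_le_sum_representatives {ι : Type*} {P T : Finset ι} (hTP : T ⊆ P) {rep : ι → ι}
    (hp : ∀ k ∈ P, rep k ∈ T) (hpT : ∀ j ∈ T, rep j = j) (m e : ι → ℝ) :
    ∑ k ∈ P, m k * e k = ∑ j ∈ T, (e j +
      ∑ k ∈ P with rep k = j, (m k - if k = j then 1 else 0) * e k) := by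
  rw [← Finset.sum_fiberwise_of_maps_to hp]
  refine sum_congr rfl fun j hj => ?_
  simp only [sub_mul, Finset.sum_sub_distrib, ite_mul, one_mul, zero_mul, Finset.sum_ite_eq']
  have : j ∈ P.filter (fun k => rep k = j) := Finset.mem_filter.2 ⟨hTP hj, hpT j hj⟩
  simp only [this, if_true]
  ring

def nearPair {α : Type*} (j k : α × ℂ) : Prop := j.1 = k.1 ∧ |k.2.im - j.2.im| ≤ 1 / 8

theorem nearPair_refl {α : Type*} (j : α × ℂ) : nearPair j j := ⟨rfl, by simp⟩

theorem nearPair_symm {α : Type*} {j k : α × ℂ} (h : nearPair j k) : nearPair k j :=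
  ⟨h.1.symm, by rw [abs_sub_comm]; exact h.2⟩

variable {q : ℕ}

theorem Gk_nonneg {l y : ℝ} (hl : 0 ≤ l) : 0 ≤ Gk 1 l y := by
  unfold Gk
  positivity

theorem lam_nonneg_of_mem_rect {R : ℝ} {ρ : ℂ} (hρ : ρ ∈ rect q R) : 0 ≤ lam q ρ :=
  mul_nonneg (by linarith [hρ.2.1]) (Real.log_natCast_nonneg q)

theorem lam_le_of_mem_rect {R : ℝ} {ρ : ℂ} (hq : 0 < Real.log q) (hρ : ρ ∈ rect q R) :
    lam q ρ ≤ R := by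
  have : 1 - ρ.re ≤ R / Real.log q := by linarith [hρ.1]
  rwa [le_div_iff₀ hq] at this

variable [NeZero q]

/-- `p.2 ∈ ℛ` is a zero of the `L`-function of the nonprincipal character `p.1`. -/
def IsZeroPair (R : ℝ) (p : DirichletCharacter ℂ q × ℂ) : Prop :=
  p.1 ≠ 1 ∧ p.2 ∈ rect q R ∧ p.1.LFunction p.2 = 0

noncomputable def pairMult (p : DirichletCharacter ℂ q × ℂ) : ℝ := zeroMult p.1.LFunction p.2

/-- The kernel `Gk 1` centred at the height of `j` and evaluated at `k`. -/
noncomputable def pairKernel (j k : DirichletCharacter ℂ q × ℂ) : ℝ :=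
  Gk 1 (lam q k.2) ((k.2.im - j.2.im) * Real.log q)

/-- The kernel sum over the zeros near `j`, one copy of `j` being removed. -/
noncomputable def excess (P : Finset (DirichletCharacter ℂ q × ℂ))
    (j : DirichletCharacter ℂ q × ℂ) : ℝ :=
  ∑ k ∈ P with nearPair j k, (pairMult k - if k = j then 1 else 0) * pairKernel j k

theorem one_le_pairMult {R : ℝ} {p : DirichletCharacter ℂ q × ℂ}
    (hp : IsZeroPair R p) : 1 ≤ pairMult p := by
  have h := zeroMult_pos (DirichletCharacter.differentiable_LFunction hp.1) (w := 2)
    (DirichletCharacter.LFunction_ne_zero_of_one_le_re p.1 (Or.inl hp.1) (by simp)) hp.2.2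
  unfold pairMult
  exact_mod_cast h

theorem pairMult_sub_nonneg {R : ℝ} {p : DirichletCharacter ℂ q × ℂ}
    (hp : IsZeroPair R p) (j : DirichletCharacter ℂ q × ℂ) :
    0 ≤ pairMult p - if p = j then 1 else 0 := by
  have := one_le_pairMult hp
  split_ifs <;> linarith

theorem pairKernel_nonneg {R : ℝ} (j : DirichletCharacter ℂ q × ℂ)
    {k : DirichletCharacter ℂ q × ℂ} (hk : IsZeroPair R k) : 0 ≤ pairKernel j k :=
  Gk_nonneg (lam_nonneg_of_mem_rect hk.2.1)

theorem sum_le_excess {R : ℝ} {P T : Finset (DirichletCharacter ℂ q × ℂ)}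
    (hP : ∀ p ∈ P, IsZeroPair R p) {j : DirichletCharacter ℂ q × ℂ}
    (hT : ∀ k ∈ T, k ∈ P ∧ nearPair j k) :
    ∑ k ∈ T, (pairMult k - if k = j then 1 else 0) * pairKernel j k ≤ excess P j := by
  refine Finset.sum_le_sum_of_subset_of_nonneg (fun k hk => Finset.mem_filter.2 (hT k hk)) ?_
  intro k hk _
  have hk' := hP k (Finset.mem_filter.1 hk).1
  exact mul_nonneg (pairMult_sub_nonneg hk' j) (pairKernel_nonneg j hk')

theorem excess_nonneg {R : ℝ} {P : Finset (DirichletCharacter ℂ q × ℂ)}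
    (hP : ∀ p ∈ P, IsZeroPair R p) (j : DirichletCharacter ℂ q × ℂ) : 0 ≤ excess P j := by
  simpa using sum_le_excess (T := ∅) (j := j) hP (by simp)

theorem sum_image_near_eq {P : Finset (DirichletCharacter ℂ q × ℂ)}
    {j : DirichletCharacter ℂ q × ℂ} (hj : j ∈ P) :
    ∑ ρ ∈ (P.filter (nearPair j)).image Prod.snd, (zeroMult j.1.LFunction ρ : ℝ) *
      Gk 1 (lam q ρ) ((ρ.im - j.2.im) * Real.log q) = excess P j + Gk 1 (lam q j.2) 0 := by
  rw [Finset.sum_image]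
  · unfold excess
    simp only [sub_mul, Finset.sum_sub_distrib, ite_mul, one_mul, zero_mul, Finset.sum_ite_eq']
    rw [if_pos (Finset.mem_filter.2 ⟨hj, nearPair_refl j⟩)]
    have : pairKernel j j = Gk 1 (lam q j.2) 0 := by simp [pairKernel]
    rw [this, sub_add_cancel]
    refine sum_congr rfl fun k hk => ?_
    rw [pairMult, ← (Finset.mem_filter.1 hk).2.1, pairKernel, sub_mul]
  · intro a ha b hb hab
    simp only [Finset.coe_filter, Set.mem_ofPred_eq] at ha hb
    exact Prod.ext (ha.2.1.symm.trans hb.2.1) hab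

theorem near_zero_data {R : ℝ} {P : Finset (DirichletCharacter ℂ q × ℂ)}
    (hP : ∀ p ∈ P, IsZeroPair R p) (j : DirichletCharacter ℂ q × ℂ) :
    ∀ ρ ∈ (P.filter (nearPair j)).image Prod.snd, j.1.LFunction ρ = 0 ∧
      |ρ.im - j.2.im| ≤ 1 / 8 ∧ 1 - R / Real.log q ≤ ρ.re := by
  intro ρ hρ
  obtain ⟨k, hk, rfl⟩ := Finset.mem_image.1 hρ
  obtain ⟨hk, hjk⟩ := Finset.mem_filter.1 hk
  have h := hP k hk
  exact ⟨hjk.1 ▸ h.2.2, hjk.2, h.2.1.1⟩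

theorem excess_add_le {R ε : ℝ} (hR : 0 < R) (hε : 0 < ε) :
    ∃ q₀ : ℕ, ∀ (q : ℕ) [NeZero q], q₀ ≤ q → ∀ P : Finset (DirichletCharacter ℂ q × ℂ),
      (∀ p ∈ P, IsZeroPair R p) → ∀ j ∈ P, excess P j + Gk 1 (lam q j.2) 0 ≤ 9 / 4 + ε := by
  obtain ⟨q₁, h1⟩ := zeros_kernel_le (b := 1) (T := R) one_pos hR hR.le (half_pos hε)
  obtain ⟨q₂, h2⟩ := eventually_atTop.1 (tendsto_log_nat.eventually
    ((tsum_vmWeight_le (a := 1) (c := 1) one_pos zero_le_one (half_pos hε)).and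
      (eventually_gt_atTop 0)))
  refine ⟨max q₁ q₂, fun q _ hq P hP j hj => ?_⟩
  obtain ⟨⟨hs, h2⟩, hL⟩ := h2 q ((le_max_right _ _).trans hq)
  have hp := hP j hj
  have h1 := (h1 q ((le_max_left _ _).trans hq) j.1 hp.1 j.2.im hp.2.1.2.2 _
    (near_zero_data hP j)).2
  rw [sum_image_near_eq hj] at h1
  have h3 : ‖∑' n, (vmWeight (1 + 1 / Real.log q) (1 / Real.log q) n : ℂ) *
      chiTwist j.1 j.2.im n‖ ≤ ∑' n, vmWeight (1 + 1 / Real.log q) (1 / Real.log q) n := by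
    refine tsum_of_norm_bounded hs.hasSum fun n => ?_
    have h0 : 0 ≤ vmWeight (1 + 1 / Real.log q) (1 / Real.log q) n :=
      vmWeight_nonneg (by positivity) n
    rw [norm_mul, Complex.norm_real, Real.norm_of_nonneg h0]
    exact mul_le_of_le_one_right h0 (norm_chiTwist_le _ _ _)
  have h4 := (abs_le.1 ((Complex.abs_re_le_norm _).trans h3)).1
  have h5 := mul_le_mul_of_nonneg_left h4 (show 0 ≤ 1 / Real.log q by positivity)
  norm_num at h2
  rw [mul_neg, one_div] at h5
  rw [one_div] at h1
  linarith

theorem excess_duality {R ε : ℝ} (hR : 0 < R) (hε : 0 < ε) :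
    ∃ q₀ : ℕ, ∀ (q : ℕ) [NeZero q], q₀ ≤ q → ∀ P : Finset (DirichletCharacter ℂ q × ℂ),
      (∀ p ∈ P, IsZeroPair R p) → ∀ T ⊆ P, ∀ w : DirichletCharacter ℂ q × ℂ → ℝ,
      (∀ j ∈ T, 0 ≤ w j) → (∀ j ∈ T, 1 / 4 + ε ≤ excess P j + Gk 1 (lam q j.2) 0) →
      (∑ j ∈ T, w j * (excess P j + Gk 1 (lam q j.2) 0 - (1 / 4 + ε))) ^ 2 ≤
        (103 / 72 + ε) * (∑ j ∈ T, ∑ k ∈ T, (if j.1 = k.1 then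
          w j * w k * hk (1 / 2) ((j.2.im - k.2.im) * Real.log q) else 0)
          + (1 / 4 + ε) * (∑ p ∈ T, w p) ^ 2) := by
  obtain ⟨q₁, h1⟩ := prime_duality hR hε
  refine ⟨q₁, fun q _ hq P hP T hT w hw hD => ?_⟩
  have h := h1 q hq T (fun p hp => ⟨(hP p (hT hp)).1, (hP p (hT hp)).2.1.2.2⟩)
    (fun j => (P.filter (nearPair j)).image Prod.snd) (fun j _ => near_zero_data hP j)
    (fun j => if j ∈ T then w j else 0)
    (fun j => by split_ifs with h; exacts [hw j h, le_rfl])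
    (∑ j ∈ T, w j * (excess P j + Gk 1 (lam q j.2) 0 - (1 / 4 + ε)))
    (Finset.sum_nonneg fun j hj => mul_nonneg (hw j hj) (sub_nonneg.2 (hD j hj)))
    (le_of_eq (sum_congr rfl fun j hj => by rw [if_pos hj, sum_image_near_eq (hT hj)]))
  refine h.trans (le_of_eq ?_)
  congr 2
  · refine sum_congr rfl fun j hj => sum_congr rfl fun k hk => ?_
    rw [if_pos hj, if_pos hk]
  · congr 2
    exact sum_congr rfl fun j hj => if_pos hj

end LFZ

namespace LFZ
open Finset Filter Topology Metric Real MeasureTheory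

theorem hk_half_le_Gk {l y : ℝ} (hl : 0.35 ≤ l) (hl2 : l ≤ 2) (hy : 1.3 ≤ |y|) :
    hk (1 / 2) y ≤ 0.193 * Gk 1 l y := by
  have hY : (1.69:ℝ) ≤ y ^ 2 := by
    rw [← sq_abs]
    nlinarith
  unfold hk Gk
  generalize y ^ 2 = Y at hY
  obtain ⟨z, rfl⟩ : ∃ z, Y = 1.69 + z := ⟨Y - 1.69, by ring⟩
  have hz : 0 ≤ z := by linarith
  obtain ⟨s, rfl⟩ : ∃ s, l = s - 1 := ⟨l + 1, by ring⟩
  have hD : 0 < (s - 1 + 1) ^ 2 + (1.69 + z) := by positivity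
  have e : (s - 1) / ((s - 1 + 1) ^ 2 + (1.69 + z)) +
      2 * 1 * (s - 1 + 1) ^ 2 / ((s - 1 + 1) ^ 2 + (1.69 + z)) ^ 2 =
      ((s - 1) * (s ^ 2 + (1.69 + z)) + 2 * s ^ 2) / (s ^ 2 + (1.69 + z)) ^ 2 := by
    have : s ^ 2 + (1.69 + z) ≠ 0 := by positivity
    rw [sub_add_cancel]
    field_simp
  rw [e, ← mul_div_assoc, div_le_div_iff₀ (by positivity) (by positivity)]
  have h0 : 0 ≤ 0.193 * ((s - 1) * (s ^ 2 + 1.69) + 2 * s ^ 2) * 1.94 ^ 2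
      - (s ^ 2 + 1.69) ^ 2 / 4 := by
    have h1 : 0 ≤ s - 1.35 := by linarith
    have h2 : 0 ≤ 3 - s := by linarith
    nlinarith [mul_nonneg h1 h2, mul_nonneg (mul_nonneg h1 h2) h1, mul_nonneg (mul_nonneg h1 h2) (mul_nonneg h1 h2), mul_nonneg (mul_nonneg h1 h2) h2, mul_nonneg (mul_nonneg h1 h1) (mul_nonneg h1 h2)]
  have h1 : 0 ≤ 0.193 * ((s - 1) * 1.94 ^ 2 + 2 * 1.94 * ((s - 1) * (s ^ 2 + 1.69) + 2 * s ^ 2))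
      - (s ^ 2 + 1.69) / 2 := by nlinarith
  have h2 : 0 ≤ 0.193 * (2 * 1.94 * (s - 1) + ((s - 1) * (s ^ 2 + 1.69) + 2 * s ^ 2)) - 1 / 4 := by
    nlinarith
  have h3 : 0 ≤ 0.193 * (s - 1) := by linarith
  nlinarith [mul_nonneg h1 hz, mul_nonneg h2 (sq_nonneg z), mul_nonneg h3 (pow_nonneg hz 3)]

theorem exp_mul_Gk_le {l l' y : ℝ} (hl : 0 ≤ l) (hll : l ≤ l') (hy : |y| ≤ 1.3) :
    Real.exp (-7.999 * l') * Gk 1 l 1.3 ≤ Real.exp (-7.999 * l) * Gk 1 l' y := by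
  obtain ⟨t, rfl⟩ : ∃ t, l' = l + t := ⟨l' - l, by ring⟩
  have ht : 0 ≤ t := by linarith
  have hy2 : y ^ 2 ≤ 1.3 ^ 2 := by
    rw [← sq_abs]
    gcongr
  have h1 : Gk 1 l 1.3 / (1 + t) ^ 4 ≤ Gk 1 (l + t) y := by
    unfold Gk
    rw [add_div]
    have hD : (l + t + 1) ^ 2 + y ^ 2 ≤ ((l + 1) ^ 2 + 1.3 ^ 2) * (1 + t) ^ 2 := by
      nlinarith [mul_nonneg hl ht, mul_nonneg (mul_nonneg hl ht) ht, mul_nonneg (mul_nonneg hl ht) hl, mul_nonneg (mul_nonneg hl ht) (mul_nonneg hl ht)]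
    have hD0 : 0 < (l + t + 1) ^ 2 + y ^ 2 := by positivity
    refine add_le_add ?_ ?_
    · calc l / ((l + 1) ^ 2 + 1.3 ^ 2) / (1 + t) ^ 4
          ≤ l / ((l + 1) ^ 2 + 1.3 ^ 2) / (1 + t) ^ 2 := by
            gcongr
            · linarith
            · norm_num
        _ = l / (((l + 1) ^ 2 + 1.3 ^ 2) * (1 + t) ^ 2) := by rw [div_div]
        _ ≤ (l + t) / ((l + t + 1) ^ 2 + y ^ 2) := by
            gcongr
    · rw [div_div]
      have : ((l + 1) ^ 2 + 1.3 ^ 2) ^ 2 * (1 + t) ^ 4 =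
          (((l + 1) ^ 2 + 1.3 ^ 2) * (1 + t) ^ 2) ^ 2 := by ring
      rw [this]
      gcongr
  have h2 : Real.exp (-7.999 * (l + t)) ≤ Real.exp (-7.999 * l) / (1 + t) ^ 4 := by
    rw [le_div_iff₀ (by positivity)]
    have h3 : (1 + t) ^ 4 ≤ Real.exp (4 * t) := by
      rw [show 4 * t = ((4:ℕ):ℝ) * t by norm_num, Real.exp_nat_mul]
      gcongr
      linarith [Real.add_one_le_exp t]
    calc Real.exp (-7.999 * (l + t)) * (1 + t) ^ 4
        ≤ Real.exp (-7.999 * (l + t)) * Real.exp (4 * t) := by gcongr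
      _ = Real.exp (-7.999 * (l + t) + 4 * t) := (Real.exp_add _ _).symm
      _ ≤ Real.exp (-7.999 * l) := Real.exp_le_exp.2 (by linarith)
  calc Real.exp (-7.999 * (l + t)) * Gk 1 l 1.3
      ≤ Real.exp (-7.999 * l) / (1 + t) ^ 4 * Gk 1 l 1.3 := by
        gcongr
        exact Gk_nonneg hl
    _ = Real.exp (-7.999 * l) * (Gk 1 l 1.3 / (1 + t) ^ 4) := by ring
    _ ≤ _ := by gcongr

theorem cubic_le_exp {x : ℝ} (hx : 0 ≤ x) : 1 + x + x ^ 2 / 2 + x ^ 3 / 6 ≤ Real.exp x := by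
  have := Real.sum_le_exp_of_nonneg hx 4
  norm_num [Finset.sum_range_succ, Nat.factorial] at this
  linarith

theorem exp_neg_le_of_cubic {a b c l : ℝ} (ha : c⁻¹ ≤ Real.exp a) (hc : 0 < c) (hb : 0 ≤ b)
    (hl : 0 ≤ l) :
    Real.exp (-(a + b * l)) * (1 + b * l + (b * l) ^ 2 / 2 + (b * l) ^ 3 / 6) ≤ c := by
  have h1 := cubic_le_exp (mul_nonneg hb hl)
  have h2 : Real.exp (-a) ≤ c := by
    rw [Real.exp_neg]
    exact inv_le_of_inv_le₀ hc ha
  calc _ ≤ Real.exp (-(a + b * l)) * Real.exp (b * l) := by gcongr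
    _ = Real.exp (-a) := by rw [← Real.exp_add]; ring_nf
    _ ≤ c := h2

theorem exp_quintic_mul_le {n : ℕ} {r : ℝ} (hr : 0 ≤ r) :
    2.718 ^ n * (1 + r + r ^ 2 / 2 + r ^ 3 / 6 + r ^ 4 / 24 + r ^ 5 / 120) ≤
      Real.exp (n + r) := by
  have := Real.sum_le_exp_of_nonneg hr 6
  norm_num [Finset.sum_range_succ, Nat.factorial] at this
  rw [Real.exp_add, ← mul_one (n:ℝ), Real.exp_nat_mul]
  have h2 := Real.exp_one_gt_d9
  gcongr
  · linarith

theorem inv_Gk_le {l : ℝ} (hl : 0.35 ≤ l) (hl2 : l ≤ 2) : (Gk 1 l 1.3)⁻¹ ≤ 3 ∧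
    (l ≤ 0.78 → (Gk 1 l 1.3)⁻¹ ≤ 2.54) := by
  obtain ⟨s, rfl⟩ : ∃ s, l = s - 1 := ⟨l + 1, by ring⟩
  have e : (Gk 1 (s - 1) 1.3)⁻¹ = (s ^ 2 + 1.69) ^ 2 / ((s - 1) * (s ^ 2 + 1.69) + 2 * s ^ 2) := by
    unfold Gk
    have : s ^ 2 + 1.69 ≠ 0 := by positivity
    have h1 : 0 < s - 1 := by linarith
    have h2 : (s - 1) * (s ^ 2 + 1.69) + 2 * s ^ 2 ≠ 0 := by positivity
    rw [sub_add_cancel, show (1.3:ℝ) ^ 2 = 1.69 by norm_num, inv_eq_one_div, div_eq_div_iff]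
    · field_simp
    · have : (s - 1) / (s ^ 2 + 1.69) + 2 * 1 * s ^ 2 / (s ^ 2 + 1.69) ^ 2 =
        ((s - 1) * (s ^ 2 + 1.69) + 2 * s ^ 2) / (s ^ 2 + 1.69) ^ 2 := by
          field_simp
      rw [this]
      positivity
    · exact h2
  have h1 : 0 < s - 1 := by linarith
  rw [e]
  have h3 : 0 ≤ 3 - s := by linarith
  have h4 : 0 ≤ s - 1.35 := by linarith
  constructor
  · rw [div_le_iff₀ (by positivity)]
    nlinarith [mul_nonneg h4 h3, mul_nonneg (mul_nonneg h4 h3) h4, mul_nonneg (mul_nonneg h4 h3) (mul_nonneg h4 h3)]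
  · intro h
    have h5 : 0 ≤ 1.78 - s := by linarith
    rw [div_le_iff₀ (by positivity)]
    nlinarith [mul_nonneg h4 h5, mul_nonneg (mul_nonneg h4 h5) h4, mul_nonneg (mul_nonneg h4 h5) (mul_nonneg h4 h5)]

theorem Gk_zero_eq {l : ℝ} (hl : 0 ≤ l) : Gk 1 l 0 = (l + 1)⁻¹ + ((l + 1)⁻¹) ^ 2 := by
  unfold Gk
  field_simp
  ring

/-- Tangent-line bound for the convex function `s⁻¹ + s⁻²`. -/
theorem tangent_le_inv_add_inv_sq {s a : ℝ} (hs : 0 < s) (ha : 0 < a) :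
    a⁻¹ + (a⁻¹) ^ 2 - ((a⁻¹) ^ 2 + 2 * (a⁻¹) ^ 3) * (s - a) ≤ s⁻¹ + (s⁻¹) ^ 2 := by
  set u := s⁻¹ with hu
  set v := a⁻¹ with hv
  have e1 : s = 1 / u := by simp [hu]
  have e2 : a = 1 / v := by simp [hv]
  have hu0 : 0 < u := inv_pos.2 hs
  have hv0 : 0 < v := inv_pos.2 ha
  have : u + u ^ 2 - (v + v ^ 2 - (v ^ 2 + 2 * v ^ 3) * (s - a)) =
      (u - v) ^ 2 * (1 + u + 2 * v) / u := by
    rw [e1, e2]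
    field_simp
    ring
  have h2 : 0 ≤ (u - v) ^ 2 * (1 + u + 2 * v) / u := by
    positivity
  linarith

theorem weight_le_of_value_slope {A g w₀ E₀ E : ℝ} (hE : E₀ ≤ E)
    (h0 : A * (1 + E₀ * g) ≤ 0.088 * (w₀ ^ 2 + 1.2 * w₀ - 0.2762 * E₀))
    (h1 : A * g ≤ 0.088 * (2 * w₀ + 0.9238)) :
    A * (1 + E * g) ≤ 0.088 * ((w₀ + (E - E₀)) ^ 2 + 1.2 * (w₀ + (E - E₀)) - 0.2762 * E) := by
  nlinarith [mul_le_mul_of_nonneg_right h1 (sub_nonneg.2 hE), sq_nonneg (E - E₀)]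


/-- The weight attached to a zero with distance `l` and excess `E`. -/
noncomputable def wt (l E : ℝ) : ℝ := E + Gk 1 l 0 - 0.8505

theorem weight_le_of_le {l E A a c l₀ : ℝ} (hl : 0.35 ≤ l) (hl2 : l ≤ 0.78) (hE : 0 ≤ E)
    (hA0 : 0 ≤ A) (hl0 : 0 < l₀) (hal : a ≤ l)
    (hA : A * (1 + 7.999 * (l - a) + (7.999 * (l - a)) ^ 2 / 2 + (7.999 * (l - a)) ^ 3 / 6) ≤ c)
    {w : ℝ} (hw : w = l₀⁻¹ + (l₀⁻¹) ^ 2 - ((l₀⁻¹) ^ 2 + 2 * (l₀⁻¹) ^ 3) * (l + 1 - l₀) - 0.8505)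
    (hw0 : 0 < w)
    (h0 : c ≤ 0.088 * (w ^ 2 + 1.2 * w) *
      (1 + 7.999 * (l - a) + (7.999 * (l - a)) ^ 2 / 2 + (7.999 * (l - a)) ^ 3 / 6))
    (h1 : 2.54 * c ≤ 0.088 * (2 * w + 0.9238) *
      (1 + 7.999 * (l - a) + (7.999 * (l - a)) ^ 2 / 2 + (7.999 * (l - a)) ^ 3 / 6)) :
    0 < wt l E ∧ A * (1 + E * (Gk 1 l 1.3)⁻¹) ≤
      0.088 * (wt l E ^ 2 + 1.2 * wt l E - 0.2762 * E) := by
  have hww : w ≤ wt l 0 := by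
    have := tangent_le_inv_add_inv_sq (s := l + 1) (by linarith) hl0
    rw [hw, wt, Gk_zero_eq (by linarith)]
    linarith
  have hwE : wt l E = wt l 0 + (E - 0) := by unfold wt; ring
  set p := 1 + 7.999 * (l - a) + (7.999 * (l - a)) ^ 2 / 2 + (7.999 * (l - a)) ^ 3 / 6
  have hp : 0 < p := by
    have : 0 ≤ l - a := by linarith
    positivity
  have hA1 : A ≤ 0.088 * (w ^ 2 + 1.2 * w) := le_of_mul_le_mul_right (hA.trans h0) hp
  have hA2 : 2.54 * A ≤ 0.088 * (2 * w + 0.9238) :=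
    le_of_mul_le_mul_right (by nlinarith) hp
  have hg := (inv_Gk_le hl (by linarith)).2 hl2
  refine ⟨by rw [hwE]; linarith, ?_⟩
  rw [hwE]
  apply weight_le_of_value_slope hE
  · nlinarith
  · nlinarith [mul_le_mul_of_nonneg_left hg hA0]

theorem weight_le_of_lt {l E : ℝ} (hl : 0.35 ≤ l) (hl2 : l ≤ 0.78) (hE : 0 ≤ E) :
    0 < wt l E ∧ Real.exp (-7.999 * l) * (1 + E * (Gk 1 l 1.3)⁻¹) ≤
      0.088 * (wt l E ^ 2 + 1.2 * wt l E - 0.2762 * E) := by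
  have hA : ∀ (a c : ℝ), c⁻¹ ≤ Real.exp (7.999 * a) → 0 < c → a ≤ l → Real.exp (-7.999 * l) *
      (1 + 7.999 * (l - a) + (7.999 * (l - a)) ^ 2 / 2 + (7.999 * (l - a)) ^ 3 / 6) ≤ c := by
    intro a c h hc ha
    have := exp_neg_le_of_cubic h hc (b := 7.999) (by norm_num) (sub_nonneg.2 ha)
    rwa [show -(7.999 * a + 7.999 * (l - a)) = -7.999 * l by ring] at this
  have hA0 := (Real.exp_pos (-7.999 * l)).le
  rcases le_total l 0.5 with h | h
  · obtain ⟨t, rfl⟩ : ∃ t, l = 0.35 + t := ⟨l - 0.35, by ring⟩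
    refine weight_le_of_le (a := 0.35) (c := 0.0609) (l₀ := 1.35) hl hl2 hE hA0 (by norm_num)
      (by linarith) (hA _ _ ?_ (by norm_num) (by linarith)) rfl ?_ ?_ ?_
    · have := exp_quintic_mul_le (n := 2) (r := 7.999 * 0.35 - 2) (by norm_num)
      norm_num at this ⊢
      linarith
    · norm_num
      linarith
    all_goals
      norm_num
      have h1 : 0 ≤ t := by linarith
      have h2 : 0 ≤ 0.15 - t := by linarith
      nlinarith [mul_nonneg h1 h2, mul_nonneg (mul_nonneg h1 h2) h1]
  rcases le_total l 0.65 with h' | h'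
  · obtain ⟨t, rfl⟩ : ∃ t, l = 0.5 + t := ⟨l - 0.5, by ring⟩
    refine weight_le_of_le (a := 0.5) (c := 0.0187) (l₀ := 1.5) hl hl2 hE hA0 (by norm_num)
      (by linarith) (hA _ _ ?_ (by norm_num) (by linarith)) rfl ?_ ?_ ?_
    · have := exp_quintic_mul_le (n := 3) (r := 7.999 * 0.5 - 3) (by norm_num)
      norm_num at this ⊢
      linarith
    · norm_num
      linarith
    all_goals
      norm_num
      have h1 : 0 ≤ t := by linarith
      have h2 : 0 ≤ 0.15 - t := by linarith
      nlinarith [mul_nonneg h1 h2, mul_nonneg (mul_nonneg h1 h2) h1]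
  · obtain ⟨t, rfl⟩ : ∃ t, l = 0.65 + t := ⟨l - 0.65, by ring⟩
    refine weight_le_of_le (a := 0.65) (c := 0.0056) (l₀ := 1.72) hl hl2 hE hA0 (by norm_num)
      (by linarith) (hA _ _ ?_ (by norm_num) (by linarith)) rfl ?_ ?_ ?_
    · have := exp_quintic_mul_le (n := 5) (r := 7.999 * 0.65 - 5) (by norm_num)
      norm_num at this ⊢
      linarith
    · norm_num
      linarith
    all_goals
      norm_num
      have h1 : 0 ≤ t := by linarith
      have h2 : 0 ≤ 0.13 - t := by linarith
      nlinarith [mul_nonneg h1 h2, mul_nonneg (mul_nonneg h1 h2) h1]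

theorem weight_le_of_ge {l E : ℝ} (hl : 0.78 ≤ l) (hl2 : l ≤ 2) (hE : 0.7 * (l - 0.78) ≤ E) :
    0 < wt l E ∧ Real.exp (-7.999 * l) * (1 + E * (Gk 1 l 1.3)⁻¹) ≤
      0.088 * (wt l E ^ 2 + 1.2 * wt l E - 0.2762 * E) := by
  obtain ⟨u, rfl⟩ : ∃ u, l = 0.78 + u := ⟨l - 0.78, by ring⟩
  have hu : 0 ≤ u := by linarith
  have hA : Real.exp (-7.999 * (0.78 + u)) * (1 + 7.999 * u + (7.999 * u) ^ 2 / 2) ≤ 0.00199 := by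
    have h1 : (0.00199:ℝ)⁻¹ ≤ Real.exp (7.999 * 0.78) := by
      have := exp_quintic_mul_le (n := 6) (r := 7.999 * 0.78 - 6) (by norm_num)
      norm_num at this ⊢
      linarith
    have := exp_neg_le_of_cubic h1 (by norm_num) (b := 7.999) (by norm_num) hu
    rw [show -(7.999 * 0.78 + 7.999 * u) = -7.999 * (0.78 + u) by ring] at this
    have h3 : 0 ≤ Real.exp (-7.999 * (0.78 + u)) * ((7.999 * u) ^ 3 / 6) := by positivity
    linarith
  set A := Real.exp (-7.999 * (0.78 + u))
  have hA0 : 0 ≤ A := (Real.exp_pos _).le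
  have hA1 : A ≤ 0.00199 := by
    nlinarith [mul_nonneg hA0 hu, mul_nonneg hA0 (mul_nonneg hu hu)]
  have hg := (inv_Gk_le (by linarith) hl2).1
  have hg0 : 0 ≤ (Gk 1 (0.78 + u) 1.3)⁻¹ := inv_nonneg.2 (Gk_nonneg (by linarith))
  have hwE : wt (0.78 + u) E = wt (0.78 + u) (0.7 * u) + (E - 0.7 * u) := by unfold wt; ring
  have t1 := tangent_le_inv_add_inv_sq (s := 0.78 + u + 1) (a := 1.95) (by linarith) (by norm_num)
  have t2 := tangent_le_inv_add_inv_sq (s := 0.78 + u + 1) (a := 1.78) (by linarith) (by norm_num)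
  rw [← Gk_zero_eq (by linarith)] at t1 t2
  have hE' : 0.7 * u ≤ E := by linarith
  set w := wt (0.78 + u) (0.7 * u) with hw
  have hw' : w = 0.7 * u + Gk 1 (0.78 + u) 0 - 0.8505 := rfl
  norm_num at t1 t2
  have hw0 : 0.02 ≤ w := by linarith
  have key : A * (1 + 2.1 * u) ≤ 0.088 * (w ^ 2 + 1.2 * w - 0.19334 * u) := by
    rcases le_total u 0.04 with h | h
    · have h2 : A * (1 + 2.1 * u) ≤ 0.00199 := by
        nlinarith [mul_nonneg hA0 hu, mul_nonneg hA0 (mul_nonneg hu hu)]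
      nlinarith
    · have h2 : A * (1 + 2.1 * u) * 1.2 ≤ 0.00199 := by
        nlinarith [mul_nonneg hA0 hu, mul_nonneg hA0 (mul_nonneg hu hu), mul_nonneg hA0 (sub_nonneg.2 h)]
      nlinarith
  refine ⟨by rw [hwE]; linarith, ?_⟩
  rw [hwE]
  apply weight_le_of_value_slope hE'
  · have : A * (1 + 0.7 * u * (Gk 1 (0.78 + u) 1.3)⁻¹) ≤ A * (1 + 2.1 * u) :=
      mul_le_mul_of_nonneg_left (by linarith [mul_le_mul_of_nonneg_left hg hu]) hA0
    linarith
  · nlinarith [mul_le_mul_of_nonneg_left hg hA0]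

variable {q : ℕ}

theorem hk_neg (γ y : ℝ) : hk γ (-y) = hk γ y := by simp [hk]

theorem hk_half_nonneg (y : ℝ) : 0 ≤ hk (1 / 2) y := by
  unfold hk
  positivity

theorem hk_half_zero : hk (1 / 2) 0 = 4 := by norm_num [hk]

theorem hk_half_le_of_ten_le {y : ℝ} (hy : 10 ≤ |y|) : hk (1 / 2) y ≤ 1 / 2000 := by
  have : (100:ℝ) ≤ y ^ 2 := by
    rw [← sq_abs]
    nlinarith
  unfold hk
  rw [div_le_iff₀ (by positivity)]
  nlinarith

/-- Two zeros of the same `L`-function whose heights differ by less than `1.3 / log q`. -/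
def closePair (j k : DirichletCharacter ℂ q × ℂ) : Prop :=
  j.1 = k.1 ∧ |(k.2.im - j.2.im) * Real.log q| < 1.3

theorem nearPair_of_closePair (hL : 80 ≤ Real.log q) {j k : DirichletCharacter ℂ q × ℂ}
    (h : closePair j k) : nearPair j k := by
  refine ⟨h.1, ?_⟩
  have h2 := h.2
  rw [abs_mul, abs_of_pos (show 0 < Real.log q by linarith)] at h2
  nlinarith [abs_nonneg (k.2.im - j.2.im)]

variable [NeZero q]

theorem sum_sum_hk_le {R : ℝ} (hL : 80 ≤ Real.log q)
    {P T : Finset (DirichletCharacter ℂ q × ℂ)} (hP : ∀ p ∈ P, IsZeroPair R p) (hTP : T ⊆ P)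
    (hT : ∀ p ∈ T, 0.35 ≤ lam q p.2 ∧ lam q p.2 ≤ 2)
    (hsep : ∀ j ∈ T, ∀ k ∈ T, closePair j k → j = k)
    {w : DirichletCharacter ℂ q × ℂ → ℝ} (hw : ∀ j ∈ T, 0 ≤ w j) :
    ∑ j ∈ T, ∑ k ∈ T, (if j.1 = k.1 then
        w j * w k * hk (1 / 2) ((j.2.im - k.2.im) * Real.log q) else 0) ≤
      ∑ j ∈ T, w j ^ 2 * (4 + 0.193 * excess P j) + 1 / 2000 * (∑ j ∈ T, w j) ^ 2 := by
  set c : DirichletCharacter ℂ q × ℂ → DirichletCharacter ℂ q × ℂ → ℝ := fun j k =>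
    if nearPair j k then hk (1 / 2) ((j.2.im - k.2.im) * Real.log q) else 0 with hc
  have hc0 : ∀ j k, 0 ≤ c j k := by
    intro j k
    simp only [hc]
    split_ifs
    · exact hk_half_nonneg _
    · exact le_rfl
  have hcs : ∀ j k, c j k = c k j := by
    intro j k
    have h1 : nearPair j k ↔ nearPair k j := ⟨nearPair_symm, nearPair_symm⟩
    simp only [hc, h1]
    rw [← hk_neg]
    ring_nf
  have hpt : ∀ j ∈ T, ∀ k ∈ T, (if j.1 = k.1 then
      w j * w k * hk (1 / 2) ((j.2.im - k.2.im) * Real.log q) else 0) ≤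
      c j k * (w j * w k) + 1 / 2000 * (w j * w k) := by
    intro j hj k hk'
    have hjk := mul_nonneg (hw j hj) (hw k hk')
    by_cases h1 : j.1 = k.1
    · simp only [h1, if_true, hc]
      by_cases h2 : nearPair j k
      · simp only [h2, if_true]
        linarith
      · simp only [h2, if_false]
        have h3 : ¬ |k.2.im - j.2.im| ≤ 1 / 8 := fun h => h2 ⟨h1, h⟩
        have h4 : 10 ≤ |(j.2.im - k.2.im) * Real.log q| := by
          rw [abs_mul, abs_sub_comm, abs_of_pos (show 0 < Real.log q by linarith)]
          nlinarith
        nlinarith [mul_le_mul_of_nonneg_left (hk_half_le_of_ten_le h4) hjk]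
    · simp only [h1, if_false]
      have := mul_nonneg (hc0 j k) hjk
      positivity
  have hrow : ∀ j ∈ T, ∑ k ∈ T, c j k ≤ 4 + 0.193 * excess P j := by
    intro j hj
    have h1 : ∀ k ∈ T, c j k ≤ (if k = j then 4 else 0) + 0.193 *
        (if nearPair j k then (pairMult k - if k = j then 1 else 0) * pairKernel j k else 0) := by
      intro k hk'
      have hkP := hP k (hTP hk')
      have h0 := pairKernel_nonneg j hkP
      by_cases hkj : k = j
      · subst hkj
        have := one_le_pairMult hkP
        simp only [hc, nearPair_refl, if_true, sub_self, zero_mul, hk_half_zero]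
        have := mul_nonneg (sub_nonneg.2 this) h0
        linarith
      · by_cases hn : nearPair j k
        · simp only [hc, hn, hkj, if_true, if_false, zero_add, sub_zero]
          have h2 : 1.3 ≤ |(k.2.im - j.2.im) * Real.log q| := by
            by_contra! h
            exact hkj (hsep j hj k hk' ⟨hn.1, h⟩).symm
          have h3 := hk_half_le_Gk (hT k hk').1 (hT k hk').2 h2
          rw [← hk_neg, show -((j.2.im - k.2.im) * Real.log q) =
            (k.2.im - j.2.im) * Real.log q by ring]
          have h4 := mul_le_mul_of_nonneg_right (one_le_pairMult hkP) h0
          unfold pairKernel at h4 ⊢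
          linarith
        · simp [hc, hn, hkj]
    refine (sum_le_sum h1).trans ?_
    rw [Finset.sum_add_distrib, Finset.sum_ite_eq', ← mul_sum, ← Finset.sum_filter]
    simp only [hj, if_true]
    have := sum_le_excess (T := T.filter (nearPair j)) (j := j) hP fun k hk' =>
      ⟨hTP (Finset.mem_filter.1 hk').1, (Finset.mem_filter.1 hk').2⟩
    linarith
  have h2 := sum_sum_mul_le_weighted T c w (fun _ => 1) (fun j _ k _ => hc0 j k)
    (fun j _ k _ => hcs j k) (fun _ _ => one_pos)
  calc _ ≤ ∑ j ∈ T, ∑ k ∈ T, (c j k * (w j * w k) + 1 / 2000 * (w j * w k)) :=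
        sum_le_sum fun j hj => sum_le_sum fun k hk' => hpt j hj k hk'
    _ = ∑ j ∈ T, ∑ k ∈ T, c j k * (w j * w k) + 1 / 2000 * (∑ j ∈ T, w j) ^ 2 := by
        simp only [Finset.sum_add_distrib, ← mul_sum]
        rw [sq, Finset.sum_mul]
    _ ≤ _ := by
        refine add_le_add_left ?_ _
        refine h2.trans (sum_le_sum fun j hj => ?_)
        simp only [div_one, mul_one]
        rw [← Finset.sum_mul, mul_comm]
        exact mul_le_mul_of_nonneg_left (hrow j hj) (sq_nonneg _)

theorem sum_close_le {R : ℝ} (hL : 80 ≤ Real.log q)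
    {P S : Finset (DirichletCharacter ℂ q × ℂ)} (hP : ∀ p ∈ P, IsZeroPair R p) (hSP : S ⊆ P)
    {j : DirichletCharacter ℂ q × ℂ} (hj : 0.35 ≤ lam q j.2)
    (hS : ∀ k ∈ S, closePair j k ∧ lam q j.2 ≤ lam q k.2) :
    ∑ k ∈ S, (pairMult k - if k = j then 1 else 0) * Real.exp (-7.999 * lam q k.2) ≤
      Real.exp (-7.999 * lam q j.2) * (excess P j * (Gk 1 (lam q j.2) 1.3)⁻¹) := by
  have hG : 0 < Gk 1 (lam q j.2) 1.3 := by
    have : 0 < lam q j.2 := by linarith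
    unfold Gk
    positivity
  rw [← mul_assoc, ← div_eq_mul_inv, le_div_iff₀ hG, Finset.sum_mul]
  have h1 := sum_le_excess (T := S) (j := j) hP fun k hk' =>
    ⟨hSP hk', nearPair_of_closePair hL (hS k hk').1⟩
  refine le_trans ?_ (mul_le_mul_of_nonneg_left h1 (Real.exp_pos _).le)
  rw [mul_sum]
  refine sum_le_sum fun k hk' => ?_
  have h2 := exp_mul_Gk_le (by linarith) (hS k hk').2 (hS k hk').1.2.le
  have h3 := mul_le_mul_of_nonneg_left h2 (pairMult_sub_nonneg (hP k (hSP hk')) j)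
  unfold pairKernel
  linarith

theorem prime_group_le {R : ℝ} (hR : 0 < R) : ∃ q₀ : ℕ, ∀ (q : ℕ) [NeZero q], q₀ ≤ q →
    ∀ P : Finset (DirichletCharacter ℂ q × ℂ), (∀ p ∈ P, IsZeroPair R p) →
    (∀ p ∈ P, 0.35 ≤ lam q p.2) → ∀ Q ⊆ P,
    (∀ p ∈ Q, lam q p.2 ≤ 2 ∧ (lam q p.2 < 0.78 ∨ 0.7 * (lam q p.2 - 0.78) ≤ excess P p)) →
    ∑ p ∈ Q, pairMult p * Real.exp (-7.999 * lam q p.2) ≤ 0.505 := by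
  obtain ⟨q₁, h₁⟩ := excess_duality hR (ε := 1 / 2000) (by norm_num)
  obtain ⟨q₂, h₂⟩ := eventually_atTop.1 (tendsto_log_nat.eventually_ge_atTop 80)
  refine ⟨max q₁ q₂, fun q _ hq P hP hlam Q hQP hQ => ?_⟩
  have hL : 80 ≤ Real.log q := h₂ q (le_of_max_le_right hq)
  obtain ⟨T, hTQ, hsep, rep, hrep⟩ := exists_separated_representatives
    (closePair (q := q)) (fun j => ⟨rfl, by norm_num⟩)
    (fun j k h => ⟨h.1.symm, by
      rw [← abs_neg, show -((j.2.im - k.2.im) * Real.log q) =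
        (k.2.im - j.2.im) * Real.log q by ring]
      exact h.2⟩) (fun p => lam q p.2) Q
  have hTP : T ⊆ P := hTQ.trans hQP
  set w : DirichletCharacter ℂ q × ℂ → ℝ := fun j => wt (lam q j.2) (excess P j) with hwdef
  have hE : ∀ j, 0 ≤ excess P j := excess_nonneg hP
  have hpt : ∀ j ∈ Q, 0 < w j ∧
      Real.exp (-7.999 * lam q j.2) * (1 + excess P j * (Gk 1 (lam q j.2) 1.3)⁻¹) ≤
        0.088 * (w j ^ 2 + 1.2 * w j - 0.2762 * excess P j) := by
    intro j hj
    rcases lt_or_ge (lam q j.2) 0.78 with h | h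
    · exact weight_le_of_lt (hlam j (hQP hj)) h.le (hE j)
    · exact weight_le_of_ge h (hQ j hj).1 ((hQ j hj).2.resolve_left (not_lt.2 h))
  have hd : (∑ j ∈ T, w j * (w j + 0.6)) ^ 2 ≤ (103 / 72 + 1 / 2000) *
      (∑ j ∈ T, w j ^ 2 * (4 + 0.193 * excess P j) +
        (1 / 4 + 1 / 2000 + 1 / 2000) * (∑ j ∈ T, w j) ^ 2) := by
    have h := h₁ q (le_of_max_le_left hq) P hP T hTP w (fun j hj => (hpt j (hTQ hj)).1.le)
      fun j hj => by
        have := (hpt j (hTQ hj)).1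
        simp only [hwdef, wt] at this
        linarith
    have e : ∑ j ∈ T, w j * (excess P j + Gk 1 (lam q j.2) 0 - (1 / 4 + 1 / 2000)) =
        ∑ j ∈ T, w j * (w j + 0.6) := by
      refine sum_congr rfl fun j _ => ?_
      simp only [hwdef, wt]
      ring
    rw [e] at h
    have h2 := sum_sum_hk_le hL hP hTP
      (fun p hp => ⟨hlam p (hTP hp), (hQ p (hTQ hp)).1⟩) hsep
      (w := w) (fun j hj => (hpt j (hTQ hj)).1.le)
    linarith
  have hmain := sum_sq_add_le_of_duality T w (excess P) (d := 0.6)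
    (fun j hj => (hpt j (hTQ hj)).1) (fun j _ => hE j) (by norm_num) (by norm_num) (by norm_num)
    (by norm_num) hd
  rw [sum_le_sum_representatives hTQ (fun k hk' => (hrep k hk').1)
    (fun j hj => hsep _ (hrep j (hTQ hj)).1 j hj (hrep j (hTQ hj)).2.1)]
  calc _ ≤ ∑ j ∈ T, 0.088 * (w j ^ 2 + 1.2 * w j - 0.2762 * excess P j) := by
        refine sum_le_sum fun j hj => le_trans ?_ (hpt j (hTQ hj)).2
        have h := sum_close_le hL hP (S := Q.filter (fun k => rep k = j)) (j := j)
          ((Finset.filter_subset _ _).trans hQP) (hlam j (hTP hj)) fun k hk' => by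
            obtain ⟨h1, h2⟩ := Finset.mem_filter.1 hk'
            have h3 := (hrep k h1).2
            rwa [h2] at h3
        rw [mul_add, mul_one]
        refine add_le_add_right ?_ _
        refine le_of_eq_of_le ?_ h
        congr!
    _ ≤ ∑ j ∈ T, 0.088 * (w j ^ 2 + 2 * 0.6 * w j -
          (103 / 72 + 1 / 2000) * 0.193 * excess P j) := by
        refine sum_le_sum fun j hj => ?_
        linarith [hE j]
    _ ≤ 0.505 := by
        rw [← mul_sum]
        linarith

end LFZ

namespace LFZ
open Finset Filter Topology Metric Real MeasureTheory

theorem exp_le_quintic {n : ℕ} {r : ℝ} (hr : 0 ≤ r) (hr1 : r ≤ 1) :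
    Real.exp (n + r) ≤ 2.71829 ^ n * (1 + r + r ^ 2 / 2 + r ^ 3 / 6 + r ^ 4 / 24 + r ^ 5 / 120 +
      r ^ 6 * 7 / 4320) := by
  have := Real.exp_bound' hr hr1 (n := 6) (by norm_num)
  norm_num [Finset.sum_range_succ, Nat.factorial] at this
  rw [Real.exp_add, ← mul_one (n:ℝ), Real.exp_nat_mul]
  have h2 := Real.exp_one_lt_d9
  gcongr
  · linarith

theorem sieve_constant_le :
    (0.45 * Real.exp 1.935 - Real.exp 0.822 * (Real.exp 0.45 - 1)) / 0.449 ^ 2 + 0.001 ≤ 9.06 := by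
  have h1 := exp_le_quintic (n := 1) (r := 0.935) (by norm_num) (by norm_num)
  have h2 := exp_quintic_mul_le (n := 1) (r := 0.272) (by norm_num)
  have h3 := exp_le_quintic (n := 0) (r := 0.822) (by norm_num) (by norm_num)
  rw [mul_sub, ← Real.exp_add]
  norm_num at h1 h2 h3 ⊢
  linarith

theorem trapK_le : trapK 0.372 0.822 1.934 2.334 0.56 ≤ 3.42 := by
  have h1 := exp_le_quintic (n := 0) (r := 0.56 * 0.372) (by norm_num) (by norm_num)
  have h2 := exp_quintic_mul_le (n := 0) (r := 0.56 * 0.822) (by norm_num)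
  have h3 := exp_le_quintic (n := 1) (r := 0.56 * 2.334 - 1) (by norm_num) (by norm_num)
  have h4 := exp_quintic_mul_le (n := 1) (r := 0.56 * 1.934 - 1) (by norm_num)
  unfold trapK
  norm_num at h1 h2 h3 h4 ⊢
  linarith

theorem trapA_le : trapA 0.372 0.822 1.934 2.334 0.56 ≤ 22.9 := by
  have h1 := exp_le_quintic (n := 0) (r := 0.56 * 0.372) (by norm_num) (by norm_num)
  have h2 := exp_le_quintic (n := 0) (r := 0.56 * 0.822) (by norm_num) (by norm_num)
  have h3 := exp_le_quintic (n := 1) (r := 0.56 * 2.334 - 1) (by norm_num) (by norm_num)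
  have h4 := exp_le_quintic (n := 1) (r := 0.56 * 1.934 - 1) (by norm_num) (by norm_num)
  unfold trapA
  norm_num at h1 h2 h3 h4 ⊢
  linarith

/-- The weight `min l l⁻¹` used to compare `1 / (4 / 3 + y ^ 2)` with the kernel. -/
noncomputable def minInv (l : ℝ) : ℝ := min l l⁻¹

theorem minInv_pos {l : ℝ} (hl : 0 < l) : 0 < minInv l := lt_min hl (inv_pos.2 hl)

theorem minInv_div_le_Gk {l y : ℝ} (hl : 0 < l) : minInv l / (4 / 3 + y ^ 2) ≤ Gk 1 l y := by
  unfold Gk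
  have e : l / ((l + 1) ^ 2 + y ^ 2) + 2 * 1 * (l + 1) ^ 2 / ((l + 1) ^ 2 + y ^ 2) ^ 2 =
      (l * ((l + 1) ^ 2 + y ^ 2) + 2 * (l + 1) ^ 2) / ((l + 1) ^ 2 + y ^ 2) ^ 2 := by
    field_simp
  rw [e]
  have hY := sq_nonneg y
  generalize y ^ 2 = Y at hY
  rcases le_total l 1 with h | h
  · refine (div_le_div_of_nonneg_right (min_le_left l l⁻¹) (by positivity)).trans ?_
    rw [div_le_div_iff₀ (by positivity) (by positivity)]
    have : 0 ≤ 1 - l := by linarith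
    nlinarith [mul_nonneg hl.le this, mul_nonneg hl.le hY, mul_nonneg (mul_nonneg hl.le this) hY, mul_nonneg (mul_nonneg hl.le this) hl.le, mul_nonneg (mul_nonneg hl.le hl.le) hY, mul_nonneg this hY]
  · refine (div_le_div_of_nonneg_right (min_le_right l l⁻¹) (by positivity)).trans ?_
    rw [inv_eq_one_div, div_div, div_le_div_iff₀ (by positivity) (by positivity)]
    have : 0 ≤ l - 1 := by linarith
    nlinarith [mul_nonneg hl.le this, mul_nonneg hl.le hY, mul_nonneg (mul_nonneg hl.le this) hY, mul_nonneg (mul_nonneg hl.le this) hl.le, mul_nonneg (mul_nonneg hl.le hl.le) hY, mul_nonneg this hY, mul_nonneg (mul_nonneg this this) hY, mul_nonneg this (mul_nonneg hY hY)]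

theorem minInv_eq_of_le_one {l : ℝ} (hl : 0 < l) (h : l ≤ 1) : minInv l = l :=
  min_eq_left (h.trans ((one_le_inv₀ hl).2 h))

theorem minInv_eq_of_one_le {l : ℝ} (h : 1 ≤ l) : minInv l = l⁻¹ :=
  min_eq_right ((inv_le_one_of_one_le₀ h).trans h)

theorem row_weight_le {l E : ℝ} (hl : 0.78 ≤ l) (hE2 : E ≤ 2.26)
    (hE : l ≤ 2 → E ≤ 0.7 * (l - 0.78)) :
    (Real.exp (-7.999 * l) * Real.exp ((l - 0.78) * 2.334)) ^ 2 *
        (3.42 + 26.4 * (E / minInv l)) ≤ 0.00804 * Real.exp (-7.999 * l) := by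
  obtain ⟨t, rfl⟩ : ∃ t, l = 0.78 + t := ⟨l - 0.78, by ring⟩
  have ht : 0 ≤ t := by linarith
  have h1 : Real.exp (-7.999 * 0.78) ≤ 0.00196 := by
    have := exp_quintic_mul_le (n := 6) (r := 7.999 * 0.78 - 6) (by norm_num)
    rw [show -7.999 * 0.78 = -(7.999 * 0.78 : ℝ) by norm_num, Real.exp_neg]
    refine inv_le_of_inv_le₀ (by norm_num) ?_
    norm_num at this ⊢
    linarith
  have e : (Real.exp (-7.999 * (0.78 + t)) * Real.exp ((0.78 + t - 0.78) * 2.334)) ^ 2 =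
      Real.exp (-7.999 * (0.78 + t)) * (Real.exp (-7.999 * 0.78) * Real.exp (-(3.331 * t))) := by
    rw [← Real.exp_add, ← Real.exp_add, ← Real.exp_add, sq, ← Real.exp_add]
    ring_nf
  have h2 : Real.exp (-(3.331 * t)) * (3.42 + 26.4 * (E / minInv (0.78 + t))) ≤ 4.1 := by
    rw [Real.exp_neg, inv_mul_le_iff₀ (Real.exp_pos _)]
    have hc : 1 + 3.331 * t + (3.331 * t) ^ 2 / 2 + (3.331 * t) ^ 3 / 6 + (3.331 * t) ^ 4 / 24 ≤
        Real.exp (3.331 * t) := by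
      have := Real.sum_le_exp_of_nonneg (x := 3.331 * t) (by positivity) 5
      norm_num [Finset.sum_range_succ, Nat.factorial] at this ⊢
      linarith
    refine le_trans ?_ (mul_le_mul_of_nonneg_right hc (by norm_num))
    rcases le_total (0.78 + t) 1 with h | h
    · rw [minInv_eq_of_le_one (by linarith) h]
      have hE' : E ≤ 0.7 * t := by linarith [hE (by linarith)]
      have : E / (0.78 + t) ≤ 0.7 * t / (0.78 + t) := by gcongr
      have h3 : 3.42 + 26.4 * (0.7 * t / (0.78 + t)) ≤
          (1 + 3.331 * t + (3.331 * t) ^ 2 / 2) * 4.1 := by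
        rw [← mul_div_assoc, ← le_sub_iff_add_le', div_le_iff₀ (by linarith)]
        nlinarith [mul_nonneg ht (sq_nonneg (t - 0.1)), sq_nonneg (t - 0.1)]
      have : 0 ≤ ((3.331 * t) ^ 3 / 6 + (3.331 * t) ^ 4 / 24) * 4.1 := by positivity
      linarith
    · rw [minInv_eq_of_one_le h, div_inv_eq_mul]
      rcases le_total (0.78 + t) 2 with h' | h'
      · have hE' : E * (0.78 + t) ≤ 0.7 * t * (0.78 + t) := by
          have := hE h'
          gcongr
          linarith
        nlinarith [pow_nonneg ht 3, pow_nonneg ht 4, mul_nonneg ht (sq_nonneg (t - 0.5))]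
      · have hE' : E * (0.78 + t) ≤ 2.26 * (0.78 + t) := by gcongr
        have : 0 ≤ t - 1.22 := by linarith
        nlinarith [pow_nonneg ht 3, pow_nonneg ht 4, mul_nonneg ht this, mul_nonneg (mul_nonneg ht ht) this, mul_nonneg (pow_nonneg ht 3) this]
  have h0 : 0 ≤ Real.exp (-7.999 * 0.78) := (Real.exp_pos _).le
  rw [e]
  have h3 : Real.exp (-7.999 * 0.78) *
      (Real.exp (-(3.331 * t)) * (3.42 + 26.4 * (E / minInv (0.78 + t)))) ≤ 0.00804 :=
    (mul_le_mul_of_nonneg_left h2 h0).trans (by linarith)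
  have h4 := mul_le_mul_of_nonneg_left h3 (Real.exp_pos (-7.999 * (0.78 + t))).le
  linarith

variable {q : ℕ}

theorem norm_integral_pairExp_le {ρ σ : ℂ} (hρ : 0.78 ≤ lam q ρ) (hσ : 0.78 ≤ lam q σ) :
    ‖∫ t in (0.372:ℝ)..2.334, (trap 0.372 0.822 1.934 2.334 t : ℂ) *
        Complex.exp (pairExp q ρ σ * t)‖ ≤
      Real.exp ((lam q ρ - 0.78) * 2.334) * Real.exp ((lam q σ - 0.78) * 2.334) * 3.42 := by
  have h := norm_integral_trap_le (u₀ := 0.372) (u := 0.822) (x := 1.934) (x₁ := 2.334)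
    (μ := 0.56) (z := pairExp q ρ σ) (by norm_num) (by norm_num) (by norm_num) (by norm_num)
    (by rw [pairExp_re]; linarith)
  rw [pairExp_re] at h
  rw [← Real.exp_add]
  refine h.trans ?_
  rw [show (lam q ρ + lam q σ - 1 - 0.56) * 2.334 =
    (lam q ρ - 0.78) * 2.334 + (lam q σ - 0.78) * 2.334 by ring]
  exact mul_le_mul_of_nonneg_left trapK_le (Real.exp_pos _).le

theorem norm_integral_pairExp_le_div {ρ σ : ℂ} (hρ : 0.78 ≤ lam q ρ) (hσ : 0.78 ≤ lam q σ) :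
    ‖∫ t in (0.372:ℝ)..2.334, (trap 0.372 0.822 1.934 2.334 t : ℂ) *
        Complex.exp (pairExp q ρ σ * t)‖ ≤
      Real.exp ((lam q ρ - 0.78) * 2.334) * Real.exp ((lam q σ - 0.78) * 2.334) *
        (26.4 / (4 / 3 + ((σ.im - ρ.im) * Real.log q) ^ 2)) := by
  have h := norm_integral_trap_mul_add_le (u₀ := 0.372) (u := 0.822) (x := 1.934) (x₁ := 2.334)
    (μ := 0.56) (X := 4 / 3) (z := pairExp q ρ σ) (by norm_num) (by norm_num) (by norm_num)
    (by norm_num) (by norm_num) (by rw [pairExp_re]; linarith)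
  rw [pairExp_re, pairExp_im] at h
  rw [← Real.exp_add, ← mul_div_assoc, le_div_iff₀ (by positivity)]
  rw [show (σ.im - ρ.im) * Real.log q = -((ρ.im - σ.im) * Real.log q) by ring]
  refine h.trans ?_
  rw [show (lam q ρ + lam q σ - 1 - 0.56) * 2.334 =
    (lam q ρ - 0.78) * 2.334 + (lam q σ - 0.78) * 2.334 by ring]
  refine mul_le_mul_of_nonneg_left ?_ (Real.exp_pos _).le
  linarith [trapK_le, trapA_le]

end LFZ

namespace LFZ
open Finset Filter Topology Metric Real MeasureTheory

variable {q : ℕ} [NeZero q]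

theorem pairMult_nonneg (p : DirichletCharacter ℂ q × ℂ) : 0 ≤ pairMult p := Nat.cast_nonneg _

/-- The norm of the smoothed correlation integral of two zeros. -/
noncomputable def pairInt (j k : DirichletCharacter ℂ q × ℂ) : ℝ :=
  ‖∫ t in (0.372:ℝ)..2.334, (trap 0.372 0.822 1.934 2.334 t : ℂ) *
    Complex.exp (pairExp q j.2 k.2 * t)‖

theorem pairInt_far_le {R η : ℝ} (hL : 1 ≤ Real.log q)
    (hη : Real.exp (R * 2.334) ^ 2 * 1689.6 ≤ η * Real.log q ^ 2)
    {j k : DirichletCharacter ℂ q × ℂ} (hj : IsZeroPair R j) (hk : IsZeroPair R k)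
    (hj' : 0.78 ≤ lam q j.2) (hk' : 0.78 ≤ lam q k.2) (h : 1 / 8 ≤ |k.2.im - j.2.im|) :
    pairInt j k ≤ η := by
  refine (norm_integral_pairExp_le_div hj' hk').trans ?_
  have h1 := lam_le_of_mem_rect (by linarith) hj.2.1
  have h2 := lam_le_of_mem_rect (by linarith) hk.2.1
  have h3 : Real.log q ^ 2 / 64 ≤ ((k.2.im - j.2.im) * Real.log q) ^ 2 := by
    rw [mul_pow, ← sq_abs (k.2.im - j.2.im)]
    have : (1 / 8 : ℝ) ^ 2 ≤ |k.2.im - j.2.im| ^ 2 := by gcongr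
    nlinarith [sq_nonneg (Real.log q)]
  calc _ ≤ Real.exp (R * 2.334) * Real.exp (R * 2.334) * (26.4 / (Real.log q ^ 2 / 64)) := by
        gcongr
        · linarith
        · linarith
        · linarith
    _ = Real.exp (R * 2.334) ^ 2 * 1689.6 / Real.log q ^ 2 := by
        field_simp
        norm_num
    _ ≤ η := by
        rw [div_le_iff₀ (by positivity)]
        exact hη

theorem sum_sum_pairInt_le {R η : ℝ} (hη0 : 0 ≤ η) (hL : 1 ≤ Real.log q)
    (hη : Real.exp (R * 2.334) ^ 2 * 1689.6 ≤ η * Real.log q ^ 2)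
    {P G : Finset (DirichletCharacter ℂ q × ℂ)} (hP : ∀ p ∈ P, IsZeroPair R p) (hGP : G ⊆ P)
    (hG : ∀ p ∈ G, 0.78 ≤ lam q p.2 ∧ excess P p ≤ 2.26 ∧
      (lam q p.2 ≤ 2 → excess P p ≤ 0.7 * (lam q p.2 - 0.78)))
    {m : DirichletCharacter ℂ q × ℂ → ℝ}
    (hm : ∀ p, m p = pairMult p * Real.exp (-7.999 * lam q p.2)) :
    ∑ j ∈ G, ∑ k ∈ G, (if j.1 = k.1 then m j * m k * pairInt j k else 0) ≤
      0.00804 * ∑ j ∈ G, m j + η * (∑ j ∈ G, m j) ^ 2 := by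
  set e : DirichletCharacter ℂ q × ℂ → ℝ := fun j => Real.exp (-7.999 * lam q j.2) with he
  set f : DirichletCharacter ℂ q × ℂ → ℝ := fun j => Real.exp ((lam q j.2 - 0.78) * 2.334) with hf
  set s : DirichletCharacter ℂ q × ℂ → ℝ := fun j => minInv (lam q j.2) with hs
  set b : DirichletCharacter ℂ q × ℂ → ℝ := fun j => e j * f j with hb
  set D : DirichletCharacter ℂ q × ℂ → DirichletCharacter ℂ q × ℂ → ℝ := fun j k =>
    26.4 / (4 / 3 + ((k.2.im - j.2.im) * Real.log q) ^ 2) with hD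
  set c : DirichletCharacter ℂ q × ℂ → DirichletCharacter ℂ q × ℂ → ℝ := fun j k =>
    if nearPair j k then pairMult j * (pairMult k - if k = j then 1 else 0) * D j k else 0 with hc
  have he0 : ∀ j, 0 ≤ e j := fun j => (Real.exp_pos _).le
  have hf0 : ∀ j, 0 ≤ f j := fun j => (Real.exp_pos _).le
  have hD0 : ∀ j k, 0 ≤ D j k := fun j k => by positivity
  have hm0 : ∀ j, 0 ≤ m j := fun j => by
    rw [hm]
    exact mul_nonneg (pairMult_nonneg j) (he0 j)
  have hs0 : ∀ j ∈ G, 0 < s j := fun j hj => minInv_pos (by linarith [(hG j hj).1])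
  have hc0 : ∀ j ∈ G, ∀ k ∈ G, 0 ≤ c j k := by
    intro j _ k hk
    simp only [hc]
    split_ifs with h1 h2
    · exact mul_nonneg (mul_nonneg (pairMult_nonneg j) (by
        linarith [one_le_pairMult (hP k (hGP hk))])) (hD0 j k)
    · exact mul_nonneg (mul_nonneg (pairMult_nonneg j) (by
        linarith [pairMult_nonneg k])) (hD0 j k)
    · exact le_rfl
  have hcs : ∀ j ∈ G, ∀ k ∈ G, c j k = c k j := by
    intro j _ k _
    by_cases hjk : k = j
    · rw [hjk]
    have h1 : nearPair j k ↔ nearPair k j := ⟨nearPair_symm, nearPair_symm⟩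
    have h2 : D j k = D k j := by simp only [hD]; ring_nf
    simp only [hc, h1, h2, hjk, Ne.symm hjk, if_false]
    ring_nf
  have hpt : ∀ j ∈ G, ∀ k ∈ G, (if j.1 = k.1 then m j * m k * pairInt j k else 0) ≤
      c j k * (b j * b k) + (if k = j then pairMult j * b j ^ 2 * 3.42 else 0) +
        η * (m j * m k) := by
    intro j hj k hk
    have hjk := mul_nonneg (hm0 j) (hm0 k)
    have hcb := mul_nonneg (hc0 j hj k hk)
      (mul_nonneg (mul_nonneg (he0 j) (hf0 j)) (mul_nonneg (he0 k) (hf0 k)))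
    have hcb' : 0 ≤ if k = j then pairMult j * b j ^ 2 * 3.42 else 0 := by
      have := pairMult_nonneg j
      split_ifs <;> positivity
    have hηm := mul_nonneg hη0 hjk
    by_cases h1 : j.1 = k.1
    swap
    · simp only [h1, if_false]
      linarith
    simp only [h1, if_true]
    by_cases h2 : nearPair j k
    · have hI : m j * m k * pairInt j k =
          (pairMult j * (pairMult k - if k = j then 1 else 0) * (e j * e k)) * pairInt j k +
          (if k = j then pairMult j * e j ^ 2 * pairInt j k else 0) := by
        rw [hm, hm]
        by_cases h3 : k = j
        · subst h3
          simp only [if_true, he]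
          ring
        · simp only [h3, if_false, he]
          ring
      have hI1 : (pairMult j * (pairMult k - if k = j then 1 else 0) * (e j * e k)) *
          pairInt j k ≤ c j k * (b j * b k) := by
        have h4 : pairInt j k ≤ f j * f k * D j k :=
          norm_integral_pairExp_le_div (hG j hj).1 (hG k hk).1
        have h5 : 0 ≤ pairMult j * (pairMult k - if k = j then 1 else 0) * (e j * e k) :=
          mul_nonneg (mul_nonneg (pairMult_nonneg j)
            (by simpa using pairMult_sub_nonneg (hP k (hGP hk)) j)) (mul_nonneg (he0 j) (he0 k))
        refine (mul_le_mul_of_nonneg_left h4 h5).trans (le_of_eq ?_)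
        simp only [hc, h2, if_true, hb]
        ring
      have hI2 : (if k = j then pairMult j * e j ^ 2 * pairInt j k else 0) ≤
          if k = j then pairMult j * b j ^ 2 * 3.42 else 0 := by
        split_ifs with h3
        · subst h3
          have h4 : pairInt k k ≤ f k * f k * 3.42 :=
            norm_integral_pairExp_le (hG k hk).1 (hG k hk).1
          refine (mul_le_mul_of_nonneg_left h4 (mul_nonneg (pairMult_nonneg k)
            (sq_nonneg (e k)))).trans (le_of_eq ?_)
          simp only [hb]
          ring
        · exact le_rfl
      rw [hI]
      linarith
    · have h3 : ¬ |k.2.im - j.2.im| ≤ 1 / 8 := fun h => h2 ⟨h1, h⟩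
      have h4 := pairInt_far_le hL hη (hP j (hGP hj)) (hP k (hGP hk)) (hG j hj).1 (hG k hk).1
        (not_le.1 h3).le
      have := mul_le_mul_of_nonneg_left h4 hjk
      linarith
  have hrow : ∀ j ∈ G, ∑ k ∈ G, c j k * (b j ^ 2 * (s k / s j)) ≤
      pairMult j * b j ^ 2 * (26.4 * (excess P j / s j)) := by
    intro j hj
    have h1 := sum_le_excess (T := G.filter (nearPair j)) (j := j) hP fun k hk' =>
      ⟨hGP (Finset.mem_filter.1 hk').1, (Finset.mem_filter.1 hk').2⟩
    have h2 : ∀ k ∈ G, c j k * (b j ^ 2 * (s k / s j)) ≤ pairMult j * b j ^ 2 * 26.4 / s j *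
        (if nearPair j k then (pairMult k - if k = j then 1 else 0) * pairKernel j k else 0) := by
      intro k hk
      by_cases hn : nearPair j k
      · have h3 : s k / (4 / 3 + ((k.2.im - j.2.im) * Real.log q) ^ 2) ≤ pairKernel j k :=
          minInv_div_le_Gk (by linarith [(hG k hk).1])
        have h4 : 0 ≤ pairMult j * b j ^ 2 * 26.4 / s j *
            (pairMult k - if k = j then 1 else 0) :=
          mul_nonneg (div_nonneg (mul_nonneg (mul_nonneg (pairMult_nonneg j) (sq_nonneg _))
            (by norm_num)) (hs0 j hj).le)
            (by simpa using pairMult_sub_nonneg (hP k (hGP hk)) j)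
        have h5 := mul_le_mul_of_nonneg_left h3 h4
        simp only [hc, hn, if_true, hD]
        refine le_trans (le_of_eq ?_) (h5.trans (le_of_eq ?_)) <;> ring
      · simp [hc, hn]
    refine (sum_le_sum h2).trans ?_
    rw [← mul_sum, ← Finset.sum_filter]
    have h6 : 0 ≤ pairMult j * b j ^ 2 * 26.4 / s j :=
      div_nonneg (mul_nonneg (mul_nonneg (pairMult_nonneg j) (sq_nonneg _))
        (by norm_num)) (hs0 j hj).le
    have h7 := mul_le_mul_of_nonneg_left h1 h6
    refine le_trans (le_of_eq ?_) (h7.trans (le_of_eq (by ring)))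
    congr!
  calc _ ≤ ∑ j ∈ G, ∑ k ∈ G, (c j k * (b j * b k) +
          (if k = j then pairMult j * b j ^ 2 * 3.42 else 0) + η * (m j * m k)) :=
        sum_le_sum fun j hj => sum_le_sum fun k hk => hpt j hj k hk
    _ = ∑ j ∈ G, ∑ k ∈ G, c j k * (b j * b k) + ∑ j ∈ G, pairMult j * b j ^ 2 * 3.42 +
          η * (∑ j ∈ G, m j) ^ 2 := by
        simp only [Finset.sum_add_distrib, Finset.sum_ite_eq', ← mul_sum]
        rw [sq, Finset.sum_mul]
        congr 2
        exact sum_congr rfl fun j hj => by simp only [hj, if_true]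
    _ ≤ ∑ j ∈ G, pairMult j * b j ^ 2 * (26.4 * (excess P j / s j)) +
          ∑ j ∈ G, pairMult j * b j ^ 2 * 3.42 + η * (∑ j ∈ G, m j) ^ 2 := by
        have := (sum_sum_mul_le_weighted G c b s hc0 hcs hs0).trans (sum_le_sum hrow)
        linarith
    _ ≤ _ := by
        rw [← Finset.sum_add_distrib, mul_sum]
        refine add_le_add_left (sum_le_sum fun j hj => ?_) _
        have h := row_weight_le (hG j hj).1 (hG j hj).2.1 (hG j hj).2.2
        have h' := mul_le_mul_of_nonneg_left h (pairMult_nonneg j)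
        rw [hm]
        simp only [hb, he, hf, hs]
        linarith

end LFZ

namespace LFZ
open Finset Filter Topology Metric Real MeasureTheory

theorem sum_le_of_quadratic {S : ℝ} (hS : 0 ≤ S)
    (h : (1 - 0.001) ^ 2 * S ^ 2 ≤ 9.06 * ((1 / 0.16) * (0.00804 * S + 0.0001 * S ^ 2) +
      0.001 * S ^ 2)) : S ≤ 0.48 := by
  by_contra! hc
  nlinarith

theorem graham_group_le {R : ℝ} (hR : 0 < R) : ∃ q₀ : ℕ, ∀ (q : ℕ) [NeZero q], q₀ ≤ q →
    ∀ P : Finset (DirichletCharacter ℂ q × ℂ), (∀ p ∈ P, IsZeroPair R p) → ∀ G ⊆ P,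
    (∀ p ∈ G, 0.78 ≤ lam q p.2 ∧ (lam q p.2 ≤ 2 → excess P p ≤ 0.7 * (lam q p.2 - 0.78))) →
    ∑ p ∈ G, pairMult p * Real.exp (-7.999 * lam q p.2) ≤ 0.48 := by
  obtain ⟨F, hF, hFc, hF1, hF0, hFa, he1, he2⟩ := exists_cutoff (u := 0.822) (δ := 0.45)
    (δ' := 0.449) (by norm_num) (by norm_num) (by norm_num)
  have hms := sieveWt_mean_square hF hFc (u := 0.822) (δ := 0.45) (δ' := 0.449) (x := 1.934)
    (x' := 1.935) (ε := 0.001) (by norm_num) (by norm_num) (by norm_num)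
    (hF1 0 le_rfl (by norm_num)) he1 he2 (by norm_num) (by norm_num) (by norm_num)
  obtain ⟨q₁, h₁⟩ := zero_duality (F := F) (g := trap 0.372 0.822 1.934 2.334) (R := R)
    (C := 1 / (0.822 - 0.372) + 1 / (2.334 - 1.934)) (M := 9.06) (u := 0.822) (v := 0.822 + 0.45)
    (w := 0.16) (x := 1.934) (u₀ := 0.372) (x₁ := 2.334) (ε := 0.001) hR (by norm_num)
    (by norm_num) (by norm_num) (by norm_num) (by norm_num) hF1 hF0 hFa (by norm_num)
    (hms.mono fun L h N hN => (h N hN).trans sieve_constant_le)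
    (abs_trap_sub_le (by norm_num) (by norm_num)) (trap_nonneg _ _ _ _) (trap_le_one _ _ _ _)
    (fun t => trap_eq_zero_left (by norm_num)) (fun t => trap_eq_zero_right (by norm_num))
    (fun t => trap_eq_one (by norm_num) (by norm_num)) (by norm_num) (by norm_num) (by norm_num)
    (by norm_num) (by norm_num) (by norm_num)
  obtain ⟨q₂, h₂⟩ := excess_add_le hR (ε := 0.01) (by norm_num)
  obtain ⟨q₃, h₃⟩ := eventually_atTop.1 (tendsto_log_nat.eventually_ge_atTop
    (max 1 (Real.exp (R * 2.334) ^ 2 * 1689.6 / 0.0001)))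
  refine ⟨max q₁ (max q₂ q₃), fun q _ hq P hP G hGP hG => ?_⟩
  simp only [max_le_iff] at hq h₃
  obtain ⟨hL, hLR⟩ := h₃ q hq.2.2
  set m : DirichletCharacter ℂ q × ℂ → ℝ := fun p =>
    pairMult p * Real.exp (-7.999 * lam q p.2) with hm
  have hm0 : ∀ p, 0 ≤ m p := fun p => mul_nonneg (pairMult_nonneg p) (Real.exp_pos _).le
  have h := h₁ q hq.1 G (fun p hp => hP p (hGP hp)) m hm0
  have hη : Real.exp (R * 2.334) ^ 2 * 1689.6 ≤ 0.0001 * Real.log q ^ 2 := by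
    rw [div_le_iff₀ (by norm_num)] at hLR
    nlinarith
  have h' := sum_sum_pairInt_le (by norm_num) hL hη hP hGP (fun p hp => ⟨(hG p hp).1, by
    have h1 := h₂ q hq.2.1 P hP p (hGP hp)
    have h2 : 0 ≤ Gk 1 (lam q p.2) 0 := Gk_nonneg (by linarith [(hG p hp).1])
    norm_num at h1 ⊢
    linarith, (hG p hp).2⟩) (m := m) (fun _ => rfl)
  refine sum_le_of_quadratic (Finset.sum_nonneg fun p _ => hm0 p) (h.trans ?_)
  have e : (∑ j ∈ G, ∑ k ∈ G, if j.1 = k.1 then m j * m k * (1 / 0.16 *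
      ‖∫ t in (0.372:ℝ)..2.334, (trap 0.372 0.822 1.934 2.334 t : ℂ) *
        Complex.exp (pairExp q j.2 k.2 * t)‖) else 0) = 1 / 0.16 *
      ∑ j ∈ G, ∑ k ∈ G, (if j.1 = k.1 then m j * m k * pairInt j k else 0) := by
    simp only [mul_sum, mul_ite, mul_zero]
    refine sum_congr rfl fun j _ => sum_congr rfl fun k _ => ?_
    split_ifs
    · unfold pairInt
      ring
    · rfl
  rw [e]
  gcongr

theorem isCompact_rect (q : ℕ) (R : ℝ) : IsCompact (rect q R) := by
  have : rect q R = Set.Icc (1 - R / Real.log q) 1 ×ℂ Set.Icc (-R) R := by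
    ext z
    simp only [rect, Set.mem_ofPred_eq, Complex.mem_reProdIm, Set.mem_Icc, abs_le]
    tauto
  rw [this]
  exact isCompact_Icc.reProdIm isCompact_Icc

theorem finite_zeros {q : ℕ} [NeZero q] (R : ℝ) {χ : DirichletCharacter ℂ q} (hχ : χ ≠ 1) :
    {ρ : ℂ | ρ ∈ rect q R ∧ χ.LFunction ρ = 0}.Finite :=
  zeros_finite (DirichletCharacter.differentiable_LFunction hχ) (w := 2)
    (DirichletCharacter.LFunction_ne_zero_of_one_le_re χ (Or.inl hχ) (by simp)) (isCompact_rect q R)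

theorem exists_zeroPairs {q : ℕ} [NeZero q] (R : ℝ) :
    ∃ P : Finset (DirichletCharacter ℂ q × ℂ), (∀ p, p ∈ P ↔ IsZeroPair R p) ∧
      ∀ f : DirichletCharacter ℂ q → ℂ → ℝ,
        ∑ χ ∈ Finset.univ.filter (fun χ : DirichletCharacter ℂ q => χ ≠ 1),
          ∑ᶠ ρ ∈ {ρ : ℂ | ρ ∈ rect q R ∧ χ.LFunction ρ = 0}, f χ ρ = ∑ p ∈ P, f p.1 p.2 := by
  have hfin : {p : DirichletCharacter ℂ q × ℂ | IsZeroPair R p}.Finite := by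
    have : {p : DirichletCharacter ℂ q × ℂ | IsZeroPair R p} ⊆
        ⋃ χ ∈ {χ : DirichletCharacter ℂ q | χ ≠ 1},
          (Prod.mk χ) '' {ρ : ℂ | ρ ∈ rect q R ∧ χ.LFunction ρ = 0} := by
      rintro ⟨χ, ρ⟩ ⟨h1, h2⟩
      exact Set.mem_biUnion (x := χ) h1 ⟨ρ, h2, rfl⟩
    exact ((Set.toFinite _).biUnion fun χ hχ => (finite_zeros R hχ).image _).subset this
  refine ⟨hfin.toFinset, fun p => by simp, fun f => ?_⟩
  rw [Finset.sum_finset_product' hfin.toFinset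
    (Finset.univ.filter (fun χ : DirichletCharacter ℂ q => χ ≠ 1))
    (fun χ => if h : χ ≠ 1 then (finite_zeros R h).toFinset else ∅)]
  · refine sum_congr rfl fun χ hχ => ?_
    have h := (Finset.mem_filter.1 hχ).2
    rw [finsum_mem_eq_finite_toFinset_sum _ (finite_zeros R h), dif_pos h]
  · rintro ⟨χ, ρ⟩
    by_cases h : χ = 1 <;> simp [IsZeroPair, h]

end LFZ

/-- **No zero close to 1**: for each fixed `R > 0` there is `q₀` such that for all `q ≥ q₀`,
if every zero `ρ ∈ ℛ` of any `L(s,χ)` with `χ` nonprincipal mod `q` satisfies `λ_ρ ≥ 0.35`,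
then `∑_{χ≠χ₀} ∑_{ρ ∈ ℛ} exp(-7.999 λ_ρ) < 0.99`. -/
theorem no_zero_close_to_one_case (R : ℝ) (hR : 0 < R) :
    ∃ q₀ : ℕ, ∀ (q : ℕ) [NeZero q], q₀ ≤ q →
      (∀ χ : DirichletCharacter ℂ q, χ ≠ 1 →
        ∀ ρ ∈ rect q R, χ.LFunction ρ = 0 → (0.35 : ℝ) ≤ lam q ρ) →
      (∑ χ ∈ Finset.univ.filter (fun χ : DirichletCharacter ℂ q => χ ≠ 1),
          ∑ᶠ ρ ∈ {ρ : ℂ | ρ ∈ rect q R ∧ χ.LFunction ρ = 0},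
            (zeroMult χ.LFunction ρ : ℝ) * Real.exp (-7.999 * lam q ρ))
        < 0.99 := by
  obtain ⟨q₁, h₁⟩ := LFZ.prime_group_le hR
  obtain ⟨q₂, h₂⟩ := LFZ.graham_group_le hR
  refine ⟨max q₁ q₂, fun q _ hq hlam => ?_⟩
  obtain ⟨P, hP, hsum⟩ := LFZ.exists_zeroPairs (q := q) R
  rw [hsum fun χ ρ => (zeroMult χ.LFunction ρ : ℝ) * Real.exp (-7.999 * lam q ρ)]
  have hP' : ∀ p ∈ P, LFZ.IsZeroPair R p := fun p hp => (hP p).1 hp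
  have hlam' : ∀ p ∈ P, 0.35 ≤ lam q p.2 := fun p hp =>
    hlam p.1 (hP' p hp).1 p.2 (hP' p hp).2.1 (hP' p hp).2.2
  set C : DirichletCharacter ℂ q × ℂ → Prop := fun p => lam q p.2 ≤ 2 ∧
    (lam q p.2 < 0.78 ∨ 0.7 * (lam q p.2 - 0.78) ≤ LFZ.excess P p) with hC
  rw [← Finset.sum_filter_add_sum_filter_not P C]
  have a := h₁ q (le_of_max_le_left hq) P hP' hlam' (P.filter C) (Finset.filter_subset _ _)
    fun p hp => (Finset.mem_filter.1 hp).2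
  have b := h₂ q (le_of_max_le_right hq) P hP' (P.filter fun p => ¬ C p)
    (Finset.filter_subset _ _) fun p hp => by
      have h := (Finset.mem_filter.1 hp).2
      simp only [hC, not_and_or, not_or, not_le, not_lt] at h
      constructor
      · rcases h with h | h
        · linarith
        · exact h.1
      · intro h2
        rcases h with h | h
        · linarith
        · exact h.2.le
  simp only [LFZ.pairMult] at a b
  norm_num at a b ⊢
  linarith
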